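/- Let f : ℝ → ℝ be C¹ satisfying (f₁)–(f₄) and let V : ℝ³ → ℝ be locally Hölder continuous with V(x) ≥ α > 0 for all x. Then for every R > 0 there exists u : ℝ³ → ℝ, twice continuously differentiable on the open ball B_R = {x : |x| < R}, continuous on its closure, vanishing outside B_R, such that, with φ = φ_u the Newtonian potential of u² (u extended by zero outside B_R), one has −Δu + V(x)u + φ u = f(u) pointwise in B_R, max(u,0) ≠ 0 and min(u,0) ≠ 0, and u has least energy among such sign-changing solutions: J_R(u) ≤ J_R(v) for every v with the same regularity and boundary condition solving −Δv + V(x)v + φ_v v = f(v) in B_R with max(v,0) ≠ 0 and min(v,0) ≠ 0, where J_R(v) = ½∫_{B_R}(|∇v|² + V(x)v²) dx + ¼∫_{B_R} φ_v v² dx − ∫_{B_R} F(v) dx. -/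

import Mathlib

open MeasureTheory Filter Topology intervalIntegral Metric
open scoped NNReal

noncomputable section

/-- The Newtonian potential of `u²`, for `u : ℝ³ → ℝ`:
`φ_u(x) = (1/(4π)) ∫ u(y)²/|x - y| dy`. -/
def phiu (u : EuclideanSpace ℝ (Fin 3) → ℝ) (x : EuclideanSpace ℝ (Fin 3)) : ℝ :=
  (1 / (4 * Real.pi)) * ∫ y : EuclideanSpace ℝ (Fin 3), (u y) ^ 2 / ‖x - y‖

/-- The Laplacian of `u : ℝ³ → ℝ`: the sum of the second partial derivatives. -/
def lap3 (u : EuclideanSpace ℝ (Fin 3) → ℝ) (x : EuclideanSpace ℝ (Fin 3)) : ℝ :=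
  ∑ i : Fin 3,
    fderiv ℝ (fun y => fderiv ℝ u y (EuclideanSpace.single i (1:ℝ))) x
      (EuclideanSpace.single i (1:ℝ))

/-- `V` is locally Hölder continuous: around each point there is a neighborhood on which
`V` is Hölder continuous with some exponent in `(0,1]`. -/
def LocallyHolder (V : EuclideanSpace ℝ (Fin 3) → ℝ) : Prop :=
  ∀ x : EuclideanSpace ℝ (Fin 3), ∃ s ∈ 𝓝 x, ∃ C β : ℝ≥0, 0 < β ∧ β ≤ 1 ∧
    HolderOnWith C β V s

/-- The energy functional on the ball `B_R`:
`J_R(v) = ½ ∫_{B_R} (|∇v|² + V v²) + ¼ ∫_{B_R} φ_v v² - ∫_{B_R} F(v)`, `F(s) = ∫₀ˢ f`. -/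
def energyBall (f : ℝ → ℝ) (V : EuclideanSpace ℝ (Fin 3) → ℝ) (R : ℝ)
    (v : EuclideanSpace ℝ (Fin 3) → ℝ) : ℝ :=
  (1 / 2) * (∫ x in ball (0 : EuclideanSpace ℝ (Fin 3)) R,
      (‖fderiv ℝ v x‖ ^ 2 + V x * (v x) ^ 2))
    + (1 / 4) * (∫ x in ball (0 : EuclideanSpace ℝ (Fin 3)) R, phiu v x * (v x) ^ 2)
    - ∫ x in ball (0 : EuclideanSpace ℝ (Fin 3)) R, ∫ t in (0:ℝ)..(v x), f t

/-- The properties of an admissible sign-changing solution of the Schrödinger–Poisson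
problem on the ball `B_R`: `C²` in `B_R`, continuous on the closed ball, vanishing outside
`B_R`, solving `-Δv + V v + φ_v v = f(v)` pointwise in `B_R` (with `φ_v` the Newtonian
potential of `v²` for `v` extended by zero), with `v⁺ ≠ 0` and `v⁻ ≠ 0`. -/
def IsSignChangingBallSolution (f : ℝ → ℝ) (V : EuclideanSpace ℝ (Fin 3) → ℝ) (R : ℝ)
    (v : EuclideanSpace ℝ (Fin 3) → ℝ) : Prop :=
  ContDiffOn ℝ 2 v (ball (0 : EuclideanSpace ℝ (Fin 3)) R) ∧
  ContinuousOn v (closedBall (0 : EuclideanSpace ℝ (Fin 3)) R) ∧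
  (∀ x ∉ ball (0 : EuclideanSpace ℝ (Fin 3)) R, v x = 0) ∧
  (∀ x ∈ ball (0 : EuclideanSpace ℝ (Fin 3)) R,
    -lap3 v x + V x * v x + phiu v x * v x = f (v x)) ∧
  (fun x => max (v x) 0) ≠ 0 ∧ (fun x => min (v x) 0) ≠ 0

namespace BallSolution

open scoped ENNReal ContDiff

/-- Three-dimensional Euclidean space. -/
abbrev E3 := EuclideanSpace ℝ (Fin 3)

section LpTools

variable {F : Type*} [NormedAddCommGroup F]

theorem tendsto_eLpNorm_two_of_dominated {h : ℕ → E3 → F} {b : E3 → ℝ}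
    (hm : ∀ n, AEStronglyMeasurable (h n) volume) (hb : MemLp b 2 volume)
    (hle : ∀ n, ∀ᵐ x, ‖h n x‖ ≤ b x) (hlim : ∀ᵐ x, Tendsto (fun n => h n x) atTop (𝓝 0)) :
    Tendsto (fun n => eLpNorm (h n) 2 volume) atTop (𝓝 0) := by
  have key : Tendsto (fun n => ∫⁻ x, ‖h n x‖ₑ ^ (2 : ℝ)) atTop (𝓝 (∫⁻ _ : E3, 0)) := by
    refine tendsto_lintegral_of_dominated_convergence' (fun x => ‖b x‖ₑ ^ (2 : ℝ))
      (fun n => (hm n).enorm.pow_const _) ?_ ?_ ?_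
    · intro n
      filter_upwards [hle n] with x hx
      gcongr
      rw [enorm_le_iff_norm_le]
      exact hx.trans (le_abs_self _)
    · have := hb.2
      rw [eLpNorm_lt_top_iff_lintegral_rpow_enorm_lt_top (by norm_num) (by norm_num)] at this
      simpa using this.ne
    · filter_upwards [hlim] with x hx
      have h1 : Tendsto (fun n => ‖h n x‖ₑ) atTop (𝓝 0) := by
        simpa using hx.enorm
      simpa using h1.ennrpow_const 2
  simp only [lintegral_const, zero_mul] at key
  have h2 := key.ennrpow_const (1 / 2)
  simp only [one_div] at h2
  rw [ENNReal.zero_rpow_of_pos (by norm_num)] at h2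
  refine h2.congr fun n => ?_
  rw [eLpNorm_eq_lintegral_rpow_enorm_toReal (by norm_num) (by norm_num)]
  simp

variable [InnerProductSpace ℝ F]

theorem integrable_inner_of_memLp {f g : E3 → F} (hf : MemLp f 2 volume) (hg : MemLp g 2 volume) :
    Integrable (fun x => inner ℝ (f x) (g x)) := by
  have := L2.integrable_inner (𝕜 := ℝ) (hf.toLp f) (hg.toLp g)
  refine this.congr ?_
  filter_upwards [hf.coeFn_toLp, hg.coeFn_toLp] with x h1 h2
  rw [h1, h2]

theorem tendsto_integral_inner {f : ℕ → E3 → F} {f' : E3 → F} {g : ℕ → E3 → F} {g' : E3 → F}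
    (hf : ∀ n, MemLp (f n) 2 volume) (hf' : MemLp f' 2 volume)
    (hg : ∀ n, MemLp (g n) 2 volume) (hg' : MemLp g' 2 volume)
    (hfl : Tendsto (fun n => eLpNorm (f n - f') 2 volume) atTop (𝓝 0))
    (hgl : Tendsto (fun n => eLpNorm (g n - g') 2 volume) atTop (𝓝 0)) :
    Tendsto (fun n => ∫ x, inner ℝ (f n x) (g n x)) atTop (𝓝 (∫ x, inner ℝ (f' x) (g' x))) := by
  have e : ∀ {a b : E3 → F} (ha : MemLp a 2 volume) (hb : MemLp b 2 volume),
      ∫ x, inner ℝ (a x) (b x) = inner ℝ (ha.toLp a) (hb.toLp b) := by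
    intro a b ha hb
    rw [L2.inner_def]
    refine integral_congr_ae ?_
    filter_upwards [ha.coeFn_toLp, hb.coeFn_toLp] with x h1 h2
    rw [h1, h2]
  have h1 : Tendsto (fun n => (hf n).toLp (f n)) atTop (𝓝 (hf'.toLp f')) :=
    (Lp.tendsto_Lp_iff_tendsto_eLpNorm'' f hf f' hf').2 hfl
  have h2 : Tendsto (fun n => (hg n).toLp (g n)) atTop (𝓝 (hg'.toLp g')) :=
    (Lp.tendsto_Lp_iff_tendsto_eLpNorm'' g hg g' hg').2 hgl
  rw [e hf' hg']
  refine (h1.inner h2).congr fun n => (e (hf n) (hg n)).symm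

end LpTools

/-- `C¹` functions with compact support. -/
def IsTest (φ : E3 → ℝ) : Prop := ContDiff ℝ 1 φ ∧ HasCompactSupport φ

/-- `u` belongs to the Sobolev space `H¹(ℝ³)` with weak gradient `D`, expressed as the
`L²`-approximability of the pair `(u, D)` by `(φ, ∇φ)` with `φ` a `C¹` function of compact
support. -/
structure H1 (u : E3 → ℝ) (D : E3 → E3) : Prop where
  memLp : MemLp u 2 volume
  memLp_grad : MemLp D 2 volume
  approx : ∀ ε : ℝ≥0∞, ε ≠ 0 → ∃ φ, IsTest φ ∧ eLpNorm (φ - u) 2 volume < ε ∧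
    eLpNorm (gradient φ - D) 2 volume < ε

theorem continuous_gradient {φ : E3 → ℝ} (h : ContDiff ℝ 1 φ) : Continuous (gradient φ) :=
  (InnerProductSpace.toDual ℝ E3).symm.continuous.comp (h.continuous_fderiv one_ne_zero)

theorem norm_gradient (φ : E3 → ℝ) (x : E3) : ‖gradient φ x‖ = ‖fderiv ℝ φ x‖ := by
  simp [gradient]

namespace IsTest

variable {φ ψ : E3 → ℝ}

theorem differentiable (h : IsTest φ) : Differentiable ℝ φ := h.1.differentiable one_ne_zero

theorem hasCompactSupport_gradient (h : IsTest φ) : HasCompactSupport (gradient φ) := by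
  have := h.2.fderiv (𝕜 := ℝ)
  exact this.comp_left (g := (InnerProductSpace.toDual ℝ E3).symm) (by simp)

theorem memLp (h : IsTest φ) (p : ℝ≥0∞) : MemLp φ p volume :=
  h.1.continuous.memLp_of_hasCompactSupport h.2

theorem memLp_gradient (h : IsTest φ) (p : ℝ≥0∞) : MemLp (gradient φ) p volume :=
  (continuous_gradient h.1).memLp_of_hasCompactSupport h.hasCompactSupport_gradient

theorem h1 (h : IsTest φ) : H1 φ (gradient φ) :=
  ⟨h.memLp 2, h.memLp_gradient 2, fun ε hε => ⟨φ, h, by simpa using hε.bot_lt, by simpa using hε.bot_lt⟩⟩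

theorem add (h : IsTest φ) (h' : IsTest ψ) : IsTest (φ + ψ) := ⟨h.1.add h'.1, h.2.add h'.2⟩

theorem const_smul (h : IsTest φ) (c : ℝ) : IsTest (c • φ) :=
  ⟨contDiff_const.smul h.1, h.2.smul_left (f := fun _ => c)⟩

theorem comp_left (h : IsTest φ) {G : ℝ → ℝ} (hG : ContDiff ℝ 1 G) (h0 : G 0 = 0) :
    IsTest (G ∘ φ) := ⟨hG.comp h.1, h.2.comp_left h0⟩

end IsTest

theorem gradient_add' {φ ψ : E3 → ℝ} (h : Differentiable ℝ φ) (h' : Differentiable ℝ ψ) :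
    gradient (φ + ψ) = gradient φ + gradient ψ := by
  ext1 x
  simp [gradient, fderiv_add (h x) (h' x)]

theorem gradient_const_smul' {φ : E3 → ℝ} (c : ℝ) (h : Differentiable ℝ φ) :
    gradient (c • φ) = c • gradient φ := by
  ext1 x
  simp [gradient, fderiv_const_smul (h x)]

theorem gradient_comp {φ : E3 → ℝ} {G : ℝ → ℝ} {x : E3} {g : ℝ} (h : DifferentiableAt ℝ φ x)
    (hG : HasDerivAt G g (φ x)) : gradient (G ∘ φ) x = g • gradient φ x := by
  have := (hG.comp_hasFDerivAt x h.hasFDerivAt).fderiv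
  simp [gradient, this]

namespace H1

variable {u v : E3 → ℝ} {D D' : E3 → E3}

theorem exists_seq (h : H1 u D) : ∃ φ : ℕ → E3 → ℝ, (∀ n, IsTest (φ n)) ∧
    Tendsto (fun n => eLpNorm (φ n - u) 2 volume) atTop (𝓝 0) ∧
    Tendsto (fun n => eLpNorm (gradient (φ n) - D) 2 volume) atTop (𝓝 0) ∧
    ∀ᵐ x, Tendsto (fun n => φ n x) atTop (𝓝 (u x)) := by
  have h1 : ∀ n : ℕ, ((n : ℝ≥0∞) + 1)⁻¹ ≠ 0 := fun n => by simp
  choose φ hφ h2 h3 using fun n : ℕ => h.approx _ (h1 n)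
  have lim : Tendsto (fun n : ℕ => ((n : ℝ≥0∞) + 1)⁻¹) atTop (𝓝 0) := by
    have := ENNReal.tendsto_inv_nat_nhds_zero
    simpa using (tendsto_add_atTop_iff_nat 1).2 this
  have l2 := tendsto_of_tendsto_of_tendsto_of_le_of_le tendsto_const_nhds lim
    (fun n => zero_le) (fun n => (h2 n).le)
  have l3 := tendsto_of_tendsto_of_tendsto_of_le_of_le tendsto_const_nhds lim
    (fun n => zero_le) (fun n => (h3 n).le)
  obtain ⟨ns, hns, hae⟩ := (tendstoInMeasure_of_tendsto_eLpNorm (p := 2) (by norm_num)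
    (fun n => ((hφ n).memLp 2).1) h.memLp.1 l2).exists_seq_tendsto_ae
  exact ⟨fun n => φ (ns n), fun n => hφ _, l2.comp hns.tendsto_atTop, l3.comp hns.tendsto_atTop, hae⟩

theorem of_tendsto {w : ℕ → E3 → ℝ} {W : ℕ → E3 → E3} (h : ∀ n, H1 (w n) (W n))
    (hu : MemLp u 2 volume) (hD : MemLp D 2 volume)
    (h1 : Tendsto (fun n => eLpNorm (w n - u) 2 volume) atTop (𝓝 0))
    (h2 : Tendsto (fun n => eLpNorm (W n - D) 2 volume) atTop (𝓝 0)) : H1 u D := by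
  refine ⟨hu, hD, fun ε hε => ?_⟩
  have hε2 : ε / 2 ≠ 0 := by simpa using hε
  obtain ⟨n, hn1, hn2⟩ := ((h1.eventually_lt_const hε2.bot_lt).and
    (h2.eventually_lt_const hε2.bot_lt)).exists
  obtain ⟨φ, hφ, h3, h4⟩ := (h n).approx _ hε2
  refine ⟨φ, hφ, ?_, ?_⟩
  · calc eLpNorm (φ - u) 2 volume = eLpNorm ((φ - w n) + (w n - u)) 2 volume := by simp
      _ ≤ _ := eLpNorm_add_le ((hφ.memLp 2).1.sub (h n).memLp.1) ((h n).memLp.1.sub hu.1)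
        (by norm_num)
      _ < ε / 2 + ε / 2 := ENNReal.add_lt_add h3 hn1
      _ = ε := ENNReal.add_halves _
  · calc eLpNorm (gradient φ - D) 2 volume
          = eLpNorm ((gradient φ - W n) + (W n - D)) 2 volume := by simp
      _ ≤ _ := eLpNorm_add_le ((hφ.memLp_gradient 2).1.sub (h n).memLp_grad.1)
        ((h n).memLp_grad.1.sub hD.1) (by norm_num)
      _ < ε / 2 + ε / 2 := ENNReal.add_lt_add h4 hn2
      _ = ε := ENNReal.add_halves _

theorem congr_ae (h : H1 u D) (hu : u =ᵐ[volume] v) (hD : D =ᵐ[volume] D') : H1 v D' := by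
  refine ⟨h.memLp.ae_eq hu, h.memLp_grad.ae_eq hD, fun ε hε => ?_⟩
  obtain ⟨φ, hφ, h1, h2⟩ := h.approx ε hε
  refine ⟨φ, hφ, ?_, ?_⟩
  · rwa [← eLpNorm_congr_ae (EventuallyEq.rfl.sub hu)]
  · rwa [← eLpNorm_congr_ae (EventuallyEq.rfl.sub hD)]

theorem add (h : H1 u D) (h' : H1 v D') : H1 (u + v) (D + D') := by
  refine ⟨h.memLp.add h'.memLp, h.memLp_grad.add h'.memLp_grad, fun ε hε => ?_⟩
  have hε2 : ε / 2 ≠ 0 := by simpa using hε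
  obtain ⟨φ, hφ, h1, h2⟩ := h.approx _ hε2
  obtain ⟨ψ, hψ, h3, h4⟩ := h'.approx _ hε2
  refine ⟨φ + ψ, hφ.add hψ, ?_, ?_⟩
  · rw [add_sub_add_comm]
    calc _ ≤ _ := eLpNorm_add_le ((hφ.memLp 2).1.sub h.memLp.1) ((hψ.memLp 2).1.sub h'.memLp.1)
          (by norm_num)
      _ < ε / 2 + ε / 2 := ENNReal.add_lt_add h1 h3
      _ = ε := ENNReal.add_halves _
  · rw [gradient_add' hφ.differentiable hψ.differentiable, add_sub_add_comm]
    calc _ ≤ _ := eLpNorm_add_le ((hφ.memLp_gradient 2).1.sub h.memLp_grad.1)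
          ((hψ.memLp_gradient 2).1.sub h'.memLp_grad.1) (by norm_num)
      _ < ε / 2 + ε / 2 := ENNReal.add_lt_add h2 h4
      _ = ε := ENNReal.add_halves _

theorem const_smul (h : H1 u D) (c : ℝ) : H1 (c • u) (c • D) := by
  obtain ⟨φ, hφ, h1, h2, -⟩ := h.exists_seq
  refine of_tendsto (w := fun n => c • φ n) (W := fun n => c • gradient (φ n)) (fun n => ?_)
    (h.memLp.const_smul c) (h.memLp_grad.const_smul c) ?_ ?_
  · rw [← gradient_const_smul' c (hφ n).differentiable]
    exact ((hφ n).const_smul c).h1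
  · simp_rw [← smul_sub, eLpNorm_const_smul]
    simpa using ENNReal.Tendsto.const_mul h1 (Or.inr (by simp : ‖c‖ₑ ≠ ⊤))
  · simp_rw [← smul_sub, eLpNorm_const_smul]
    simpa using ENNReal.Tendsto.const_mul h2 (Or.inr (by simp : ‖c‖ₑ ≠ ⊤))

theorem neg (h : H1 u D) : H1 (-u) (-D) := by simpa using h.const_smul (-1)

theorem sub (h : H1 u D) (h' : H1 v D') : H1 (u - v) (D - D') := by
  simpa [sub_eq_add_neg] using h.add h'.neg

end H1

theorem IsTest.integral_inner_gradient_mul {φ ψ : E3 → ℝ} (hφ : IsTest φ) (hψ : IsTest ψ) (v : E3) :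
    ∫ x, inner ℝ (gradient φ x) v * ψ x = -∫ x, φ x * fderiv ℝ ψ x v := by
  simp_rw [inner_gradient_left]
  have c1 : Continuous fun x => fderiv ℝ φ x v :=
    (hφ.1.continuous_fderiv one_ne_zero).clm_apply continuous_const
  have c2 : Continuous fun x => fderiv ℝ ψ x v :=
    (hψ.1.continuous_fderiv one_ne_zero).clm_apply continuous_const
  have := integral_mul_fderiv_eq_neg_fderiv_mul_of_integrable (μ := volume) (f := φ) (g := ψ) (v := v)
    ((c1.mul hψ.1.continuous).integrable_of_hasCompactSupport hψ.2.mul_left)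
    ((hφ.1.continuous.mul c2).integrable_of_hasCompactSupport hφ.2.mul_right)
    ((hφ.1.continuous.mul hψ.1.continuous).integrable_of_hasCompactSupport hφ.2.mul_right)
    (fun x _ => hφ.differentiable x) (fun x _ => hψ.differentiable x)
  rw [this, neg_neg]

theorem IsTest.memLp_fderiv_apply {ψ : E3 → ℝ} (hψ : IsTest ψ) (v : E3) (p : ℝ≥0∞) :
    MemLp (fun x => fderiv ℝ ψ x v) p volume := by
  refine ((hψ.1.continuous_fderiv one_ne_zero).clm_apply
    continuous_const).memLp_of_hasCompactSupport (hψ.2.fderiv (𝕜 := ℝ) |>.mono fun x hx => ?_)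
  contrapose! hx
  simp_all

namespace H1

variable {D D' : E3 → E3} {u v : E3 → ℝ}

/-- Integration by parts: `D` is the distributional gradient of `u`. -/
theorem integral_inner_mul (h : H1 u D) {ψ : E3 → ℝ} (hψ : IsTest ψ) (v : E3) :
    ∫ x, inner ℝ (D x) v * ψ x = -∫ x, u x * fderiv ℝ ψ x v := by
  obtain ⟨φ, hφ, h1, h2, -⟩ := h.exists_seq
  have a1 : MemLp (fun x => ψ x • v) 2 volume :=
    (hψ.1.continuous.smul continuous_const).memLp_of_hasCompactSupport hψ.2.smul_right
  have l1 := tendsto_integral_inner (fun n => (hφ n).memLp_gradient 2) h.memLp_grad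
    (fun _ => a1) a1 h2 (by simp)
  have a2 := hψ.memLp_fderiv_apply v 2
  have l2 := tendsto_integral_inner (fun n => (hφ n).memLp 2) h.memLp (fun _ => a2) a2 h1 (by simp)
  have e1 : ∀ W : E3 → E3, ∫ x, inner ℝ (W x) v * ψ x = ∫ x, inner ℝ (W x) (ψ x • v) := by
    intro W
    congr 1 with x
    rw [real_inner_smul_right, mul_comm]
  have e2 : ∀ w : E3 → ℝ, ∫ x, w x * fderiv ℝ ψ x v = ∫ x, inner ℝ (w x) (fderiv ℝ ψ x v) := by
    intro W
    congr 1 with x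
    simp [mul_comm]
  rw [e1, e2]
  refine tendsto_nhds_unique l1 (l2.neg.congr fun n => ?_)
  rw [← e1, ← e2, (hφ n).integral_inner_gradient_mul hψ]

/-- The weak gradient is determined by the function. -/
theorem grad_ae_eq (h : H1 u D) (h' : H1 v D') (huv : u =ᵐ[volume] v) : D =ᵐ[volume] D' := by
  have hi := (h.memLp_grad.locallyIntegrable (by norm_num))
  have hi' := (h'.memLp_grad.locallyIntegrable (by norm_num))
  refine ae_eq_of_integral_contDiff_smul_eq hi hi' fun g hg hc => ?_
  have hT : IsTest g := ⟨hg.of_le (by simp), hc⟩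
  refine ext_inner_right ℝ fun v => ?_
  have e : ∀ {W : E3 → E3}, LocallyIntegrable W volume →
      inner ℝ (∫ x, g x • W x) v = ∫ x, inner ℝ (W x) v * g x := by
    intro W hW
    rw [real_inner_comm, ← integral_inner (hW.integrable_smul_left_of_hasCompactSupport
      hg.continuous hc)]
    congr 1 with x
    rw [real_inner_smul_right, real_inner_comm, mul_comm]
  rw [e hi, e hi', h.integral_inner_mul hT, h'.integral_inner_mul hT]
  congr 1
  refine integral_congr_ae ?_
  filter_upwards [huv] with x hx
  rw [hx]

theorem comp_primitive_of_continuous (h : H1 u D) {g : ℝ → ℝ} {C : ℝ} (hg : Continuous g)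
    (hb : ∀ s, |g s| ≤ C) : H1 (fun x => ∫ s in (0 : ℝ)..u x, g s) (fun x => g (u x) • D x) := by
  obtain ⟨φ, hφ, h1, h2, h3⟩ := h.exists_seq
  have hC : 0 ≤ C := (abs_nonneg _).trans (hb 0)
  set G : ℝ → ℝ := fun t => ∫ s in (0 : ℝ)..t, g s with hGdef
  have hder : ∀ t, HasDerivAt G (g t) t := fun t =>
    integral_hasDerivAt_right (hg.intervalIntegrable _ _) (hg.stronglyMeasurableAtFilter _ _)
      hg.continuousAt
  have hG1 : ContDiff ℝ 1 G := by
    rw [contDiff_one_iff_deriv]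
    refine ⟨fun t => (hder t).differentiableAt, ?_⟩
    have : deriv G = g := funext fun t => (hder t).deriv
    rwa [this]
  have hlip : ∀ a b, |G a - G b| ≤ C * |a - b| := by
    intro a b
    have : G a - G b = ∫ s in b..a, g s := by
      rw [hGdef]
      exact integral_interval_sub_left (hg.intervalIntegrable _ _) (hg.intervalIntegrable _ _)
    rw [this]
    exact norm_integral_le_of_norm_le_const (f := g) (C := C) fun x _ => hb x
  have hG0 : G 0 = 0 := by simp [hGdef]
  have mem1 : MemLp (fun x => G (u x)) 2 volume := by
    refine (h.memLp.const_mul C).mono (hG1.continuous.comp_aestronglyMeasurable h.memLp.1)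
      (ae_of_all _ fun x => ?_)
    have := hlip (u x) 0
    simp only [hG0, sub_zero] at this
    rw [norm_mul, Real.norm_of_nonneg hC]
    exact this
  have mem2 : MemLp (fun x => g (u x) • D x) 2 volume := by
    refine (h.memLp_grad.const_smul C).mono
      ((hg.comp_aestronglyMeasurable h.memLp.1).smul h.memLp_grad.1) (ae_of_all _ fun x => ?_)
    rw [Pi.smul_apply, norm_smul, norm_smul, Real.norm_of_nonneg hC]
    gcongr
    exact hb _
  have grad : ∀ n, gradient (G ∘ φ n) = fun x => g (φ n x) • gradient (φ n) x := fun n =>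
    funext fun x => gradient_comp ((hφ n).differentiable x) (hder _)
  refine of_tendsto (w := fun n => G ∘ φ n) (W := fun n => gradient (G ∘ φ n))
    (fun n => ((hφ n).comp_left hG1 hG0).h1) mem1 mem2 ?_ ?_
  · have lim : Tendsto (fun n => ENNReal.ofReal C * eLpNorm (φ n - u) 2 volume) atTop (𝓝 0) := by
      simpa using ENNReal.Tendsto.const_mul h1 (Or.inr (ENNReal.ofReal_ne_top (r := C)))
    refine tendsto_of_tendsto_of_tendsto_of_le_of_le tendsto_const_nhds lim
      (fun n => zero_le) fun n => ?_
    exact eLpNorm_le_mul_eLpNorm_of_ae_le_mul (ae_of_all _ fun x => hlip _ _) 2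
  · have lim1 : Tendsto (fun n => ENNReal.ofReal C * eLpNorm (gradient (φ n) - D) 2 volume)
        atTop (𝓝 0) := by
      simpa using ENNReal.Tendsto.const_mul h2 (Or.inr (ENNReal.ofReal_ne_top (r := C)))
    have hmeas : ∀ n, AEStronglyMeasurable (fun x => (g (φ n x) - g (u x)) • D x) volume := fun n =>
      ((hg.comp_aestronglyMeasurable ((hφ n).memLp 2).1).sub
        (hg.comp_aestronglyMeasurable h.memLp.1)).smul h.memLp_grad.1
    have lim2 : Tendsto (fun n => eLpNorm (fun x => (g (φ n x) - g (u x)) • D x) 2 volume)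
        atTop (𝓝 0) := by
      refine tendsto_eLpNorm_two_of_dominated hmeas (h.memLp_grad.norm.const_mul (2 * C))
        (fun n => ae_of_all _ fun x => ?_) ?_
      · rw [norm_smul]
        gcongr
        calc _ ≤ |g (φ n x)| + |g (u x)| := abs_sub _ _
          _ ≤ 2 * C := by linarith [hb (φ n x), hb (u x)]
      · filter_upwards [h3] with x hx
        have : Tendsto (fun n => g (φ n x) - g (u x)) atTop (𝓝 0) := by
          simpa using ((hg.tendsto _).comp hx).sub_const (g (u x))
        simpa using this.smul_const (D x)
    have lim := lim1.add lim2
    rw [add_zero] at lim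
    refine tendsto_of_tendsto_of_tendsto_of_le_of_le tendsto_const_nhds lim
      (fun n => zero_le) fun n => ?_
    have e : gradient (G ∘ φ n) - (fun x => g (u x) • D x)
        = (fun x => g (φ n x) • (gradient (φ n) - D) x) + fun x => (g (φ n x) - g (u x)) • D x := by
      rw [grad n]
      ext1 x
      simp [smul_sub, sub_smul]
    dsimp only
    rw [e]
    refine (eLpNorm_add_le ((hg.comp_aestronglyMeasurable ((hφ n).memLp 2).1).smul
      (((hφ n).memLp_gradient 2).1.sub h.memLp_grad.1)) (hmeas n) (by norm_num)).trans ?_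
    refine add_le_add (eLpNorm_le_mul_eLpNorm_of_ae_le_mul (ae_of_all _ fun x => ?_) 2) le_rfl
    rw [Pi.smul_apply', norm_smul]
    gcongr
    exact hb _

/-- Chain rule for the primitive of a bounded pointwise limit of continuous functions. -/
theorem comp_primitive (h : H1 u D) {g : ℕ → ℝ → ℝ} {g' : ℝ → ℝ} {C : ℝ}
    (hg : ∀ n, Continuous (g n)) (hb : ∀ n s, |g n s| ≤ C)
    (hlim : ∀ s, Tendsto (fun n => g n s) atTop (𝓝 (g' s))) :
    H1 (fun x => ∫ s in (0 : ℝ)..u x, g' s) (fun x => g' (u x) • D x) := by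
  have hC : 0 ≤ C := (abs_nonneg _).trans (hb 0 0)
  have hb' : ∀ s, |g' s| ≤ C := fun s =>
    le_of_tendsto (hlim s).abs (Eventually.of_forall fun n => hb n s)
  have hmeas : Measurable g' := measurable_of_tendsto_metrizable (fun n => (hg n).measurable)
    (tendsto_pi_nhds.2 hlim)
  have hcomp := fun n => h.comp_primitive_of_continuous (hg n) (hb n)
  have hGlim : ∀ t, Tendsto (fun n => ∫ s in (0 : ℝ)..t, g n s) atTop (𝓝 (∫ s in (0 : ℝ)..t, g' s)) :=
    fun t => intervalIntegral.tendsto_integral_filter_of_dominated_convergence (fun _ => C)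
      (Eventually.of_forall fun n => (hg n).aestronglyMeasurable)
      (Eventually.of_forall fun n => ae_of_all _ fun x _ => hb n x) (by simp)
      (ae_of_all _ fun x _ => hlim x)
  have hle : ∀ {k : ℝ → ℝ}, (∀ s, |k s| ≤ C) → ∀ t, |∫ s in (0 : ℝ)..t, k s| ≤ C * |t| := by
    intro k hk t
    simpa using norm_integral_le_of_norm_le_const (a := 0) (b := t) (f := k) fun x _ => hk x
  have m1 : AEStronglyMeasurable (fun x => ∫ s in (0 : ℝ)..u x, g' s) volume :=
    aestronglyMeasurable_of_tendsto_ae atTop (fun n => (hcomp n).memLp.1)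
      (ae_of_all _ fun x => hGlim (u x))
  have m2 : AEStronglyMeasurable (fun x => g' (u x) • D x) volume :=
    aestronglyMeasurable_of_tendsto_ae atTop (fun n => (hcomp n).memLp_grad.1)
      (ae_of_all _ fun x => (hlim (u x)).smul_const (D x))
  have mem1 : MemLp (fun x => ∫ s in (0 : ℝ)..u x, g' s) 2 volume := by
    refine (h.memLp.const_mul C).mono m1 (ae_of_all _ fun x => ?_)
    rw [norm_mul, Real.norm_of_nonneg hC]
    exact hle hb' _
  have mem2 : MemLp (fun x => g' (u x) • D x) 2 volume := by
    refine (h.memLp_grad.const_smul C).mono m2 (ae_of_all _ fun x => ?_)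
    rw [Pi.smul_apply, norm_smul, norm_smul, Real.norm_of_nonneg hC]
    gcongr
    exact hb' _
  refine of_tendsto hcomp mem1 mem2 ?_ ?_
  · refine tendsto_eLpNorm_two_of_dominated (fun n => (hcomp n).memLp.1.sub m1)
      (h.memLp.norm.const_mul (2 * C)) (fun n => ae_of_all _ fun x => ?_) (ae_of_all _ fun x => ?_)
    · have h1 := hle (hb n) (u x)
      have h2 := hle hb' (u x)
      calc _ ≤ |∫ s in (0 : ℝ)..u x, g n s| + |∫ s in (0 : ℝ)..u x, g' s| := abs_sub _ _
        _ ≤ 2 * C * ‖u x‖ := by rw [Real.norm_eq_abs]; linarith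
    · simpa using (hGlim (u x)).sub_const (∫ s in (0 : ℝ)..u x, g' s)
  · refine tendsto_eLpNorm_two_of_dominated (fun n => (hcomp n).memLp_grad.1.sub m2)
      (h.memLp_grad.norm.const_mul (2 * C)) (fun n => ae_of_all _ fun x => ?_)
      (ae_of_all _ fun x => ?_)
    · rw [Pi.sub_apply, ← sub_smul, norm_smul]
      gcongr
      calc _ ≤ |g n (u x)| + |g' (u x)| := abs_sub _ _
        _ ≤ 2 * C := by linarith [hb n (u x), hb' (u x)]
    · simpa using ((hlim (u x)).smul_const (D x)).sub_const (g' (u x) • D x)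

end H1

theorem integral_indicator_Ioi {k : ℝ} (hk : 0 ≤ k) (t : ℝ) :
    ∫ s in (0 : ℝ)..t, (if k < s then (1 : ℝ) else 0) = max (t - k) 0 := by
  rcases le_total t k with h | h
  · rw [max_eq_right (by linarith)]
    rw [intervalIntegral.integral_congr (g := fun _ => (0 : ℝ))]
    · simp
    · intro s hs
      have : s ≤ k := hs.2.trans (max_le hk h)
      simp [this]
  · rw [max_eq_left (by linarith)]
    have i1 : ∀ a b : ℝ, IntervalIntegrable (fun s => if k < s then (1 : ℝ) else 0) volume a b := by
      intro a b
      refine (intervalIntegrable_const (c := (1 : ℝ))).mono_fun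
        (Measurable.ite measurableSet_Ioi measurable_const measurable_const).aestronglyMeasurable
        (ae_of_all _ fun s => ?_)
      dsimp only
      split_ifs <;> simp
    rw [← integral_add_adjacent_intervals (i1 0 k) (i1 k t)]
    have e1 : ∫ s in (0 : ℝ)..k, (if k < s then (1 : ℝ) else 0) = 0 := by
      rw [intervalIntegral.integral_congr (g := fun _ => (0 : ℝ))]
      · simp
      · intro s hs
        have : s ≤ k := by simpa [hk] using hs.2
        simp [this]
    have e2 : ∫ s in k..t, (if k < s then (1 : ℝ) else 0) = t - k := by
      rw [intervalIntegral.integral_congr_ae (g := fun _ => (1 : ℝ))]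
      · simp
      · refine ae_of_all _ fun s hs => ?_
        have : k < s := by
          rw [Set.uIoc_of_le h] at hs
          exact hs.1
        simp [this]
    rw [e1, e2, zero_add]

theorem tendsto_ramp (k s : ℝ) :
    Tendsto (fun n : ℕ => min 1 (max 0 ((n : ℝ) * (s - k)))) atTop
      (𝓝 (if k < s then (1 : ℝ) else 0)) := by
  split_ifs with h
  · refine tendsto_const_nhds.congr' ?_
    have : Tendsto (fun n : ℕ => (n : ℝ) * (s - k)) atTop atTop :=
      tendsto_natCast_atTop_atTop.atTop_mul_const (by linarith)
    filter_upwards [this.eventually_ge_atTop 1] with n hn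
    rw [min_eq_left]
    exact hn.trans (le_max_right _ _)
  · refine tendsto_const_nhds.congr fun n => ?_
    have : (n : ℝ) * (s - k) ≤ 0 := mul_nonpos_of_nonneg_of_nonpos (by positivity) (by linarith)
    rw [max_eq_left this]
    simp

theorem tendsto_spike (s : ℝ) :
    Tendsto (fun n : ℕ => max 0 (1 - (n : ℝ) * |s|)) atTop (𝓝 (if s = 0 then (1 : ℝ) else 0)) := by
  split_ifs with h
  · simp [h]
  · refine tendsto_const_nhds.congr' ?_
    have : Tendsto (fun n : ℕ => (n : ℝ) * |s|) atTop atTop :=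
      tendsto_natCast_atTop_atTop.atTop_mul_const (by positivity)
    filter_upwards [this.eventually_ge_atTop 1] with n hn
    rw [max_eq_left (by linarith)]

namespace H1

variable {u v : E3 → ℝ} {D D' : E3 → E3}

theorem posPart_sub (h : H1 u D) {k : ℝ} (hk : 0 ≤ k) :
    H1 (fun x => max (u x - k) 0) (fun x => if k < u x then D x else 0) := by
  have := h.comp_primitive (g := fun n s => min 1 (max 0 ((n : ℝ) * (s - k))))
    (g' := fun s => if k < s then (1 : ℝ) else 0) (C := 1) (fun n => by fun_prop)
    (fun n s => by
      rw [abs_of_nonneg (le_min zero_le_one (le_max_left _ _))]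
      exact min_le_left _ _) (fun s => tendsto_ramp k s)
  simpa [integral_indicator_Ioi hk] using this

theorem posPart (h : H1 u D) :
    H1 (fun x => max (u x) 0) (fun x => if 0 < u x then D x else 0) := by
  simpa using h.posPart_sub le_rfl

theorem negPart (h : H1 u D) :
    H1 (fun x => min (u x) 0) (fun x => if u x < 0 then D x else 0) := by
  have := h.neg.posPart.neg
  convert this using 1
  · ext1 x
    simp [← min_neg_neg]
  · ext1 x
    simp only [Pi.neg_apply, Left.neg_pos_iff]
    split_ifs <;> simp

theorem grad_eq_zero (h : H1 u D) : ∀ᵐ x, u x = 0 → D x = 0 := by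
  have h1 := h.comp_primitive (g := fun n s => max 0 (1 - (n : ℝ) * |s|))
    (g' := fun s => if s = 0 then (1 : ℝ) else 0) (C := 1) (fun n => by fun_prop)
    (fun n s => by
      rw [abs_of_nonneg (le_max_left _ _)]
      exact max_le zero_le_one (by nlinarith [abs_nonneg s, (n.cast_nonneg : (0 : ℝ) ≤ n)]))
    (fun s => tendsto_spike s)
  have e : ∀ t : ℝ, ∫ s in (0 : ℝ)..t, (if s = 0 then (1 : ℝ) else 0) = 0 := by
    intro t
    rw [intervalIntegral.integral_congr_ae (g := fun _ => (0 : ℝ))]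
    · simp
    · have : ∀ᵐ s : ℝ, s ≠ 0 := by simp [ae_iff]
      filter_upwards [this] with s hs _
      simp [hs]
  simp only [e] at h1
  have h0 : H1 (fun _ => (0 : ℝ)) (fun _ => (0 : E3)) := by
    have := h.const_smul 0
    rwa [zero_smul, zero_smul] at this
  filter_upwards [h1.grad_ae_eq h0 EventuallyEq.rfl] with x hx hu
  simpa [hu] using hx

end H1

theorem exists_sobolev_const : ∃ S : ℝ, 0 < S ∧ ∀ (u : E3 → ℝ) (D : E3 → E3), H1 u D →
    MemLp u 6 volume ∧ ∫ x, |u x| ^ 6 ≤ S * (∫ x, ‖D x‖ ^ 2) ^ 3 := by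
  set c : ℝ≥0 := SNormLESNormFDerivOfEqConst ℝ (volume : Measure E3) 2
  have base : ∀ φ, IsTest φ → eLpNorm φ 6 volume ≤ c * eLpNorm (gradient φ) 2 volume := by
    intro φ hφ
    have := eLpNorm_le_eLpNorm_fderiv_of_eq (F := ℝ) (volume : Measure E3) hφ.1 hφ.2 (p := 2)
      (p' := 6) (by norm_num) (by simp) (by simp; norm_num)
    have e : eLpNorm (gradient φ) 2 volume = eLpNorm (fderiv ℝ φ) 2 volume :=
      eLpNorm_congr_norm_ae (ae_of_all _ fun x => norm_gradient φ x)
    rw [e]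
    exact_mod_cast this
  have gen : ∀ (u : E3 → ℝ) (D : E3 → E3), H1 u D → eLpNorm u 6 volume ≤ c * eLpNorm D 2 volume := by
    intro u D h
    obtain ⟨φ, hφ, -, h2, h3⟩ := h.exists_seq
    refine (Lp.eLpNorm_lim_le_liminf_eLpNorm (fun n => ((hφ n).memLp 2).1) u h3).trans ?_
    have lim : Tendsto (fun n => (c : ℝ≥0∞) * (eLpNorm (gradient (φ n) - D) 2 volume
        + eLpNorm D 2 volume)) atTop (𝓝 (c * eLpNorm D 2 volume)) := by
      have := ENNReal.Tendsto.const_mul (h2.add_const (eLpNorm D 2 volume))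
        (Or.inr (ENNReal.coe_ne_top (r := c)))
      simpa using this
    rw [← lim.liminf_eq]
    refine liminf_le_liminf (Eventually.of_forall fun n => (base _ (hφ n)).trans ?_)
    gcongr
    calc eLpNorm (gradient (φ n)) 2 volume = eLpNorm ((gradient (φ n) - D) + D) 2 volume := by simp
      _ ≤ _ := eLpNorm_add_le (((hφ n).memLp_gradient 2).1.sub h.memLp_grad.1) h.memLp_grad.1
        (by norm_num)
  refine ⟨(c : ℝ) ^ 6 + 1, by positivity, fun u D h => ?_⟩
  have h6 : MemLp u 6 volume := ⟨h.memLp.1, (gen u D h).trans_lt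
    (ENNReal.mul_lt_top ENNReal.coe_lt_top h.memLp_grad.2)⟩
  refine ⟨h6, ?_⟩
  have := gen u D h
  rw [h6.eLpNorm_eq_integral_rpow_norm (by norm_num) (by norm_num),
    h.memLp_grad.eLpNorm_eq_integral_rpow_norm (by norm_num) (by norm_num),
    ← ENNReal.ofReal_coe_nnreal, ← ENNReal.ofReal_mul (by positivity),
    ENNReal.ofReal_le_ofReal_iff (by positivity)] at this
  simp only [ENNReal.toReal_ofNat, Real.norm_eq_abs] at this
  have e6 : ∀ y : ℝ, y ^ (6 : ℝ) = y ^ 6 := fun y => by exact_mod_cast Real.rpow_natCast y 6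
  have e2 : ∀ y : ℝ, y ^ (2 : ℝ) = y ^ 2 := fun y => by exact_mod_cast Real.rpow_natCast y 2
  simp only [e6, e2] at this
  have nn1 : 0 ≤ ∫ x, |u x| ^ 6 := integral_nonneg fun x => by positivity
  have nn2 : 0 ≤ ∫ x, ‖D x‖ ^ 2 := integral_nonneg fun x => by positivity
  have p := pow_le_pow_left₀ (by positivity) this 6
  rw [mul_pow, ← Real.rpow_natCast (_ ^ _), ← Real.rpow_mul nn1,
    ← Real.rpow_natCast (((∫ x, ‖D x‖ ^ 2)) ^ _), ← Real.rpow_mul nn2] at p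
  norm_num at p
  refine p.trans ?_
  gcongr
  linarith

theorem exists_weakly_convergent_subseq {X : Type*} [NormedAddCommGroup X] [InnerProductSpace ℝ X]
    [CompleteSpace X] [TopologicalSpace.SeparableSpace X] (x : ℕ → X) {M : ℝ}
    (hM : ∀ n, ‖x n‖ ≤ M) :
    ∃ y : X, ∃ ns : ℕ → ℕ, StrictMono ns ∧
      ∀ z, Tendsto (fun k => inner ℝ (x (ns k)) z) atTop (𝓝 (inner ℝ y z)) := by
  let f : ℕ → WeakDual ℝ X := fun n =>
    StrongDual.toWeakDual (InnerProductSpace.toDual ℝ X (x n))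
  have hf : ∀ n, f n ∈ WeakDual.toStrongDual ⁻¹' Metric.closedBall (0 : StrongDual ℝ X) M := by
    intro n
    simp only [Set.mem_preimage, mem_closedBall, dist_zero_right]
    change ‖InnerProductSpace.toDual ℝ X (x n)‖ ≤ M
    simpa using hM n
  obtain ⟨a, -, ns, hns, hlim⟩ := WeakDual.isSeqCompact_closedBall ℝ X (0 : StrongDual ℝ X) M hf
  refine ⟨(InnerProductSpace.toDual ℝ X).symm (WeakDual.toStrongDual a), ns, hns, fun z => ?_⟩
  rw [InnerProductSpace.toDual_symm_apply]
  have := (WeakBilin.eval_continuous (topDualPairing ℝ X) z).continuousAt.tendsto.comp hlim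
  refine this.congr fun k => ?_
  rfl

/-- The Hilbert space containing the pairs `(u, ∇u)`. -/
abbrev PairSpace := WithLp 2 (Lp ℝ 2 (volume : Measure E3) × Lp E3 2 (volume : Measure E3))

/-- The graph of the weak gradient, as a closed subspace of `L² × L²`. -/
def graphSubmodule : Submodule ℝ PairSpace where
  carrier := {p | H1 p.fst p.snd}
  add_mem' {a b} ha hb := (H1.add ha hb).congr_ae (Lp.coeFn_add _ _).symm (Lp.coeFn_add _ _).symm
  zero_mem' := by
    have h : H1 ((0 : ℝ) • (0 : E3 → ℝ)) ((0 : ℝ) • gradient (0 : E3 → ℝ)) :=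
      H1.const_smul (IsTest.h1 ⟨contDiff_const, HasCompactSupport.zero⟩) 0
    rw [zero_smul, zero_smul] at h
    exact h.congr_ae (Lp.coeFn_zero _ _ _).symm (Lp.coeFn_zero _ _ _).symm
  smul_mem' c _ ha := (H1.const_smul ha c).congr_ae (Lp.coeFn_smul _ _).symm (Lp.coeFn_smul _ _).symm

theorem isClosed_graphSubmodule : IsClosed (graphSubmodule : Set PairSpace) := by
  rw [← isSeqClosed_iff_isClosed]
  intro x p hx hp
  have h1 : Tendsto (fun n => (x n).fst) atTop (𝓝 p.fst) :=
    ((WithLp.prod_continuous_ofLp 2 _ _).tendsto p |>.comp hp).fst_nhds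
  have h2 : Tendsto (fun n => (x n).snd) atTop (𝓝 p.snd) :=
    ((WithLp.prod_continuous_ofLp 2 _ _).tendsto p |>.comp hp).snd_nhds
  exact H1.of_tendsto hx (Lp.memLp _) (Lp.memLp _) ((Lp.tendsto_Lp_iff_tendsto_eLpNorm' _ _).1 h1)
    ((Lp.tendsto_Lp_iff_tendsto_eLpNorm' _ _).1 h2)

theorem inner_toLp_eq_integral {F : Type*} [NormedAddCommGroup F] [InnerProductSpace ℝ F]
    {a b : E3 → F} (ha : MemLp a 2 volume) (hb : MemLp b 2 volume) :
    inner ℝ (ha.toLp a) (hb.toLp b) = ∫ x, inner ℝ (a x) (b x) := by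
  rw [L2.inner_def]
  refine integral_congr_ae ?_
  filter_upwards [ha.coeFn_toLp, hb.coeFn_toLp] with x h1 h2
  rw [h1, h2]

theorem norm_toLp_sq_eq_integral {F : Type*} [NormedAddCommGroup F] [InnerProductSpace ℝ F]
    {a : E3 → F} (ha : MemLp a 2 volume) : ‖ha.toLp a‖ ^ 2 = ∫ x, ‖a x‖ ^ 2 := by
  rw [← real_inner_self_eq_norm_sq, inner_toLp_eq_integral]
  simp

theorem H1.exists_weak_limit {u : ℕ → E3 → ℝ} {D : ℕ → E3 → E3} (h : ∀ n, H1 (u n) (D n)) {M : ℝ}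
    (hu : ∀ n, ∫ x, ‖u n x‖ ^ 2 ≤ M) (hD : ∀ n, ∫ x, ‖D n x‖ ^ 2 ≤ M) :
    ∃ (v : E3 → ℝ) (G : E3 → E3) (ns : ℕ → ℕ), StrictMono ns ∧ H1 v G ∧
      (∀ w, MemLp w 2 volume →
        Tendsto (fun k => ∫ x, inner ℝ (u (ns k) x) (w x)) atTop (𝓝 (∫ x, inner ℝ (v x) (w x)))) ∧
      (∀ W, MemLp W 2 volume →
        Tendsto (fun k => ∫ x, inner ℝ (D (ns k) x) (W x)) atTop
          (𝓝 (∫ x, inner ℝ (G x) (W x)))) := by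
  let p : ℕ → PairSpace := fun n =>
    WithLp.toLp 2 ((h n).memLp.toLp (u n), (h n).memLp_grad.toLp (D n))
  have hp : ∀ n, p n ∈ graphSubmodule := fun n =>
    (h n).congr_ae (h n).memLp.coeFn_toLp.symm (h n).memLp_grad.coeFn_toLp.symm
  have hM : ∀ n, ‖p n‖ ≤ √(M + M) := by
    intro n
    refine Real.le_sqrt_of_sq_le ?_
    rw [WithLp.prod_norm_sq_eq_of_L2]
    change ‖(h n).memLp.toLp (u n)‖ ^ 2 + ‖(h n).memLp_grad.toLp (D n)‖ ^ 2 ≤ M + M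
    rw [norm_toLp_sq_eq_integral, norm_toLp_sq_eq_integral]
    exact add_le_add (hu n) (hD n)
  have : Fact ((2 : ℝ≥0∞) ≠ ⊤) := ⟨by norm_num⟩
  have : SecondCountableTopology (Lp ℝ 2 (volume : Measure E3)) := Lp.SecondCountableTopology
  have : SecondCountableTopology (Lp E3 2 (volume : Measure E3)) := Lp.SecondCountableTopology
  have : TopologicalSpace.SeparableSpace PairSpace :=
    ((WithLp.homeomorphProd 2 (Lp ℝ 2 (volume : Measure E3))
      (Lp E3 2 (volume : Measure E3))).symm.surjective.denseRange).separableSpace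
        (WithLp.homeomorphProd 2 _ _).symm.continuous
  obtain ⟨y, ns, hns, hlim⟩ := exists_weakly_convergent_subseq p hM
  have hy : y ∈ graphSubmodule := by
    have : CompleteSpace graphSubmodule := isClosed_graphSubmodule.completeSpace_coe
    rw [← Submodule.orthogonal_orthogonal graphSubmodule, Submodule.mem_orthogonal']
    intro z hz
    refine tendsto_nhds_unique (hlim z) ?_
    simp_rw [Submodule.inner_right_of_mem_orthogonal (hp _) hz]
    exact tendsto_const_nhds
  refine ⟨y.fst, y.snd, ns, hns, hy, fun w hw => ?_, fun W hW => ?_⟩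
  · have := hlim (WithLp.toLp 2 (hw.toLp w, 0))
    simp only [WithLp.prod_inner_apply, p, inner_zero_right, add_zero] at this
    simp_rw [inner_toLp_eq_integral] at this
    convert this using 2
    rw [← inner_toLp_eq_integral (Lp.memLp _) hw, Lp.toLp_coeFn]
    rfl
  · have := hlim (WithLp.toLp 2 (0, hW.toLp W))
    simp only [WithLp.prod_inner_apply, p, inner_zero_right, zero_add] at this
    simp_rw [inner_toLp_eq_integral] at this
    convert this using 2
    rw [← inner_toLp_eq_integral (Lp.memLp _) hW, Lp.toLp_coeFn]
    rfl

theorem integral_inner_sq_le {F : Type*} [NormedAddCommGroup F] [InnerProductSpace ℝ F]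
    {a b : E3 → F} (ha : MemLp a 2 volume) (hb : MemLp b 2 volume) :
    |∫ x, inner ℝ (a x) (b x)| ≤ √(∫ x, ‖a x‖ ^ 2) * √(∫ x, ‖b x‖ ^ 2) := by
  rw [← inner_toLp_eq_integral ha hb, ← norm_toLp_sq_eq_integral ha, ← norm_toLp_sq_eq_integral hb,
    Real.sqrt_sq (norm_nonneg _), Real.sqrt_sq (norm_nonneg _)]
  exact abs_real_inner_le_norm _ _

theorem integral_mul_sq_le {a b : E3 → ℝ} (ha : MemLp a 2 volume) (hb : MemLp b 2 volume) :
    |∫ x, a x * b x| ≤ √(∫ x, a x ^ 2) * √(∫ x, b x ^ 2) := by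
  have := integral_inner_sq_le hb ha
  simp only [Real.norm_eq_abs, sq_abs] at this
  rw [mul_comm]
  exact this

theorem memLp_translate {F : Type*} [NormedAddCommGroup F] {a : E3 → F} (ha : MemLp a 2 volume)
    (z : E3) : MemLp (fun x => a (x + z)) 2 volume :=
  ha.comp_measurePreserving (measurePreserving_add_right volume z)

theorem IsTest.integral_mul_translate_le {φ : E3 → ℝ} (h : IsTest φ) (z : E3) :
    |(∫ x, φ x * φ (x + z)) - ∫ x, φ x * φ x| ≤
      ‖z‖ * (√(∫ x, φ x ^ 2) * √(∫ x, ‖gradient φ x‖ ^ 2)) := by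
  have hc : Continuous φ := h.1.continuous
  have hdc : Continuous (fderiv ℝ φ) := h.1.continuous_fderiv one_ne_zero
  obtain ⟨C, hC⟩ := (h.2.fderiv (𝕜 := ℝ)).exists_bound_of_continuous hdc
  have hder : ∀ t : ℝ, HasDerivAt (fun t : ℝ => ∫ x, φ x * φ (x + t • z))
      (∫ x, φ x * fderiv ℝ φ (x + t • z) z) t := by
    intro t
    refine (hasDerivAt_integral_of_dominated_loc_of_deriv_le (𝕜 := ℝ) (s := Set.univ)
      (F := fun t x => φ x * φ (x + t • z)) (F' := fun t x => φ x * fderiv ℝ φ (x + t • z) z)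
      (bound := fun x => |φ x| * (C * ‖z‖)) univ_mem ?_ ?_ ?_ ?_ ?_ ?_).2
    · exact Eventually.of_forall fun t => (by fun_prop : Continuous _).aestronglyMeasurable
    · exact (Continuous.integrable_of_hasCompactSupport (by fun_prop) h.2.mul_right)
    · exact (by fun_prop : Continuous fun x => φ x * fderiv ℝ φ (x + t • z) z).aestronglyMeasurable
    · refine Eventually.of_forall fun x t _ => ?_
      rw [norm_mul, Real.norm_eq_abs]
      gcongr
      exact (ContinuousLinearMap.le_opNorm _ _).trans (by gcongr; exact hC _)
    · exact ((hc.integrable_of_hasCompactSupport h.2).abs.mul_const _)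
    · refine Eventually.of_forall fun x t _ => ?_
      have h1 : HasDerivAt (fun t : ℝ => x + t • z) z t := by
        simpa using ((hasDerivAt_id t).smul_const z).const_add x
      exact ((h.differentiable _).hasFDerivAt.comp_hasDerivAt t h1).const_mul _
  have hb : ∀ t : ℝ, ‖∫ x, φ x * fderiv ℝ φ (x + t • z) z‖ ≤
      ‖z‖ * (√(∫ x, φ x ^ 2) * √(∫ x, ‖gradient φ x‖ ^ 2)) := by
    intro t
    have h1 := integral_inner_sq_le ((h.memLp 2).norm.mul_const ‖z‖ |>.congr_norm
      (by fun_prop : Continuous fun x => φ x • z).aestronglyMeasurable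
      (Eventually.of_forall fun x => by simp [norm_smul]))
      (memLp_translate (h.memLp_gradient 2) (t • z))
    have e1 : ∀ x, inner ℝ (φ x • z) (gradient φ (x + t • z)) = φ x * fderiv ℝ φ (x + t • z) z := by
      intro x
      rw [inner_smul_left, real_inner_comm, inner_gradient_left]
      simp
    simp_rw [e1] at h1
    rw [integral_add_right_eq_self (fun x => ‖gradient φ x‖ ^ 2) (t • z)] at h1
    simp_rw [norm_smul, mul_pow, Real.norm_eq_abs, sq_abs] at h1
    rw [MeasureTheory.integral_mul_const, Real.sqrt_mul (integral_nonneg fun x => sq_nonneg _),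
      Real.sqrt_sq (norm_nonneg _)] at h1
    rw [Real.norm_eq_abs]
    calc _ ≤ _ := h1
      _ = _ := by ring
  have := norm_image_sub_le_of_norm_deriv_le_segment_01'
    (fun t _ => (hder t).hasDerivWithinAt) (fun t _ => hb t)
  simpa using this

theorem H1.integral_mul_translate_le {u : E3 → ℝ} {D : E3 → E3} (h : H1 u D) (z : E3) :
    |(∫ x, u x * u (x + z)) - ∫ x, u x * u x| ≤
      ‖z‖ * (√(∫ x, u x ^ 2) * √(∫ x, ‖D x‖ ^ 2)) := by
  obtain ⟨φ, hφ, h1, h2, -⟩ := h.exists_seq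
  have hm := fun n => (hφ n).memLp 2
  have t1 : Tendsto (fun n => ∫ x, φ n x * φ n x) atTop (𝓝 (∫ x, u x * u x)) :=
    tendsto_integral_inner (F := ℝ) hm h.memLp hm h.memLp h1 h1
  have hz : ∀ n, eLpNorm ((fun x => φ n (x + z)) - fun x => u (x + z)) 2 volume
      = eLpNorm (φ n - u) 2 volume := fun n =>
    eLpNorm_comp_measurePreserving ((hm n).sub h.memLp).1 (measurePreserving_add_right volume z)
  have t2 : Tendsto (fun n => ∫ x, φ n x * φ n (x + z)) atTop (𝓝 (∫ x, u x * u (x + z))) := by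
    have := tendsto_integral_inner (F := ℝ) (fun n => memLp_translate (hm n) z)
      (memLp_translate h.memLp z) hm h.memLp ((tendsto_congr hz).2 h1) h1
    exact this
  have hg := fun n => (hφ n).memLp_gradient 2
  have t3 := tendsto_integral_inner hg h.memLp_grad hg h.memLp_grad h2 h2
  simp_rw [real_inner_self_eq_norm_sq] at t3
  simp_rw [pow_two (u _)]
  refine le_of_tendsto_of_tendsto (t2.sub t1).abs
    ((t1.sqrt.mul t3.sqrt).const_mul ‖z‖) (Eventually.of_forall fun n => ?_)
  simpa only [pow_two (φ n _)] using (hφ n).integral_mul_translate_le z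

theorem MemLp.integrable_of_ball {u : E3 → ℝ} {R : ℝ} (hu : MemLp u 2 volume)
    (h0 : ∀ᵐ x, x ∉ ball (0 : E3) R → u x = 0) : Integrable u := by
  have h1 : MemLp ((ball (0 : E3) R).indicator fun _ => (1 : ℝ)) 2 volume :=
    memLp_indicator_const 2 measurableSet_ball 1 (Or.inr measure_ball_lt_top.ne)
  refine (hu.integrable_mul h1).congr ?_
  filter_upwards [h0] with x hx
  by_cases hxb : x ∈ ball (0 : E3) R <;> simp [hxb, hx]

theorem integrable_mul_translate {u : E3 → ℝ} (h : Integrable u) :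
    Integrable (fun p : E3 × E3 => u p.1 * u (p.1 + p.2)) (volume.prod volume) :=
  ((measurePreserving_prod_add (volume : Measure E3) volume).integrable_comp
    (h.mul_prod h).1).2 (h.mul_prod h)

/-- The integral of `u` over the ball of radius `ε` around `x`. -/
def ballIntegral (ε : ℝ) (u : E3 → ℝ) (x : E3) : ℝ := ∫ z in ball (0 : E3) ε, u (x + z)

theorem ballIntegral_eq (ε : ℝ) (u : E3 → ℝ) (x : E3) :
    ballIntegral ε u x = ∫ y, u y * (ball x ε).indicator (fun _ => 1) y := by
  rw [ballIntegral, ← MeasureTheory.integral_indicator measurableSet_ball,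
    ← integral_add_left_eq_self (fun y => u y * _) x]
  refine integral_congr_ae (Eventually.of_forall fun z => ?_)
  by_cases hz : z ∈ ball (0 : E3) ε
  · have : x + z ∈ ball x ε := by simpa using hz
    simp [hz, this]
  · have : x + z ∉ ball x ε := by simpa using hz
    simp [hz, this]

theorem memLp_indicator_ball (x : E3) (ε : ℝ) :
    MemLp ((ball x ε).indicator fun _ => (1 : ℝ)) 2 volume :=
  memLp_indicator_const 2 measurableSet_ball 1 (Or.inr measure_ball_lt_top.ne)

theorem integral_indicator_ball_sq (x : E3) (ε : ℝ) :
    ∫ y, ((ball x ε).indicator (fun _ => (1 : ℝ)) y) ^ 2 = volume.real (ball (0 : E3) ε) := by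
  have : ∀ y, ((ball x ε).indicator (fun _ => (1 : ℝ)) y) ^ 2 =
      (ball x ε).indicator (fun _ => (1 : ℝ)) y := fun y => by
    by_cases hy : y ∈ ball x ε <;> simp [hy]
  simp_rw [this]
  rw [MeasureTheory.integral_indicator measurableSet_ball, setIntegral_const, smul_eq_mul, mul_one,
    measureReal_def, measureReal_def, Measure.addHaar_ball_center]

theorem abs_ballIntegral_le {u : E3 → ℝ} (hu : MemLp u 2 volume) (ε : ℝ) (x : E3) :
    |ballIntegral ε u x| ≤ √(∫ y, u y ^ 2) * √(volume.real (ball (0 : E3) ε)) := by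
  rw [ballIntegral_eq, ← integral_indicator_ball_sq x]
  exact integral_mul_sq_le hu (memLp_indicator_ball x ε)

theorem H1.integral_sq_le {u : E3 → ℝ} {D : E3 → E3} (h : H1 u D) {R : ℝ}
    (h0 : ∀ᵐ x, x ∉ ball (0 : E3) R → u x = 0) {ε : ℝ} :
    volume.real (ball (0 : E3) ε) * ∫ x, u x ^ 2 ≤
      (∫ x, u x * ballIntegral ε u x) +
      volume.real (ball (0 : E3) ε) * (ε * (√(∫ x, u x ^ 2) * √(∫ x, ‖D x‖ ^ 2))) := by
  have hu := MemLp.integrable_of_ball h.memLp h0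
  have hp := integrable_mul_translate hu
  have hp' : Integrable (fun p : E3 × E3 => u p.1 * u (p.1 + p.2))
      (volume.prod (volume.restrict (ball (0 : E3) ε))) :=
    hp.mono_measure (Measure.prod_mono le_rfl Measure.restrict_le_self)
  have e : ∫ x, u x * ballIntegral ε u x = ∫ z in ball (0 : E3) ε, ∫ x, u x * u (x + z) := by
    rw [← integral_integral_swap hp']
    simp_rw [MeasureTheory.integral_const_mul]
    rfl
  rw [e]
  have : ∫ z in ball (0 : E3) ε, ∫ x, u x ^ 2 ≤ ∫ z in ball (0 : E3) ε,
      ((∫ x, u x * u (x + z)) + ε * (√(∫ x, u x ^ 2) * √(∫ x, ‖D x‖ ^ 2))) := by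
    refine setIntegral_mono_on (integrableOn_const measure_ball_lt_top.ne)
      (hp'.integral_prod_right.add (integrableOn_const measure_ball_lt_top.ne))
      measurableSet_ball fun z hz => ?_
    have h1 := (abs_le.1 (h.integral_mul_translate_le z)).1
    have h2 : ‖z‖ * (√(∫ x, u x ^ 2) * √(∫ x, ‖D x‖ ^ 2)) ≤
        ε * (√(∫ x, u x ^ 2) * √(∫ x, ‖D x‖ ^ 2)) := by
      gcongr
      exact (mem_ball_zero_iff.1 hz).le
    simp_rw [← pow_two] at h1
    linarith
  rw [integral_add hp'.integral_prod_right (integrableOn_const measure_ball_lt_top.ne),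
    setIntegral_const, setIntegral_const] at this
  simpa using this

theorem tendsto_integral_sq_zero {d : ℕ → E3 → ℝ} {E : ℕ → E3 → E3} (h : ∀ n, H1 (d n) (E n))
    {R M : ℝ} (h0 : ∀ n, ∀ᵐ x, x ∉ ball (0 : E3) R → d n x = 0)
    (hd : ∀ n, ∫ x, d n x ^ 2 ≤ M) (hE : ∀ n, ∫ x, ‖E n x‖ ^ 2 ≤ M)
    (hw : ∀ w, MemLp w 2 volume → Tendsto (fun n => ∫ x, d n x * w x) atTop (𝓝 0)) :
    Tendsto (fun n => ∫ x, d n x ^ 2) atTop (𝓝 0) := by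
  have hM : 0 ≤ M := (integral_nonneg fun x => sq_nonneg (d 0 x)).trans (hd 0)
  have key : ∀ ε : ℝ, Tendsto (fun n => ∫ x, d n x * ballIntegral ε (d n) x) atTop (𝓝 0) := by
    intro ε
    set B : ℕ → E3 → ℝ := fun n => (ball (0 : E3) R).indicator (ballIntegral ε (d n)) with hB
    have hBb : ∀ n x, |B n x| ≤ √M * √(volume.real (ball (0 : E3) ε)) := by
      intro n x
      by_cases hx : x ∈ ball (0 : E3) R
      · simp only [hB, hx, Set.indicator_of_mem]
        exact (abs_ballIntegral_le (h n).memLp ε x).trans (by gcongr; exact hd n)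
      · simp only [hB, hx, not_false_eq_true, Set.indicator_of_notMem, abs_zero]
        positivity
    have hmeas : ∀ n, AEStronglyMeasurable (B n) volume := by
      intro n
      refine AEStronglyMeasurable.indicator ?_ measurableSet_ball
      have h2 : AEStronglyMeasurable (fun p : E3 × E3 => d n (p.1 + p.2))
          (volume.prod (volume.restrict (ball (0 : E3) ε))) :=
        (((h n).memLp.1.comp_quasiMeasurePreserving
          (Measure.quasiMeasurePreserving_snd)).comp_quasiMeasurePreserving
          (measurePreserving_prod_add (volume : Measure E3) volume).quasiMeasurePreserving).mono_measure
          (Measure.prod_mono le_rfl Measure.restrict_le_self)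
      exact h2.integral_prod_right'
    have hlim : Tendsto (fun n => ∫ x, B n x ^ 2) atTop (𝓝 0) := by
      have := tendsto_integral_of_dominated_convergence (μ := (volume : Measure E3))
        (F := fun n x => B n x ^ 2) (f := fun _ => 0)
        ((ball (0 : E3) R).indicator fun _ => (√M * √(volume.real (ball (0 : E3) ε))) ^ 2)
        (fun n => (hmeas n).pow 2)
        ((integrable_indicator_iff measurableSet_ball).2
          (integrableOn_const measure_ball_lt_top.ne))
        (fun n => Eventually.of_forall fun x => ?_) (Eventually.of_forall fun x => ?_)
      · simpa using this
      · by_cases hx : x ∈ ball (0 : E3) R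
        · simp only [hx, Set.indicator_of_mem, norm_pow, Real.norm_eq_abs]
          exact pow_le_pow_left₀ (abs_nonneg _) (hBb n x) 2
        · simp [hB, hx]
      · by_cases hx : x ∈ ball (0 : E3) R
        · simp only [hB, hx, Set.indicator_of_mem, ballIntegral_eq]
          simpa using (hw _ (memLp_indicator_ball x ε)).pow 2
        · simp [hB, hx]
    have hBm : ∀ n, MemLp (B n) 2 volume := by
      intro n
      refine MemLp.mono ((memLp_indicator_ball 0 R).const_mul
        (√M * √(volume.real (ball (0 : E3) ε)))) (hmeas n) (Eventually.of_forall fun x => ?_)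
      by_cases hx : x ∈ ball (0 : E3) R
      · simp only [hx, Set.indicator_of_mem, Real.norm_eq_abs, mul_one]
        exact (hBb n x).trans (le_abs_self _)
      · simp [hB, hx]
    have hb : ∀ n, ‖∫ x, d n x * ballIntegral ε (d n) x‖ ≤ √M * √(∫ x, B n x ^ 2) := by
      intro n
      have : ∫ x, d n x * ballIntegral ε (d n) x = ∫ x, d n x * B n x := by
        refine integral_congr_ae ?_
        filter_upwards [h0 n] with x hx
        by_cases hxb : x ∈ ball (0 : E3) R
        · simp [hB, hxb]
        · simp [hx hxb]
      rw [this]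
      exact (integral_mul_sq_le (h n).memLp (hBm n)).trans (by gcongr; exact hd n)
    refine squeeze_zero_norm hb ?_
    simpa using hlim.sqrt.const_mul √M
  rw [Metric.tendsto_atTop]
  intro δ hδ
  set ε := δ / (2 * (M + 1)) with hε
  have hε0 : 0 < ε := by positivity
  set c := volume.real (ball (0 : E3) ε) with hc
  have hc0 : 0 < c := ENNReal.toReal_pos (measure_ball_pos _ _ hε0).ne' measure_ball_lt_top.ne
  obtain ⟨N, hN⟩ := (Metric.tendsto_atTop.1 (key ε)) (c * (δ / 2)) (by positivity)
  refine ⟨N, fun n hn => ?_⟩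
  have h1 := hN n hn
  rw [Real.dist_eq, sub_zero] at h1 ⊢
  have h2 := (h n).integral_sq_le (h0 n) (ε := ε)
  have h3 : √(∫ x, d n x ^ 2) * √(∫ x, ‖E n x‖ ^ 2) ≤ M := by
    calc _ ≤ √M * √M := by gcongr; exacts [hd n, hE n]
      _ = M := Real.mul_self_sqrt hM
  have h4 : c * (ε * (√(∫ x, d n x ^ 2) * √(∫ x, ‖E n x‖ ^ 2))) ≤ c * (δ / 2) := by
    gcongr
    calc _ ≤ ε * M := by gcongr
      _ ≤ ε * (M + 1) := by gcongr; linarith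
      _ = δ / 2 := by rw [hε]; field_simp
  rw [abs_of_nonneg (integral_nonneg fun x => sq_nonneg (d n x))]
  have h5 := (abs_lt.1 h1).2
  rw [← hc] at h2
  have : c * ∫ x, d n x ^ 2 < c * δ := by nlinarith
  exact lt_of_mul_lt_mul_left this hc0.le

/-- `u ∈ H¹` with weak gradient `D`, vanishing outside the ball of radius `R`. -/
structure H10 (R : ℝ) (u : E3 → ℝ) (D : E3 → E3) : Prop where
  h1 : H1 u D
  zero : ∀ᵐ x, x ∉ ball (0 : E3) R → u x = 0

theorem eLpNorm_two_eq_sqrt {F : Type*} [NormedAddCommGroup F] [InnerProductSpace ℝ F] {a : E3 → F}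
    (ha : MemLp a 2 volume) : eLpNorm a 2 volume = ENNReal.ofReal √(∫ x, ‖a x‖ ^ 2) := by
  rw [← norm_toLp_sq_eq_integral ha, Real.sqrt_sq (norm_nonneg _), Lp.norm_toLp,
    ENNReal.ofReal_toReal ha.2.ne]

theorem exists_subseq_tendsto_ae {d : ℕ → E3 → ℝ} {v : E3 → ℝ} (hd : ∀ n, MemLp (d n) 2 volume)
    (hv : MemLp v 2 volume) (h : Tendsto (fun n => ∫ x, (d n x - v x) ^ 2) atTop (𝓝 0)) :
    ∃ ns : ℕ → ℕ, StrictMono ns ∧ ∀ᵐ x, Tendsto (fun k => d (ns k) x) atTop (𝓝 (v x)) := by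
  refine (tendstoInMeasure_of_tendsto_eLpNorm (p := 2) two_ne_zero
    (fun n => (hd n).1) hv.1 ?_).exists_seq_tendsto_ae
  have : ∀ n, eLpNorm (d n - v) 2 volume = ENNReal.ofReal √(∫ x, (d n x - v x) ^ 2) := fun n => by
    rw [eLpNorm_two_eq_sqrt ((hd n).sub hv)]
    simp
  simp_rw [this]
  simpa using (ENNReal.tendsto_ofReal h.sqrt)

namespace H10

variable {R : ℝ} {u v : E3 → ℝ} {D G : E3 → E3}

theorem grad_zero (h : H10 R u D) : ∀ᵐ x, x ∉ ball (0 : E3) R → D x = 0 := by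
  filter_upwards [h.zero, h.h1.grad_eq_zero] with x h1 h2 h3 using h2 (h1 h3)

theorem add (h : H10 R u D) (h' : H10 R v G) :
    H10 R (fun x => u x + v x) (fun x => D x + G x) := by
  refine ⟨h.h1.add h'.h1, ?_⟩
  filter_upwards [h.zero, h'.zero] with x h1 h2 h3
  rw [h1 h3, h2 h3, add_zero]

theorem sub (h : H10 R u D) (h' : H10 R v G) :
    H10 R (fun x => u x - v x) (fun x => D x - G x) := by
  refine ⟨h.h1.sub h'.h1, ?_⟩
  filter_upwards [h.zero, h'.zero] with x h1 h2 h3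
  rw [h1 h3, h2 h3, sub_zero]

theorem const_mul (h : H10 R u D) (c : ℝ) : H10 R (fun x => c * u x) (fun x => c • D x) := by
  refine ⟨h.h1.const_smul c, ?_⟩
  filter_upwards [h.zero] with x h1 h3
  rw [h1 h3, mul_zero]

theorem neg (h : H10 R u D) : H10 R (fun x => -u x) (fun x => -D x) := by
  refine ⟨h.h1.neg, ?_⟩
  filter_upwards [h.zero] with x h1 h3
  rw [h1 h3, neg_zero]

theorem posPart_sub (h : H10 R u D) {k : ℝ} (hk : 0 ≤ k) :
    H10 R (fun x => max (u x - k) 0) (fun x => if k < u x then D x else 0) := by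
  refine ⟨h.h1.posPart_sub hk, ?_⟩
  filter_upwards [h.zero] with x h1 h3
  rw [h1 h3, max_eq_right (by linarith)]

theorem posPart (h : H10 R u D) :
    H10 R (fun x => max (u x) 0) (fun x => if 0 < u x then D x else 0) := by
  refine ⟨h.h1.posPart, ?_⟩
  filter_upwards [h.zero] with x h1 h3
  rw [h1 h3, max_self]

theorem negPart (h : H10 R u D) :
    H10 R (fun x => min (u x) 0) (fun x => if u x < 0 then D x else 0) := by
  refine ⟨h.h1.negPart, ?_⟩
  filter_upwards [h.zero] with x h1 h3
  rw [h1 h3, min_self]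

theorem congr_ae (h : H10 R u D) (hu : u =ᵐ[volume] v) (hD : D =ᵐ[volume] G) : H10 R v G := by
  refine ⟨h.h1.congr_ae hu hD, ?_⟩
  filter_upwards [h.zero, hu] with x h1 h2 h3
  rw [← h2, h1 h3]

/-- Weak compactness of bounded sequences together with the Rellich theorem. -/
theorem exists_limit {u : ℕ → E3 → ℝ} {D : ℕ → E3 → E3} (h : ∀ n, H10 R (u n) (D n)) {M : ℝ}
    (hu : ∀ n, ∫ x, u n x ^ 2 ≤ M) (hD : ∀ n, ∫ x, ‖D n x‖ ^ 2 ≤ M) :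
    ∃ (v : E3 → ℝ) (G : E3 → E3) (ns : ℕ → ℕ), StrictMono ns ∧ H10 R v G ∧
      (∀ᵐ x, Tendsto (fun k => u (ns k) x) atTop (𝓝 (v x))) ∧
      Tendsto (fun k => ∫ x, (u (ns k) x - v x) ^ 2) atTop (𝓝 0) ∧
      (∀ W, MemLp W 2 volume →
        Tendsto (fun k => ∫ x, inner ℝ (D (ns k) x) (W x)) atTop
          (𝓝 (∫ x, inner ℝ (G x) (W x)))) := by
  obtain ⟨v, G, ns, hns, hv, hw, hW⟩ := H1.exists_weak_limit (fun n => (h n).h1) (M := M)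
    (by simpa using hu) hD
  have hv0 : ∀ᵐ x, x ∉ ball (0 : E3) R → v x = 0 := by
    have hm : MemLp ((ball (0 : E3) R)ᶜ.indicator v) 2 volume :=
      hv.memLp.indicator measurableSet_ball.compl
    have h1 := hw _ hm
    have e1 : ∀ k, ∫ x, inner ℝ (u (ns k) x) ((ball (0 : E3) R)ᶜ.indicator v x) = 0 := by
      intro k
      refine integral_eq_zero_of_ae ?_
      filter_upwards [(h (ns k)).zero] with x hx
      by_cases hxb : x ∈ ball (0 : E3) R
      · simp [hxb]
      · simp [hx hxb]
    simp_rw [e1] at h1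
    have h2 : ∫ x, inner ℝ (v x) ((ball (0 : E3) R)ᶜ.indicator v x) = 0 :=
      (tendsto_nhds_unique h1 tendsto_const_nhds)
    have h3 : 0 ≤ fun x => inner ℝ (v x) ((ball (0 : E3) R)ᶜ.indicator v x) := by
      intro x
      by_cases hxb : x ∈ ball (0 : E3) R
      · simp [hxb]
      · simp [hxb, sq_nonneg]
    rw [integral_eq_zero_iff_of_nonneg h3 (integrable_inner_of_memLp hv.memLp hm)] at h2
    filter_upwards [h2] with x hx hxb
    simpa [hxb] using hx
  have hvH : H10 R v G := ⟨hv, hv0⟩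
  have hd : ∀ k, H10 R (fun x => u (ns k) x - v x) (fun x => D (ns k) x - G x) := fun k =>
    (h (ns k)).sub hvH
  have hsq : ∀ {a : E3 → ℝ}, MemLp a 2 volume → Integrable (fun x => a x ^ 2) := fun ha =>
    ha.integrable_sq
  have hsqv : ∀ {a : E3 → E3}, MemLp a 2 volume → Integrable (fun x => ‖a x‖ ^ 2) := fun ha =>
    ha.norm.integrable_sq
  set M' := 2 * M + (2 * ∫ x, v x ^ 2) + 2 * ∫ x, ‖G x‖ ^ 2 with hM'
  have n1 : 0 ≤ ∫ x, v x ^ 2 := integral_nonneg fun x => sq_nonneg _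
  have n2 : 0 ≤ ∫ x, ‖G x‖ ^ 2 := integral_nonneg fun x => sq_nonneg _
  have h2 : Tendsto (fun k => ∫ x, (u (ns k) x - v x) ^ 2) atTop (𝓝 0) := by
    refine tendsto_integral_sq_zero (fun k => (hd k).h1) (M := M') (fun k => (hd k).zero)
      (fun k => ?_) (fun k => ?_) fun w hwm => ?_
    · calc _ ≤ ∫ x, (2 * u (ns k) x ^ 2 + 2 * v x ^ 2) := by
            refine integral_mono (hsq (hd k).h1.memLp) (((hsq (h _).h1.memLp).const_mul 2).add
              ((hsq hv.memLp).const_mul 2)) fun x => ?_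
            nlinarith [sq_nonneg (u (ns k) x + v x)]
        _ = 2 * (∫ x, u (ns k) x ^ 2) + 2 * ∫ x, v x ^ 2 := by
            rw [integral_add ((hsq (h _).h1.memLp).const_mul 2) ((hsq hv.memLp).const_mul 2),
              MeasureTheory.integral_const_mul, MeasureTheory.integral_const_mul]
        _ ≤ M' := by linarith [hu (ns k)]
    · calc _ ≤ ∫ x, (2 * ‖D (ns k) x‖ ^ 2 + 2 * ‖G x‖ ^ 2) := by
            refine integral_mono (hsqv (hd k).h1.memLp_grad)
              (((hsqv (h _).h1.memLp_grad).const_mul 2).add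
              ((hsqv hv.memLp_grad).const_mul 2)) fun x => ?_
            have := norm_sub_le (D (ns k) x) (G x)
            have := pow_le_pow_left₀ (norm_nonneg _) this 2
            dsimp only
            nlinarith [sq_nonneg (‖D (ns k) x‖ - ‖G x‖)]
        _ = 2 * (∫ x, ‖D (ns k) x‖ ^ 2) + 2 * ∫ x, ‖G x‖ ^ 2 := by
            rw [integral_add ((hsqv (h _).h1.memLp_grad).const_mul 2)
              ((hsqv hv.memLp_grad).const_mul 2),
              MeasureTheory.integral_const_mul, MeasureTheory.integral_const_mul]
        _ ≤ M' := by linarith [hD (ns k)]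
    · have h3 := (hw w hwm).sub_const (∫ x, inner ℝ (v x) (w x))
      rw [sub_self] at h3
      refine h3.congr fun k => ?_
      rw [← integral_sub (integrable_inner_of_memLp (h _).h1.memLp hwm)
        (integrable_inner_of_memLp hv.memLp hwm)]
      refine integral_congr_ae (Eventually.of_forall fun x => ?_)
      simp only [← inner_sub_left]
      exact mul_comm _ _
  obtain ⟨ms, hms, hae⟩ := exists_subseq_tendsto_ae (fun k => (h (ns k)).h1.memLp) hv.memLp h2
  exact ⟨v, G, ns ∘ ms, hns.comp hms, hvH, hae, h2.comp hms.tendsto_atTop,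
    fun W hWm => (hW W hWm).comp hms.tendsto_atTop⟩

end H10

/-- The standing hypotheses on the nonlinearity. -/
structure Nonlin (f : ℝ → ℝ) : Prop where
  smooth : ContDiff ℝ 1 f
  zero : Tendsto (fun s : ℝ => f s / s) (𝓝[≠] 0) (𝓝 0)
  infty : Tendsto (fun s : ℝ => f s / |s| ^ 5) (cocompact ℝ) (𝓝 0)
  super : Tendsto (fun s : ℝ => (∫ t in (0:ℝ)..s, f t) / s ^ 4) (cocompact ℝ) atTop
  mono : ∀ t s : ℝ, (0 < t ∧ t < s) ∨ (s < t ∧ t < 0) → f t / t ^ 3 ≤ f s / s ^ 3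

/-- The primitive of `f` vanishing at `0`. -/
def prim (f : ℝ → ℝ) (s : ℝ) : ℝ := ∫ t in (0:ℝ)..s, f t

/-- Continuous functions of growth `o(|s|⁶)`. -/
def SubSextic (N : ℝ → ℝ) : Prop :=
  Continuous N ∧ ∀ ε > 0, ∃ C, 0 ≤ C ∧ ∀ s, |N s| ≤ C + ε * s ^ 6

theorem tendsto_integral_zero_of_le {X : Type*} [MeasurableSpace X] {μ : Measure X}
    [IsFiniteMeasure μ] {g h : ℕ → X → ℝ} {K : ℝ} (hg : ∀ n, Integrable (g n) μ)
    (hg0 : ∀ n x, 0 ≤ g n x) (hh : ∀ n, Integrable (h n) μ) (hh0 : ∀ n x, 0 ≤ h n x) (hK : ∀ n, ∫ x, h n x ∂μ ≤ K)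
    (hle : ∀ ε > 0, ∃ C, 0 ≤ C ∧ ∀ n x, g n x ≤ C + ε * h n x)
    (hlim : ∀ᵐ x ∂μ, Tendsto (fun n => g n x) atTop (𝓝 0)) :
    Tendsto (fun n => ∫ x, g n x ∂μ) atTop (𝓝 0) := by
  rw [Metric.tendsto_atTop]
  intro δ hδ
  obtain ⟨C, hC, hb⟩ := hle (δ / (2 * (|K| + 1))) (by positivity)
  have hm : Tendsto (fun n => ∫ x, min (g n x) C ∂μ) atTop (𝓝 0) := by
    have := tendsto_integral_of_dominated_convergence (μ := μ) (F := fun n x => min (g n x) C)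
      (f := fun _ => 0) (fun _ => C) (fun n => (hg n).1.inf aestronglyMeasurable_const)
      (integrable_const C) (fun n => Eventually.of_forall fun x => ?_) ?_
    · simpa using this
    · rw [Real.norm_of_nonneg (le_min (hg0 n x) hC)]
      exact min_le_right _ _
    · filter_upwards [hlim] with x hx
      simpa [hC] using hx.min (tendsto_const_nhds (x := C))
  obtain ⟨N, hN⟩ := Metric.tendsto_atTop.1 hm (δ / 2) (by positivity)
  refine ⟨N, fun n hn => ?_⟩
  have h1 := hN n hn
  rw [Real.dist_eq, sub_zero] at h1 ⊢
  rw [abs_of_nonneg (integral_nonneg (hg0 n))]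
  have hmi : Integrable (fun x => min (g n x) C) μ := (hg n).inf (integrable_const C)
  have h2 : ∫ x, g n x ∂μ ≤ ∫ x, (min (g n x) C + δ / (2 * (|K| + 1)) * h n x) ∂μ := by
    refine integral_mono_ae (hg n) (hmi.add ((hh n).const_mul _)) (Eventually.of_forall fun x => ?_)
    rcases le_total (g n x) C with h3 | h3
    · have : 0 ≤ δ / (2 * (|K| + 1)) * h n x := mul_nonneg (by positivity) (hh0 n x)
      simp only [min_eq_left h3]
      linarith
    · simp only [min_eq_right h3]; exact hb n x
  rw [integral_add hmi ((hh n).const_mul _), MeasureTheory.integral_const_mul] at h2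
  have h5 : δ / (2 * (|K| + 1)) * ∫ x, h n x ∂μ ≤ δ / 2 := by
    calc _ ≤ δ / (2 * (|K| + 1)) * (|K| + 1) := by
          gcongr
          exact ((hK n).trans (le_abs_self K)).trans (by linarith)
      _ = δ / 2 := by field_simp
  linarith [(abs_lt.1 h1).2]

theorem SubSextic.tendsto_integral {X : Type*} [MeasurableSpace X] {μ : Measure X}
    [IsFiniteMeasure μ] {N : ℝ → ℝ} (hN : SubSextic N) {u : ℕ → X → ℝ} {v : X → ℝ} {K : ℝ}
    (hu : ∀ n, AEStronglyMeasurable (u n) μ) (hv : AEStronglyMeasurable v μ)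
    (hu6 : ∀ n, Integrable (fun x => u n x ^ 6) μ) (hv6 : Integrable (fun x => v x ^ 6) μ)
    (hK : ∀ n, ∫ x, u n x ^ 6 ∂μ ≤ K)
    (hlim : ∀ᵐ x ∂μ, Tendsto (fun n => u n x) atTop (𝓝 (v x))) :
    Tendsto (fun n => ∫ x, N (u n x) ∂μ) atTop (𝓝 (∫ x, N (v x) ∂μ)) := by
  have hInt : ∀ {w : X → ℝ}, AEStronglyMeasurable w μ → Integrable (fun x => w x ^ 6) μ →
      Integrable (fun x => N (w x)) μ := by
    intro w hw hw6
    obtain ⟨C, -, hC⟩ := hN.2 1 one_pos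
    refine ((integrable_const C).add (hw6.const_mul 1)).mono' (hN.1.comp_aestronglyMeasurable hw)
      (Eventually.of_forall fun x => hC _)
  have h6 : ∀ s : ℝ, 0 ≤ s ^ 6 := fun s => by positivity
  have := tendsto_integral_zero_of_le (μ := μ) (g := fun n x => |N (u n x) - N (v x)|)
    (h := fun n x => u n x ^ 6 + v x ^ 6) (K := K + ∫ x, v x ^ 6 ∂μ)
    (fun n => ((hInt (hu n) (hu6 n)).sub (hInt hv hv6)).abs) (fun n x => abs_nonneg _)
    (fun n => (hu6 n).add hv6) (fun n x => add_nonneg (h6 _) (h6 _))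
    (fun n => by rw [integral_add (hu6 n) hv6]; linarith [hK n]) (fun ε hε => ?_) ?_
  · rw [tendsto_iff_norm_sub_tendsto_zero]
    refine squeeze_zero (fun n => norm_nonneg _) (fun n => ?_) this
    rw [← integral_sub (hInt (hu n) (hu6 n)) (hInt hv hv6)]
    exact norm_integral_le_integral_norm _
  · obtain ⟨C, hC0, hC⟩ := hN.2 ε hε
    refine ⟨C + C, by positivity, fun n x => ?_⟩
    have := abs_sub (N (u n x)) (N (v x))
    linarith [hC (u n x), hC (v x)]
  · filter_upwards [hlim] with x hx
    have := (((hN.1.tendsto _).comp hx).sub_const (N (v x))).abs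
    simpa using this

theorem subSextic_pow_four : SubSextic fun s => s ^ 4 := by
  refine ⟨by fun_prop, fun ε hε => ⟨ε⁻¹ ^ 2, by positivity, fun s => ?_⟩⟩
  rw [abs_of_nonneg (by positivity)]
  rcases le_total (s ^ 2) (ε⁻¹) with h | h
  · have : s ^ 4 ≤ ε⁻¹ ^ 2 := by
      calc s ^ 4 = (s ^ 2) ^ 2 := by ring
        _ ≤ _ := by gcongr
    have : 0 ≤ ε * s ^ 6 := by positivity
    linarith
  · have : 1 ≤ ε * s ^ 2 := by
      calc 1 = ε * ε⁻¹ := by field_simp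
        _ ≤ _ := by gcongr
    have h4 : 0 ≤ s ^ 4 := by positivity
    have : s ^ 4 * 1 ≤ s ^ 4 * (ε * s ^ 2) := by gcongr
    have : 0 ≤ ε⁻¹ ^ 2 := by positivity
    nlinarith

theorem exists_linear_le_sextic {C ε : ℝ} (hC : 0 ≤ C) (hε : 0 < ε) :
    ∃ K, 0 ≤ K ∧ ∀ t : ℝ, 0 ≤ t → C * t ≤ K + ε / 2 * t ^ 6 := by
  set T := 1 + 2 * C / ε
  refine ⟨C * T, by positivity, fun t ht => ?_⟩
  rcases le_total t T with h2 | h2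
  · have : C * t ≤ C * T := by gcongr
    have : 0 ≤ ε / 2 * t ^ 6 := by positivity
    linarith
  · have hT1 : 1 ≤ T := by simp only [T]; linarith [show 0 ≤ 2 * C / ε by positivity]
    have h3 : C ≤ ε / 2 * t ^ 5 := by
      calc C = ε / 2 * (2 * C / ε) := by field_simp
        _ ≤ ε / 2 * T := by gcongr; simp [T]
        _ ≤ ε / 2 * t := by gcongr
        _ ≤ ε / 2 * t ^ 5 := by gcongr; exact le_self_pow₀ (hT1.trans h2) (by norm_num)
    have : C * t ≤ ε / 2 * t ^ 5 * t := by gcongr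
    have : 0 ≤ C * T := by positivity
    nlinarith

namespace Nonlin

variable {f : ℝ → ℝ} (h : Nonlin f)

include h

theorem continuous : Continuous f := h.smooth.continuous

theorem hasDerivAt_prim (s : ℝ) : HasDerivAt (prim f) (f s) s :=
  integral_hasDerivAt_right (h.continuous.intervalIntegrable _ _)
    h.continuous.stronglyMeasurable.stronglyMeasurableAtFilter h.continuous.continuousAt

theorem continuous_prim : Continuous (prim f) :=
  continuous_iff_continuousAt.2 fun s => (h.hasDerivAt_prim s).continuousAt

theorem apply_zero : f 0 = 0 := by
  have h1 : Tendsto (fun s : ℝ => f s / s * s) (𝓝[≠] 0) (𝓝 (0 * 0)) :=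
    h.zero.mul (tendsto_id.mono_left nhdsWithin_le_nhds)
  have h2 : Tendsto f (𝓝[≠] 0) (𝓝 (f 0)) := (h.continuous.tendsto 0).mono_left nhdsWithin_le_nhds
  rw [mul_zero] at h1
  refine tendsto_nhds_unique h2 (h1.congr' ?_)
  filter_upwards [self_mem_nhdsWithin] with s hs
  exact div_mul_cancel₀ _ hs

omit h in
theorem prim_zero : prim f 0 = 0 := by simp [prim]

/-- `|f s| ≤ ε|s|` near zero. -/
theorem exists_small {ε : ℝ} (hε : 0 < ε) : ∃ δ > 0, ∀ s, |s| < δ → |f s| ≤ ε * |s| := by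
  have := h.zero.eventually (Metric.ball_mem_nhds 0 hε)
  rw [eventually_nhdsWithin_iff, Metric.eventually_nhds_iff] at this
  obtain ⟨δ, hδ, h1⟩ := this
  refine ⟨δ, hδ, fun s hs => ?_⟩
  by_cases hs0 : s = 0
  · simp [hs0, h.apply_zero]
  · have h2 := h1 (y := s) (by simpa using hs) hs0
    rw [dist_zero_right, norm_div, div_lt_iff₀ (by simpa using hs0)] at h2
    exact h2.le

theorem exists_large {ε : ℝ} (hε : 0 < ε) : ∃ T > 0, ∀ s, T < |s| → |f s| ≤ ε * |s| ^ 5 := by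
  have := h.infty.eventually (Metric.ball_mem_nhds 0 hε)
  rw [← Metric.cobounded_eq_cocompact, ← comap_norm_atTop, eventually_comap] at this
  obtain ⟨T, hT⟩ := eventually_atTop.1 this
  refine ⟨max T 1, by positivity, fun s hs => ?_⟩
  have h0 : 0 < |s| := lt_of_le_of_lt (by positivity) hs
  have h2 := hT |s| ((le_max_left _ _).trans hs.le) s rfl
  rw [dist_zero_right, norm_div, norm_pow, Real.norm_eq_abs, Real.norm_eq_abs, abs_abs,
    div_lt_iff₀ (by positivity)] at h2
  exact h2.le

theorem exists_bound (T : ℝ) : ∃ C, 0 ≤ C ∧ ∀ s, |s| ≤ T → |f s| ≤ C := by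
  obtain ⟨C, hC⟩ := (isCompact_Icc (a := -T) (b := T)).exists_bound_of_continuousOn
    h.continuous.continuousOn
  exact ⟨|C|, abs_nonneg _, fun s hs => (hC s (abs_le.1 hs)).trans (le_abs_self _)⟩

theorem growth {ε : ℝ} (hε : 0 < ε) : ∃ C, 0 ≤ C ∧ ∀ s, |f s| ≤ ε * |s| + C * |s| ^ 5 := by
  obtain ⟨δ, hδ, h1⟩ := h.exists_small hε
  obtain ⟨T, hT, h2⟩ := h.exists_large one_pos
  obtain ⟨C, hC, h3⟩ := h.exists_bound T
  refine ⟨1 + C / δ ^ 5, by positivity, fun s => ?_⟩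
  have n1 : 0 ≤ ε * |s| := by positivity
  have n2 : 0 ≤ |s| ^ 5 := by positivity
  have n3 : 0 ≤ C / δ ^ 5 * |s| ^ 5 := by positivity
  rcases lt_or_ge |s| δ with hs | hs
  · nlinarith [h1 s hs]
  rcases lt_or_ge T |s| with hs' | hs'
  · nlinarith [h2 s hs']
  · have : C ≤ C / δ ^ 5 * |s| ^ 5 := by
      calc C = C / δ ^ 5 * δ ^ 5 := by field_simp
        _ ≤ _ := by gcongr
    nlinarith [h3 s hs']

theorem growth' {ε : ℝ} (hε : 0 < ε) : ∃ C, 0 ≤ C ∧ ∀ s, |f s| ≤ C + ε * |s| ^ 5 := by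
  obtain ⟨T, hT, h2⟩ := h.exists_large hε
  obtain ⟨C, hC, h3⟩ := h.exists_bound T
  refine ⟨C, hC, fun s => ?_⟩
  have n2 : 0 ≤ ε * |s| ^ 5 := by positivity
  rcases lt_or_ge T |s| with hs' | hs'
  · linarith [h2 s hs']
  · linarith [h3 s hs']

omit h in
theorem abs_prim_le {C s : ℝ} (hC : ∀ t, |t| ≤ |s| → |f t| ≤ C) : |prim f s| ≤ C * |s| := by
  have := intervalIntegral.norm_integral_le_of_norm_le_const (a := 0) (b := s) (f := f) (C := C)
    fun t ht => hC t ?_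
  · simpa [prim] using this
  · rcases le_total 0 s with h0 | h0
    · rw [Set.uIoc_of_le h0] at ht
      rw [abs_of_pos ht.1, abs_of_nonneg h0]; exact ht.2
    · rw [Set.uIoc_of_ge h0] at ht
      rw [abs_of_nonpos ht.2, abs_of_nonpos h0]; linarith [ht.1]

theorem subSextic_mul : SubSextic fun s => f s * s := by
  refine ⟨h.continuous.mul continuous_id, fun ε hε => ?_⟩
  obtain ⟨C, hC, h1⟩ := h.growth' (ε := ε / 2) (by positivity)
  obtain ⟨K, hK0, hK⟩ := exists_linear_le_sextic hC hε
  refine ⟨K, hK0, fun s => ?_⟩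
  rw [abs_mul]
  have h2 := mul_le_mul_of_nonneg_right (h1 s) (abs_nonneg s)
  have h3 := hK |s| (abs_nonneg s)
  have : |s| ^ 6 = s ^ 6 := by rw [show (6:ℕ) = 2 * 3 by norm_num, pow_mul, pow_mul, sq_abs]
  nlinarith

theorem subSextic_prim : SubSextic (prim f) := by
  refine ⟨h.continuous_prim, fun ε hε => ?_⟩
  obtain ⟨C, hC, h1⟩ := h.growth' (ε := ε / 2) (by positivity)
  obtain ⟨K, hK0, hK⟩ := exists_linear_le_sextic hC hε
  refine ⟨K, hK0, fun s => ?_⟩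
  have h2 : |prim f s| ≤ (C + ε / 2 * |s| ^ 5) * |s| :=
    abs_prim_le fun t ht => (h1 t).trans (by gcongr)
  have h3 := hK |s| (abs_nonneg s)
  have : |s| ^ 6 = s ^ 6 := by rw [show (6:ℕ) = 2 * 3 by norm_num, pow_mul, pow_mul, sq_abs]
  nlinarith

theorem quartic_ineq {s : ℝ} (hs : 0 ≤ s) (τ : ℝ) :
    0 ≤ (1 - s ^ 4) / 4 * (f τ * τ) + prim f (s * τ) - prim f τ := by
  by_cases hτ : τ = 0
  · simp [hτ, prim_zero]
  set g : ℝ → ℝ := fun s => (1 - s ^ 4) / 4 * (f τ * τ) + prim f (s * τ) - prim f τ with hg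
  have hd : ∀ r, HasDerivAt g (-r ^ 3 * (f τ * τ) + f (r * τ) * τ) r := by
    intro r
    have h1 : HasDerivAt (fun s : ℝ => (1 - s ^ 4) / 4 * (f τ * τ)) (-r ^ 3 * (f τ * τ)) r := by
      refine ((((hasDerivAt_pow 4 r).const_sub 1).div_const 4).mul_const (f τ * τ)).congr_deriv ?_
      push_cast
      ring
    have h2 : HasDerivAt (fun s : ℝ => prim f (s * τ)) (f (r * τ) * τ) r := by
      have := (h.hasDerivAt_prim (r * τ)).comp r ((hasDerivAt_id r).mul_const τ)
      rw [one_mul] at this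
      exact this
    exact (h1.add h2).sub_const _
  have hgc : Continuous g := continuous_iff_continuousAt.2 fun r => (hd r).continuousAt
  have h1 : g 1 = 0 := by simp [hg]
  have key : ∀ a b : ℝ, 0 < a → a < b → f (a * τ) * τ * b ^ 3 ≤ f (b * τ) * τ * a ^ 3 := by
    intro a b ha hab
    have hb : 0 < b := ha.trans hab
    have h3 := h.mono (a * τ) (b * τ) (by
      rcases lt_or_gt_of_ne hτ with h4 | h4
      · right; constructor <;> nlinarith
      · left; constructor <;> nlinarith)
    have h4 : 0 < τ ^ 4 := by positivity
    have e1 : f (a * τ) / (a * τ) ^ 3 * (a ^ 3 * b ^ 3 * τ ^ 4) = f (a * τ) * τ * b ^ 3 := by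
      field_simp
    have e2 : f (b * τ) / (b * τ) ^ 3 * (a ^ 3 * b ^ 3 * τ ^ 4) = f (b * τ) * τ * a ^ 3 := by
      field_simp
    rw [← e1, ← e2]
    gcongr
  rw [← h1]
  rcases le_total s 1 with hs1 | hs1
  · refine antitoneOn_of_deriv_nonpos (convex_Icc 0 1) hgc.continuousOn
      (fun r _ => (hd r).differentiableAt.differentiableWithinAt) (fun r hr => ?_)
      ⟨hs, hs1⟩ ⟨zero_le_one, le_rfl⟩ hs1
    rw [interior_Icc] at hr
    rw [(hd r).deriv]
    have := key r 1 hr.1 hr.2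
    simp only [one_mul, one_pow, mul_one] at this
    linarith
  · refine monotoneOn_of_deriv_nonneg (convex_Ici 1) hgc.continuousOn
      (fun r _ => (hd r).differentiableAt.differentiableWithinAt) (fun r hr => ?_)
      (Set.mem_Ici.2 le_rfl) hs1 hs1
    rw [interior_Ici] at hr
    rw [(hd r).deriv]
    have := key 1 r one_pos hr
    simp only [one_mul, one_pow, mul_one] at this
    linarith

theorem superquartic (K : ℝ) : ∃ C, 0 ≤ C ∧ ∀ s, K * s ^ 4 - C ≤ prim f s := by
  have := h.super.eventually (eventually_ge_atTop K)
  rw [← Metric.cobounded_eq_cocompact, ← comap_norm_atTop, eventually_comap] at this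
  obtain ⟨T, hT⟩ := eventually_atTop.1 this
  obtain ⟨C, hC⟩ := (isCompact_Icc (a := -|T|) (b := |T|)).exists_bound_of_continuousOn
    h.continuous_prim.continuousOn
  refine ⟨|C| + |K| * |T| ^ 4, by positivity, fun s => ?_⟩
  have n1 : 0 ≤ |C| + |K| * |T| ^ 4 := by positivity
  rcases le_total |s| |T| with hs | hs
  · have h1 := (abs_le.1 (hC s (abs_le.1 hs))).1
    have h2 : K * s ^ 4 ≤ |K| * |T| ^ 4 := by
      calc K * s ^ 4 ≤ |K| * s ^ 4 := by gcongr; exact le_abs_self K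
        _ = |K| * |s| ^ 4 := by rw [show (4:ℕ) = 2 * 2 by norm_num, pow_mul, pow_mul, sq_abs]
        _ ≤ _ := by gcongr
    linarith [le_abs_self C]
  · by_cases hs0 : s = 0
    · simp only [hs0, prim_zero]
      linarith
    · have h2 := hT |s| ((le_abs_self T).trans hs) s rfl
      rw [le_div_iff₀ (by positivity)] at h2
      change K * s ^ 4 ≤ prim f s at h2
      linarith

end Nonlin

theorem integrableOn_ball_norm_rpow {a : ℝ} (ha : -3 < a) (r : ℝ) :
    IntegrableOn (fun z : E3 => ‖z‖ ^ a) (ball 0 r) := by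
  rw [integrableOn_fun_norm_addHaar volume (f := fun t : ℝ => t ^ a)]
  have h1 : IntegrableOn (fun t : ℝ => t ^ (a + 2)) (Set.Ioo 0 r) := by
    rcases le_total 0 r with hr | hr
    · exact ((intervalIntegrable_iff_integrableOn_Ioo_of_le hr).1
        (intervalIntegral.intervalIntegrable_rpow' (by linarith)))
    · simp [Set.Ioo_eq_empty_of_le hr]
  refine h1.congr_fun (fun t ht => ?_) measurableSet_Ioo
  simp only [finrank_euclideanSpace, Fintype.card_fin, smul_eq_mul]
  rw [Real.rpow_add ht.1, mul_comm]
  norm_num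

/-- Square integrable functions supported in the ball of radius `R`. -/
def L2Ball (R : ℝ) (k : E3 → ℝ) : Prop :=
  MemLp k 2 volume ∧ ∀ᵐ x, x ∉ ball (0 : E3) R → k x = 0

/-- The (unnormalised) Newtonian potential of `k`. -/
def newt (k : E3 → ℝ) (x : E3) : ℝ := ∫ y, k y / ‖x - y‖

/-- The Newtonian kernel centred at `x`, cut off outside the ball of radius `R`. -/
def kern (R : ℝ) (x : E3) : E3 → ℝ := (ball (0 : E3) R).indicator fun y => ‖x - y‖⁻¹

theorem exists_kern_bound (R : ℝ) : ∃ K, 0 ≤ K ∧ ∀ x, MemLp (kern R x) 2 volume ∧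
    ∫ y, kern R x y ^ 2 ≤ K := by
  set g : E3 → ℝ := (ball (0 : E3) 1).indicator fun z => ‖z‖ ^ (-2 : ℝ) with hg
  have hgi : Integrable g := (integrable_indicator_iff measurableSet_ball).2
    (integrableOn_ball_norm_rpow (by norm_num) 1)
  have hg0 : ∀ z, 0 ≤ g z := fun z => Set.indicator_nonneg (fun _ _ => by positivity) z
  set c : E3 → ℝ := (ball (0 : E3) R).indicator fun _ => (1 : ℝ) with hc
  have hci : Integrable c := (integrable_indicator_iff measurableSet_ball).2
    (integrableOn_const measure_ball_lt_top.ne)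
  have hc0 : ∀ z, 0 ≤ c z := fun z => Set.indicator_nonneg (fun _ _ => zero_le_one) z
  refine ⟨(∫ z, g z) + ∫ z, c z, add_nonneg (integral_nonneg hg0) (integral_nonneg hc0),
    fun x => ?_⟩
  have hgx : Integrable (fun y => g (x - y)) := hgi.comp_sub_left x
  have hle : ∀ y, kern R x y ^ 2 ≤ g (x - y) + c y := by
    intro y
    by_cases hy : y ∈ ball (0 : E3) R
    · simp only [kern, hc, hy, Set.indicator_of_mem]
      by_cases h1 : x - y ∈ ball (0 : E3) 1
      · simp only [hg, h1, Set.indicator_of_mem]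
        rw [Real.rpow_neg (norm_nonneg _), inv_pow]
        norm_num
      · simp only [hg, h1, not_false_eq_true, Set.indicator_of_notMem, zero_add]
        have : 1 ≤ ‖x - y‖ := by simpa using h1
        exact pow_le_one₀ (by positivity) (inv_le_one_of_one_le₀ this)
    · simp only [kern, hy, not_false_eq_true, Set.indicator_of_notMem]
      simpa using add_nonneg (hg0 (x - y)) (hc0 y)
  have hm : Measurable (kern R x) :=
    (by fun_prop : Measurable fun y => ‖x - y‖⁻¹).indicator measurableSet_ball
  have hi : Integrable (fun y => kern R x y ^ 2) :=
    (hgx.add hci).mono' (hm.pow_const 2).aestronglyMeasurable (Eventually.of_forall fun y => by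
      rw [Real.norm_of_nonneg (sq_nonneg _)]; exact hle y)
  refine ⟨(memLp_two_iff_integrable_sq hm.aestronglyMeasurable).2 hi, ?_⟩
  calc _ ≤ ∫ y, (g (x - y) + c y) := integral_mono hi (hgx.add hci) hle
    _ = (∫ y, g (x - y)) + ∫ y, c y := integral_add hgx hci
    _ = _ := by rw [integral_sub_left_eq_self g volume x]

namespace L2Ball

variable {R : ℝ} {k l : E3 → ℝ}

theorem abs (h : L2Ball R k) : L2Ball R fun x => |k x| :=
  ⟨h.1.abs, h.2.mono fun x hx hxb => by simp [hx hxb]⟩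

theorem mul_kern_ae (h : L2Ball R k) (x : E3) :
    (fun y => k y * kern R x y) =ᵐ[volume] fun y => k y / ‖x - y‖ := by
  filter_upwards [h.2] with y hy
  by_cases hyb : y ∈ ball (0 : E3) R
  · simp [kern, hyb, div_eq_mul_inv]
  · simp [hy hyb]

theorem integrable_div (h : L2Ball R k) (x : E3) : Integrable fun y => k y / ‖x - y‖ := by
  obtain ⟨K, -, hK⟩ := exists_kern_bound R
  exact (h.1.integrable_mul (hK x).1).congr (h.mul_kern_ae x)

theorem integrable (h : L2Ball R k) : Integrable k := MemLp.integrable_of_ball h.1 h.2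

theorem newt_add (h : L2Ball R k) (h' : L2Ball R l) (x : E3) :
    newt (fun y => k y + l y) x = newt k x + newt l x := by
  simp only [newt, add_div]
  exact integral_add (h.integrable_div x) (h'.integrable_div x)

theorem newt_sub (h : L2Ball R k) (h' : L2Ball R l) (x : E3) :
    newt (fun y => k y - l y) x = newt k x - newt l x := by
  simp only [newt, sub_div]
  exact integral_sub (h.integrable_div x) (h'.integrable_div x)

omit R in
theorem _root_.BallSolution.newt_const_mul (c : ℝ) (k : E3 → ℝ) (x : E3) :
    newt (fun y => c * k y) x = c * newt k x := by
  simp only [newt, mul_div_assoc]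
  exact MeasureTheory.integral_const_mul _ _

theorem _root_.BallSolution.newt_congr_ae {k l : E3 → ℝ} (h : k =ᵐ[volume] l) (x : E3) :
    newt k x = newt l x :=
  integral_congr_ae (h.mono fun y hy => by simp only [hy])

theorem _root_.BallSolution.newt_nonneg {k : E3 → ℝ} (h : ∀ x, 0 ≤ k x) (x : E3) : 0 ≤ newt k x :=
  integral_nonneg fun y => div_nonneg (h y) (norm_nonneg _)

theorem _root_.BallSolution.exists_newt_bound (R : ℝ) : ∃ C, 0 ≤ C ∧ ∀ k, L2Ball R k → ∀ x,
    |newt k x| ≤ C * √(∫ y, k y ^ 2) := by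
  obtain ⟨K, hK0, hK⟩ := exists_kern_bound R
  refine ⟨√K, Real.sqrt_nonneg _, fun k h x => ?_⟩
  rw [newt, ← integral_congr_ae (h.mul_kern_ae x), mul_comm]
  exact (integral_mul_sq_le h.1 (hK x).1).trans (by gcongr; exact (hK x).2)

theorem integrable_prod (h : L2Ball R k) (h' : L2Ball R l) :
    Integrable (fun p : E3 × E3 => k p.2 / ‖p.1 - p.2‖ * l p.1) (volume.prod volume) := by
  have hm : ∀ {k l : E3 → ℝ}, L2Ball R k → L2Ball R l → AEStronglyMeasurable
      (fun p : E3 × E3 => k p.2 / ‖p.1 - p.2‖ * l p.1) (volume.prod volume) := by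
    intro k l h h'
    have h1 : AEStronglyMeasurable (fun p : E3 × E3 => k p.2) (volume.prod volume) :=
      h.1.1.comp_snd
    have h2 : AEStronglyMeasurable (fun p : E3 × E3 => l p.1) (volume.prod volume) :=
      h'.1.1.comp_fst
    have h3 : Measurable (fun p : E3 × E3 => ‖p.1 - p.2‖⁻¹) := by fun_prop
    simp_rw [div_eq_mul_inv]
    exact (h1.mul h3.aestronglyMeasurable).mul h2
  rw [integrable_prod_iff (hm h h')]
  refine ⟨Eventually.of_forall fun x => (h.integrable_div x).mul_const (l x), ?_⟩
  obtain ⟨C, hC0, hC⟩ := exists_newt_bound R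
  refine (h'.integrable.abs.const_mul (C * √(∫ y, |k y| ^ 2))).mono'
    (hm h h').norm.integral_prod_right' (Eventually.of_forall fun x => ?_)
  have e : ∀ y, ‖k y / ‖x - y‖ * l x‖ = |k y| / ‖x - y‖ * |l x| := fun y => by
    rw [norm_mul, norm_div, norm_norm, Real.norm_eq_abs, Real.norm_eq_abs]
  simp only [e]
  rw [MeasureTheory.integral_mul_const, norm_mul, Real.norm_eq_abs, Real.norm_eq_abs, abs_abs]
  gcongr
  exact hC _ h.abs x

/-- The Coulomb energy. -/
def _root_.BallSolution.coul (k l : E3 → ℝ) : ℝ := ∫ x, newt k x * l x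

theorem aestronglyMeasurable_newt (h : L2Ball R k) : AEStronglyMeasurable (newt k) volume := by
  have h1 : AEStronglyMeasurable (fun p : E3 × E3 => k p.2) (volume.prod volume) :=
    h.1.1.comp_snd
  have h3 : Measurable (fun p : E3 × E3 => ‖p.1 - p.2‖⁻¹) := by fun_prop
  have := (h1.mul h3.aestronglyMeasurable).integral_prod_right'
  exact this

theorem integrable_newt_mul (h : L2Ball R k) (h' : L2Ball R l) :
    Integrable fun x => newt k x * l x := by
  refine (h.integrable_prod h').integral_prod_left.congr (Eventually.of_forall fun x => ?_)
  simp only [newt]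
  rw [MeasureTheory.integral_mul_const]

theorem coul_comm (h : L2Ball R k) (h' : L2Ball R l) : coul k l = coul l k := by
  have e1 : coul k l = ∫ x, ∫ y, k y / ‖x - y‖ * l x := by
    simp_rw [MeasureTheory.integral_mul_const]; rfl
  have e2 : coul l k = ∫ y, ∫ x, k y / ‖x - y‖ * l x := by
    simp only [coul, newt]
    refine integral_congr_ae (Eventually.of_forall fun y => ?_)
    simp only []
    rw [← MeasureTheory.integral_mul_const]
    refine integral_congr_ae (Eventually.of_forall fun x => ?_)
    simp only []
    rw [norm_sub_rev]
    ring
  rw [e1, e2]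
  exact integral_integral_swap (h.integrable_prod h')

theorem coul_add_right (h : L2Ball R k) {l' : E3 → ℝ} (h' : L2Ball R l) (h'' : L2Ball R l') :
    coul k (fun x => l x + l' x) = coul k l + coul k l' := by
  simp only [coul, mul_add]
  exact integral_add (h.integrable_newt_mul h') (h.integrable_newt_mul h'')

theorem coul_add_left {k' : E3 → ℝ} (h : L2Ball R k) (h' : L2Ball R k') (h'' : L2Ball R l) :
    coul (fun x => k x + k' x) l = coul k l + coul k' l := by
  simp only [coul, h.newt_add h', add_mul]
  exact integral_add (h.integrable_newt_mul h'') (h'.integrable_newt_mul h'')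

theorem coul_sub_right (h : L2Ball R k) {l' : E3 → ℝ} (h' : L2Ball R l) (h'' : L2Ball R l') :
    coul k (fun x => l x - l' x) = coul k l - coul k l' := by
  simp only [coul, mul_sub]
  exact integral_sub (h.integrable_newt_mul h') (h.integrable_newt_mul h'')

theorem coul_sub_left {k' : E3 → ℝ} (h : L2Ball R k) (h' : L2Ball R k') (h'' : L2Ball R l) :
    coul (fun x => k x - k' x) l = coul k l - coul k' l := by
  simp only [coul, h.newt_sub h', sub_mul]
  exact integral_sub (h.integrable_newt_mul h'') (h'.integrable_newt_mul h'')

theorem _root_.BallSolution.coul_mul_left (c : ℝ) (k l : E3 → ℝ) :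
    coul (fun x => c * k x) l = c * coul k l := by
  simp only [coul, newt_const_mul, mul_assoc]
  exact MeasureTheory.integral_const_mul _ _

theorem _root_.BallSolution.coul_mul_right (c : ℝ) (k l : E3 → ℝ) :
    coul k (fun x => c * l x) = c * coul k l := by
  simp only [coul, mul_left_comm _ c]
  exact MeasureTheory.integral_const_mul _ _

theorem _root_.BallSolution.coul_nonneg {k l : E3 → ℝ} (hk : ∀ x, 0 ≤ k x) (hl : ∀ x, 0 ≤ l x) :
    0 ≤ coul k l :=
  integral_nonneg fun x => mul_nonneg (newt_nonneg hk x) (hl x)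

theorem _root_.BallSolution.coul_congr {k k' l l' : E3 → ℝ} (hk : k =ᵐ[volume] k')
    (hl : l =ᵐ[volume] l') : coul k l = coul k' l' :=
  integral_congr_ae (hl.mono fun x hx => by simp only [hx, newt_congr_ae hk])

theorem _root_.BallSolution.exists_coul_bound (R : ℝ) : ∃ C, 0 ≤ C ∧ ∀ k l, L2Ball R k →
    L2Ball R l → |coul k l| ≤ C * √(∫ y, k y ^ 2) * √(∫ y, l y ^ 2) := by
  obtain ⟨C, hC0, hC⟩ := exists_newt_bound R
  refine ⟨C * √(volume.real (ball (0 : E3) R)), by positivity, fun k l hk hl => ?_⟩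
  have h1 : ∫ x, |l x| ≤ √(∫ y, l y ^ 2) * √(volume.real (ball (0 : E3) R)) := by
    have := integral_mul_sq_le hl.abs.1 (memLp_indicator_ball 0 R)
    rw [integral_indicator_ball_sq] at this
    simp_rw [sq_abs] at this
    refine le_trans (le_of_eq ?_) ((le_abs_self _).trans this)
    refine integral_congr_ae ?_
    filter_upwards [hl.2] with x hx
    by_cases hxb : x ∈ ball (0 : E3) R
    · simp [hxb]
    · simp [hx hxb]
  calc |coul k l| ≤ ∫ x, C * √(∫ y, k y ^ 2) * |l x| := by
        refine MeasureTheory.norm_integral_le_of_norm_le (f := fun x => newt k x * l x)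
          (hl.integrable.abs.const_mul _) (Eventually.of_forall fun x => ?_)
        rw [norm_mul]
        exact mul_le_mul_of_nonneg_right (hC k hk x) (abs_nonneg _)
    _ = C * √(∫ y, k y ^ 2) * ∫ x, |l x| := MeasureTheory.integral_const_mul _ _
    _ ≤ C * √(∫ y, k y ^ 2) * (√(∫ y, l y ^ 2) * √(volume.real (ball (0 : E3) R))) := by gcongr
    _ = _ := by ring

end L2Ball

/-- The standing hypotheses of the problem on the ball of radius `R`. -/
structure Setup (f : ℝ → ℝ) (V : E3 → ℝ) (α R : ℝ) : Prop where
  nonlin : Nonlin f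
  cont : Continuous V
  pos : 0 < α
  le : ∀ x, α ≤ V x
  radius : 0 < R

theorem integrable_sextic {u : E3 → ℝ} {D : E3 → E3} (h : H1 u D) :
    Integrable (fun x => u x ^ 6) := by
  obtain ⟨S, -, hS⟩ := exists_sobolev_const
  have := (hS u D h).1.integrable_norm_pow (by norm_num)
  refine this.congr (Eventually.of_forall fun x => ?_)
  simp only [Real.norm_eq_abs]
  rw [show (6:ℕ) = 2 * 3 by norm_num, pow_mul, pow_mul, sq_abs]

namespace H10

variable {R : ℝ} {u v : E3 → ℝ} {D G : E3 → E3}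

theorem setIntegral_eq (h : H10 R u D) {g : E3 → ℝ → ℝ} (hg : ∀ x, g x 0 = 0) :
    ∫ x in ball (0 : E3) R, g x (u x) = ∫ x, g x (u x) := by
  refine setIntegral_eq_integral_of_ae_compl_eq_zero ?_
  filter_upwards [h.zero] with x hx hxb
  rw [hx hxb, hg]

theorem integrable_sq (h : H10 R u D) : Integrable fun x => u x ^ 2 := h.h1.memLp.integrable_sq

theorem integrable_mul (h : H10 R u D) (h' : H10 R v G) : Integrable fun x => u x * v x :=
  h.h1.memLp.integrable_mul h'.h1.memLp

theorem integrable_grad_sq (h : H10 R u D) : Integrable fun x => ‖D x‖ ^ 2 :=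
  h.h1.memLp_grad.norm.integrable_sq

theorem integrable_pow_six (h : H10 R u D) : Integrable fun x => u x ^ 6 := integrable_sextic h.h1

theorem aestronglyMeasurable (h : H10 R u D) : AEStronglyMeasurable u volume := h.h1.memLp.1

theorem integrable_pow_four (h : H10 R u D) : Integrable fun x => u x ^ 4 := by
  refine (h.integrable_sq.add h.integrable_pow_six).mono' (h.aestronglyMeasurable.pow 4)
    (Eventually.of_forall fun x => ?_)
  rw [Real.norm_of_nonneg (by positivity)]
  simp only [Pi.add_apply]
  nlinarith [mul_nonneg (sq_nonneg (u x)) (sq_nonneg (u x ^ 2 - 1)), sq_nonneg (u x)]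

theorem integrableOn_subSextic (h : H10 R u D) {N : ℝ → ℝ} (hN : SubSextic N) :
    IntegrableOn (fun x => N (u x)) (ball 0 R) := by
  obtain ⟨C, -, hC⟩ := hN.2 1 one_pos
  exact ((integrableOn_const measure_ball_lt_top.ne).add
    (h.integrable_pow_six.integrableOn.const_mul 1)).mono'
    (hN.1.comp_aestronglyMeasurable h.aestronglyMeasurable.restrict)
    (Eventually.of_forall fun x => hC _)

theorem l2Ball (h : H10 R u D) : L2Ball R u := ⟨h.h1.memLp, h.zero⟩

theorem l2Ball_mul (h : H10 R u D) (h' : H10 R v G) : L2Ball R fun x => u x * v x := by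
  refine ⟨(memLp_two_iff_integrable_sq (h.aestronglyMeasurable.mul h'.aestronglyMeasurable)).2 ?_,
    h.zero.mono fun x hx hxb => by simp [hx hxb]⟩
  refine (h.integrable_pow_four.add h'.integrable_pow_four).mono'
    ((h.aestronglyMeasurable.mul h'.aestronglyMeasurable).pow 2) (Eventually.of_forall fun x => ?_)
  rw [Real.norm_of_nonneg (by positivity)]
  simp only [Pi.add_apply, Pi.mul_apply]
  nlinarith [sq_nonneg (u x ^ 2 - v x ^ 2), sq_nonneg (u x * v x)]

theorem l2Ball_sq (h : H10 R u D) : L2Ball R fun x => u x ^ 2 := by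
  simpa only [pow_two] using h.l2Ball_mul h

theorem integrableOn_pot {V : E3 → ℝ} (hV : Continuous V) {g : E3 → ℝ} (hg : Integrable g) :
    IntegrableOn (fun x => V x * g x) (ball 0 R) := by
  obtain ⟨C, hC⟩ := (isCompact_closedBall (0 : E3) R).exists_bound_of_continuousOn hV.continuousOn
  refine (hg.integrableOn.norm.const_mul C).mono'
    (hV.aestronglyMeasurable.mul hg.1.restrict) ?_
  filter_upwards [ae_restrict_mem measurableSet_ball] with x hx
  rw [norm_mul]
  gcongr
  exact hC x (ball_subset_closedBall hx)

end H10

/-- The squared norm `∫ |∇p|² + ∫ V p²`. -/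
def nrm (V : E3 → ℝ) (R : ℝ) (p : E3 → ℝ) (P : E3 → E3) : ℝ :=
  (∫ x, ‖P x‖ ^ 2) + ∫ x in ball (0 : E3) R, V x * p x ^ 2

/-- The interaction energy of `p²` and `q²`. -/
def cc (p q : E3 → ℝ) : ℝ := 1 / (4 * Real.pi) * coul (fun x => p x ^ 2) fun x => q x ^ 2

/-- The integral of `F(p)` over the ball. -/
def primInt (f : ℝ → ℝ) (R : ℝ) (p : E3 → ℝ) : ℝ := ∫ x in ball (0 : E3) R, prim f (p x)

/-- The integral of `f(p) p` over the ball. -/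
def mulInt (f : ℝ → ℝ) (R : ℝ) (p : E3 → ℝ) : ℝ := ∫ x in ball (0 : E3) R, f (p x) * p x

/-- A nonnegative and a nonpositive function with disjoint supports. -/
structure Split (R : ℝ) (p : E3 → ℝ) (P : E3 → E3) (q : E3 → ℝ) (Q : E3 → E3) : Prop where
  left : H10 R p P
  right : H10 R q Q
  nonneg : ∀ x, 0 ≤ p x
  nonpos : ∀ x, q x ≤ 0
  disj : ∀ x, (p x = 0 ∧ P x = 0) ∨ (q x = 0 ∧ Q x = 0)

/-- The energy of `p + q` for a split pair. -/
def splitEnergy (f : ℝ → ℝ) (V : E3 → ℝ) (R : ℝ) (p : E3 → ℝ) (P : E3 → E3) (q : E3 → ℝ)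
    (Q : E3 → E3) : ℝ :=
  1 / 2 * nrm V R p P + 1 / 2 * nrm V R q Q + 1 / 4 * (cc p p + 2 * cc p q + cc q q)
    - primInt f R p - primInt f R q

/-- The sign-changing Nehari set. -/
structure Nehari (f : ℝ → ℝ) (V : E3 → ℝ) (R : ℝ) (p : E3 → ℝ) (P : E3 → E3) (q : E3 → ℝ)
    (Q : E3 → E3) : Prop where
  split : Split R p P q Q
  left_ne : ¬ p =ᵐ[volume] 0
  right_ne : ¬ q =ᵐ[volume] 0
  left_eq : nrm V R p P + cc p p + cc p q = mulInt f R p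
  right_eq : nrm V R q Q + cc q q + cc p q = mulInt f R q

theorem nrm_smul (V : E3 → ℝ) (R : ℝ) (p : E3 → ℝ) (P : E3 → E3) (s : ℝ) :
    nrm V R (fun x => s * p x) (fun x => s • P x) = s ^ 2 * nrm V R p P := by
  simp only [nrm, norm_smul, mul_pow, Real.norm_eq_abs, sq_abs, mul_left_comm _ (s ^ 2),
    MeasureTheory.integral_const_mul, mul_add]

theorem cc_mul (p q : E3 → ℝ) (s t : ℝ) :
    cc (fun x => s * p x) (fun x => t * q x) = s ^ 2 * t ^ 2 * cc p q := by
  simp only [cc, mul_pow, coul_mul_left, coul_mul_right]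
  ring

theorem cc_nonneg (p q : E3 → ℝ) : 0 ≤ cc p q :=
  mul_nonneg (by positivity) (coul_nonneg (fun _ => sq_nonneg _) fun _ => sq_nonneg _)

theorem cc_comm {R : ℝ} {p q : E3 → ℝ} {P Q : E3 → E3} (hp : H10 R p P) (hq : H10 R q Q) :
    cc p q = cc q p := by
  rw [cc, cc, hp.l2Ball_sq.coul_comm hq.l2Ball_sq]

theorem Split.smul {R : ℝ} {p q : E3 → ℝ} {P Q : E3 → E3} (h : Split R p P q Q) {s t : ℝ}
    (hs : 0 ≤ s) (ht : 0 ≤ t) : Split R (fun x => s * p x) (fun x => s • P x) (fun x => t * q x)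
      (fun x => t • Q x) where
  left := h.left.const_mul s
  right := h.right.const_mul t
  nonneg x := mul_nonneg hs (h.nonneg x)
  nonpos x := mul_nonpos_of_nonneg_of_nonpos ht (h.nonpos x)
  disj x := by
    rcases h.disj x with ⟨h1, h2⟩ | ⟨h1, h2⟩
    · left; simp [h1, h2]
    · right; simp [h1, h2]

theorem H10.split {R : ℝ} {u : E3 → ℝ} {D : E3 → E3} (h : H10 R u D) :
    Split R (fun x => max (u x) 0) (fun x => if 0 < u x then D x else 0)
      (fun x => min (u x) 0) (fun x => if u x < 0 then D x else 0) where
  left := h.posPart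
  right := h.negPart
  nonneg x := le_max_right _ _
  nonpos x := min_le_right _ _
  disj x := by
    rcases lt_or_ge 0 (u x) with h1 | h1
    · right; simp [h1.le, not_lt.2 h1.le]
    · left; simp [h1, not_lt.2 h1]

namespace Setup

variable {f : ℝ → ℝ} {V : E3 → ℝ} {α R : ℝ} (h : Setup f V α R) {p q : E3 → ℝ} {P Q : E3 → E3}

include h

theorem nrm_ge (hp : H10 R p P) : (∫ x, ‖P x‖ ^ 2) + α * ∫ x, p x ^ 2 ≤ nrm V R p P := by
  rw [nrm, ← hp.setIntegral_eq (g := fun _ s => s ^ 2) (by simp), ← MeasureTheory.integral_const_mul]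
  gcongr 1
  refine integral_mono (hp.integrable_sq.integrableOn.const_mul α)
    (H10.integrableOn_pot h.cont hp.integrable_sq) fun x => ?_
  dsimp only
  gcongr
  exact h.le x

theorem nrm_nonneg (hp : H10 R p P) : 0 ≤ nrm V R p P :=
  le_trans (add_nonneg (integral_nonneg fun _ => sq_nonneg _)
    (mul_nonneg h.pos.le (integral_nonneg fun _ => sq_nonneg _))) (h.nrm_ge hp)

omit h in
theorem integral_sq_pos (hp : H10 R p P) (h0 : ¬ p =ᵐ[volume] 0) : 0 < ∫ x, p x ^ 2 := by
  refine lt_of_le_of_ne (integral_nonneg fun _ => sq_nonneg _) fun h1 => h0 ?_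
  have := (integral_eq_zero_iff_of_nonneg (fun x => sq_nonneg (p x)) hp.integrable_sq).1 h1.symm
  filter_upwards [this] with x hx
  simpa using hx

theorem nrm_pos (hp : H10 R p P) (h0 : ¬ p =ᵐ[volume] 0) : 0 < nrm V R p P := by
  refine lt_of_lt_of_le ?_ (h.nrm_ge hp)
  have := mul_pos h.pos (integral_sq_pos hp h0)
  have : 0 ≤ ∫ x, ‖P x‖ ^ 2 := integral_nonneg fun x => sq_nonneg _
  linarith

theorem hasDerivAt_primInt (hp : H10 R p P) (s : ℝ) :
    HasDerivAt (fun s => primInt f R fun x => s * p x)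
      (∫ x in ball (0 : E3) R, f (s * p x) * p x) s := by
  obtain ⟨C, hC, hb⟩ := h.nonlin.growth' one_pos
  set T := |s| + 1
  have hp1 : Integrable (fun x => |p x|) := hp.l2Ball.integrable.abs
  refine (hasDerivAt_integral_of_dominated_loc_of_deriv_le (𝕜 := ℝ) (s := ball s 1)
    (F := fun s x => prim f (s * p x)) (F' := fun s x => f (s * p x) * p x)
    (bound := fun x => C * |p x| + T ^ 5 * p x ^ 6) (ball_mem_nhds s one_pos) ?_ ?_ ?_ ?_ ?_ ?_).2
  · exact Eventually.of_forall fun t => h.nonlin.continuous_prim.comp_aestronglyMeasurable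
      (hp.const_mul t).aestronglyMeasurable.restrict
  · exact (hp.const_mul s).integrableOn_subSextic h.nonlin.subSextic_prim
  · exact (h.nonlin.continuous.comp_aestronglyMeasurable
      (hp.const_mul s).aestronglyMeasurable.restrict).mul hp.aestronglyMeasurable.restrict
  · refine Eventually.of_forall fun x t ht => ?_
    have h1 : |t| ≤ T := by
      have := abs_sub_abs_le_abs_sub t s
      rw [mem_ball, Real.dist_eq] at ht
      simp only [T]; linarith
    rw [norm_mul, Real.norm_eq_abs, Real.norm_eq_abs]
    have e : p x ^ 6 = |p x| ^ 5 * |p x| := by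
      rw [← pow_succ]; exact (Even.pow_abs (by decide) (p x)).symm
    calc |f (t * p x)| * |p x| ≤ (C + 1 * |t * p x| ^ 5) * |p x| := by gcongr; exact hb _
      _ = C * |p x| + |t| ^ 5 * p x ^ 6 := by rw [e, abs_mul, mul_pow]; ring
      _ ≤ _ := by gcongr
  · exact (hp1.integrableOn.const_mul C).add (hp.integrable_pow_six.integrableOn.const_mul _)
  · refine Eventually.of_forall fun x t _ => ?_
    have := (h.nonlin.hasDerivAt_prim (t * p x)).comp t ((hasDerivAt_id t).mul_const (p x))
    rw [one_mul] at this
    exact this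

omit h in
theorem splitEnergy_smul (s t : ℝ) :
    splitEnergy f V R (fun x => s * p x) (fun x => s • P x) (fun x => t * q x) (fun x => t • Q x) =
      1 / 2 * (s ^ 2 * nrm V R p P) + 1 / 2 * (t ^ 2 * nrm V R q Q) +
      1 / 4 * (s ^ 4 * cc p p + 2 * (s ^ 2 * t ^ 2 * cc p q) + t ^ 4 * cc q q)
      - (primInt f R fun x => s * p x) - (primInt f R fun x => t * q x) := by
  simp only [splitEnergy, nrm_smul, cc_mul]
  ring

theorem primInt_ineq (hp : H10 R p P) {s : ℝ} (hs : 0 ≤ s) :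
    primInt f R p - (primInt f R fun x => s * p x) ≤ (1 - s ^ 4) / 4 * mulInt f R p := by
  have h1 := hp.integrableOn_subSextic h.nonlin.subSextic_prim
  have h2 := (hp.const_mul s).integrableOn_subSextic h.nonlin.subSextic_prim
  have h3 := hp.integrableOn_subSextic h.nonlin.subSextic_mul
  rw [primInt, primInt, mulInt, ← integral_sub h1 h2, ← MeasureTheory.integral_const_mul]
  refine integral_mono (h1.sub h2) (h3.const_mul _) fun x => ?_
  have := h.nonlin.quartic_ineq hs (p x)
  dsimp only
  linarith

theorem energy_gap (hn : Nehari f V R p P q Q) {s t : ℝ} (hs : 0 ≤ s) (ht : 0 ≤ t) :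
    splitEnergy f V R (fun x => s * p x) (fun x => s • P x) (fun x => t * q x) (fun x => t • Q x) +
      1 / 4 * (1 - s ^ 2) ^ 2 * nrm V R p P + 1 / 4 * (1 - t ^ 2) ^ 2 * nrm V R q Q ≤
      splitEnergy f V R p P q Q := by
  rw [splitEnergy_smul, splitEnergy]
  have h1 := h.primInt_ineq hn.split.left hs
  have h2 := h.primInt_ineq hn.split.right ht
  rw [← hn.left_eq] at h1
  rw [← hn.right_eq] at h2
  have h3 := mul_nonneg (cc_nonneg p q) (sq_nonneg (s ^ 2 - t ^ 2))
  nlinarith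

theorem energy_ge (hn : Nehari f V R p P q Q) :
    1 / 4 * (nrm V R p P + nrm V R q Q) ≤ splitEnergy f V R p P q Q := by
  have := h.energy_gap hn le_rfl le_rfl
  rw [splitEnergy_smul] at this
  simp only [zero_mul, primInt, Nonlin.prim_zero, integral_zero] at this
  linarith

theorem nehari_of_isLocalMax (hsp : Split R p P q Q) (hp : ¬ p =ᵐ[volume] 0)
    (hq : ¬ q =ᵐ[volume] 0) {s t : ℝ} (hs : 0 < s) (ht : 0 < t)
    (h1 : IsLocalMax (fun s => splitEnergy f V R (fun x => s * p x) (fun x => s • P x)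
      (fun x => t * q x) (fun x => t • Q x)) s)
    (h2 : IsLocalMax (fun t => splitEnergy f V R (fun x => s * p x) (fun x => s • P x)
      (fun x => t * q x) (fun x => t • Q x)) t) :
    Nehari f V R (fun x => s * p x) (fun x => s • P x) (fun x => t * q x) (fun x => t • Q x) := by
  have hne : ∀ {p : E3 → ℝ} {s : ℝ}, 0 < s → ¬ p =ᵐ[volume] 0 →
      ¬ (fun x => s * p x) =ᵐ[volume] 0 := by
    intro p s hs hp h3
    refine hp (h3.mono fun x hx => ?_)
    simpa [hs.ne'] using hx
  have hm : ∀ (p : E3 → ℝ) (s : ℝ), s * ∫ x in ball (0 : E3) R, f (s * p x) * p x =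
      mulInt f R fun x => s * p x := by
    intro p s
    rw [mulInt, ← MeasureTheory.integral_const_mul]
    refine integral_congr_ae (Eventually.of_forall fun x => ?_)
    dsimp only
    ring
  refine ⟨hsp.smul hs.le ht.le, hne hs hp, hne ht hq, ?_, ?_⟩
  · simp only [splitEnergy_smul] at h1
    have hd : HasDerivAt (fun s : ℝ => 1 / 2 * (s ^ 2 * nrm V R p P) +
        1 / 2 * (t ^ 2 * nrm V R q Q) +
        1 / 4 * (s ^ 4 * cc p p + 2 * (s ^ 2 * t ^ 2 * cc p q) + t ^ 4 * cc q q)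
        - (primInt f R fun x => s * p x) - (primInt f R fun x => t * q x))
        (s * nrm V R p P + s ^ 3 * cc p p + s * t ^ 2 * cc p q -
          ∫ x in ball (0 : E3) R, f (s * p x) * p x) s := by
      have d2 := hasDerivAt_pow 2 s
      have d4 := hasDerivAt_pow 4 s
      refine ((((((d2.mul_const _).const_mul _).add_const _).add ((((d4.mul_const _).add
        (((d2.mul_const _).mul_const _).const_mul _)).add_const _).const_mul _)).sub
        (h.hasDerivAt_primInt hsp.left s)).sub_const _).congr_deriv ?_
      push_cast
      ring
    have h3 := h1.hasDerivAt_eq_zero hd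
    rw [nrm_smul, cc_mul, cc_mul, ← hm]
    linear_combination s * h3
  · simp only [splitEnergy_smul] at h2
    have hd : HasDerivAt (fun t : ℝ => 1 / 2 * (s ^ 2 * nrm V R p P) +
        1 / 2 * (t ^ 2 * nrm V R q Q) +
        1 / 4 * (s ^ 4 * cc p p + 2 * (s ^ 2 * t ^ 2 * cc p q) + t ^ 4 * cc q q)
        - (primInt f R fun x => s * p x) - (primInt f R fun x => t * q x))
        (t * nrm V R q Q + t ^ 3 * cc q q + t * s ^ 2 * cc p q -
          ∫ x in ball (0 : E3) R, f (t * q x) * q x) t := by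
      have d2 := hasDerivAt_pow 2 t
      have d4 := hasDerivAt_pow 4 t
      refine ((((((d2.mul_const _).const_mul _).const_add _).add ((((((d2.const_mul _).mul_const
        _).const_mul _).const_add _).add (d4.mul_const _)).const_mul _)).sub_const _).sub
        (h.hasDerivAt_primInt hsp.right t)).congr_deriv ?_
      push_cast
      ring
    have h3 := h2.hasDerivAt_eq_zero hd
    rw [nrm_smul, cc_mul, cc_mul, ← hm]
    linear_combination t * h3

end Setup

theorem integrable_setIntegral_pow_six {R : ℝ} {p : E3 → ℝ} {P : E3 → E3} (hp : H10 R p P) :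
    ∫ x in ball (0 : E3) R, p x ^ 6 = ∫ x, p x ^ 6 :=
  hp.setIntegral_eq (g := fun _ s => s ^ 6) (by simp)

theorem exists_pow_six_le : ∃ S > 0, ∀ (R : ℝ) (u : E3 → ℝ) (D : E3 → E3), H10 R u D →
    ∫ x, u x ^ 6 ≤ S * (∫ x, ‖D x‖ ^ 2) ^ 3 := by
  obtain ⟨S, hS, h⟩ := exists_sobolev_const
  refine ⟨S, hS, fun R u D hu => ?_⟩
  have := (h u D hu.h1).2
  simpa only [Even.pow_abs (show Even 6 by decide)] using this

theorem exists_small_pow {a : ℝ} (ha : 0 < a) (K : ℝ) (T : ℝ) (hT : 0 < T) :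
    ∃ s, 0 < s ∧ s < T ∧ K * s ^ 6 < a * s ^ 2 := by
  have : Tendsto (fun s : ℝ => K * s ^ 4) (𝓝[>] 0) (𝓝 (K * 0 ^ 4)) :=
    ((continuous_const.mul (continuous_pow 4)).tendsto 0).mono_left nhdsWithin_le_nhds
  rw [zero_pow four_ne_zero, mul_zero] at this
  obtain ⟨s, h1, h2, h3⟩ := ((this.eventually (gt_mem_nhds ha)).and
    (Ioo_mem_nhdsGT hT)).exists
  refine ⟨s, h2, h3, ?_⟩
  have : 0 < s ^ 2 := by positivity
  nlinarith

/-- A fibering functional of two parameters has an interior maximum point. -/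
theorem exists_fibering_max {a b A B C C1 C2 K1 K2 : ℝ} {φ ψ : ℝ → ℝ} (ha : 0 < a) (hb : 0 < b)
    (hA : 0 ≤ A) (hB : 0 ≤ B) (hC : 0 ≤ C) (hφ : Continuous φ) (hψ : Continuous ψ)
    (hφ0 : φ 0 = 0) (hψ0 : ψ 0 = 0) (hC1 : 0 ≤ C1) (hC2 : 0 ≤ C2)
    (hb1 : ∀ s, (A + B + 1) * s ^ 4 - C1 ≤ φ s) (hb2 : ∀ t, (C + B + 1) * t ^ 4 - C2 ≤ ψ t)
    (hφs : ∀ s, φ s ≤ s ^ 2 * (a / 4) + K1 * s ^ 6)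
    (hψs : ∀ t, ψ t ≤ t ^ 2 * (b / 4) + K2 * t ^ 6) {E : ℝ → ℝ → ℝ}
    (hEe : ∀ s t, E s t = 1 / 2 * (s ^ 2 * a) + 1 / 2 * (t ^ 2 * b) +
      1 / 4 * (s ^ 4 * A + 2 * (s ^ 2 * t ^ 2 * B) + t ^ 4 * C) - φ s - ψ t) :
    ∃ s t : ℝ, 0 < s ∧ 0 < t ∧ IsLocalMax (fun s => E s t) s ∧ IsLocalMax (fun t => E s t) t := by
  have cont : Continuous fun z : ℝ × ℝ => E z.1 z.2 := by
    simp only [hEe]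
    fun_prop
  obtain ⟨K, hK⟩ : ∃ K, K = a ^ 2 + b ^ 2 + C1 + C2 := ⟨_, rfl⟩
  have hK0 : 0 ≤ K := by rw [hK]; positivity
  have hbd : ∀ s t, E s t ≤ K - 1 / 2 * (s ^ 4 + t ^ 4) := by
    intro s t
    rw [hEe]
    have h1 := hb1 s
    have h2 := hb2 t
    have h3 : 2 * (s ^ 2 * t ^ 2) * B ≤ (s ^ 4 + t ^ 4) * B := by
      gcongr
      nlinarith [sq_nonneg (s ^ 2 - t ^ 2)]
    have h4 : 1 / 2 * (s ^ 2 * a) ≤ 1 / 2 * s ^ 4 + a ^ 2 := by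
      nlinarith [sq_nonneg (s ^ 2 - a), sq_nonneg a, sq_nonneg (s ^ 2)]
    have h5 : 1 / 2 * (t ^ 2 * b) ≤ 1 / 2 * t ^ 4 + b ^ 2 := by
      nlinarith [sq_nonneg (t ^ 2 - b), sq_nonneg b, sq_nonneg (t ^ 2)]
    have n1 : 0 ≤ s ^ 4 * A := by positivity
    have n2 : 0 ≤ t ^ 4 * C := by positivity
    have n3 : 0 ≤ s ^ 4 * B := by positivity
    have n4 : 0 ≤ t ^ 4 * B := by positivity
    rw [hK]
    linarith
  obtain ⟨T, hTd⟩ : ∃ T, T = 1 + 2 * K := ⟨_, rfl⟩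
  have hT0 : 0 < T := by rw [hTd]; positivity
  have hTE : ∀ s t, T ≤ s ∨ T ≤ t → E s t ≤ 0 := by
    intro s t hst
    refine (hbd s t).trans ?_
    have hT4 : 2 * K ≤ T ^ 4 := by
      have h1 : T ≤ T ^ 4 := le_self_pow₀ (by linarith) (by norm_num)
      linarith
    rcases hst with hs | hs
    · have : T ^ 4 ≤ s ^ 4 := by gcongr
      have : 0 ≤ t ^ 4 := by positivity
      linarith
    · have : T ^ 4 ≤ t ^ 4 := by gcongr
      have : 0 ≤ s ^ 4 := by positivity
      linarith
  obtain ⟨s1, hs1, hs1T, hs1'⟩ := exists_small_pow (a := a / 4) (by positivity) K1 T hT0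
  obtain ⟨t1, ht1, ht1T, ht1'⟩ := exists_small_pow (a := b / 4) (by positivity) K2 T hT0
  have inc1 : ∀ t, E 0 t < E s1 t := by
    intro t
    rw [hEe, hEe, hφ0]
    have h1 := hφs s1
    have n1 : 0 ≤ s1 ^ 4 * A := by positivity
    have n2 : 0 ≤ s1 ^ 2 * t ^ 2 * B := by positivity
    have n3 : 0 < s1 ^ 2 * a := by positivity
    simp only [ne_eq, OfNat.ofNat_ne_zero, not_false_eq_true, zero_pow, zero_mul, mul_zero]
    linarith
  have inc2 : ∀ s, E s 0 < E s t1 := by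
    intro t
    rw [hEe, hEe, hψ0]
    have h1 := hψs t1
    have n1 : 0 ≤ t1 ^ 4 * C := by positivity
    have n2 : 0 ≤ t ^ 2 * t1 ^ 2 * B := by positivity
    have n3 : 0 < t1 ^ 2 * b := by positivity
    simp only [ne_eq, OfNat.ofNat_ne_zero, not_false_eq_true, zero_pow, zero_mul, mul_zero]
    linarith
  obtain ⟨⟨s, t⟩, ⟨⟨hs0, hsT⟩, ht0, htT⟩, hmax⟩ :=
    (isCompact_Icc.prod isCompact_Icc : IsCompact (Set.Icc 0 T ×ˢ Set.Icc 0 T)).exists_isMaxOn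
      ⟨(0, 0), by simp [hT0.le]⟩ cont.continuousOn
  have hmax' : ∀ s' t', 0 ≤ s' → s' ≤ T → 0 ≤ t' → t' ≤ T → E s' t' ≤ E s t :=
    fun s' t' h1 h2 h3 h4 => hmax (show (s', t') ∈ _ from ⟨⟨h1, h2⟩, h3, h4⟩)
  have hpos : 0 < E s t := by
    have h00 : E 0 0 = 0 := by
      rw [hEe, hφ0, hψ0]; ring
    have := inc1 0
    have := hmax' s1 0 hs1.le hs1T.le le_rfl hT0.le
    linarith
  simp only at hs0 hsT ht0 htT
  have hs : 0 < s := by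
    refine lt_of_le_of_ne hs0 fun h1 => ?_
    have h2 := hmax' s1 t hs1.le hs1T.le ht0 htT
    have h3 := inc1 t
    rw [← h1] at h2
    linarith
  have ht : 0 < t := by
    refine lt_of_le_of_ne ht0 fun h1 => ?_
    have h2 := hmax' s t1 hs0 hsT ht1.le ht1T.le
    have h3 := inc2 s
    rw [← h1] at h2
    linarith
  have hsT' : s < T := by
    by_contra! h1
    linarith [hTE s t (Or.inl h1)]
  have htT' : t < T := by
    by_contra! h1
    linarith [hTE s t (Or.inr h1)]
  refine ⟨s, t, hs, ht, ?_, ?_⟩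
  · filter_upwards [Ioo_mem_nhds hs hsT'] with s' hs'
    exact hmax' s' t hs'.1.le hs'.2.le ht0 htT
  · filter_upwards [Ioo_mem_nhds ht htT'] with t' ht'
    exact hmax' s t' hs0 hsT ht'.1.le ht'.2.le

namespace Setup

variable {f : ℝ → ℝ} {V : E3 → ℝ} {α R : ℝ} (h : Setup f V α R) {p q : E3 → ℝ} {P Q : E3 → E3}

include h

theorem integral_grad_le_nrm (hp : H10 R p P) : ∫ x, ‖P x‖ ^ 2 ≤ nrm V R p P := by
  have := h.nrm_ge hp
  have : 0 ≤ α * ∫ x, p x ^ 2 := mul_nonneg h.pos.le (integral_nonneg fun _ => sq_nonneg _)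
  linarith

theorem integral_sq_le_nrm (hp : H10 R p P) : α * ∫ x, p x ^ 2 ≤ nrm V R p P := by
  have := h.nrm_ge hp
  have : 0 ≤ ∫ x, ‖P x‖ ^ 2 := integral_nonneg fun x => sq_nonneg _
  linarith

theorem exists_primInt_le : ∃ C, 0 ≤ C ∧ ∀ (p : E3 → ℝ) (P : E3 → E3), H10 R p P → ∀ s : ℝ,
    (primInt f R fun x => s * p x) ≤ s ^ 2 * (nrm V R p P / 4) + C * s ^ 6 * ∫ x, p x ^ 6 := by
  have hα := h.pos
  obtain ⟨C, hC, hb⟩ := h.nonlin.growth (ε := α / 4) (by positivity)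
  refine ⟨C, hC, fun p P hp s => ?_⟩
  have i1 := (hp.const_mul s).integrableOn_subSextic h.nonlin.subSextic_prim
  have i2 := (hp.const_mul s).integrable_sq.integrableOn (s := ball 0 R)
  have i3 := (hp.const_mul s).integrable_pow_six.integrableOn (s := ball 0 R)
  have e1 : ∫ x in ball (0 : E3) R, (s * p x) ^ 2 = s ^ 2 * ∫ x, p x ^ 2 := by
    rw [(hp.const_mul s).setIntegral_eq (g := fun _ s => s ^ 2) (by simp),
      ← MeasureTheory.integral_const_mul]
    simp only [mul_pow]
  have e2 : ∫ x in ball (0 : E3) R, (s * p x) ^ 6 = s ^ 6 * ∫ x, p x ^ 6 := by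
    rw [integrable_setIntegral_pow_six (hp.const_mul s), ← MeasureTheory.integral_const_mul]
    simp only [mul_pow]
  calc primInt f R (fun x => s * p x)
      ≤ ∫ x in ball (0 : E3) R, (α / 4 * (s * p x) ^ 2 + C * (s * p x) ^ 6) := by
        refine integral_mono i1 ((i2.const_mul _).add (i3.const_mul _)) fun x => ?_
        have h1 : |prim f (s * p x)| ≤
            (α / 4 * |s * p x| + C * |s * p x| ^ 5) * |s * p x| :=
          Nonlin.abs_prim_le fun t ht => (hb t).trans (by gcongr)
        refine (le_abs_self _).trans (h1.trans_eq ?_)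
        have : |s * p x| ^ 6 = (s * p x) ^ 6 := Even.pow_abs (by decide) _
        rw [← this, ← sq_abs (s * p x)]
        ring
    _ = α / 4 * (s ^ 2 * ∫ x, p x ^ 2) + C * (s ^ 6 * ∫ x, p x ^ 6) := by
        rw [integral_add (i2.const_mul _) (i3.const_mul _), MeasureTheory.integral_const_mul,
          MeasureTheory.integral_const_mul, e1, e2]
    _ ≤ _ := by
        have := h.integral_sq_le_nrm hp
        have := mul_le_mul_of_nonneg_left this (sq_nonneg s)
        linarith

theorem exists_le_nrm : ∃ c > 0, ∀ (p : E3 → ℝ) (P : E3 → E3), H10 R p P → 0 < nrm V R p P →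
    nrm V R p P ≤ mulInt f R p → c ≤ nrm V R p P := by
  have hα := h.pos
  obtain ⟨C, hC, hb⟩ := h.nonlin.growth (ε := α / 2) (by positivity)
  obtain ⟨S, hS, hs⟩ := exists_pow_six_le
  set K := 1 + 2 * C * S with hK
  have hK1 : 1 ≤ K := by simp only [hK]; linarith [mul_nonneg hC hS.le]
  refine ⟨1 / K, by positivity, fun p P hp h0 hle => ?_⟩
  set n := nrm V R p P
  have i1 := hp.integrableOn_subSextic h.nonlin.subSextic_mul
  have i2 := hp.integrable_sq.integrableOn (s := ball 0 R)
  have i3 := hp.integrable_pow_six.integrableOn (s := ball 0 R)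
  have h1 : mulInt f R p ≤ α / 2 * (∫ x, p x ^ 2) + C * ∫ x, p x ^ 6 := by
    calc mulInt f R p ≤ ∫ x in ball (0 : E3) R, (α / 2 * p x ^ 2 + C * p x ^ 6) := by
          refine integral_mono i1 ((i2.const_mul _).add (i3.const_mul _)) fun x => ?_
          refine (le_abs_self _).trans ?_
          rw [abs_mul]
          refine (mul_le_mul_of_nonneg_right (hb _) (abs_nonneg _)).trans_eq ?_
          have : |p x| ^ 6 = p x ^ 6 := Even.pow_abs (by decide) _
          rw [← this, ← sq_abs (p x)]
          ring
      _ = _ := by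
          rw [integral_add (i2.const_mul _) (i3.const_mul _), MeasureTheory.integral_const_mul,
            MeasureTheory.integral_const_mul, integrable_setIntegral_pow_six hp,
            hp.setIntegral_eq (g := fun _ s => s ^ 2) (by simp)]
  have h2 : ∫ x, p x ^ 6 ≤ S * n ^ 3 := (hs R p P hp).trans (by
    gcongr
    exact h.integral_grad_le_nrm hp)
  have h3 := h.integral_sq_le_nrm hp
  have h4 : n ≤ K * n ^ 3 := by
    have : C * ∫ x, p x ^ 6 ≤ C * (S * n ^ 3) := by gcongr
    have : 0 ≤ n ^ 3 := by positivity
    simp only [hK]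
    nlinarith
  by_contra! hlt
  have h5 : K * n < 1 := by rwa [lt_div_iff₀ (by positivity), mul_comm] at hlt
  have h6 : n < 1 := lt_of_le_of_lt (by nlinarith) h5
  have : K * n ^ 3 < n := by
    calc K * n ^ 3 = (K * n) * (n * n) := by ring
      _ < 1 * (n * n) := by gcongr
      _ ≤ n := by nlinarith
  linarith

theorem exists_primInt_ge (hp : H10 R p P) (h0 : ¬ p =ᵐ[volume] 0) (M : ℝ) :
    ∃ C, 0 ≤ C ∧ ∀ s, M * s ^ 4 - C ≤ primInt f R fun x => s * p x := by
  have hpos : 0 < ∫ x, p x ^ 4 := by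
    refine lt_of_le_of_ne (integral_nonneg fun x => by positivity) fun h1 => h0 ?_
    have := (integral_eq_zero_iff_of_nonneg (fun x => by positivity)
      hp.integrable_pow_four).1 h1.symm
    filter_upwards [this] with x hx
    simpa using hx
  obtain ⟨C, hC, hb⟩ := h.nonlin.superquartic (M / ∫ x, p x ^ 4)
  refine ⟨(volume (ball (0 : E3) R)).toReal * C, by positivity, fun s => ?_⟩
  have i3 := (hp.const_mul s).integrable_pow_four.integrableOn (s := ball 0 R)
  have i1 := (hp.const_mul s).integrableOn_subSextic h.nonlin.subSextic_prim
  calc M * s ^ 4 - (volume (ball (0 : E3) R)).toReal * C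
      = ∫ x in ball (0 : E3) R, (M / (∫ x, p x ^ 4) * (s * p x) ^ 4 - C) := by
        rw [integral_sub (i3.const_mul _) (integrableOn_const measure_ball_lt_top.ne),
          MeasureTheory.integral_const_mul,
          (hp.const_mul s).setIntegral_eq (g := fun _ s => s ^ 4) (by simp)]
        simp only [mul_pow, MeasureTheory.integral_const_mul, setIntegral_const, smul_eq_mul,
          Measure.real]
        field_simp
    _ ≤ _ := integral_mono ((i3.const_mul _).sub (integrableOn_const measure_ball_lt_top.ne)) i1
        fun x => hb _

theorem continuous_primInt (hp : H10 R p P) : Continuous fun s => primInt f R fun x => s * p x :=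
  continuous_iff_continuousAt.2 fun s => (h.hasDerivAt_primInt hp s).continuousAt

/-- Every sign-changing function can be rescaled on each side to lie in the Nehari set. -/
theorem exists_nehari (hsp : Split R p P q Q) (hp : ¬ p =ᵐ[volume] 0) (hq : ¬ q =ᵐ[volume] 0) :
    ∃ s t : ℝ, 0 < s ∧ 0 < t ∧
      Nehari f V R (fun x => s * p x) (fun x => s • P x) (fun x => t * q x) (fun x => t • Q x) := by
  obtain ⟨C1, hC1, hb1⟩ := h.exists_primInt_ge hsp.left hp (cc p p + cc p q + 1)
  obtain ⟨C2, hC2, hb2⟩ := h.exists_primInt_ge hsp.right hq (cc q q + cc p q + 1)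
  obtain ⟨K, -, hsm⟩ := h.exists_primInt_le
  have e0 : ∀ p : E3 → ℝ, (primInt f R fun x => 0 * p x) = 0 := by
    simp [primInt, Nonlin.prim_zero]
  obtain ⟨s, t, hs, ht, h1, h2⟩ := exists_fibering_max (K1 := K * ∫ x, p x ^ 6)
    (K2 := K * ∫ x, q x ^ 6) (h.nrm_pos hsp.left hp)
    (h.nrm_pos hsp.right hq) (cc_nonneg p p) (cc_nonneg p q) (cc_nonneg q q)
    (h.continuous_primInt hsp.left) (h.continuous_primInt hsp.right) (e0 p) (e0 q) hC1 hC2 hb1 hb2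
    (fun s => (hsm p P hsp.left s).trans_eq (by ring))
    (fun s => (hsm q Q hsp.right s).trans_eq (by ring)) (fun s t => splitEnergy_smul s t)
  exact ⟨s, t, hs, ht, h.nehari_of_isLocalMax hsp hp hq hs ht h1 h2⟩

end Setup

theorem L2Ball.integrable_sq {R : ℝ} {k : E3 → ℝ} (h : L2Ball R k) :
    Integrable fun x => k x ^ 2 := h.1.integrable_sq

theorem L2Ball.sub {R : ℝ} {k l : E3 → ℝ} (h : L2Ball R k) (h' : L2Ball R l) :
    L2Ball R fun x => k x - l x := by
  refine ⟨h.1.sub h'.1, ?_⟩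
  filter_upwards [h.2, h'.2] with x h1 h2 h3
  rw [h1 h3, h2 h3, sub_zero]

theorem tendsto_coul {R : ℝ} {a b : ℕ → E3 → ℝ} {a' b' : E3 → ℝ} (ha : ∀ n, L2Ball R (a n))
    (ha' : L2Ball R a') (hb : ∀ n, L2Ball R (b n)) (hb₀ : L2Ball R b')
    (hal : Tendsto (fun n => ∫ x, (a n x - a' x) ^ 2) atTop (𝓝 0))
    (hbl : Tendsto (fun n => ∫ x, (b n x - b' x) ^ 2) atTop (𝓝 0)) :
    Tendsto (fun n => coul (a n) (b n)) atTop (𝓝 (coul a' b')) := by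
  obtain ⟨C, hC0, hC⟩ := exists_coul_bound R
  have hal' := hal.sqrt
  have hbl' := hbl.sqrt
  rw [Real.sqrt_zero] at hal' hbl'
  have hlim := (((hal'.const_mul C).mul hbl').add
    ((hal'.const_mul C).mul_const √(∫ y, b' y ^ 2))).add
    (hbl'.const_mul (C * √(∫ y, a' y ^ 2)))
  simp only [mul_zero, zero_mul, add_zero] at hlim
  rw [tendsto_iff_dist_tendsto_zero]
  refine squeeze_zero (fun _ => dist_nonneg) (fun n => ?_) hlim
  rw [Real.dist_eq]
  have e : coul (a n) (b n) - coul a' b' = coul (fun x => a n x - a' x) (fun x => b n x - b' x) +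
      coul (fun x => a n x - a' x) b' + coul a' fun x => b n x - b' x := by
    rw [((ha n).sub ha').coul_sub_right (hb n) hb₀, (ha n).coul_sub_left ha' (hb n),
      ha'.coul_sub_right (hb n) hb₀]
    ring
  rw [e]
  refine (abs_add_three _ _ _).trans ?_
  gcongr
  · exact hC _ _ ((ha n).sub ha') ((hb n).sub hb₀)
  · exact hC _ _ ((ha n).sub ha') hb₀
  · exact hC _ _ ha' ((hb n).sub hb₀)

/-- Convergence weakly in `H¹₀`, strongly in `L²`, and almost everywhere. -/
structure Conv (R : ℝ) (u : ℕ → E3 → ℝ) (D : ℕ → E3 → E3) (v : E3 → ℝ) (G : E3 → E3) : Prop where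
  mem : ∀ n, H10 R (u n) (D n)
  lim : H10 R v G
  bound : ∃ K, ∀ n, ∫ x, u n x ^ 6 ≤ K
  ae : ∀ᵐ x, Tendsto (fun n => u n x) atTop (𝓝 (v x))
  sq : Tendsto (fun n => ∫ x, (u n x - v x) ^ 2) atTop (𝓝 0)
  weak : ∀ W, MemLp W 2 volume →
    Tendsto (fun n => ∫ x, inner ℝ (D n x) (W x)) atTop (𝓝 (∫ x, inner ℝ (G x) (W x)))

namespace Conv

variable {R : ℝ} {u w : ℕ → E3 → ℝ} {D : ℕ → E3 → E3} {v z : E3 → ℝ} {G : E3 → E3}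
  {D' : ℕ → E3 → E3} {G' : E3 → E3}

theorem comp (h : Conv R u D v G) {ns : ℕ → ℕ} (hns : Tendsto ns atTop atTop) :
    Conv R (u ∘ ns) (D ∘ ns) v G where
  mem _ := h.mem _
  lim := h.lim
  bound := h.bound.imp fun _ hK _ => hK _
  ae := h.ae.mono fun _ hx => hx.comp hns
  sq := h.sq.comp hns
  weak W hW := (h.weak W hW).comp hns

theorem const_mul (h : Conv R u D v G) (c : ℝ) :
    Conv R (fun n x => c * u n x) (fun n x => c • D n x) (fun x => c * v x) (fun x => c • G x) where
  mem n := (h.mem n).const_mul c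
  lim := h.lim.const_mul c
  bound := by
    obtain ⟨K, hK⟩ := h.bound
    refine ⟨c ^ 6 * K, fun n => ?_⟩
    simp only [mul_pow, MeasureTheory.integral_const_mul]
    have : 0 ≤ c ^ 6 := by positivity
    gcongr
    exact hK n
  ae := h.ae.mono fun x hx => hx.const_mul c
  sq := by
    simp only [← mul_sub, mul_pow, MeasureTheory.integral_const_mul]
    simpa using h.sq.const_mul (c ^ 2)
  weak W hW := by
    simp only [inner_smul_left, MeasureTheory.integral_const_mul, RCLike.conj_to_real]
    exact (h.weak W hW).const_mul c

theorem tendsto_subSextic (h : Conv R u D v G) {N : ℝ → ℝ} (hN : SubSextic N) :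
    Tendsto (fun n => ∫ x in ball (0 : E3) R, N (u n x)) atTop
      (𝓝 (∫ x in ball (0 : E3) R, N (v x))) := by
  obtain ⟨K, hK⟩ := h.bound
  have : IsFiniteMeasure (volume.restrict (ball (0 : E3) R)) :=
    isFiniteMeasure_restrict.2 measure_ball_lt_top.ne
  exact hN.tendsto_integral (fun n => (h.mem n).aestronglyMeasurable.restrict)
    h.lim.aestronglyMeasurable.restrict (fun n => (h.mem n).integrable_pow_six.integrableOn)
    h.lim.integrable_pow_six.integrableOn
    (fun n => (integrable_setIntegral_pow_six (h.mem n)).trans_le (hK n)) (ae_restrict_of_ae h.ae)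

theorem tendsto_sq_sub_sq (h : Conv R u D v G) :
    Tendsto (fun n => ∫ x, (u n x ^ 2 - v x ^ 2) ^ 2) atTop (𝓝 0) := by
  obtain ⟨K, hK⟩ := h.bound
  have : IsFiniteMeasure (volume.restrict (ball (0 : E3) R)) :=
    isFiniteMeasure_restrict.2 measure_ball_lt_top.ne
  have hi : ∀ n, L2Ball R fun x => u n x ^ 2 - v x ^ 2 := fun n => (h.mem n).l2Ball_sq.sub h.lim.l2Ball_sq
  have e : ∀ n, ∫ x, (u n x ^ 2 - v x ^ 2) ^ 2 =
      ∫ x in ball (0 : E3) R, (u n x ^ 2 - v x ^ 2) ^ 2 := fun n => by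
    refine (setIntegral_eq_integral_of_ae_compl_eq_zero ?_).symm
    filter_upwards [(hi n).2] with x hx hxb
    simp [hx hxb]
  simp only [e]
  have i6 : ∀ n, Integrable (fun x => u n x ^ 6 + v x ^ 6) := fun n =>
    (h.mem n).integrable_pow_six.add h.lim.integrable_pow_six
  refine tendsto_integral_zero_of_le (h := fun n x => u n x ^ 6 + v x ^ 6)
    (K := K + ∫ x, v x ^ 6) (fun n => (hi n).integrable_sq.integrableOn)
    (fun n x => sq_nonneg _) (fun n => (i6 n).integrableOn) (fun n x => by positivity) (fun n => ?_)
    (fun ε hε => ?_) (ae_restrict_of_ae ?_)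
  · refine (setIntegral_le_integral (i6 n) (Eventually.of_forall fun x => by positivity)).trans ?_
    rw [integral_add (h.mem n).integrable_pow_six h.lim.integrable_pow_six]
    linarith [hK n]
  · obtain ⟨C, hC, hb⟩ := subSextic_pow_four.2 (ε / 2) (by positivity)
    refine ⟨4 * C, by positivity, fun n x => ?_⟩
    have h1 := (le_abs_self _).trans (hb (u n x))
    have h2 := (le_abs_self _).trans (hb (v x))
    have h3 : (u n x ^ 2 - v x ^ 2) ^ 2 ≤ 2 * (u n x ^ 4 + v x ^ 4) := by
      nlinarith [sq_nonneg (u n x ^ 2 + v x ^ 2)]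
    linarith
  · filter_upwards [h.ae] with x hx
    have := ((hx.pow 2).sub_const (v x ^ 2)).pow 2
    simpa using this

theorem tendsto_cc (h : Conv R u D v G) (h' : Conv R w D' z G') :
    Tendsto (fun n => cc (u n) (w n)) atTop (𝓝 (cc v z)) :=
  (tendsto_coul (fun n => (h.mem n).l2Ball_sq) h.lim.l2Ball_sq (fun n => (h'.mem n).l2Ball_sq)
    h'.lim.l2Ball_sq h.tendsto_sq_sub_sq h'.tendsto_sq_sub_sq).const_mul _

theorem tendsto_pot (h : Conv R u D v G) {V : E3 → ℝ} (hV : Continuous V) :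
    Tendsto (fun n => ∫ x in ball (0 : E3) R, V x * u n x ^ 2) atTop
      (𝓝 (∫ x in ball (0 : E3) R, V x * v x ^ 2)) := by
  obtain ⟨C, hC⟩ := (isCompact_closedBall (0 : E3) R).exists_bound_of_continuousOn hV.continuousOn
  set C' := |C| + 1
  have hC' : 0 < C' := by positivity
  have iu := fun n => H10.integrableOn_pot (R := R) hV (h.mem n).integrable_sq
  have iv := H10.integrableOn_pot (R := R) hV h.lim.integrable_sq
  have hd : ∀ n, MemLp (fun x => u n x - v x) 2 volume := fun n =>
    (h.mem n).h1.memLp.sub h.lim.h1.memLp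
  have hlim := (((h.sq.sqrt).mul_const √(∫ x, v x ^ 2)).const_mul (2 * C')).add
    (h.sq.const_mul C')
  simp only [Real.sqrt_zero, zero_mul, mul_zero, add_zero] at hlim
  rw [tendsto_iff_dist_tendsto_zero]
  refine squeeze_zero (fun _ => dist_nonneg) (fun n => ?_) hlim
  rw [Real.dist_eq, ← integral_sub (iu n) iv]
  have i1 : Integrable fun x => |u n x - v x| * |v x| :=
    (hd n).abs.integrable_mul h.lim.h1.memLp.abs
  have i2 : Integrable fun x => (u n x - v x) ^ 2 := (hd n).integrable_sq
  calc |∫ x in ball (0 : E3) R, (V x * u n x ^ 2 - V x * v x ^ 2)|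
      ≤ ∫ x in ball (0 : E3) R, (2 * C' * (|u n x - v x| * |v x|) + C' * (u n x - v x) ^ 2) := by
        rw [← Real.norm_eq_abs]
        refine MeasureTheory.norm_integral_le_of_norm_le
          ((i1.const_mul _).add (i2.const_mul _)).integrableOn ?_
        filter_upwards [ae_restrict_mem measurableSet_ball] with x hx
        have h1 : |V x| ≤ C' := ((hC x (ball_subset_closedBall hx)).trans (le_abs_self C)).trans
          (by simp only [C']; linarith)
        have e : V x * u n x ^ 2 - V x * v x ^ 2 =
            V x * (2 * ((u n x - v x) * v x) + (u n x - v x) ^ 2) := by ring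
        rw [Real.norm_eq_abs, e, abs_mul]
        calc |V x| * |2 * ((u n x - v x) * v x) + (u n x - v x) ^ 2|
            ≤ C' * (2 * (|u n x - v x| * |v x|) + (u n x - v x) ^ 2) := by
              gcongr
              refine (abs_add_le _ _).trans_eq ?_
              rw [abs_mul, abs_mul, abs_two, abs_of_nonneg (sq_nonneg (u n x - v x))]
          _ = _ := by ring
    _ ≤ ∫ x, (2 * C' * (|u n x - v x| * |v x|) + C' * (u n x - v x) ^ 2) :=
        setIntegral_le_integral ((i1.const_mul _).add (i2.const_mul _))
          (Eventually.of_forall fun x => by positivity)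
    _ = 2 * C' * (∫ x, |u n x - v x| * |v x|) + C' * ∫ x, (u n x - v x) ^ 2 := by
        rw [integral_add (i1.const_mul _) (i2.const_mul _), MeasureTheory.integral_const_mul,
          MeasureTheory.integral_const_mul]
    _ ≤ _ := by
        gcongr
        have := (le_abs_self _).trans (integral_mul_sq_le (a := fun x => |u n x - v x|)
          (b := fun x => |v x|) (hd n).abs h.lim.h1.memLp.abs)
        simpa only [sq_abs] using this

/-- Weak lower semicontinuity of the norm, through an explicit minorant. -/
theorem exists_minorant (h : Conv R u D v G) {V : E3 → ℝ} (hV : Continuous V) :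
    ∃ c : ℕ → ℝ, (∀ n, c n ≤ nrm V R (u n) (D n)) ∧ Tendsto c atTop (𝓝 (nrm V R v G)) := by
  refine ⟨fun n => 2 * (∫ x, inner ℝ (D n x) (G x)) - (∫ x, ‖G x‖ ^ 2) +
    ∫ x in ball (0 : E3) R, V x * u n x ^ 2, fun n => ?_, ?_⟩
  · rw [nrm]
    refine add_le_add_left ?_ _
    have i1 := (h.mem n).integrable_grad_sq
    have i2 := h.lim.integrable_grad_sq
    have i3 := integrable_inner_of_memLp (h.mem n).h1.memLp_grad h.lim.h1.memLp_grad
    rw [← MeasureTheory.integral_const_mul, ← integral_sub (i3.const_mul _) i2]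
    refine integral_mono ((i3.const_mul _).sub i2) i1 fun x => ?_
    have := norm_sub_sq_real (D n x) (G x)
    have := sq_nonneg ‖D n x - G x‖
    dsimp only
    linarith
  · have := (((h.weak G h.lim.h1.memLp_grad).const_mul 2).sub_const (∫ x, ‖G x‖ ^ 2)).add
      (h.tendsto_pot hV)
    simp only [real_inner_self_eq_norm_sq] at this
    convert this using 2
    rw [nrm]
    ring

end Conv

section

section congr

variable {f : ℝ → ℝ} {V : E3 → ℝ} {R : ℝ} {p p' q q' : E3 → ℝ} {P P' : E3 → E3}

theorem nrm_congr (hp : p =ᵐ[volume] p') (hP : P =ᵐ[volume] P') :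
    nrm V R p P = nrm V R p' P' := by
  rw [nrm, nrm]
  congr 1
  · exact integral_congr_ae (hP.mono fun x hx => by simp only [hx])
  · exact integral_congr_ae (ae_restrict_of_ae (hp.mono fun x hx => by simp only [hx]))

theorem cc_congr (hp : p =ᵐ[volume] p') (hq : q =ᵐ[volume] q') : cc p q = cc p' q' := by
  rw [cc, cc, coul_congr (k := fun x => p x ^ 2) (k' := fun x => p' x ^ 2)
    (l := fun x => q x ^ 2) (l' := fun x => q' x ^ 2)
    (hp.mono fun x hx => by simp only [hx]) (hq.mono fun x hx => by simp only [hx])]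

theorem primInt_congr (hp : p =ᵐ[volume] p') : primInt f R p = primInt f R p' :=
  integral_congr_ae (ae_restrict_of_ae (hp.mono fun x hx => by simp only [hx]))

theorem mulInt_congr (hp : p =ᵐ[volume] p') : mulInt f R p = mulInt f R p' :=
  integral_congr_ae (ae_restrict_of_ae (hp.mono fun x hx => by simp only [hx]))

end congr

theorem H10.exists_conv {R : ℝ} {u : ℕ → E3 → ℝ} {D : ℕ → E3 → E3} (h : ∀ n, H10 R (u n) (D n))
    {M : ℝ} (hu : ∀ n, ∫ x, u n x ^ 2 ≤ M) (hD : ∀ n, ∫ x, ‖D n x‖ ^ 2 ≤ M) :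
    ∃ (v : E3 → ℝ) (G : E3 → E3) (ns : ℕ → ℕ), StrictMono ns ∧ Conv R (u ∘ ns) (D ∘ ns) v G := by
  obtain ⟨v, G, ns, hns, hv, hae, hsq, hw⟩ := H10.exists_limit h hu hD
  obtain ⟨S, hS, hb⟩ := exists_pow_six_le
  refine ⟨v, G, ns, hns, fun n => h _, hv, ⟨S * M ^ 3, fun n => ?_⟩, hae, hsq, hw⟩
  refine (hb R _ _ (h (ns n))).trans ?_
  have : 0 ≤ ∫ x, ‖D (ns n) x‖ ^ 2 := integral_nonneg fun x => sq_nonneg _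
  gcongr
  exact hD _

theorem exists_signChanging {R : ℝ} (hR : 0 < R) : ∃ u D, H10 R u D ∧
    ¬ (fun x => max (u x) 0) =ᵐ[volume] 0 ∧ ¬ (fun x => min (u x) 0) =ᵐ[volume] 0 := by
  let φ : ContDiffBump (0 : E3) := ⟨R / 4, R / 2, by positivity, by linarith⟩
  have hc : Continuous φ := φ.continuous
  have hl : ContDiff ℝ 1 fun x : E3 => x 0 := by fun_prop
  have hT : IsTest fun x : E3 => x 0 * φ x :=
    ⟨hl.mul φ.contDiff, φ.hasCompactSupport.mul_left⟩
  refine ⟨fun x => x 0 * φ x, gradient fun x : E3 => x 0 * φ x, ⟨hT.h1, Eventually.of_forall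
    fun x hx => ?_⟩, fun h => ?_, fun h => ?_⟩
  · have : φ x = 0 := by
      refine Function.notMem_support.1 ?_
      rw [φ.support_eq]
      exact fun h => hx (ball_subset_ball (show φ.rOut ≤ R by simp only [φ]; linarith) h)
    simp [this]
  · have h1 := (Continuous.ae_eq_iff_eq (μ := (volume : Measure E3)) (g := fun _ => (0 : ℝ))
      (by fun_prop) continuous_const).1 h
    have h2 := congrFun h1 (EuclideanSpace.single 0 (R / 4))
    have h3 : φ (EuclideanSpace.single 0 (R / 4)) = 1 := by
      refine φ.one_of_mem_closedBall ?_
      simp [φ, abs_of_pos hR]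
    simp [h3] at h2
    linarith
  · have h1 := (Continuous.ae_eq_iff_eq (μ := (volume : Measure E3)) (g := fun _ => (0 : ℝ))
      (by fun_prop) continuous_const).1 h
    have h2 := congrFun h1 (EuclideanSpace.single 0 (-(R / 4)))
    have h3 : φ (EuclideanSpace.single 0 (-(R / 4))) = 1 := by
      refine φ.one_of_mem_closedBall ?_
      simp [φ, abs_of_pos hR]
    simp [h3] at h2
    linarith

/-- A split pair of `H¹₀` functions up to null sets is the pair of parts of its sum. -/
theorem H10.parts_ae_eq {R : ℝ} {p q : E3 → ℝ} {P Q : E3 → E3} (hp : H10 R p P) (hq : H10 R q Q)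
    (hp0 : ∀ᵐ x, 0 ≤ p x) (hq0 : ∀ᵐ x, q x ≤ 0) (hpq : ∀ᵐ x, p x * q x = 0) :
    p =ᵐ[volume] (fun x => max (p x + q x) 0) ∧ q =ᵐ[volume] (fun x => min (p x + q x) 0) ∧
    P =ᵐ[volume] (fun x => if 0 < p x + q x then P x + Q x else 0) ∧
    Q =ᵐ[volume] (fun x => if p x + q x < 0 then P x + Q x else 0) := by
  have e1 : p =ᵐ[volume] (fun x => max (p x + q x) 0) := by
    filter_upwards [hp0, hq0, hpq] with x h1 h2 h3
    rcases mul_eq_zero.1 h3 with h | h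
    · rw [h, zero_add, max_eq_right h2]
    · rw [h, add_zero, max_eq_left h1]
  have e2 : q =ᵐ[volume] (fun x => min (p x + q x) 0) := by
    filter_upwards [hp0, hq0, hpq] with x h1 h2 h3
    rcases mul_eq_zero.1 h3 with h | h
    · rw [h, zero_add, min_eq_left h2]
    · rw [h, add_zero, min_eq_right h1]
  exact ⟨e1, e2, hp.h1.grad_ae_eq (hp.add hq).posPart.h1 e1,
    hq.h1.grad_ae_eq (hp.add hq).negPart.h1 e2⟩

/-- `u` minimizes the energy over the sign-changing Nehari set. -/
structure IsMinimizer (f : ℝ → ℝ) (V : E3 → ℝ) (R : ℝ) (u : E3 → ℝ) (D : E3 → E3) : Prop where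
  mem : H10 R u D
  nehari : Nehari f V R (fun x => max (u x) 0) (fun x => if 0 < u x then D x else 0)
    (fun x => min (u x) 0) (fun x => if u x < 0 then D x else 0)
  le : ∀ p P q Q, Nehari f V R p P q Q →
    splitEnergy f V R (fun x => max (u x) 0) (fun x => if 0 < u x then D x else 0)
      (fun x => min (u x) 0) (fun x => if u x < 0 then D x else 0) ≤ splitEnergy f V R p P q Q

variable {f : ℝ → ℝ} {V : E3 → ℝ} {α R : ℝ}

theorem Setup.exists_minimizing_limit (h : Setup f V α R) : ∃ p P q Q, ∃ m : ℝ, ∃ E : ℕ → ℝ,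
    ∃ (a : ℕ → E3 → ℝ) (A : ℕ → E3 → E3) (b : ℕ → E3 → ℝ) (B : ℕ → E3 → E3),
    (∀ p P q Q, Nehari f V R p P q Q → m ≤ splitEnergy f V R p P q Q) ∧
    Tendsto E atTop (𝓝 m) ∧ Conv R a A p P ∧ Conv R b B q Q ∧
    (∀ n, Nehari f V R (a n) (A n) (b n) (B n)) ∧
    ∀ n, E n = splitEnergy f V R (a n) (A n) (b n) (B n) := by
  set S : Set ℝ := {e | ∃ p P q Q, Nehari f V R p P q Q ∧ splitEnergy f V R p P q Q = e}
  have hne : S.Nonempty := by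
    obtain ⟨u, D, hu, h1, h2⟩ := exists_signChanging h.radius
    obtain ⟨s, t, -, -, hn⟩ := h.exists_nehari hu.split h1 h2
    exact ⟨_, _, _, _, _, hn, rfl⟩
  have hbdd : BddBelow S := by
    refine ⟨0, ?_⟩
    rintro _ ⟨p, P, q, Q, hn, rfl⟩
    have := h.energy_ge hn
    have := h.nrm_nonneg hn.split.left
    have := h.nrm_nonneg hn.split.right
    linarith
  obtain ⟨E, hanti, hE, hmem⟩ := exists_seq_tendsto_sInf hne hbdd
  choose a A b B hn he using hmem
  have hα := h.pos
  have h0 : ∀ n, nrm V R (a n) (A n) + nrm V R (b n) (B n) ≤ 4 * E 0 := fun n => by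
    have h1 := h.energy_ge (hn n)
    have h2 := hanti (Nat.zero_le n)
    rw [he n] at h1
    linarith
  set M := 4 * E 0 + 4 * E 0 / α
  have hE0 : 0 ≤ 4 * E 0 := le_trans (add_nonneg (h.nrm_nonneg (hn 0).split.left)
    (h.nrm_nonneg (hn 0).split.right)) (h0 0)
  have key : ∀ (p : E3 → ℝ) (P : E3 → E3), H10 R p P → nrm V R p P ≤ 4 * E 0 →
      ∫ x, p x ^ 2 ≤ M ∧ ∫ x, ‖P x‖ ^ 2 ≤ M := by
    intro p P hp hle
    have : 0 ≤ 4 * E 0 / α := by positivity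
    constructor
    · have h1 := (h.integral_sq_le_nrm hp).trans hle
      have h2 : ∫ x, p x ^ 2 ≤ 4 * E 0 / α := by rwa [le_div_iff₀ hα, mul_comm]
      simp only [M]; linarith
    · have h1 := (h.integral_grad_le_nrm hp).trans hle
      simp only [M]; linarith
  have ha := fun n => key _ _ (hn n).split.left
    (by linarith [h0 n, h.nrm_nonneg (hn n).split.right])
  have hb := fun n => key _ _ (hn n).split.right
    (by linarith [h0 n, h.nrm_nonneg (hn n).split.left])
  obtain ⟨p, P, ns, hns, hp⟩ := H10.exists_conv (fun n => (hn n).split.left) (fun n => (ha n).1)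
    fun n => (ha n).2
  obtain ⟨q, Q, ms, hms, hq⟩ := H10.exists_conv (u := b ∘ ns) (D := B ∘ ns)
    (fun n => (hn _).split.right) (fun n => (hb _).1) fun n => (hb _).2
  refine ⟨p, P, q, Q, sInf S, E ∘ ns ∘ ms, _, _, _, _, ?_,
    hE.comp (hns.tendsto_atTop.comp hms.tendsto_atTop), hp.comp hms.tendsto_atTop, hq,
    fun n => hn _, fun n => (he _).symm⟩
  intro p P q Q hn
  exact csInf_le hbdd ⟨_, _, _, _, hn, rfl⟩

theorem Setup.exists_minimizer (h : Setup f V α R) : ∃ u D, IsMinimizer f V R u D := by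
  obtain ⟨p, P, q, Q, m, E, a, A, b, B, hm, hE, hp, hq, hn, hEn⟩ := h.exists_minimizing_limit
  obtain ⟨c, hc, hcl⟩ := h.exists_le_nrm
  have hne : ∀ {p : ℕ → E3 → ℝ} {P : ℕ → E3 → E3} {v : E3 → ℝ} {G : E3 → E3}, Conv R p P v G →
      (∀ n, c ≤ mulInt f R (p n)) → ¬ v =ᵐ[volume] 0 := by
    intro p P v G hv hle h0
    have h1 : c ≤ mulInt f R v := ge_of_tendsto'
      (hv.tendsto_subSextic h.nonlin.subSextic_mul) hle
    rw [mulInt_congr h0] at h1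
    simp [mulInt] at h1
    linarith
  have hp0 : ¬ p =ᵐ[volume] 0 := hne hp fun n => by
    have h1 := (hn n).left_eq
    have h2 := cc_nonneg (a n) (a n)
    have h3 := cc_nonneg (a n) (b n)
    have := hcl _ _ (hn n).split.left (h.nrm_pos (hn n).split.left (hn n).left_ne) (by linarith)
    linarith
  have hq0 : ¬ q =ᵐ[volume] 0 := hne hq fun n => by
    have h1 := (hn n).right_eq
    have h2 := cc_nonneg (b n) (b n)
    have h3 := cc_nonneg (a n) (b n)
    have := hcl _ _ (hn n).split.right (h.nrm_pos (hn n).split.right (hn n).right_ne) (by linarith)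
    linarith
  have hpos : ∀ᵐ x, 0 ≤ p x := hp.ae.mono fun x hx => ge_of_tendsto' hx fun n => (hn n).split.nonneg x
  have hneg : ∀ᵐ x, q x ≤ 0 := hq.ae.mono fun x hx => le_of_tendsto' hx fun n => (hn n).split.nonpos x
  have hpq : ∀ᵐ x, p x * q x = 0 := by
    filter_upwards [hp.ae, hq.ae] with x h1 h2
    refine tendsto_nhds_unique ((h1.mul h2).congr fun n => ?_) tendsto_const_nhds
    rcases (hn n).split.disj x with h | h
    · rw [h.1, zero_mul]
    · rw [h.1, mul_zero]
  obtain ⟨e1, e2, e3, e4⟩ := hp.lim.parts_ae_eq hq.lim hpos hneg hpq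
  have hsp := (hp.lim.add hq.lim).split
  obtain ⟨s, t, hs, ht, hN⟩ := h.exists_nehari hsp (fun h => hp0 (e1.trans h))
    (fun h => hq0 (e2.trans h))
  have hle : splitEnergy f V R (fun x => s * p x) (fun x => s • P x) (fun x => t * q x)
      (fun x => t • Q x) ≤ m := by
    obtain ⟨c1, hc1, hc1'⟩ := (hp.const_mul s).exists_minorant h.cont
    obtain ⟨c2, hc2, hc2'⟩ := (hq.const_mul t).exists_minorant h.cont
    have hps := hp.const_mul s
    have hqt := hq.const_mul t
    have l1 := (hc1'.const_mul (1 / 2)).add (hc2'.const_mul (1 / 2))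
    have l2 := (((hps.tendsto_cc hps).add ((hps.tendsto_cc hqt).const_mul 2)).add
      (hqt.tendsto_cc hqt)).const_mul (1 / 4)
    have l3 := hps.tendsto_subSextic h.nonlin.subSextic_prim
    have l4 := hqt.tendsto_subSextic h.nonlin.subSextic_prim
    refine le_of_tendsto_of_tendsto' (((l1.add l2).sub l3).sub l4) hE fun n => ?_
    have g := h.energy_gap (hn n) hs.le ht.le
    have n1 := mul_nonneg (by positivity : 0 ≤ 1 / 4 * (1 - s ^ 2) ^ 2)
      (h.nrm_nonneg (hn n).split.left)
    have n2 := mul_nonneg (by positivity : 0 ≤ 1 / 4 * (1 - t ^ 2) ^ 2)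
      (h.nrm_nonneg (hn n).split.right)
    rw [hEn]
    refine le_trans ?_ (le_trans (le_add_of_le_of_nonneg (le_add_of_le_of_nonneg le_rfl n1) n2) g)
    have := hc1 n
    have := hc2 n
    simp only [splitEnergy, primInt]
    linarith
  have hcg : ∀ {r : ℝ} {g g' : E3 → ℝ}, g =ᵐ[volume] g' →
      (fun x => r * g x) =ᵐ[volume] fun x => r * g' x := fun h =>
    h.mono fun x hx => by simp only [hx]
  have hcG : ∀ {r : ℝ} {g g' : E3 → E3}, g =ᵐ[volume] g' →
      (fun x => r • g x) =ᵐ[volume] fun x => r • g' x := fun h =>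
    h.mono fun x hx => by simp only [hx]
  rw [splitEnergy, nrm_congr (hcg e1) (hcG e3), nrm_congr (hcg e2) (hcG e4),
    cc_congr (hcg e1) (hcg e1), cc_congr (hcg e1) (hcg e2), cc_congr (hcg e2) (hcg e2),
    primInt_congr (hcg e1), primInt_congr (hcg e2), ← splitEnergy] at hle
  set v : E3 → ℝ := fun x => p x + q x
  set w : E3 → ℝ := fun x => s * max (v x) 0 + t * min (v x) 0 with hw
  set W : E3 → E3 := fun x => s • (if 0 < v x then P x + Q x else 0) +
    t • (if v x < 0 then P x + Q x else 0) with hW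
  have w1 : ∀ x, max (w x) 0 = s * max (v x) 0 ∧ min (w x) 0 = t * min (v x) 0 ∧
      (0 < w x ↔ 0 < v x) ∧ (w x < 0 ↔ v x < 0) := by
    intro x
    rcases lt_trichotomy (v x) 0 with h | h | h
    · have : w x = t * v x := by simp [hw, h.le]
      have h' : t * v x < 0 := mul_neg_of_pos_of_neg ht h
      simp [this, h.le, h, h.not_gt, h'.le, h', h'.not_gt, -smul_eq_mul]
    · have : w x = 0 := by simp [hw, h]
      simp [this, h]
    · have : w x = s * v x := by simp [hw, h.le]
      have h' : 0 < s * v x := mul_pos hs h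
      simp [this, h.le, h, h.not_gt, h'.le, h', h'.not_gt]
  have f1 : (fun x => max (w x) 0) = fun x => s * max (v x) 0 := funext fun x => (w1 x).1
  have f2 : (fun x => min (w x) 0) = fun x => t * min (v x) 0 := funext fun x => (w1 x).2.1
  have f3 : (fun x => if 0 < w x then W x else 0) = fun x => s • (if 0 < v x then P x + Q x else 0) := by
    funext x
    simp only [(w1 x).2.2.1, hW]
    split_ifs with h1 h2
    · exact absurd h1 h2.not_gt
    · simp
    · simp
  have f4 : (fun x => if w x < 0 then W x else 0) = fun x => t • (if v x < 0 then P x + Q x else 0) := by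
    funext x
    simp only [(w1 x).2.2.2, hW]
    split_ifs with h1 h2
    · exact absurd h1 h2.not_gt
    · simp
    · simp
  refine ⟨w, W, (hsp.left.const_mul s).add (hsp.right.const_mul t), ?_, ?_⟩
  · rw [f1, f2, f3, f4]; exact hN
  · intro p' P' q' Q' hn'
    rw [f1, f2, f3, f4]
    exact hle.trans (hm _ _ _ _ hn')

end

section

/-- The energy functional in terms of a function and its weak gradient. -/
def en (f : ℝ → ℝ) (V : E3 → ℝ) (R : ℝ) (u : E3 → ℝ) (D : E3 → E3) : ℝ :=
  1 / 2 * nrm V R u D + 1 / 4 * cc u u - primInt f R u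

/-- The factor `s` on positive numbers and `t` elsewhere. -/
def swt (s t y : ℝ) : ℝ := if 0 < y then s else t

variable {f : ℝ → ℝ} {V : E3 → ℝ} {α R : ℝ} {u p q : E3 → ℝ} {D P Q : E3 → E3}

theorem en_congr {v : E3 → ℝ} {G : E3 → E3} (h : u =ᵐ[volume] v) (h' : D =ᵐ[volume] G) :
    en f V R u D = en f V R v G := by
  rw [en, en, nrm_congr h h', cc_congr h h, primInt_congr h]

theorem H10.swt (h : H10 R u D) (s t : ℝ) :
    H10 R (fun x => swt s t (u x) * u x) (fun x => swt s t (u x) • D x) := by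
  refine ((h.posPart.const_mul s).add (h.negPart.const_mul t)).congr_ae
    (Eventually.of_forall fun x => ?_) ?_
  · dsimp only [BallSolution.swt]
    split_ifs with h1
    · rw [max_eq_left h1.le, min_eq_right h1.le]; ring
    · rw [max_eq_right (not_lt.1 h1), min_eq_left (not_lt.1 h1)]; ring
  · filter_upwards [h.h1.grad_eq_zero] with x hx
    dsimp only [BallSolution.swt]
    rcases lt_trichotomy (u x) 0 with h1 | h1 | h1
    · simp [h1, h1.not_gt]
    · simp [h1, hx h1]
    · simp [h1, h1.not_gt]

theorem H10.abs (h : H10 R u D) : H10 R (fun x => |u x|) (fun x => BallSolution.swt 1 (-1) (u x) • D x) := by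
  refine (h.swt 1 (-1)).congr_ae (Eventually.of_forall fun x => ?_) (ae_eq_refl _)
  dsimp only [BallSolution.swt]
  split_ifs with h1
  · rw [abs_of_pos h1, one_mul]
  · rw [abs_of_nonpos (not_lt.1 h1), neg_one_mul]

theorem Split.energy_eq (h : Split R p P q Q) (hf : Nonlin f) (hV : Continuous V) :
    splitEnergy f V R p P q Q = en f V R (fun x => p x + q x) (fun x => P x + Q x) := by
  have e1 : ∀ x, ‖P x + Q x‖ ^ 2 = ‖P x‖ ^ 2 + ‖Q x‖ ^ 2 := fun x => by
    rcases h.disj x with h | h <;> simp [h]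
  have e2 : ∀ x, (p x + q x) ^ 2 = p x ^ 2 + q x ^ 2 := fun x => by
    rcases h.disj x with h | h <;> simp [h]
  have e3 : ∀ x, prim f (p x + q x) = prim f (p x) + prim f (q x) := fun x => by
    rcases h.disj x with h | h <;> simp [h, Nonlin.prim_zero]
  have hp := h.left.l2Ball_sq
  have hq := h.right.l2Ball_sq
  have h1 : L2Ball R fun x => p x ^ 2 + q x ^ 2 := by simpa only [e2] using (h.left.add h.right).l2Ball_sq
  simp only [en, nrm, cc, primInt, e1, e2, e3, mul_add, splitEnergy]
  rw [hp.coul_add_left hq h1, hp.coul_add_right hp hq, hq.coul_add_right hp hq, hq.coul_comm hp,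
    integral_add h.left.integrable_grad_sq h.right.integrable_grad_sq,
    integral_add (H10.integrableOn_pot hV h.left.integrable_sq)
      (H10.integrableOn_pot hV h.right.integrable_sq),
    integral_add (h.left.integrableOn_subSextic hf.subSextic_prim)
      (h.right.integrableOn_subSextic hf.subSextic_prim)]
  ring

theorem H10.splitEnergy_eq (h : H10 R u D) (hf : Nonlin f) (hV : Continuous V) {s t : ℝ}
    (hs : 0 ≤ s) (ht : 0 ≤ t) :
    splitEnergy f V R (fun x => s * max (u x) 0) (fun x => s • if 0 < u x then D x else 0)
      (fun x => t * min (u x) 0) (fun x => t • if u x < 0 then D x else 0) =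
    en f V R (fun x => BallSolution.swt s t (u x) * u x) (fun x => BallSolution.swt s t (u x) • D x) := by
  rw [(h.split.smul hs ht).energy_eq hf hV]
  refine en_congr (Eventually.of_forall fun x => ?_) ?_
  · dsimp only [BallSolution.swt]
    split_ifs with h1
    · rw [max_eq_left h1.le, min_eq_right h1.le]; ring
    · rw [max_eq_right (not_lt.1 h1), min_eq_left (not_lt.1 h1)]; ring
  · filter_upwards [h.h1.grad_eq_zero] with x hx
    dsimp only [BallSolution.swt]
    rcases lt_trichotomy (u x) 0 with h1 | h1 | h1
    · simp [h1, h1.not_gt]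
    · simp [h1, hx h1]
    · simp [h1, h1.not_gt]

theorem tendsto_integral_sq_sub {a : ℕ → E3 → ℝ} {a' b : E3 → ℝ}
    (hm : ∀ n, AEStronglyMeasurable (a n) volume) (hm' : AEStronglyMeasurable a' volume)
    (hb : MemLp b 2 volume)
    (hle : ∀ n, ∀ᵐ x, |a n x| ≤ b x) (hlim : ∀ᵐ x, Tendsto (fun n => a n x) atTop (𝓝 (a' x))) :
    Tendsto (fun n => ∫ x, (a n x - a' x) ^ 2) atTop (𝓝 0) := by
  have h0 : ∀ᵐ x, |a' x| ≤ b x := by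
    filter_upwards [ae_all_iff.2 hle, hlim] with x h1 h2
    exact le_of_tendsto' h2.abs h1
  rw [← integral_zero E3 ℝ]
  refine tendsto_integral_of_dominated_convergence (fun x => (2 * b x) ^ 2)
    (fun n => ((hm n).sub hm').pow 2) (hb.const_mul 2).integrable_sq (fun n => ?_) ?_
  · filter_upwards [hle n, h0] with x h1 h2
    rw [Real.norm_of_nonneg (sq_nonneg _), ← sq_abs]
    gcongr
    exact (abs_sub _ _).trans (by linarith)
  · filter_upwards [hlim] with x hx
    simpa using (hx.sub_const (a' x)).pow 2

theorem Setup.tendsto_en (h : Setup f V α R) {θ : ℕ → E3 → ℝ} {A : ℕ → E3 → E3} {g b : E3 → ℝ}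
    {G : E3 → E3} (hθ : ∀ n, H10 R (θ n) (A n)) (hu : H10 R u D) (hg : H10 R g G)
    (hb : MemLp b 2 volume) (hle : ∀ n, ∀ᵐ x, |θ n x| ≤ g x) (hle' : ∀ n, ∀ᵐ x, ‖A n x‖ ≤ b x)
    (hlim : ∀ᵐ x, Tendsto (fun n => θ n x) atTop (𝓝 (u x)))
    (hlim' : ∀ᵐ x, Tendsto (fun n => A n x) atTop (𝓝 (D x))) :
    Tendsto (fun n => en f V R (θ n) (A n)) atTop (𝓝 (en f V R u D)) := by
  have h1 : Tendsto (fun n => ∫ x, ‖A n x‖ ^ 2) atTop (𝓝 (∫ x, ‖D x‖ ^ 2)) := by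
    refine tendsto_integral_of_dominated_convergence (fun x => b x ^ 2)
      (fun n => (hθ n).h1.memLp_grad.1.norm.pow 2) hb.integrable_sq (fun n => ?_) ?_
    · filter_upwards [hle' n] with x hx
      rw [Real.norm_of_nonneg (sq_nonneg _)]
      gcongr
    · filter_upwards [hlim'] with x hx using hx.norm.pow 2
  have h2 : Tendsto (fun n => ∫ x in ball (0 : E3) R, V x * θ n x ^ 2) atTop
      (𝓝 (∫ x in ball (0 : E3) R, V x * u x ^ 2)) := by
    refine tendsto_integral_of_dominated_convergence (fun x => V x * g x ^ 2)
      (fun n => (h.cont.aestronglyMeasurable.mul ((hθ n).aestronglyMeasurable.pow 2)).restrict)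
      (H10.integrableOn_pot h.cont hg.integrable_sq) (fun n => ?_) ?_
    · filter_upwards [ae_restrict_of_ae (hle n)] with x hx
      have hV := h.pos.trans_le (h.le x)
      rw [Real.norm_of_nonneg (mul_nonneg hV.le (sq_nonneg _)), ← sq_abs (θ n x)]
      gcongr
    · filter_upwards [ae_restrict_of_ae hlim] with x hx using (hx.pow 2).const_mul _
  have h3 : Tendsto (fun n => cc (θ n) (θ n)) atTop (𝓝 (cc u u)) := by
    have : Tendsto (fun n => ∫ x, (θ n x ^ 2 - u x ^ 2) ^ 2) atTop (𝓝 0) := by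
      refine tendsto_integral_sq_sub (b := fun x => g x ^ 2)
        (fun n => (hθ n).aestronglyMeasurable.pow 2) (hu.aestronglyMeasurable.pow 2) hg.l2Ball_sq.1
        (fun n => ?_) ?_
      · filter_upwards [hle n] with x hx
        rw [abs_pow]
        gcongr
      · filter_upwards [hlim] with x hx using hx.pow 2
    exact (tendsto_coul (fun n => (hθ n).l2Ball_sq) hu.l2Ball_sq (fun n => (hθ n).l2Ball_sq)
      hu.l2Ball_sq this this).const_mul _
  have h4 : Tendsto (fun n => primInt f R (θ n)) atTop (𝓝 (primInt f R u)) := by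
    obtain ⟨C, -, hC⟩ := h.nonlin.subSextic_prim.2 1 one_pos
    have hi : IntegrableOn (fun x => C + 1 * g x ^ 6) (ball 0 R) :=
      (integrableOn_const measure_ball_lt_top.ne).add
        (hg.integrable_pow_six.integrableOn.const_mul 1)
    refine tendsto_integral_of_dominated_convergence (fun x => C + 1 * g x ^ 6)
      (fun n => h.nonlin.continuous_prim.comp_aestronglyMeasurable
        (hθ n).aestronglyMeasurable.restrict) hi (fun n => ?_) ?_
    · filter_upwards [ae_restrict_of_ae (hle n)] with x hx
      refine (hC _).trans ?_
      rw [← Even.pow_abs (by decide : Even 6) (θ n x)]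
      gcongr
    · filter_upwards [ae_restrict_of_ae hlim] with x hx
      exact (h.nonlin.continuous_prim.tendsto _).comp hx
  exact (((h1.add h2).const_mul _).add (h3.const_mul _)).sub h4

end

section

variable {f : ℝ → ℝ} {V : E3 → ℝ} {α R : ℝ} {u ψ : E3 → ℝ} {D Ψ : E3 → E3}

theorem abs_swt_le {s t M : ℝ} (hs : s ∈ Set.Icc 0 M) (ht : t ∈ Set.Icc 0 M) (y : ℝ) :
    |swt s t y| ≤ M := by
  rw [swt]
  split_ifs
  · rw [abs_of_nonneg hs.1]; exact hs.2
  · rw [abs_of_nonneg ht.1]; exact ht.2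

theorem tendsto_swt {s t y : ℕ → ℝ} {s' t' y' : ℝ} (hs : Tendsto s atTop (𝓝 s'))
    (ht : Tendsto t atTop (𝓝 t')) (hy : Tendsto y atTop (𝓝 y')) (h0 : y' ≠ 0) :
    Tendsto (fun n => swt (s n) (t n) (y n)) atTop (𝓝 (swt s' t' y')) := by
  rcases h0.lt_or_gt with h | h
  · rw [swt, if_neg h.not_gt]
    refine ht.congr' ?_
    filter_upwards [hy.eventually (eventually_lt_nhds h)] with n hn
    rw [swt, if_neg hn.not_gt]
  · rw [swt, if_pos h]
    refine hs.congr' ?_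
    filter_upwards [hy.eventually (eventually_gt_nhds h)] with n hn
    rw [swt, if_pos hn]

theorem tendsto_swt_smul {F : Type*} [NormedAddCommGroup F] [NormedSpace ℝ F] {s t y : ℕ → ℝ}
    {s' t' y' M : ℝ} {z : ℕ → F} {z' : F} (hs : Tendsto s atTop (𝓝 s'))
    (ht : Tendsto t atTop (𝓝 t')) (hy : Tendsto y atTop (𝓝 y')) (hz : Tendsto z atTop (𝓝 z'))
    (hsM : ∀ n, s n ∈ Set.Icc 0 M) (htM : ∀ n, t n ∈ Set.Icc 0 M) (h0 : y' = 0 → z' = 0) :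
    Tendsto (fun n => swt (s n) (t n) (y n) • z n) atTop (𝓝 (swt s' t' y' • z')) := by
  by_cases h : y' = 0
  · rw [h0 h] at hz ⊢
    rw [smul_zero]
    refine squeeze_zero_norm (a := fun n => M * ‖z n‖) (fun n => ?_) (by simpa using hz.norm.const_mul M)
    rw [norm_smul]
    gcongr
    exact abs_swt_le (hsM n) (htM n) _
  · exact (tendsto_swt hs ht hy h).smul hz

theorem Setup.tendsto_en_swt (h : Setup f V α R) (hu : H10 R u D) (hψ : H10 R ψ Ψ) {s t ε : ℕ → ℝ}
    {s' t' M : ℝ} (hs : Tendsto s atTop (𝓝 s')) (ht : Tendsto t atTop (𝓝 t'))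
    (hsM : ∀ n, s n ∈ Set.Icc 0 M) (htM : ∀ n, t n ∈ Set.Icc 0 M)
    (hε : Tendsto ε atTop (𝓝 0)) (hε1 : ∀ n, ε n ∈ Set.Icc 0 1) :
    Tendsto (fun n => en f V R (fun x => swt (s n) (t n) (u x + ε n * ψ x) * (u x + ε n * ψ x))
      fun x => swt (s n) (t n) (u x + ε n * ψ x) • (D x + ε n • Ψ x)) atTop
      (𝓝 (en f V R (fun x => swt s' t' (u x) * u x) fun x => swt s' t' (u x) • D x)) := by
  have hM : 0 ≤ M := (hsM 0).1.trans (hsM 0).2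
  have hy : ∀ x, Tendsto (fun n => u x + ε n * ψ x) atTop (𝓝 (u x)) := fun x => by
    simpa using (hε.mul_const (ψ x)).const_add (u x)
  have hz : ∀ x, Tendsto (fun n => D x + ε n • Ψ x) atTop (𝓝 (D x)) := fun x => by
    simpa using (hε.smul_const (Ψ x)).const_add (D x)
  refine h.tendsto_en (fun n => (hu.add (hψ.const_mul (ε n))).swt (s n) (t n)) (hu.swt s' t')
    ((hu.abs.add hψ.abs).const_mul M) (b := fun x => M * (‖D x‖ + ‖Ψ x‖))
    ((hu.h1.memLp_grad.norm.add hψ.h1.memLp_grad.norm).const_mul M)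
    (fun n => Eventually.of_forall fun x => ?_) (fun n => Eventually.of_forall fun x => ?_)
    (Eventually.of_forall fun x => ?_) ?_
  · rw [abs_mul]
    gcongr
    · exact abs_swt_le (hsM n) (htM n) _
    · refine (abs_add_le _ _).trans ?_
      rw [abs_mul, abs_of_nonneg (hε1 n).1]
      gcongr
      exact mul_le_of_le_one_left (abs_nonneg _) (hε1 n).2
  · rw [norm_smul]
    gcongr
    · exact abs_swt_le (hsM n) (htM n) _
    · refine (norm_add_le _ _).trans ?_
      rw [norm_smul, Real.norm_of_nonneg (hε1 n).1]
      gcongr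
      exact mul_le_of_le_one_left (norm_nonneg _) (hε1 n).2
  · exact tendsto_swt_smul hs ht (hy x) (hy x) hsM htM id
  · filter_upwards [hu.h1.grad_eq_zero] with x hx
    exact tendsto_swt_smul hs ht (hy x) (hz x) hsM htM hx

theorem H10.eventually_parts_ne (hu : H10 R u D) (hψ : H10 R ψ Ψ)
    (h1 : ¬ (fun x => max (u x) 0) =ᵐ[volume] 0) {ε : ℕ → ℝ} (hε : Tendsto ε atTop (𝓝 0))
    (hε1 : ∀ n, ε n ∈ Set.Icc 0 1) :
    ∀ᶠ n in atTop, ¬ (fun x => max (u x + ε n * ψ x) 0) =ᵐ[volume] 0 := by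
  have h2 := Setup.integral_sq_pos hu.posPart h1
  have h3 : Tendsto (fun n => ∫ x, max (u x + ε n * ψ x) 0 ^ 2) atTop
      (𝓝 (∫ x, max (u x) 0 ^ 2)) := by
    refine tendsto_integral_of_dominated_convergence (fun x => (|u x| + |ψ x|) ^ 2)
      (fun n => (hu.add (hψ.const_mul (ε n))).posPart.aestronglyMeasurable.pow 2)
      (hu.abs.add hψ.abs).integrable_sq (fun n => Eventually.of_forall fun x => ?_)
      (Eventually.of_forall fun x => ?_)
    · rw [Real.norm_of_nonneg (sq_nonneg _)]
      have : u x + ε n * ψ x ≤ |u x| + |ψ x| := by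
        refine add_le_add (le_abs_self _) ((le_abs_self _).trans ?_)
        rw [abs_mul, abs_of_nonneg (hε1 n).1]
        exact mul_le_of_le_one_left (abs_nonneg _) (hε1 n).2
      have h0 : 0 ≤ max (u x + ε n * ψ x) 0 := le_max_right _ _
      gcongr
      exact max_le this (by positivity)
    · have : Tendsto (fun n => u x + ε n * ψ x) atTop (𝓝 (u x)) := by
        simpa using (hε.mul_const (ψ x)).const_add (u x)
      exact (this.max tendsto_const_nhds).pow 2
  filter_upwards [h3.eventually (eventually_gt_nhds h2)] with n hn h0
  rw [integral_congr_ae (g := fun _ => (0 : ℝ)) (h0.mono fun x hx => by simp [hx])] at hn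
  simp at hn

theorem Setup.continuous_splitEnergy (h : Setup f V α R) (hu : H10 R u D) (hψ : H10 R ψ Ψ) :
    Continuous fun a : ℝ × ℝ => splitEnergy f V R (fun x => a.1 * u x) (fun x => a.1 • D x)
      (fun x => a.2 * ψ x) (fun x => a.2 • Ψ x) := by
  simp only [splitEnergy_smul]
  have h1 := (h.continuous_primInt hu).comp (continuous_fst (X := ℝ) (Y := ℝ))
  have h2 := (h.continuous_primInt hψ).comp (continuous_snd (X := ℝ) (Y := ℝ))
  exact (Continuous.sub (by fun_prop) h1).sub h2

theorem IsMinimizer.exists_perturbation (h : Setup f V α R) (hu : IsMinimizer f V R u D)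
    (hψ : H10 R ψ Ψ) {ε : ℕ → ℝ} (hε : Tendsto ε atTop (𝓝 0)) (hε1 : ∀ n, ε n ∈ Set.Icc 0 1) :
    ∃ (ns : ℕ → ℕ) (s t : ℕ → ℝ), StrictMono ns ∧ Tendsto s atTop (𝓝 1) ∧ Tendsto t atTop (𝓝 1) ∧
      (∀ n, s n ∈ Set.Icc (1 / 2) (3 / 2)) ∧ (∀ n, t n ∈ Set.Icc (1 / 2) (3 / 2)) ∧
      ∀ᶠ n in atTop, en f V R (fun x => swt (s n) (t n) (u x) * u x)
          (fun x => swt (s n) (t n) (u x) • D x) ≤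
        en f V R (fun x => swt (s n) (t n) (u x + ε (ns n) * ψ x) * (u x + ε (ns n) * ψ x))
          (fun x => swt (s n) (t n) (u x + ε (ns n) * ψ x) • (D x + ε (ns n) • Ψ x)) := by
  set K : Set (ℝ × ℝ) := Set.Icc (1 / 2) (3 / 2) ×ˢ Set.Icc (1 / 2) (3 / 2)
  have hK : IsCompact K := isCompact_Icc.prod isCompact_Icc
  have h11 : ((1 : ℝ), (1 : ℝ)) ∈ K := by constructor <;> norm_num
  have hw : ∀ n, H10 R (fun x => u x + ε n * ψ x) (fun x => D x + ε n • Ψ x) := fun n =>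
    hu.mem.add (hψ.const_mul (ε n))
  have hmax := fun n => hK.exists_isMaxOn ⟨_, h11⟩
    (h.continuous_splitEnergy (hw n).posPart (hw n).negPart).continuousOn
  choose a haK hamax using hmax
  obtain ⟨a', ha', ns, hns, hlim⟩ := hK.tendsto_subseq haK
  have hs : Tendsto (fun n => (a (ns n)).1) atTop (𝓝 a'.1) := (continuous_fst.tendsto _).comp hlim
  have ht : Tendsto (fun n => (a (ns n)).2) atTop (𝓝 a'.2) := (continuous_snd.tendsto _).comp hlim
  have hsub : ∀ {r : ℝ}, r ∈ Set.Icc (1 / 2 : ℝ) (3 / 2) → r ∈ Set.Icc (0 : ℝ) (3 / 2) := fun h =>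
    ⟨by linarith [h.1], h.2⟩
  have hε' := hε.comp hns.tendsto_atTop
  have l1 := h.tendsto_en_swt hu.mem hψ hs ht (fun n => hsub (haK (ns n)).1)
    (fun n => hsub (haK (ns n)).2) hε' fun n => hε1 _
  have l2 := h.tendsto_en_swt hu.mem hψ tendsto_const_nhds tendsto_const_nhds
    (fun n => hsub h11.1) (fun n => hsub h11.2) hε' fun n => hε1 _
  have hle := le_of_tendsto_of_tendsto' l2 l1 fun n => by
    have := isMaxOn_iff.1 (hamax (ns n)) _ h11
    dsimp only at this
    rwa [(hw (ns n)).splitEnergy_eq h.nonlin h.cont zero_le_one zero_le_one,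
      (hw (ns n)).splitEnergy_eq h.nonlin h.cont (hsub (haK (ns n)).1).1
      (hsub (haK (ns n)).2).1] at this
  have gap := fun {s t : ℝ} (hs : 0 ≤ s) (ht : 0 ≤ t) => h.energy_gap hu.nehari hs ht
  have e11 := hu.mem.splitEnergy_eq h.nonlin h.cont (s := 1) (t := 1) zero_le_one zero_le_one
  simp only [one_mul, one_smul] at e11
  have n1 := h.nrm_pos hu.nehari.split.left hu.nehari.left_ne
  have n2 := h.nrm_pos hu.nehari.split.right hu.nehari.right_ne
  have g := gap (hsub ha'.1).1 (hsub ha'.2).1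
  rw [hu.mem.splitEnergy_eq h.nonlin h.cont (hsub ha'.1).1 (hsub ha'.2).1, e11] at g
  have m1 := mul_nonneg (by positivity : 0 ≤ 1 / 4 * (1 - a'.1 ^ 2) ^ 2) n1.le
  have m2 := mul_nonneg (by positivity : 0 ≤ 1 / 4 * (1 - a'.2 ^ 2) ^ 2) n2.le
  have one : ∀ {r N : ℝ}, 0 ≤ r → 0 < N → 1 / 4 * (1 - r ^ 2) ^ 2 * N = 0 → r = 1 := by
    intro r N hr hN h0
    have : (1 - r ^ 2) ^ 2 = 0 := by
      rcases mul_eq_zero.1 h0 with h | h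
      · linarith
      · exact absurd h hN.ne'
    have : 1 - r ^ 2 = 0 := by simpa using this
    nlinarith
  rw [one (hsub ha'.1).1 n1 (by linarith)] at hs
  rw [one (hsub ha'.2).1 n2 (by linarith)] at ht
  refine ⟨ns, _, _, hns, hs, ht, fun n => (haK (ns n)).1, fun n => (haK (ns n)).2, ?_⟩
  have hneg : ¬ (fun x => max (-u x) 0) =ᵐ[volume] 0 := fun h0 => hu.nehari.right_ne
    (h0.mono fun x hx => by
      have := max_neg_neg (u x) 0
      simp only [neg_zero, Pi.zero_apply] at this hx ⊢
      linarith)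
  filter_upwards [hs.eventually (Ioo_mem_nhds (by norm_num : (1 / 2 : ℝ) < 1) (by norm_num : (1 : ℝ) < 3 / 2)),
    ht.eventually (Ioo_mem_nhds (by norm_num : (1 / 2 : ℝ) < 1) (by norm_num : (1 : ℝ) < 3 / 2)),
    hu.mem.eventually_parts_ne hψ hu.nehari.left_ne hε' (fun n => hε1 _),
    hu.mem.neg.eventually_parts_ne hψ.neg hneg hε' (fun n => hε1 _)] with n c1 c2 c3 c4
  have c4' : ¬ (fun x => min (u x + ε (ns n) * ψ x) 0) =ᵐ[volume] 0 := fun h0 => c4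
    (h0.mono fun x hx => by
      have := max_neg_neg (u x + ε (ns n) * ψ x) 0
      have e : -u x + ε (ns n) * -ψ x = -(u x + ε (ns n) * ψ x) := by ring
      simp only [neg_zero, Pi.zero_apply, Function.comp, e] at this hx ⊢
      linarith)
  have hm := hamax (ns n)
  have hN := h.nehari_of_isLocalMax (s := (a (ns n)).1) (t := (a (ns n)).2) (hw (ns n)).split c3 c4' (by linarith [c1.1]) (by linarith [c2.1])
    (by
      filter_upwards [Ioo_mem_nhds c1.1 c1.2] with r hr
      exact hm (a := (r, (a (ns n)).2)) ⟨⟨hr.1.le, hr.2.le⟩, (haK (ns n)).2⟩)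
    (by
      filter_upwards [Ioo_mem_nhds c2.1 c2.2] with r hr
      exact hm (a := ((a (ns n)).1, r)) ⟨(haK (ns n)).1, ⟨hr.1.le, hr.2.le⟩⟩)
  have k1 := hu.le _ _ _ _ hN
  rw [(hw (ns n)).splitEnergy_eq h.nonlin h.cont (by linarith [c1.1]) (by linarith [c2.1])] at k1
  refine le_trans ?_ k1
  have g := gap (hsub (haK (ns n)).1).1 (hsub (haK (ns n)).2).1
  rw [hu.mem.splitEnergy_eq h.nonlin h.cont (hsub (haK (ns n)).1).1 (hsub (haK (ns n)).2).1] at g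
  have m1 := mul_nonneg (by positivity : 0 ≤ 1 / 4 * (1 - (a (ns n)).1 ^ 2) ^ 2) n1.le
  have m2 := mul_nonneg (by positivity : 0 ≤ 1 / 4 * (1 - (a (ns n)).2 ^ 2) ^ 2) n2.le
  linarith

end

section

theorem abs_swt_mul_sub_le {s t M : ℝ} (hs : s ∈ Set.Icc 0 M) (ht : t ∈ Set.Icc 0 M) (a b : ℝ) :
    |swt s t a * a - swt s t b * b| ≤ M * |a - b| := by
  obtain ⟨hs0, hs1⟩ := hs
  obtain ⟨ht0, ht1⟩ := ht
  have key : ∀ {r : ℝ} (c : ℝ), 0 ≤ r → r ≤ M → |r * c| ≤ M * |c| := fun c h0 h1 => by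
    rw [abs_mul, abs_of_nonneg h0]; gcongr
  simp only [swt]
  split_ifs with h1 h2 h2
  · rw [← mul_sub]; exact key _ hs0 hs1
  · rw [abs_of_nonneg (by nlinarith), abs_of_nonneg (by linarith)]
    nlinarith
  · rw [abs_of_nonpos (by nlinarith), abs_of_nonpos (by linarith)]
    nlinarith
  · rw [← mul_sub]; exact key _ ht0 ht1

/-- The difference quotient of `y ↦ swt s t y * y` at `a` in the direction `b`. -/
def dq (s t ε a b : ℝ) : ℝ := (swt s t (a + ε * b) * (a + ε * b) - swt s t a * a) / ε

theorem abs_dq_le {s t M ε : ℝ} (hs : s ∈ Set.Icc 0 M) (ht : t ∈ Set.Icc 0 M) (hε : 0 < ε)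
    (a b : ℝ) : |dq s t ε a b| ≤ M * |b| := by
  rw [dq, abs_div, abs_of_pos hε, div_le_iff₀ hε]
  refine (abs_swt_mul_sub_le hs ht _ _).trans ?_
  rw [add_sub_cancel_left, abs_mul, abs_of_pos hε]
  exact le_of_eq (by ring)

theorem tendsto_dq {s t ε : ℕ → ℝ} {r : ℝ} (hs : Tendsto s atTop (𝓝 r)) (ht : Tendsto t atTop (𝓝 r))
    (hε : Tendsto ε atTop (𝓝 0)) (hε0 : ∀ n, 0 < ε n) (a b : ℝ) :
    Tendsto (fun n => dq (s n) (t n) (ε n) a b) atTop (𝓝 (r * b)) := by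
  have hy : Tendsto (fun n => a + ε n * b) atTop (𝓝 a) := by
    simpa using (hε.mul_const b).const_add a
  rcases lt_trichotomy a 0 with h | h | h
  · refine (ht.mul_const b).congr' ?_
    filter_upwards [hy.eventually (eventually_lt_nhds h)] with n hn
    rw [dq, swt, swt, if_neg h.not_gt, if_neg hn.not_gt]
    field_simp [(hε0 n).ne']
    ring
  · have : ∀ n, dq (s n) (t n) (ε n) a b = swt (s n) (t n) b * b := fun n => by
      have e : swt (s n) (t n) (ε n * b) = swt (s n) (t n) b := by
        simp only [swt, mul_pos_iff_of_pos_left (hε0 n)]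
      rw [dq, h, zero_add, e, mul_zero, sub_zero]
      field_simp [(hε0 n).ne']
    simp only [this]
    refine Tendsto.mul_const b ?_
    unfold swt
    split_ifs <;> assumption
  · refine (hs.mul_const b).congr' ?_
    filter_upwards [hy.eventually (eventually_gt_nhds h)] with n hn
    rw [dq, swt, swt, if_pos h, if_pos hn]
    field_simp [(hε0 n).ne']
    ring

variable {f : ℝ → ℝ} {V : E3 → ℝ} {α R : ℝ} {u ψ : E3 → ℝ} {D Ψ : E3 → E3}

/-- The derivative of the energy at `u` in the direction `ψ`. -/
def pairing (f : ℝ → ℝ) (V : E3 → ℝ) (R : ℝ) (u : E3 → ℝ) (D : E3 → E3) (ψ : E3 → ℝ)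
    (Ψ : E3 → E3) : ℝ :=
  (∫ x, inner ℝ (D x) (Ψ x)) + (∫ x in ball (0 : E3) R, V x * (u x * ψ x)) +
    1 / (4 * Real.pi) * coul (fun x => u x ^ 2) (fun x => u x * ψ x) -
    ∫ x in ball (0 : E3) R, f (u x) * ψ x

section quotients

variable {s t ε : ℕ → ℝ} {M : ℝ}

theorem abs_swt_add_le (hs : ∀ n, s n ∈ Set.Icc 0 M) (ht : ∀ n, t n ∈ Set.Icc 0 M)
    (hε1 : ∀ n, ε n ∈ Set.Ioc 0 1) (n : ℕ) (a b : ℝ) :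
    |swt (s n) (t n) (a + ε n * b) * (a + ε n * b)| ≤ M * (|a| + |b|) := by
  have hM : 0 ≤ M := (hs 0).1.trans (hs 0).2
  rw [abs_mul]
  gcongr
  · exact abs_swt_le (hs n) (ht n) _
  · refine (abs_add_le _ _).trans ?_
    rw [abs_mul, abs_of_pos (hε1 n).1]
    gcongr
    exact mul_le_of_le_one_left (abs_nonneg _) (hε1 n).2

theorem abs_swt_self_le (hs : ∀ n, s n ∈ Set.Icc 0 M) (ht : ∀ n, t n ∈ Set.Icc 0 M)
    (n : ℕ) (a b : ℝ) : |swt (s n) (t n) a * a| ≤ M * (|a| + |b|) := by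
  have hM : 0 ≤ M := (hs 0).1.trans (hs 0).2
  rw [abs_mul]
  gcongr
  · exact abs_swt_le (hs n) (ht n) _
  · linarith [abs_nonneg b]

theorem tendsto_swt_add (hs : ∀ n, s n ∈ Set.Icc 0 M) (ht : ∀ n, t n ∈ Set.Icc 0 M)
    (hs1 : Tendsto s atTop (𝓝 1)) (ht1 : Tendsto t atTop (𝓝 1)) (hε : Tendsto ε atTop (𝓝 0))
    (a b : ℝ) : Tendsto (fun n => swt (s n) (t n) (a + ε n * b) * (a + ε n * b)) atTop (𝓝 a) := by
  have hy : Tendsto (fun n => a + ε n * b) atTop (𝓝 a) := by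
    simpa using (hε.mul_const b).const_add a
  have := tendsto_swt_smul hs1 ht1 hy hy hs ht id
  have e : swt 1 1 a • a = a := by simp [swt]
  rw [e] at this
  exact this

theorem H10.aestronglyMeasurable_dq (hu : H10 R u D) (hψ : H10 R ψ Ψ) (s t ε : ℝ) :
    AEStronglyMeasurable (fun x => dq s t ε (u x) (ψ x)) volume := by
  have := ((hu.add (hψ.const_mul ε)).swt s t).aestronglyMeasurable.sub (hu.swt s t).aestronglyMeasurable
  exact (this.mul_const (1 / ε)).congr (Eventually.of_forall fun x => by
    simp only [dq, Pi.sub_apply]; ring)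

theorem swt_sq_sub_sq (ε s t : ℝ) (h : ε ≠ 0) (a b : ℝ) :
    (swt s t (a + ε * b) * (a + ε * b)) ^ 2 - (swt s t a * a) ^ 2 =
    ε * ((swt s t (a + ε * b) * (a + ε * b) + swt s t a * a) * dq s t ε a b) := by
  rw [dq]
  field_simp
  ring

variable (h : Setup f V α R) (hu : H10 R u D) (hψ : H10 R ψ Ψ)
  (hs : ∀ n, s n ∈ Set.Icc 0 M) (ht : ∀ n, t n ∈ Set.Icc 0 M)
  (hs1 : Tendsto s atTop (𝓝 1)) (ht1 : Tendsto t atTop (𝓝 1)) (hε : Tendsto ε atTop (𝓝 0))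
  (hε1 : ∀ n, ε n ∈ Set.Ioc 0 1)

include hs ht hs1 ht1 hε hε1

theorem tendsto_swt_add_mul_dq (a b : ℝ) : Tendsto (fun n => (swt (s n) (t n) (a + ε n * b) *
    (a + ε n * b) + swt (s n) (t n) a * a) * dq (s n) (t n) (ε n) a b) atTop (𝓝 (2 * (a * b))) := by
  have h1 := tendsto_swt_add hs ht hs1 ht1 hε a b
  have h2 := tendsto_swt_add hs ht hs1 ht1 hε a 0
  simp only [mul_zero, add_zero] at h2
  have h3 := tendsto_dq hs1 ht1 hε (fun n => (hε1 n).1) a b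
  convert (h1.add h2).mul h3 using 2
  ring

omit hs1 ht1 hε in
theorem abs_swt_add_mul_dq_le (n : ℕ) (a b : ℝ) : |(swt (s n) (t n) (a + ε n * b) *
    (a + ε n * b) + swt (s n) (t n) a * a) * dq (s n) (t n) (ε n) a b| ≤
    2 * M ^ 2 * ((|a| + |b|) * |b|) := by
  have hM : 0 ≤ M := (hs 0).1.trans (hs 0).2
  rw [abs_mul]
  calc _ ≤ (M * (|a| + |b|) + M * (|a| + |b|)) * (M * |b|) := by
        gcongr
        · exact (abs_add_le _ _).trans (add_le_add (abs_swt_add_le hs ht hε1 n a b)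
            (abs_swt_self_le hs ht n a b))
        · exact abs_dq_le (hs n) (ht n) (hε1 n).1 a b
    _ = _ := by ring

include hu hψ

theorem tendsto_pot_quotient (hV : Continuous V) :
    Tendsto (fun n => ((∫ x in ball (0 : E3) R, V x * (swt (s n) (t n) (u x + ε n * ψ x) *
      (u x + ε n * ψ x)) ^ 2) - ∫ x in ball (0 : E3) R, V x * (swt (s n) (t n) (u x) * u x) ^ 2) / ε n)
      atTop (𝓝 (2 * ∫ x in ball (0 : E3) R, V x * (u x * ψ x))) := by
  have hi := ((hu.abs.add hψ.abs).integrable_mul hψ.abs)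
  have : Tendsto (fun n => ∫ x in ball (0 : E3) R, V x * ((swt (s n) (t n) (u x + ε n * ψ x) *
      (u x + ε n * ψ x) + swt (s n) (t n) (u x) * u x) * dq (s n) (t n) (ε n) (u x) (ψ x))) atTop
      (𝓝 (∫ x in ball (0 : E3) R, V x * (2 * (u x * ψ x)))) := by
    refine tendsto_integral_of_dominated_convergence (fun x => |V x * (2 * M ^ 2 *
      ((|u x| + |ψ x|) * |ψ x|))|) (fun n => ?_)
      (H10.integrableOn_pot hV (hi.const_mul _)).abs (fun n => ?_) ?_
    · have h1 := ((hu.add (hψ.const_mul (ε n))).swt (s n) (t n)).add (hu.swt (s n) (t n))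
      exact (hV.aestronglyMeasurable.mul (h1.aestronglyMeasurable.mul
        (hu.aestronglyMeasurable_dq hψ _ _ _))).restrict
    · refine Eventually.of_forall fun x => ?_
      rw [Real.norm_eq_abs, abs_mul, abs_mul (V x) (2 * M ^ 2 * _)]
      exact mul_le_mul_of_nonneg_left
        ((abs_swt_add_mul_dq_le hs ht hε1 n _ _).trans (le_abs_self _)) (abs_nonneg _)
    · exact Eventually.of_forall fun x =>
        (tendsto_swt_add_mul_dq hs ht hs1 ht1 hε hε1 (u x) (ψ x)).const_mul _
  simp only [mul_left_comm (V _) (2 : ℝ), MeasureTheory.integral_const_mul] at this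
  refine this.congr fun n => ?_
  have hw := ((hu.add (hψ.const_mul (ε n))).swt (s n) (t n)).integrable_sq
  have hu' := (hu.swt (s n) (t n)).integrable_sq
  rw [eq_div_iff (hε1 n).1.ne', ← integral_sub (H10.integrableOn_pot hV hw)
    (H10.integrableOn_pot hV hu'), mul_comm, ← MeasureTheory.integral_const_mul]
  refine integral_congr_ae (Eventually.of_forall fun x => ?_)
  dsimp only
  rw [← mul_sub, swt_sq_sub_sq _ _ _ (hε1 n).1.ne']
  ring

theorem tendsto_cc_quotient :
    Tendsto (fun n => (cc (fun x => swt (s n) (t n) (u x + ε n * ψ x) * (u x + ε n * ψ x))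
      (fun x => swt (s n) (t n) (u x + ε n * ψ x) * (u x + ε n * ψ x)) -
      cc (fun x => swt (s n) (t n) (u x) * u x) (fun x => swt (s n) (t n) (u x) * u x)) / ε n)
      atTop (𝓝 (4 * (1 / (4 * Real.pi) * coul (fun x => u x ^ 2) (fun x => u x * ψ x)))) := by
  have hW := fun n => (hu.add (hψ.const_mul (ε n))).swt (s n) (t n)
  have hU := fun n => hu.swt (s n) (t n)
  have m1 := fun n => ((hW n).add (hU n)).aestronglyMeasurable.mul
        (hu.aestronglyMeasurable_dq hψ (s n) (t n) (ε n))
  have b1 := (((hu.abs.add hψ.abs).l2Ball_mul hψ.abs).1.const_mul (2 * M ^ 2))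
  have l1 : Tendsto (fun n => ∫ x, ((swt (s n) (t n) (u x + ε n * ψ x) *
      (u x + ε n * ψ x) + swt (s n) (t n) (u x) * u x) * dq (s n) (t n) (ε n) (u x) (ψ x) -
      2 * (u x * ψ x)) ^ 2) atTop (𝓝 0) :=
    tendsto_integral_sq_sub m1 ((hu.l2Ball_mul hψ).1.1.const_mul 2) b1
      (fun n => Eventually.of_forall fun x => abs_swt_add_mul_dq_le hs ht hε1 n _ _)
      (Eventually.of_forall fun x => tendsto_swt_add_mul_dq hs ht hs1 ht1 hε hε1 (u x) (ψ x))
  have b2 := (((hu.abs.add hψ.abs).l2Ball_sq).1.const_mul (2 * M ^ 2))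
  have l2 : Tendsto (fun n => ∫ x, ((swt (s n) (t n) (u x + ε n * ψ x) *
      (u x + ε n * ψ x)) ^ 2 + (swt (s n) (t n) (u x) * u x) ^ 2 - (u x ^ 2 + u x ^ 2)) ^ 2) atTop
      (𝓝 0) := by
    refine tendsto_integral_sq_sub
      (fun n => ((hW n).aestronglyMeasurable.pow 2).add ((hU n).aestronglyMeasurable.pow 2))
      ((hu.aestronglyMeasurable.pow 2).add (hu.aestronglyMeasurable.pow 2)) b2
      (fun n => Eventually.of_forall fun x => ?_) (Eventually.of_forall fun x => ?_)
    · rw [abs_of_nonneg (by positivity), ← sq_abs, ← sq_abs (swt (s n) (t n) (u x) * u x)]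
      have := abs_swt_add_le hs ht hε1 n (u x) (ψ x)
      have := abs_swt_self_le hs ht n (u x) (ψ x)
      calc _ ≤ (M * (|u x| + |ψ x|)) ^ 2 + (M * (|u x| + |ψ x|)) ^ 2 := by gcongr
        _ = _ := by ring
    · have h2 := tendsto_swt_add hs ht hs1 ht1 hε (u x) 0
      simp only [mul_zero, add_zero] at h2
      exact ((tendsto_swt_add hs ht hs1 ht1 hε (u x) (ψ x)).pow 2).add (h2.pow 2)
  have hL1 : ∀ n, L2Ball R (fun x => (swt (s n) (t n) (u x + ε n * ψ x) *
      (u x + ε n * ψ x) + swt (s n) (t n) (u x) * u x) * dq (s n) (t n) (ε n) (u x) (ψ x)) := fun n => by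
    refine ⟨b1.mono' (m1 n) (Eventually.of_forall fun x => abs_swt_add_mul_dq_le hs ht hε1 n _ _), ?_⟩
    filter_upwards [hu.zero, hψ.zero] with x h1 h2 h3
    simp [h1 h3, h2 h3]
  have hL1' : L2Ball R (fun x => 2 * (u x * ψ x)) := by
    have := (hu.const_mul 2).l2Ball_mul hψ
    simpa only [mul_assoc] using this
  have hadd : ∀ {a b : E3 → ℝ}, L2Ball R a → L2Ball R b → L2Ball R fun x => a x + b x :=
    fun ha hb => ⟨ha.1.add hb.1, by
      filter_upwards [ha.2, hb.2] with x h1 h2 h3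
      rw [h1 h3, h2 h3, add_zero]⟩
  have hu2 := hu.l2Ball_sq
  have l3 := tendsto_coul hL1 hL1' (fun n => hadd (hW n).l2Ball_sq (hU n).l2Ball_sq)
    (hadd hu2 hu2) l1 l2
  rw [coul_mul_left, (hu.l2Ball_mul hψ).coul_add_right hu2 hu2, (hu.l2Ball_mul hψ).coul_comm hu2] at l3
  convert l3.const_mul (1 / (4 * Real.pi)) using 2 with n
  · rw [div_eq_iff (hε1 n).1.ne', cc, cc, ← mul_sub, mul_assoc, mul_comm _ (ε n), ← coul_mul_left]
    congr 1
    simp only [← swt_sq_sub_sq (ε n) (s n) (t n) (hε1 n).1.ne']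
    have k1 := (hW n).l2Ball_sq
    have k2 := (hU n).l2Ball_sq
    rw [k1.coul_sub_left k2 (hadd k1 k2), k1.coul_add_right k1 k2, k2.coul_add_right k1 k2,
      k2.coul_comm k1]
    ring
  · ring

theorem tendsto_prim_quotient (hf : Nonlin f) :
    Tendsto (fun n => ((primInt f R fun x => swt (s n) (t n) (u x + ε n * ψ x) *
      (u x + ε n * ψ x)) - primInt f R fun x => swt (s n) (t n) (u x) * u x) / ε n)
      atTop (𝓝 (∫ x in ball (0 : E3) R, f (u x) * ψ x)) := by
  have hM : 0 ≤ M := (hs 0).1.trans (hs 0).2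
  obtain ⟨C, hC, hb⟩ := hf.growth' one_pos
  have hW := fun n => (hu.add (hψ.const_mul (ε n))).swt (s n) (t n)
  have hU := fun n => hu.swt (s n) (t n)
  have mvt : ∀ n x, ∃ c, |c| ≤ M * (|u x| + |ψ x|) ∧
      |c - swt (s n) (t n) (u x) * u x| ≤ |ε n * dq (s n) (t n) (ε n) (u x) (ψ x)| ∧
      (prim f (swt (s n) (t n) (u x + ε n * ψ x) * (u x + ε n * ψ x)) -
        prim f (swt (s n) (t n) (u x) * u x)) / ε n = f c * dq (s n) (t n) (ε n) (u x) (ψ x) := by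
    intro n x
    have e : ε n * dq (s n) (t n) (ε n) (u x) (ψ x) = swt (s n) (t n) (u x + ε n * ψ x) *
      (u x + ε n * ψ x) - swt (s n) (t n) (u x) * u x := by
      rw [dq, mul_div_cancel₀ _ (hε1 n).1.ne']
    have e' : dq (s n) (t n) (ε n) (u x) (ψ x) = (swt (s n) (t n) (u x + ε n * ψ x) *
      (u x + ε n * ψ x) - swt (s n) (t n) (u x) * u x) / ε n := rfl
    rw [e, e']
    have b1 := abs_swt_add_le hs ht hε1 n (u x) (ψ x)
    have b2 := abs_swt_self_le hs ht n (u x) (ψ x)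
    generalize swt (s n) (t n) (u x + ε n * ψ x) * (u x + ε n * ψ x) = b at *
    generalize swt (s n) (t n) (u x) * u x = a at *
    have hd := hf.hasDerivAt_prim
    rcases lt_trichotomy a b with hab | hab | hab
    · obtain ⟨c, hc, hc'⟩ := exists_hasDerivAt_eq_slope (prim f) f hab
        hf.continuous_prim.continuousOn fun x _ => hd x
      refine ⟨c, ?_, ?_, ?_⟩
      · exact abs_le.2 ⟨by linarith [(abs_le.1 b2).1, hc.1], by linarith [(abs_le.1 b1).2, hc.2]⟩
      · rw [abs_of_nonneg (by linarith [hc.1]), abs_of_nonneg (by linarith)]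
        linarith [hc.2]
      · rw [hc']
        have : b - a ≠ 0 := by linarith
        field_simp
    · exact ⟨a, b2, by simp, by simp [hab]⟩
    · obtain ⟨c, hc, hc'⟩ := exists_hasDerivAt_eq_slope (prim f) f hab
        hf.continuous_prim.continuousOn fun x _ => hd x
      refine ⟨c, ?_, ?_, ?_⟩
      · exact abs_le.2 ⟨by linarith [(abs_le.1 b1).1, hc.1], by linarith [(abs_le.1 b2).2, hc.2]⟩
      · rw [abs_of_nonpos (by linarith [hc.2]), abs_of_nonpos (by linarith)]
        linarith [hc.1]
      · rw [hc']
        have : a - b ≠ 0 := by linarith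
        field_simp
        ring
  choose c hc1 hc2 hc3 using mvt
  have g6 := (hu.abs.add hψ.abs).integrable_pow_six
  have g1 := (hψ.l2Ball.abs).integrable
  have : Tendsto (fun n => ∫ x in ball (0 : E3) R, (prim f (swt (s n) (t n) (u x + ε n * ψ x) *
      (u x + ε n * ψ x)) - prim f (swt (s n) (t n) (u x) * u x)) / ε n) atTop
      (𝓝 (∫ x in ball (0 : E3) R, f (u x) * ψ x)) := by
    refine tendsto_integral_of_dominated_convergence (fun x => C * M * |ψ x| +
      M ^ 6 * (|u x| + |ψ x|) ^ 6) (fun n => ?_)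
      ((g1.integrableOn.const_mul (C * M)).add (g6.integrableOn.const_mul (M ^ 6)))
      (fun n => ?_) ?_
    · have := ((hf.continuous_prim.comp_aestronglyMeasurable (hW n).aestronglyMeasurable).sub
        (hf.continuous_prim.comp_aestronglyMeasurable (hU n).aestronglyMeasurable)).restrict
        (s := ball (0 : E3) R)
      exact (this.mul_const (1 / ε n)).congr (Eventually.of_forall fun x => by
        simp only [Pi.sub_apply]; ring)
    · refine Eventually.of_forall fun x => ?_
      rw [hc3, norm_mul, Real.norm_eq_abs, Real.norm_eq_abs]
      have k1 := hc1 n x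
      have k2 := abs_dq_le (hs n) (ht n) (hε1 n).1 (u x) (ψ x)
      have k3 : 0 ≤ |u x| := abs_nonneg _
      calc _ ≤ (C + 1 * |c n x| ^ 5) * (M * |ψ x|) := by gcongr; exact hb _
        _ ≤ (C + 1 * (M * (|u x| + |ψ x|)) ^ 5) * (M * |ψ x|) := by gcongr
        _ = C * M * |ψ x| + M ^ 6 * ((|u x| + |ψ x|) ^ 5 * |ψ x|) := by ring
        _ ≤ C * M * |ψ x| + M ^ 6 * ((|u x| + |ψ x|) ^ 5 * (|u x| + |ψ x|)) := by gcongr; linarith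
        _ = _ := by ring
    · refine Eventually.of_forall fun x => ?_
      simp only [hc3]
      have d1 := tendsto_dq hs1 ht1 hε (fun n => (hε1 n).1) (u x) (ψ x)
      have d2 := tendsto_swt_add hs ht hs1 ht1 hε (u x) 0
      simp only [mul_zero, add_zero] at d2
      have d3 := (hε.mul d1).abs
      rw [zero_mul, abs_zero] at d3
      have d4 : Tendsto (fun n => c n x - swt (s n) (t n) (u x) * u x) atTop (𝓝 0) :=
        squeeze_zero_norm (fun n => hc2 n x) d3
      have d5 := d4.add d2
      simp only [sub_add_cancel, zero_add] at d5
      rw [one_mul] at d1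
      exact ((hf.continuous.tendsto _).comp d5).mul d1
  refine this.congr fun n => ?_
  rw [MeasureTheory.integral_div, integral_sub ((hW n).integrableOn_subSextic hf.subSextic_prim)
    ((hU n).integrableOn_subSextic hf.subSextic_prim)]
  rfl

end quotients

end

section

variable {f : ℝ → ℝ} {V : E3 → ℝ} {α R : ℝ} {u ψ : E3 → ℝ} {D Ψ : E3 → E3}

theorem H10.integrable_inner (h : H10 R u D) (h' : H10 R ψ Ψ) :
    Integrable (fun x => inner ℝ (D x) (Ψ x)) :=
  integrable_inner_of_memLp h.h1.memLp_grad h'.h1.memLp_grad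

theorem sq_swt_mul_le {s t ε a b d : ℝ} (hε : 0 ≤ ε) (hd : 0 ≤ d) (h0 : a = 0 → d = 0) :
    swt s t (a + ε * b) ^ 2 * d ≤ swt s t a ^ 2 * d +
      |s ^ 2 - t ^ 2| * (if 0 < |a| ∧ |a| ≤ ε * |b| then d else 0) := by
  by_cases ha : a = 0
  · rw [h0 ha]; simp
  by_cases hab : |a| ≤ ε * |b|
  · rw [if_pos ⟨abs_pos.2 ha, hab⟩, ← add_mul]
    refine mul_le_mul_of_nonneg_right ?_ hd
    have h1 := le_abs_self (s ^ 2 - t ^ 2)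
    have h2 := neg_abs_le (s ^ 2 - t ^ 2)
    have h3 := abs_nonneg (s ^ 2 - t ^ 2)
    simp only [swt]
    split_ifs <;> linarith
  · have h1 : |ε * b| < |a| := by rw [abs_mul, abs_of_nonneg hε]; exact not_le.1 hab
    have : swt s t (a + ε * b) = swt s t a := by
      simp only [swt]
      rcases lt_or_gt_of_ne ha with h | h
      · rw [abs_of_neg h] at h1
        rw [if_neg (by linarith [le_abs_self (ε * b)]), if_neg (by linarith)]
      · rw [abs_of_pos h] at h1
        rw [if_pos (by linarith [neg_abs_le (ε * b)]), if_pos h]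
    rw [this, if_neg (fun h => hab h.2)]
    simp

theorem integral_grad_swt_sub_le (hu : H10 R u D) (hψ : H10 R ψ Ψ) {s t ε C : ℝ} (hε : 0 ≤ ε)
    (hC : ∫ x, (if 0 < |u x| ∧ |u x| ≤ ε * |ψ x| then ‖D x‖ ^ 2 else 0) ≤ C * ε) :
    (∫ x, ‖swt s t (u x + ε * ψ x) • (D x + ε • Ψ x)‖ ^ 2) - ∫ x, ‖swt s t (u x) • D x‖ ^ 2 ≤
      ε * (|s ^ 2 - t ^ 2| * C + ∫ x, swt s t (u x + ε * ψ x) ^ 2 *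
        (2 * inner ℝ (D x) (Ψ x) + ε * ‖Ψ x‖ ^ 2)) := by
  have hw := (hu.add (hψ.const_mul ε)).swt s t
  have hm : NullMeasurableSet {x | 0 < |u x| ∧ |u x| ≤ ε * |ψ x|} := by
    have a := hu.aestronglyMeasurable.aemeasurable
    have b := hψ.aestronglyMeasurable.aemeasurable
    exact (nullMeasurableSet_lt aemeasurable_const (measurable_abs.comp_aemeasurable a)).inter
      (nullMeasurableSet_le (measurable_abs.comp_aemeasurable a)
        ((measurable_abs.comp_aemeasurable b).const_mul ε))
  have i1 : Integrable (fun x => if 0 < |u x| ∧ |u x| ≤ ε * |ψ x| then ‖D x‖ ^ 2 else 0) := by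
    refine (hu.integrable_grad_sq.indicator₀ hm).congr (Eventually.of_forall fun x => ?_)
    simp only [Set.indicator, Set.mem_ofPred_eq]
  have i2 := hw.integrable_grad_sq
  have i3 := (hu.swt s t).integrable_grad_sq
  have i4 : Integrable (fun x => swt s t (u x + ε * ψ x) ^ 2 *
      (2 * inner ℝ (D x) (Ψ x) + ε * ‖Ψ x‖ ^ 2)) := by
    refine Integrable.bdd_mul (c := max (|s|) (|t|) ^ 2) (((hu.integrable_inner hψ).const_mul 2).add
      (hψ.integrable_grad_sq.const_mul ε)) ?_ (Eventually.of_forall fun x => ?_)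
    · have a := (hu.add (hψ.const_mul ε)).aestronglyMeasurable.aemeasurable
      have : Measurable (swt s t) :=
        Measurable.ite measurableSet_Ioi measurable_const measurable_const
      exact ((this.comp_aemeasurable a).pow_const 2).aestronglyMeasurable
    · rw [norm_pow, Real.norm_eq_abs]
      gcongr
      simp only [swt]
      split_ifs
      exacts [le_max_left _ _, le_max_right _ _]
  have key : ∫ x, ‖swt s t (u x + ε * ψ x) • (D x + ε • Ψ x)‖ ^ 2 ≤
      ∫ x, (‖swt s t (u x) • D x‖ ^ 2 + (|s ^ 2 - t ^ 2| *
        (if 0 < |u x| ∧ |u x| ≤ ε * |ψ x| then ‖D x‖ ^ 2 else 0) + ε * (swt s t (u x + ε * ψ x) ^ 2 *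
        (2 * inner ℝ (D x) (Ψ x) + ε * ‖Ψ x‖ ^ 2)))) := by
    refine integral_mono_ae i2 (i3.add ((i1.const_mul _).add (i4.const_mul _))) ?_
    filter_upwards [hu.h1.grad_eq_zero] with x hx
    have := sq_swt_mul_le (s := s) (t := t) (b := ψ x) hε (sq_nonneg ‖D x‖)
      (fun h => by rw [hx h]; simp)
    rw [norm_smul, norm_smul, mul_pow, mul_pow, Real.norm_eq_abs, Real.norm_eq_abs, sq_abs, sq_abs,
      norm_add_sq_real, norm_smul, inner_smul_right, Real.norm_eq_abs, abs_of_nonneg hε]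
    refine le_of_eq_of_le ?_ ((add_le_add_left this (swt s t (u x + ε * ψ x) ^ 2 *
        (ε * (2 * inner ℝ (D x) (Ψ x) + ε * ‖Ψ x‖ ^ 2)))).trans_eq ?_) <;> ring
  have i5 : Integrable (fun x => |s ^ 2 - t ^ 2| *
      (if 0 < |u x| ∧ |u x| ≤ ε * |ψ x| then ‖D x‖ ^ 2 else 0) + ε * (swt s t (u x + ε * ψ x) ^ 2 *
      (2 * inner ℝ (D x) (Ψ x) + ε * ‖Ψ x‖ ^ 2))) := (i1.const_mul _).add (i4.const_mul _)
  rw [integral_add i3 i5, integral_add (i1.const_mul _) (i4.const_mul _), MeasureTheory.integral_const_mul,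
    MeasureTheory.integral_const_mul] at key
  have := mul_le_mul_of_nonneg_left hC (abs_nonneg (s ^ 2 - t ^ 2))
  linarith

theorem tendsto_integral_swt_grad (hu : H10 R u D) (hψ : H10 R ψ Ψ) {s t ε : ℕ → ℝ} {M : ℝ}
    (hs : ∀ n, s n ∈ Set.Icc 0 M) (ht : ∀ n, t n ∈ Set.Icc 0 M)
    (hs1 : Tendsto s atTop (𝓝 1)) (ht1 : Tendsto t atTop (𝓝 1)) (hε : Tendsto ε atTop (𝓝 0))
    (hε1 : ∀ n, ε n ∈ Set.Ioc 0 1) :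
    Tendsto (fun n => ∫ x, swt (s n) (t n) (u x + ε n * ψ x) ^ 2 *
      (2 * inner ℝ (D x) (Ψ x) + ε n * ‖Ψ x‖ ^ 2)) atTop (𝓝 (2 * ∫ x, inner ℝ (D x) (Ψ x))) := by
  rw [← MeasureTheory.integral_const_mul]
  have i1 := hu.integrable_inner hψ
  refine tendsto_integral_of_dominated_convergence
    (fun x => M ^ 2 * (2 * |inner ℝ (D x) (Ψ x)| + ‖Ψ x‖ ^ 2)) (fun n => ?_)
    (((i1.abs.const_mul 2).add hψ.integrable_grad_sq).const_mul _) (fun n => ?_) ?_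
  · have a := (hu.add (hψ.const_mul (ε n))).aestronglyMeasurable.aemeasurable
    have : Measurable (swt (s n) (t n)) :=
      Measurable.ite measurableSet_Ioi measurable_const measurable_const
    exact ((this.comp_aemeasurable a).pow_const 2).aestronglyMeasurable.mul
      ((i1.const_mul 2).add (hψ.integrable_grad_sq.const_mul (ε n))).aestronglyMeasurable
  · refine Eventually.of_forall fun x => ?_
    rw [norm_mul, norm_pow, Real.norm_eq_abs, Real.norm_eq_abs]
    have := abs_swt_le (hs n) (ht n) (u x + ε n * ψ x)
    gcongr
    refine (abs_add_le _ _).trans ?_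
    rw [abs_mul, abs_two, abs_mul, abs_of_pos (hε1 n).1, abs_of_nonneg (sq_nonneg ‖Ψ x‖)]
    have := mul_le_mul_of_nonneg_right (hε1 n).2 (sq_nonneg ‖Ψ x‖)
    linarith
  · refine Eventually.of_forall fun x => ?_
    have h1 : Tendsto (fun n => swt (s n) (t n) (u x + ε n * ψ x)) atTop (𝓝 1) := by
      rw [tendsto_iff_norm_sub_tendsto_zero] at hs1 ht1 ⊢
      refine squeeze_zero (fun n => norm_nonneg _) (fun n => ?_) (by simpa using hs1.add ht1)
      simp only [swt]
      have h2 := norm_nonneg (s n - 1)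
      have h3 := norm_nonneg (t n - 1)
      split_ifs
      exacts [le_add_of_nonneg_right h3, le_add_of_nonneg_left h2]
    have := (h1.pow 2).mul ((hε.mul_const (‖Ψ x‖ ^ 2)).const_add (2 * inner ℝ (D x) (Ψ x)))
    simpa using this

/-- The first variation of a minimizer is nonnegative in a direction which moves the nodal set
only slightly. -/
theorem IsMinimizer.pairing_nonneg (h : Setup f V α R) (hu : IsMinimizer f V R u D)
    (hψ : H10 R ψ Ψ) {C : ℝ} (hC : ∀ ε : ℝ, 0 < ε → ε < 1 →
      ∫ x, (if 0 < |u x| ∧ |u x| ≤ ε * |ψ x| then ‖D x‖ ^ 2 else 0) ≤ C * ε) :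
    0 ≤ pairing f V R u D ψ Ψ := by
  have e0 : Tendsto (fun n : ℕ => 1 / ((n : ℝ) + 2)) atTop (𝓝 0) := by
    have := (tendsto_add_atTop_iff_nat (f := fun n : ℕ => 1 / (n : ℝ)) 2).2
      tendsto_one_div_atTop_nhds_zero_nat
    simpa using this
  have e1 : ∀ n : ℕ, 0 < 1 / ((n : ℝ) + 2) ∧ 1 / ((n : ℝ) + 2) < 1 := fun n =>
    ⟨by positivity, by rw [div_lt_one (by positivity)]; linarith [n.cast_nonneg (α := ℝ)]⟩
  obtain ⟨ns, s, t, hns, hs1, ht1, hs, ht, hle⟩ := hu.exists_perturbation h hψ e0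
    (fun n => ⟨(e1 n).1.le, (e1 n).2.le⟩)
  set ε : ℕ → ℝ := fun n => 1 / ((ns n : ℝ) + 2) with hεdef
  have hε : Tendsto ε atTop (𝓝 0) := e0.comp hns.tendsto_atTop
  have hε1 : ∀ n, ε n ∈ Set.Ioc 0 1 := fun n => ⟨(e1 _).1, (e1 _).2.le⟩
  have hsub : ∀ {r : ℝ}, r ∈ Set.Icc (1 / 2 : ℝ) (3 / 2) → r ∈ Set.Icc (0 : ℝ) (3 / 2) := fun h =>
    ⟨by linarith [h.1], h.2⟩
  replace hs := fun n => hsub (hs n)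
  replace ht := fun n => hsub (ht n)
  have q1 := tendsto_integral_swt_grad hu.mem hψ hs ht hs1 ht1 hε hε1
  have q2 := tendsto_pot_quotient hu.mem hψ hs ht hs1 ht1 hε hε1 h.cont
  have q3 := tendsto_cc_quotient hu.mem hψ hs ht hs1 ht1 hε hε1
  have q4 := tendsto_prim_quotient hu.mem hψ hs ht hs1 ht1 hε hε1 h.nonlin
  have q0 : Tendsto (fun n => |s n ^ 2 - t n ^ 2| * C) atTop (𝓝 0) := by
    have := (((hs1.pow 2).sub (ht1.pow 2)).abs).mul_const C
    simpa using this
  have q := ((((q0.add q1).const_mul (1 / 2)).add (q2.const_mul (1 / 2))).add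
    (q3.const_mul (1 / 4))).sub q4
  have : pairing f V R u D ψ Ψ = 1 / 2 * (0 + 2 * ∫ x, inner ℝ (D x) (Ψ x)) +
      1 / 2 * (2 * ∫ x in ball (0 : E3) R, V x * (u x * ψ x)) +
      1 / 4 * (4 * (1 / (4 * Real.pi) * coul (fun x => u x ^ 2) (fun x => u x * ψ x))) -
      ∫ x in ball (0 : E3) R, f (u x) * ψ x := by
    rw [pairing]; ring
  rw [this]
  refine ge_of_tendsto q ?_
  filter_upwards [hle] with n hn
  have g := integral_grad_swt_sub_le hu.mem hψ (s := s n) (t := t n) (hε1 n).1.le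
    (hC (ε n) (e1 _).1 (e1 _).2)
  have hp := (hε1 n).1
  rw [← div_le_iff₀' hp] at g
  simp only [en, nrm] at hn
  have hn2 := div_nonneg (sub_nonneg.2 hn) hp.le
  refine hn2.trans ?_
  refine le_trans (le_of_eq ?_) (sub_le_sub_right (add_le_add_left (add_le_add_left
    (mul_le_mul_of_nonneg_left g (by norm_num : (0 : ℝ) ≤ 1 / 2)) _) _) _)
  ring

end

section

variable {f : ℝ → ℝ} {V : E3 → ℝ} {α R : ℝ} {u ψ : E3 → ℝ} {D Ψ : E3 → E3}

/-- Functions whose energy has nonnegative first variation in each direction which moves the nodal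
set only slightly. -/
structure Crit (f : ℝ → ℝ) (V : E3 → ℝ) (R : ℝ) (u : E3 → ℝ) (D : E3 → E3) : Prop where
  mem : H10 R u D
  nonneg : ∀ ψ Ψ C, H10 R ψ Ψ → (∀ ε : ℝ, 0 < ε → ε < 1 →
    ∫ x, (if 0 < |u x| ∧ |u x| ≤ ε * |ψ x| then ‖D x‖ ^ 2 else 0) ≤ C * ε) →
    0 ≤ pairing f V R u D ψ Ψ

theorem IsMinimizer.crit (h : Setup f V α R) (hu : IsMinimizer f V R u D) : Crit f V R u D :=
  ⟨hu.mem, fun _ _ _ hψ hC => hu.pairing_nonneg h hψ hC⟩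

theorem pairing_neg : pairing f V R u D (fun x => -ψ x) (fun x => -Ψ x) =
    -pairing f V R u D ψ Ψ := by
  have := coul_mul_right (-1) (fun x => u x ^ 2) (fun x => u x * ψ x)
  simp only [neg_mul, one_mul] at this
  simp only [pairing, inner_neg_right, mul_neg, MeasureTheory.integral_neg, this]
  ring

theorem pairing_reflect : pairing (fun s => -f (-s)) V R (fun x => -u x) (fun x => -D x) ψ Ψ =
    pairing f V R u D (fun x => -ψ x) (fun x => -Ψ x) := by
  simp only [pairing, inner_neg_right, inner_neg_left, mul_neg, neg_mul, neg_neg, even_two.neg_pow]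

namespace Crit

theorem neg (h : Crit f V R u D) :
    Crit (fun s => -f (-s)) V R (fun x => -u x) (fun x => -D x) := by
  refine ⟨h.mem.neg, fun ψ Ψ C hψ hC => ?_⟩
  rw [pairing_reflect]
  refine h.nonneg _ _ C hψ.neg fun ε h0 h1 => ?_
  simpa only [abs_neg, norm_neg] using hC ε h0 h1

theorem pairing_eq_zero (h : Crit f V R u D) (hψ : H10 R ψ Ψ) {C : ℝ}
    (hC : ∀ ε : ℝ, 0 < ε → ε < 1 →
      ∫ x, (if 0 < |u x| ∧ |u x| ≤ ε * |ψ x| then ‖D x‖ ^ 2 else 0) ≤ C * ε) :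
    pairing f V R u D ψ Ψ = 0 := by
  have h1 := h.nonneg _ _ C hψ hC
  have h2 := h.nonneg _ _ C hψ.neg (by simpa only [abs_neg] using hC)
  rw [pairing_neg] at h2
  linarith

theorem pairing_eq_zero_of_abs_le (h : Crit f V R u D) (hψ : H10 R ψ Ψ)
    (hle : ∀ x, |ψ x| ≤ |u x|) : pairing f V R u D ψ Ψ = 0 := by
  refine h.pairing_eq_zero hψ (C := 0) fun ε h0 h1 => ?_
  have : ∀ x, ¬(0 < |u x| ∧ |u x| ≤ ε * |ψ x|) := fun x ⟨h2, h3⟩ => by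
    have := mul_le_mul_of_nonneg_left (hle x) h0.le
    nlinarith
  simp only [if_neg (this _), integral_zero]
  simp
/-- The equation tested with nonnegative functions vanishing where `u ≤ 0`. -/
theorem integral_inner_le (hV : ∀ x, 0 ≤ V x) (h : Crit f V R u D) (hψ : H10 R ψ Ψ)
    (h0 : ∀ x, 0 ≤ ψ x) (hle : ∀ x, ψ x ≤ max (u x) 0) :
    ∫ x, inner ℝ (D x) (Ψ x) ≤ ∫ x in ball (0 : E3) R, |f (u x)| * ψ x := by
  have hab : ∀ x, |ψ x| ≤ |u x| := fun x => by
    rw [abs_of_nonneg (h0 x)]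
    exact (hle x).trans (max_le (le_abs_self _) (abs_nonneg _))
  have hpos : ∀ x, 0 ≤ u x * ψ x := fun x => by
    rcases le_or_gt 0 (u x) with h1 | h1
    · exact mul_nonneg h1 (h0 x)
    · have := hle x
      rw [max_eq_right h1.le] at this
      rw [le_antisymm this (h0 x), mul_zero]
  have := h.pairing_eq_zero_of_abs_le hψ hab
  rw [pairing] at this
  have h1 : 0 ≤ ∫ x in ball (0 : E3) R, V x * (u x * ψ x) :=
    integral_nonneg fun x => mul_nonneg (hV x) (hpos x)
  have h2 : 0 ≤ 1 / (4 * Real.pi) * coul (fun x => u x ^ 2) (fun x => u x * ψ x) :=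
    mul_nonneg (by positivity) (coul_nonneg (fun x => sq_nonneg _) hpos)
  have h3 := (le_abs_self _).trans (norm_integral_le_integral_norm
    (μ := volume.restrict (ball (0 : E3) R)) (fun x => f (u x) * ψ x))
  simp only [norm_mul, Real.norm_eq_abs, abs_of_nonneg (h0 _)] at h3
  linarith

theorem exists_integral_small_pos_le (hV : ∀ x, 0 ≤ V x) (hf : Nonlin f) (h : Crit f V R u D) :
    ∃ C, 0 ≤ C ∧ ∀ δ > 0, ∫ x, (if 0 < u x ∧ u x ≤ δ then ‖D x‖ ^ 2 else 0) ≤ C * δ := by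
  obtain ⟨C₀, hC₀, hb⟩ := hf.growth' one_pos
  have hi : IntegrableOn (fun x => |f (u x)|) (ball 0 R) := by
    have hj : IntegrableOn (fun x => (C₀ + 1) + u x ^ 6) (ball 0 R) :=
      (integrableOn_const measure_ball_lt_top.ne).add h.mem.integrable_pow_six.integrableOn
    refine hj.mono' (hf.continuous.comp_aestronglyMeasurable
      h.mem.aestronglyMeasurable.restrict).norm (Eventually.of_forall fun x => ?_)
    rw [Real.norm_eq_abs, abs_abs]
    refine (hb _).trans ?_
    have : |u x| ^ 6 = u x ^ 6 := (by decide : Even 6).pow_abs _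
    rw [← this]
    rcases le_total (|u x|) 1 with h1 | h1
    · linarith [pow_le_one₀ (n := 5) (abs_nonneg (u x)) h1, pow_nonneg (abs_nonneg (u x)) 6]
    · linarith [pow_le_pow_right₀ h1 (by norm_num : 5 ≤ 6)]
  refine ⟨∫ x in ball (0 : E3) R, |f (u x)|, integral_nonneg fun x => abs_nonneg _,
    fun δ hδ => ?_⟩
  have hψ := h.mem.posPart.sub (h.mem.posPart_sub hδ.le)
  have h1 : ∀ x, max (u x) 0 - max (u x - δ) 0 = min (max (u x) 0) δ := fun x => by
    grind
  have := h.integral_inner_le hV hψ (fun x => ?_) (fun x => ?_)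
  · refine le_trans (le_of_eq ?_) (this.trans ?_)
    · refine integral_congr_ae (Eventually.of_forall fun x => ?_)
      dsimp only
      by_cases h2 : 0 < u x <;> by_cases h3 : δ < u x
      · rw [if_neg (by intro h; linarith [h.2]), if_pos h2, if_pos h3]; simp
      · rw [if_pos ⟨h2, not_lt.1 h3⟩, if_pos h2, if_neg h3]; simp
      · exact absurd (hδ.trans h3) h2
      · rw [if_neg (fun h => h2 h.1), if_neg h2, if_neg h3]; simp
    · rw [← MeasureTheory.integral_mul_const]
      refine integral_mono_of_nonneg (Eventually.of_forall fun x => ?_) (hi.mul_const δ)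
        (Eventually.of_forall fun x => ?_)
      · dsimp only; rw [h1]
        exact mul_nonneg (abs_nonneg _) (le_min (le_max_right _ _) hδ.le)
      · dsimp only; rw [h1]
        exact mul_le_mul_of_nonneg_left (min_le_right _ _) (abs_nonneg _)
  · rw [h1]; exact le_min (le_max_right _ _) hδ.le
  · rw [h1]; exact min_le_left _ _

end Crit

theorem Nonlin.reflect (hf : Nonlin f) : Nonlin fun s => -f (-s) where
  smooth := (hf.smooth.comp contDiff_neg).neg
  zero := by
    have h : Tendsto (fun s : ℝ => -s) (𝓝[≠] 0) (𝓝[≠] 0) := by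
      refine tendsto_nhdsWithin_iff.2 ⟨?_, ?_⟩
      · simpa using (continuous_neg.tendsto (0 : ℝ)).mono_left nhdsWithin_le_nhds
      · filter_upwards [self_mem_nhdsWithin] with s hs
        simpa using hs
    refine (hf.zero.comp h).congr fun s => ?_
    simp [div_neg, neg_div]
  infty := by
    have h : Tendsto (fun s : ℝ => -s) (cocompact ℝ) (cocompact ℝ) :=
      (Homeomorph.neg ℝ).isClosedEmbedding.tendsto_cocompact
    have := (hf.infty.comp h).neg
    rw [neg_zero] at this
    refine this.congr fun s => ?_
    simp [neg_div]
  super := by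
    have h : Tendsto (fun s : ℝ => -s) (cocompact ℝ) (cocompact ℝ) :=
      (Homeomorph.neg ℝ).isClosedEmbedding.tendsto_cocompact
    refine (hf.super.comp h).congr fun s => ?_
    have : ∫ t in (0 : ℝ)..s, -f (-t) = ∫ t in (0 : ℝ)..(-s), f t := by
      rw [intervalIntegral.integral_neg, intervalIntegral.integral_comp_neg, neg_zero,
        integral_symm]
      simp
    rw [this, Function.comp_apply, (by decide : Even 4).neg_pow]
  mono t s hts := by
    have := hf.mono (-t) (-s) (by
      rcases hts with h | h
      · right; constructor <;> linarith
      · left; constructor <;> linarith)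
    have e : ∀ r : ℝ, -f (-r) / r ^ 3 = f (-r) / (-r) ^ 3 := fun r => by
      rw [(by decide : Odd 3).neg_pow, div_neg, neg_div]
    rwa [e, e]

/-- The weak form of the equation, tested with bounded functions. -/
theorem Crit.pairing_eq_zero_of_bounded (hV : ∀ x, 0 ≤ V x) (hf : Nonlin f) (h : Crit f V R u D)
    (hψ : H10 R ψ Ψ) {K : ℝ} (hK : ∀ᵐ x, |ψ x| ≤ K) : pairing f V R u D ψ Ψ = 0 := by
  obtain ⟨C₁, hC₁, h₁⟩ := h.exists_integral_small_pos_le hV hf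
  obtain ⟨C₂, hC₂, h₂⟩ := h.neg.exists_integral_small_pos_le hV hf.reflect
  replace hK : ∀ᵐ x, |ψ x| ≤ |K| + 1 := hK.mono fun x hx => by linarith [le_abs_self K]
  have hu := h.mem.aestronglyMeasurable.aemeasurable
  have hInt : ∀ {S : Set E3}, NullMeasurableSet S →
      Integrable (S.indicator fun x => ‖D x‖ ^ 2) := fun hS =>
    h.mem.integrable_grad_sq.indicator₀ hS
  refine h.pairing_eq_zero hψ (C := (C₁ + C₂) * (|K| + 1)) fun ε h0 h1 => ?_
  have hp : 0 < ε * (|K| + 1) := by positivity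
  have i1 : Integrable fun x => if 0 < u x ∧ u x ≤ ε * (|K| + 1) then ‖D x‖ ^ 2 else 0 :=
    (hInt ((nullMeasurableSet_lt (aemeasurable_const (b := (0 : ℝ))) hu).inter
      (nullMeasurableSet_le hu (aemeasurable_const (b := ε * (|K| + 1)))))).congr
      (Eventually.of_forall fun x => by simp [Set.indicator])
  have i2 : Integrable fun x => if 0 < -u x ∧ -u x ≤ ε * (|K| + 1) then ‖-D x‖ ^ 2 else 0 :=
    (hInt ((nullMeasurableSet_lt (aemeasurable_const (b := (0 : ℝ))) hu.neg).inter
      (nullMeasurableSet_le hu.neg (aemeasurable_const (b := ε * (|K| + 1)))))).congr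
      (Eventually.of_forall fun x => by simp [Set.indicator])
  have := add_le_add (h₁ _ hp) (h₂ _ hp)
  rw [← integral_add i1 i2] at this
  refine le_trans ?_ (this.trans_eq (by ring))
  refine integral_mono_of_nonneg (Eventually.of_forall fun x => by dsimp; positivity) (i1.add i2) ?_
  filter_upwards [hK] with x hx
  have h3 := mul_le_mul_of_nonneg_left hx h0.le
  by_cases h4 : 0 < |u x| ∧ |u x| ≤ ε * |ψ x|
  · rw [if_pos h4, norm_neg]
    have h5 := h4.2.trans h3
    rcases lt_or_gt_of_ne (abs_pos.1 h4.1) with h6 | h6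
    · rw [abs_of_neg h6] at h5
      rw [if_neg (by intro h; linarith [h.1]), if_pos ⟨by linarith, h5⟩, zero_add]
    · rw [abs_of_pos h6] at h5
      rw [if_pos ⟨h6, h5⟩, if_neg (by intro h; linarith [h.1]), add_zero]
  · rw [if_neg h4]; positivity

end

section

variable {f : ℝ → ℝ} {V : E3 → ℝ} {α R : ℝ} {u : E3 → ℝ} {D : E3 → E3}

theorem le_geometric_of_cubic_recursion {a : ℕ → ℝ} {S q η : ℝ} (ha : ∀ n, 0 ≤ a n) (hS : 0 ≤ S)
    (hq : 1 ≤ q) (h : ∀ n, a (n + 1) ≤ S * q ^ 2 * q ^ n * a n ^ 3) (h0 : a 0 ≤ η)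
    (hη : S * q ^ 3 * η ^ 2 ≤ 1) (n : ℕ) : a n ≤ η * (q⁻¹) ^ n := by
  have hη0 : 0 ≤ η := (ha 0).trans h0
  have hq0 : 0 < q := by linarith
  induction n with
  | zero => simpa using h0
  | succ n ih =>
    refine (h n).trans ?_
    calc S * q ^ 2 * q ^ n * a n ^ 3 ≤ S * q ^ 2 * q ^ n * (η * q⁻¹ ^ n) ^ 3 := by
          gcongr
          exact ha n
      _ = (S * q ^ 3 * η ^ 2) * (η * (q⁻¹) ^ (n + 1)) * q⁻¹ ^ n := by
          have e1 : q ^ n * q⁻¹ ^ n = 1 := by rw [← mul_pow, mul_inv_cancel₀ hq0.ne', one_pow]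
          have e2 : q * q⁻¹ = 1 := mul_inv_cancel₀ hq0.ne'
          rw [pow_succ]
          linear_combination (S * q ^ 2 * η ^ 3 * (q⁻¹ ^ n) ^ 2) * e1 -
            (S * q ^ 2 * η ^ 3 * (q⁻¹ ^ n) ^ 2) * e2
      _ ≤ 1 * (η * (q⁻¹) ^ (n + 1)) * 1 := by
          have h1 : q⁻¹ ^ n ≤ 1 := pow_le_one₀ (by positivity) (inv_le_one_of_one_le₀ hq)
          gcongr
      _ = _ := by ring

namespace Crit

theorem exists_pow_six_step (hV : ∀ x, 0 ≤ V x) (hf : Nonlin f) (h : Crit f V R u D) :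
    ∃ S, 0 ≤ S ∧ ∀ k l, 0 ≤ k → k < l → 1 ≤ l → ∫ x, max (u x - l) 0 ^ 6 ≤
      S * (l / (l - k)) ^ 15 * (∫ x, max (u x - k) 0 ^ 6) ^ 3 := by
  obtain ⟨S, hS, hSob⟩ := exists_pow_six_le
  obtain ⟨C, hC, hb⟩ := hf.growth one_pos
  refine ⟨S * (1 + C) ^ 3, by positivity, fun k l hk hkl hl => ?_⟩
  have hlk : 0 < l - k := sub_pos.2 hkl
  have hψ := h.mem.posPart_sub (k := l) (by linarith)
  refine (hSob R _ _ hψ).trans ?_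
  have h1 := h.integral_inner_le hV hψ (fun x => le_max_right _ _)
    (fun x => max_le_max (by linarith) le_rfl)
  have e1 : ∫ x, ‖(if l < u x then D x else 0)‖ ^ 2 =
      ∫ x, inner ℝ (D x) (if l < u x then D x else 0) := by
    refine integral_congr_ae (Eventually.of_forall fun x => ?_)
    dsimp only
    split_ifs <;> simp
  have hi := (h.mem.posPart_sub hk).integrable_pow_six
  have h2 : ∫ x in ball (0 : E3) R, |f (u x)| * max (u x - l) 0 ≤
      ∫ x in ball (0 : E3) R, (1 + C) * (l / (l - k)) ^ 5 * max (u x - k) 0 ^ 6 := by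
    refine integral_mono_of_nonneg (Eventually.of_forall fun x => ?_)
      (hi.integrableOn.const_mul _) (Eventually.of_forall fun x => ?_)
    · exact mul_nonneg (abs_nonneg _) (le_max_right _ _)
    · dsimp only
      rcases le_or_gt (u x) l with h3 | h3
      · rw [max_eq_right (by linarith), mul_zero]
        have : 0 ≤ l / (l - k) := by positivity
        have : 0 ≤ max (u x - k) 0 := le_max_right _ _
        positivity
      · rw [max_eq_left (by linarith), max_eq_left (by linarith)]
        have h4 := hb (u x)
        rw [abs_of_pos (by linarith : 0 < u x)] at h4
        have h5 : u x ≤ u x ^ 5 := le_self_pow₀ (by linarith) (by norm_num)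
        have h6 : u x ≤ l / (l - k) * (u x - k) := by
          rw [div_mul_eq_mul_div, le_div_iff₀ hlk]
          nlinarith
        calc |f (u x)| * (u x - l) ≤ ((1 + C) * (l / (l - k) * (u x - k)) ^ 5) * (u x - k) := by
              have : 0 ≤ u x - l := by linarith
              have h7 : 0 ≤ u x := by linarith
              refine mul_le_mul ?_ (by linarith) this (by have := h7.trans h6; positivity)
              calc |f (u x)| ≤ (1 + C) * u x ^ 5 := by linarith
                _ ≤ _ := by gcongr
          _ = _ := by ring
  rw [MeasureTheory.integral_const_mul] at h2
  have h3 : ∫ x in ball (0 : E3) R, max (u x - k) 0 ^ 6 ≤ ∫ x, max (u x - k) 0 ^ 6 :=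
    setIntegral_le_integral hi (Eventually.of_forall fun x => by
      have : 0 ≤ max (u x - k) 0 := le_max_right _ _
      simp only [Pi.zero_apply]; positivity)
  have hm : 0 ≤ l / (l - k) := by positivity
  rw [e1]
  have h0 : 0 ≤ ∫ x, inner ℝ (D x) (if l < u x then D x else 0) := by
    rw [← e1]; exact integral_nonneg fun x => sq_nonneg _
  calc _ ≤ S * ((1 + C) * (l / (l - k)) ^ 5 * ∫ x, max (u x - k) 0 ^ 6) ^ 3 := by
        gcongr
        refine h1.trans (h2.trans ?_)
        gcongr
    _ = _ := by ring

theorem tendsto_integral_posPart_sub (h : H10 R u D) :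
    Tendsto (fun n : ℕ => ∫ x, max (u x - n) 0 ^ 6) atTop (𝓝 0) := by
  suffices Tendsto (fun n : ℕ => ∫ x, max (u x - n) 0 ^ 6) atTop (𝓝 (∫ x : E3, (0 : ℝ))) by
    simpa using this
  refine tendsto_integral_of_dominated_convergence (fun x => u x ^ 6)
    (fun n => ((h.posPart_sub n.cast_nonneg).aestronglyMeasurable.pow 6)) h.integrable_pow_six
    (fun n => Eventually.of_forall fun x => ?_) (Eventually.of_forall fun x => ?_)
  · rw [norm_pow, Real.norm_eq_abs, ← (by decide : Even 6).pow_abs (u x), abs_of_nonneg (le_max_right (u x - n) (0 : ℝ))]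
    refine pow_le_pow_left₀ (le_max_right _ _) ?_ 6
    exact max_le (by linarith [le_abs_self (u x), n.cast_nonneg (α := ℝ)]) (abs_nonneg _)
  · obtain ⟨N, hN⟩ := exists_nat_ge (u x)
    refine tendsto_const_nhds.congr' ?_
    filter_upwards [eventually_ge_atTop N] with n hn
    have : (N : ℝ) ≤ n := Nat.cast_le.2 hn
    rw [max_eq_right (by linarith)]
    simp

/-- De Giorgi iteration. -/
theorem exists_upper_bound (hV : ∀ x, 0 ≤ V x) (hf : Nonlin f) (h : Crit f V R u D) :
    ∃ K, ∀ᵐ x, u x ≤ K := by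
  obtain ⟨S, hS, hstep⟩ := h.exists_pow_six_step hV hf
  obtain ⟨η, hη, hη1⟩ : ∃ η : ℝ, 0 < η ∧ S * (2 ^ 15) ^ 3 * η ^ 2 ≤ 1 := by
    have hc : 0 ≤ S * (2 ^ 15) ^ 3 := by positivity
    refine ⟨1 / (1 + S * (2 ^ 15) ^ 3), by positivity, ?_⟩
    rw [div_pow, one_pow, mul_one_div, div_le_one (by positivity)]
    nlinarith
  obtain ⟨K, hK1, hK⟩ := ((eventually_ge_atTop 1).and
    ((tendsto_integral_posPart_sub h.mem).eventually (ge_mem_nhds hη))).exists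
  have hK0 : (1 : ℝ) ≤ K := by exact_mod_cast hK1
  set k : ℕ → ℝ := fun n => K * (2 - (1 / 2) ^ n) with hk
  have hp : ∀ n : ℕ, (0 : ℝ) < (1 / 2) ^ n ∧ ((1 : ℝ) / 2) ^ n ≤ 1 := fun n =>
    ⟨by positivity, pow_le_one₀ (by norm_num) (by norm_num)⟩
  have ha := le_geometric_of_cubic_recursion (a := fun n => ∫ x, max (u x - k n) 0 ^ 6) (S := S)
    (q := 2 ^ 15) (η := η) (fun n => integral_nonneg fun x => pow_nonneg (le_max_right _ _) 6) hS
    (by norm_num) (fun n => ?_) (by simpa [hk, show (2 : ℝ) - 1 = 1 by norm_num] using hK) hη1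
  · have hz : ∫ x, max (u x - 2 * K) 0 ^ 6 = 0 := by
      refine le_antisymm ?_ (integral_nonneg fun x => pow_nonneg (le_max_right _ _) 6)
      have hl : Tendsto (fun n : ℕ => η * ((2 ^ 15 : ℝ)⁻¹) ^ n) atTop (𝓝 0) := by
        simpa using (tendsto_pow_atTop_nhds_zero_of_lt_one (by positivity)
          (by norm_num : ((2 ^ 15 : ℝ)⁻¹) < 1)).const_mul η
      refine ge_of_tendsto' hl fun n => le_trans ?_ (ha n)
      have hkn : 0 ≤ k n := mul_nonneg (by linarith) (by linarith [(hp n).2])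
      refine integral_mono (h.mem.posPart_sub (by linarith)).integrable_pow_six
        (h.mem.posPart_sub hkn).integrable_pow_six fun x => ?_
      refine pow_le_pow_left₀ (le_max_right _ _) (max_le_max ?_ le_rfl) 6
      have : k n ≤ 2 * K := by
        simp only [hk]; nlinarith [(hp n).1]
      linarith
    rw [integral_eq_zero_iff_of_nonneg (fun x => pow_nonneg (le_max_right _ _) 6)
      (h.mem.posPart_sub (by linarith)).integrable_pow_six] at hz
    refine ⟨2 * K, hz.mono fun x hx => ?_⟩
    have := pow_eq_zero_iff (by norm_num : 6 ≠ 0) |>.1 hx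
    linarith [le_max_left (u x - 2 * K) 0]
  · have h1 : k n < k (n + 1) := by
      simp only [hk, pow_succ]; nlinarith [(hp n).1]
    refine (hstep (k n) (k (n + 1)) (mul_nonneg (by linarith) (by linarith [(hp n).2])) h1 ?_).trans ?_
    · simp only [hk]; nlinarith [(hp (n + 1)).2]
    · have h2 : k (n + 1) / (k (n + 1) - k n) ≤ 2 ^ (n + 2) := by
        rw [div_le_iff₀ (by linarith)]
        have e : k (n + 1) - k n = K * ((1 / 2) ^ n / 2) := by simp only [hk, pow_succ]; ring
        have e2 : (2 : ℝ) ^ (n + 2) * (K * ((1 / 2) ^ n / 2)) = 2 * K := by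
          rw [one_div, inv_pow, pow_add]; field_simp
        rw [e, e2]
        simp only [hk]
        nlinarith [(hp (n + 1)).1]
      have h3 : 0 ≤ k (n + 1) / (k (n + 1) - k n) := by
        refine div_nonneg (mul_nonneg (by linarith) (by linarith [(hp (n + 1)).2])) (by linarith)

      have e3 : S * (2 ^ 15) ^ 2 * (2 ^ 15) ^ n = S * ((2 : ℝ) ^ (n + 2)) ^ 15 := by
        rw [← pow_mul, ← pow_mul, ← pow_mul, mul_assoc, ← pow_add]; ring_nf
      rw [e3]
      have h5 : 0 ≤ ∫ x, max (u x - k n) 0 ^ 6 :=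
        integral_nonneg fun x => pow_nonneg (le_max_right _ _) 6
      gcongr

theorem exists_bound (hV : ∀ x, 0 ≤ V x) (hf : Nonlin f) (h : Crit f V R u D) :
    ∃ K, 0 ≤ K ∧ ∀ᵐ x, |u x| ≤ K := by
  obtain ⟨K, hK⟩ := h.exists_upper_bound hV hf
  obtain ⟨K', hK'⟩ := h.neg.exists_upper_bound hV hf.reflect
  refine ⟨max (max K K') 0, le_max_right _ _, ?_⟩
  filter_upwards [hK, hK'] with x h1 h2
  exact (abs_le'.2 ⟨h1.trans (le_max_left _ _), h2.trans (le_max_right _ _)⟩).trans (le_max_left _ _)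

end Crit

end

section

variable {f : ℝ → ℝ} {V : E3 → ℝ} {α R : ℝ} {u w : E3 → ℝ} {D : E3 → E3}

/-- The right-hand side of the equation `-Δu = f(u) - V u - φ_u u`. -/
def rhs (f : ℝ → ℝ) (V : E3 → ℝ) (u : E3 → ℝ) (x : E3) : ℝ := f (u x) - V x * u x - phiu u x * u x

theorem phiu_eq (u : E3 → ℝ) (x : E3) :
    phiu u x = 1 / (4 * Real.pi) * newt (fun y => u y ^ 2) x := rfl

theorem rhs_congr_ae (h : u =ᵐ[volume] w) : rhs f V u =ᵐ[volume] rhs f V w := by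
  filter_upwards [h] with x hx
  simp only [rhs, phiu_eq, hx, newt_congr_ae (k := fun y => u y ^ 2) (l := fun y => w y ^ 2)
    (h.mono fun y hy => by simp only [hy])]

theorem exists_phiu_bound (hL : L2Ball R fun x => u x ^ 2) : ∃ C, 0 ≤ C ∧ ∀ x, |phiu u x| ≤ C := by
  obtain ⟨C, hC, h⟩ := exists_newt_bound R
  refine ⟨1 / (4 * Real.pi) * (C * √(∫ y, (u y ^ 2) ^ 2)), by positivity, fun x => ?_⟩
  rw [phiu_eq, abs_mul, abs_of_pos (by positivity : 0 < 1 / (4 * Real.pi))]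
  gcongr
  exact h _ hL x

theorem exists_rhs_bound (hf : Nonlin f) (hV : Continuous V) (hL : L2Ball R fun x => u x ^ 2)
    {K : ℝ} (hK : ∀ x, |u x| ≤ K) (hz : ∀ x ∉ ball (0 : E3) R, u x = 0) :
    ∃ M, ∀ x, |rhs f V u x| ≤ M := by
  obtain ⟨C, hC, hφ⟩ := exists_phiu_bound hL
  obtain ⟨A, hA⟩ := (isCompact_closedBall (0 : E3) R).exists_bound_of_continuousOn hV.continuousOn
  obtain ⟨B, hB⟩ := (isCompact_Icc (a := -K) (b := K)).exists_bound_of_continuousOn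
    hf.continuous.continuousOn
  have hK0 : 0 ≤ K := (abs_nonneg _).trans (hK 0)
  have hB0 : 0 ≤ B := (norm_nonneg _).trans (hB 0 ⟨by linarith, hK0⟩)
  refine ⟨B + |A| * K + C * K, fun x => ?_⟩
  by_cases hx : x ∈ ball (0 : E3) R
  · have h1 := hB (u x) (abs_le.1 (hK x))
    have h2 := hA x (ball_subset_closedBall hx)
    rw [Real.norm_eq_abs] at h1 h2
    calc |rhs f V u x| ≤ |f (u x)| + |V x| * |u x| + |phiu u x| * |u x| := by
          rw [← abs_mul, ← abs_mul]
          exact (abs_sub _ _).trans (add_le_add_left (abs_sub _ _) _)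
      _ ≤ _ := by
          have := hφ x
          have := hK x
          have := h2.trans (le_abs_self A)
          gcongr
  · simp only [rhs, hz x hx, hf.apply_zero, mul_zero, sub_zero, abs_zero]
    positivity

theorem aestronglyMeasurable_rhs (hf : Nonlin f) (hV : Continuous V) (hL : L2Ball R fun x => u x ^ 2)
    (hu : AEStronglyMeasurable u volume) : AEStronglyMeasurable (rhs f V u) volume :=
  ((hf.continuous.comp_aestronglyMeasurable hu).sub (hV.aestronglyMeasurable.mul hu)).sub
    ((hL.aestronglyMeasurable_newt.const_mul (1 / (4 * Real.pi))).mul hu)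

theorem pairing_eq_rhs (hf : Nonlin f) (hV : Continuous V) (h : H10 R u D) {K : ℝ}
    (hK : ∀ x, |u x| ≤ K) {ψ : E3 → ℝ} {Ψ : E3 → E3} (hψ : H10 R ψ Ψ) :
    pairing f V R u D ψ Ψ = (∫ x, inner ℝ (D x) (Ψ x)) - ∫ x, rhs f V u x * ψ x := by
  have i1 : IntegrableOn (fun x => f (u x) * ψ x) (ball 0 R) := by
    obtain ⟨B, hB⟩ := (isCompact_Icc (a := -K) (b := K)).exists_bound_of_continuousOn
      hf.continuous.continuousOn
    exact (hψ.l2Ball.integrable.integrableOn.bdd_mul (c := B)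
      (hf.continuous.comp_aestronglyMeasurable h.aestronglyMeasurable).restrict
      (Eventually.of_forall fun x => hB (u x) (abs_le.1 (hK x))))
  have i2 : IntegrableOn (fun x => V x * (u x * ψ x)) (ball 0 R) :=
    H10.integrableOn_pot hV (h.integrable_mul hψ)
  have i3 := (h.l2Ball_sq.integrable_newt_mul (h.l2Ball_mul hψ)).const_mul (1 / (4 * Real.pi))
  have e3 : 1 / (4 * Real.pi) * coul (fun x => u x ^ 2) (fun x => u x * ψ x) =
      ∫ x in ball (0 : E3) R, 1 / (4 * Real.pi) * (newt (fun x => u x ^ 2) x * (u x * ψ x)) := by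
    rw [coul, ← MeasureTheory.integral_const_mul]
    refine (setIntegral_eq_integral_of_ae_compl_eq_zero ?_).symm
    filter_upwards [h.zero] with x hx hxb
    simp [hx hxb]
  have e4 : ∫ x, rhs f V u x * ψ x = ∫ x in ball (0 : E3) R, rhs f V u x * ψ x := by
    refine (setIntegral_eq_integral_of_ae_compl_eq_zero ?_).symm
    filter_upwards [hψ.zero] with x hx hxb
    simp [hx hxb]
  have e5 : ∫ x in ball (0 : E3) R, rhs f V u x * ψ x =
      (∫ x in ball (0 : E3) R, f (u x) * ψ x) - (∫ x in ball (0 : E3) R, V x * (u x * ψ x)) -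
      ∫ x in ball (0 : E3) R, 1 / (4 * Real.pi) * (newt (fun x => u x ^ 2) x * (u x * ψ x)) := by
    have i4 : IntegrableOn (fun x => f (u x) * ψ x - V x * (u x * ψ x)) (ball 0 R) := i1.sub i2
    rw [← integral_sub i1 i2, ← integral_sub i4 i3.integrableOn]
    refine integral_congr_ae (Eventually.of_forall fun x => ?_)
    simp only [rhs, phiu_eq]
    ring
  rw [pairing, e3, e4, e5]
  ring

/-- `u` is a bounded weak solution of `-Δu = g` in the ball of radius `R` with zero boundary
values. -/
structure WeakSol (R : ℝ) (u : E3 → ℝ) (D : E3 → E3) (g : E3 → ℝ) : Prop where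
  mem : H10 R u D
  bound : ∃ K, ∀ x, |u x| ≤ K
  zero : ∀ x ∉ ball (0 : E3) R, u x = 0
  meas : AEStronglyMeasurable g volume
  bound' : ∃ M, ∀ x, |g x| ≤ M
  zero' : ∀ x ∉ ball (0 : E3) R, g x = 0
  eq : ∀ ψ Ψ K, H10 R ψ Ψ → (∀ x, |ψ x| ≤ K) → ∫ x, inner ℝ (D x) (Ψ x) = ∫ x, g x * ψ x

theorem WeakSol.congr (hf : Nonlin f) (hV : Continuous V) (h : WeakSol R u D (rhs f V u))
    (hw : w =ᵐ[volume] u) {K : ℝ} (hK : ∀ x, |w x| ≤ K) (hz : ∀ x ∉ ball (0 : E3) R, w x = 0) :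
    WeakSol R w D (rhs f V w) where
  mem := h.mem.congr_ae hw.symm EventuallyEq.rfl
  bound := ⟨K, hK⟩
  zero := hz
  meas := h.meas.congr (rhs_congr_ae hw.symm)
  bound' := exists_rhs_bound hf hV (h.mem.congr_ae hw.symm EventuallyEq.rfl).l2Ball_sq hK hz
  zero' x hx := by simp [rhs, hz x hx, hf.apply_zero]
  eq ψ Ψ K hψ hψK := by
    rw [h.eq ψ Ψ K hψ hψK]
    refine integral_congr_ae ?_
    filter_upwards [rhs_congr_ae (f := f) (V := V) hw] with x hx
    rw [hx]

theorem Crit.exists_weakSol (hV : ∀ x, 0 ≤ V x) (hVc : Continuous V) (hf : Nonlin f)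
    (h : Crit f V R u D) : ∃ w, w =ᵐ[volume] u ∧ WeakSol R w D (rhs f V w) := by
  obtain ⟨K, hK0, hK⟩ := h.exists_bound hV hf
  classical
  set w : E3 → ℝ := fun x => if x ∈ ball (0 : E3) R ∧ |u x| ≤ K then u x else 0 with hw
  have hwu : w =ᵐ[volume] u := by
    filter_upwards [hK, h.mem.zero] with x h1 h2
    by_cases hx : x ∈ ball (0 : E3) R
    · exact if_pos ⟨hx, h1⟩
    · rw [h2 hx]; exact if_neg fun h => hx h.1
  have hwK : ∀ x, |w x| ≤ K := fun x => by
    simp only [hw]; split_ifs with h1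
    · exact h1.2
    · simpa using hK0
  have hz : ∀ x ∉ ball (0 : E3) R, w x = 0 := fun x hx => if_neg fun h => hx h.1
  have hm := h.mem.congr_ae hwu.symm EventuallyEq.rfl
  refine ⟨w, hwu, hm, ⟨K, hwK⟩, hz, aestronglyMeasurable_rhs hf hVc hm.l2Ball_sq
    hm.aestronglyMeasurable, exists_rhs_bound hf hVc hm.l2Ball_sq hwK hz,
    fun x hx => by simp [rhs, hz x hx, hf.apply_zero], fun ψ Ψ C hψ hC => ?_⟩
  have h1 := h.pairing_eq_zero_of_bounded hV hf hψ (Eventually.of_forall hC)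
  have h2 : pairing f V R u D ψ Ψ = pairing f V R w D ψ Ψ := by
    have e1 : coul (fun x => u x ^ 2) (fun x => u x * ψ x) =
        coul (fun x => w x ^ 2) (fun x => w x * ψ x) :=
      coul_congr (hwu.mono fun x hx => by simp only [hx]) (hwu.mono fun x hx => by simp only [hx])
    have e2 : ∫ x in ball (0 : E3) R, V x * (u x * ψ x) =
        ∫ x in ball (0 : E3) R, V x * (w x * ψ x) :=
      integral_congr_ae ((ae_restrict_of_ae hwu).mono fun x hx => by simp only [hx])
    have e3 : ∫ x in ball (0 : E3) R, f (u x) * ψ x = ∫ x in ball (0 : E3) R, f (w x) * ψ x :=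
      integral_congr_ae ((ae_restrict_of_ae hwu).mono fun x hx => by simp only [hx])
    rw [pairing, pairing, e1, e2, e3]
  rw [h2, pairing_eq_rhs hf hVc hm hwK hψ] at h1
  linarith

end

section

variable {R : ℝ} {u ψ g : E3 → ℝ} {D Ψ : E3 → E3}

theorem H10.integral_inner_id (hR : 0 < R) (h : H10 R ψ Ψ) :
    Integrable (fun x => inner ℝ x (Ψ x)) ∧ ∫ x, inner ℝ x (Ψ x) = -3 * ∫ x, ψ x := by
  let η : ContDiffBump (0 : E3) := ⟨R, R + 1, hR, by linarith⟩
  have hη : ∀ x ∈ ball (0 : E3) R, η =ᶠ[𝓝 x] 1 := fun x hx => η.eventuallyEq_one_of_mem_ball hx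
  let ζ : Fin 3 → E3 → ℝ := fun i x => x i * η x
  have hζ : ∀ i, IsTest (ζ i) := fun i =>
    ⟨(contDiff_euclidean.1 contDiff_id i).mul η.contDiff, η.hasCompactSupport.mul_left⟩
  have hfd : ∀ i, ∀ x ∈ ball (0 : E3) R, fderiv ℝ (ζ i) x (EuclideanSpace.single i 1) = 1 := by
    intro i x hx
    have e : ζ i =ᶠ[𝓝 x] fun y => EuclideanSpace.proj (𝕜 := ℝ) i y := by
      filter_upwards [hη x hx] with y hy
      simp [ζ, hy]
    rw [e.fderiv_eq, ContinuousLinearMap.fderiv]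
    simp
  have hterm : ∀ i, (fun x => inner ℝ (Ψ x) (EuclideanSpace.single i (1 : ℝ)) * ζ i x) =ᵐ[volume]
      fun x => x i * Ψ x i := by
    intro i
    filter_upwards [h.grad_zero] with x hx
    by_cases hxb : x ∈ ball (0 : E3) R
    · have := (hη x hxb).self_of_nhds
      simp only [EuclideanSpace.inner_single_right, ζ, this]
      simp [mul_comm]
    · simp [hx hxb]
  have hInt : ∀ i, Integrable fun x => x i * Ψ x i := fun i =>
    ((integrable_inner_of_memLp (g := fun x => ζ i x • EuclideanSpace.single i (1 : ℝ))
      h.h1.memLp_grad (((hζ i).1.continuous.smul continuous_const).memLp_of_hasCompactSupport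
      ((hζ i).2.smul_right))).congr
      (Eventually.of_forall fun x => by simp only [inner_smul_right]; ring)).congr (hterm i)
  have hval : ∀ i, ∫ x, x i * Ψ x i = -∫ x, ψ x := by
    intro i
    rw [← integral_congr_ae (hterm i), h.h1.integral_inner_mul (hζ i)]
    congr 1
    refine integral_congr_ae ?_
    filter_upwards [h.zero] with x hx
    by_cases hxb : x ∈ ball (0 : E3) R
    · simp only [hfd i x hxb, mul_one]
    · simp [hx hxb]
  have e : ∀ x, inner ℝ x (Ψ x) = ∑ i, x i * Ψ x i := fun x => by
    simp [PiLp.inner_apply, mul_comm]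
  simp only [e]
  refine ⟨integrable_finsetSum _ fun i _ => hInt i, ?_⟩
  rw [MeasureTheory.integral_finsetSum _ fun i _ => hInt i]
  simp only [hval, Finset.sum_const, Finset.card_univ, Fintype.card_fin]
  ring

/-- The paraboloid `C (R² - |x|²)⁺` belongs to the zero-trace space and `-Δ` of it is `6 C`. -/
theorem exists_barrier (hR : 0 < R) {C : ℝ} (hC : 0 < C) : ∃ B : E3 → E3,
    H10 R (fun x => max (C * (R ^ 2 - ‖x‖ ^ 2)) 0) B ∧ ∀ ψ Ψ, H10 R ψ Ψ →
      ∫ x, inner ℝ (B x) (Ψ x) = 6 * C * ∫ x, ψ x := by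
  let η : ContDiffBump (0 : E3) := ⟨R, R + 1, hR, by linarith⟩
  let p : E3 → ℝ := fun x => C * (R ^ 2 - ‖x‖ ^ 2) * η x
  have hp : IsTest p := ⟨(contDiff_const.mul (contDiff_const.sub (contDiff_norm_sq ℝ))).mul η.contDiff,
    η.hasCompactSupport.mul_left⟩
  have e1 : ∀ x, max (p x) 0 = max (C * (R ^ 2 - ‖x‖ ^ 2)) 0 := by
    intro x
    by_cases hx : x ∈ closedBall (0 : E3) R
    · simp only [p, η.one_of_mem_closedBall hx, mul_one]
    · rw [mem_closedBall_zero_iff, not_le] at hx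
      have h1 : C * (R ^ 2 - ‖x‖ ^ 2) ≤ 0 := by
        have : R ^ 2 ≤ ‖x‖ ^ 2 := by gcongr
        nlinarith
      rw [max_eq_right h1, max_eq_right (mul_nonpos_of_nonpos_of_nonneg h1 η.nonneg)]
  have hH := hp.h1.posPart
  have hH0 : H10 R (fun x => max (C * (R ^ 2 - ‖x‖ ^ 2)) 0)
      fun x => if 0 < p x then gradient p x else 0 := by
    refine ⟨hH.congr_ae (Eventually.of_forall e1) EventuallyEq.rfl, Eventually.of_forall fun x hx => ?_⟩
    rw [mem_ball_zero_iff, not_lt] at hx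
    have : R ^ 2 ≤ ‖x‖ ^ 2 := by gcongr
    exact max_eq_right (by nlinarith)
  refine ⟨_, hH0, fun ψ Ψ hψ => ?_⟩
  have e2 : ∫ x, inner ℝ (if 0 < p x then gradient p x else 0) (Ψ x) =
      ∫ x, (-2 * C) * inner ℝ x (Ψ x) := by
    refine integral_congr_ae ?_
    filter_upwards [hψ.grad_zero] with x hx
    by_cases hxb : x ∈ ball (0 : E3) R
    · have hη : η =ᶠ[𝓝 x] 1 := η.eventuallyEq_one_of_mem_ball hxb
      have h1 : 0 < p x := by
        have h2 : ‖x‖ ^ 2 < R ^ 2 := by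
          have := mem_ball_zero_iff.1 hxb
          gcongr
        have := hη.self_of_nhds
        simp only [p, this, Pi.one_apply, mul_one]
        exact mul_pos hC (by linarith)
      have h3 : p =ᶠ[𝓝 x] fun y => C * (R ^ 2 - ‖y‖ ^ 2) := by
        filter_upwards [hη] with y hy
        simp [p, hy]
      rw [if_pos h1, inner_gradient_left, h3.fderiv_eq,
        (((hasStrictFDerivAt_norm_sq x).hasFDerivAt.const_sub (R ^ 2)).const_mul C).fderiv]
      simp
      ring
    · simp [hx hxb]
  rw [e2, MeasureTheory.integral_const_mul, (hψ.integral_inner_id hR).2]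
  ring

namespace WeakSol

theorem neg (h : WeakSol R u D g) : WeakSol R (fun x => -u x) (fun x => -D x) fun x => -g x where
  mem := h.mem.neg
  bound := by simpa only [abs_neg] using h.bound
  zero x hx := by rw [h.zero x hx, neg_zero]
  meas := h.meas.neg
  bound' := by simpa only [abs_neg] using h.bound'
  zero' x hx := by rw [h.zero' x hx, neg_zero]
  eq ψ Ψ K hψ hK := by
    simp only [inner_neg_left, neg_mul, MeasureTheory.integral_neg, h.eq ψ Ψ K hψ hK]

theorem exists_upper_barrier (hR : 0 < R) (h : WeakSol R u D g) :
    ∃ C, 0 ≤ C ∧ ∀ᵐ x, u x ≤ max (C * (R ^ 2 - ‖x‖ ^ 2)) 0 := by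
  obtain ⟨M, hM⟩ := h.bound'
  obtain ⟨K, hK⟩ := h.bound
  have hM0 : 0 ≤ M := (abs_nonneg _).trans (hM 0)
  have hK0 : 0 ≤ K := (abs_nonneg _).trans (hK 0)
  obtain ⟨B, hB, hBi⟩ := exists_barrier hR (by positivity : 0 < M + 1)
  refine ⟨M + 1, by positivity, ?_⟩
  obtain ⟨S, hS, hSob⟩ := exists_pow_six_le
  have hψ := (h.mem.sub hB).posPart
  set b : E3 → ℝ := fun x => max ((M + 1) * (R ^ 2 - ‖x‖ ^ 2)) 0 with hb
  have hb0 : ∀ x, 0 ≤ b x := fun x => le_max_right _ _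
  have h0 : ∀ x, 0 ≤ max (u x - b x) 0 := fun x => le_max_right _ _
  have h1 := h.eq _ _ K hψ fun x => by
    rw [abs_of_nonneg (h0 x)]
    exact max_le (by linarith [hb0 x, le_abs_self (u x), hK x]) hK0
  have h2 := hBi _ _ hψ
  have h3 : ∫ x, ‖(if 0 < u x - b x then D x - B x else 0)‖ ^ 2 =
      (∫ x, inner ℝ (D x) (if 0 < u x - b x then D x - B x else 0)) -
      ∫ x, inner ℝ (B x) (if 0 < u x - b x then D x - B x else 0) := by
    rw [← integral_sub (integrable_inner_of_memLp h.mem.h1.memLp_grad hψ.h1.memLp_grad)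
      (integrable_inner_of_memLp hB.h1.memLp_grad hψ.h1.memLp_grad)]
    refine integral_congr_ae (Eventually.of_forall fun x => ?_)
    dsimp only
    rw [← inner_sub_left]
    split_ifs <;> simp
  have hi := hψ.l2Ball.integrable
  have h4 : ∫ x, g x * max (u x - b x) 0 ≤ 6 * (M + 1) * ∫ x, max (u x - b x) 0 := by
    rw [← MeasureTheory.integral_const_mul]
    refine integral_mono (hi.bdd_mul (c := M) h.meas (Eventually.of_forall hM)) (hi.const_mul _)
      fun x => ?_
    exact mul_le_mul_of_nonneg_right (by linarith [le_abs_self (g x), hM x]) (h0 x)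
  have h5 : ∫ x, ‖(if 0 < u x - b x then D x - B x else 0)‖ ^ 2 ≤ 0 := by
    rw [h3, h1, h2]; linarith
  have h6 : ∫ x, ‖(if 0 < u x - b x then D x - B x else 0)‖ ^ 2 = 0 :=
    le_antisymm h5 (integral_nonneg fun x => sq_nonneg _)
  have h7 := hSob R _ _ hψ
  rw [h6] at h7
  have h8 : ∫ x, max (u x - b x) 0 ^ 6 = 0 :=
    le_antisymm (by simpa using h7) (integral_nonneg fun x => pow_nonneg (h0 x) 6)
  rw [integral_eq_zero_iff_of_nonneg (fun x => pow_nonneg (h0 x) 6) hψ.integrable_pow_six] at h8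
  filter_upwards [h8] with x hx
  have := pow_eq_zero_iff (by norm_num : 6 ≠ 0) |>.1 hx
  linarith [le_max_left (u x - b x) 0]

/-- Bounded weak solutions vanish at the boundary at least linearly. -/
theorem exists_barrier (hR : 0 < R) (h : WeakSol R u D g) :
    ∃ C, 0 ≤ C ∧ ∀ᵐ x, |u x| ≤ max (C * (R ^ 2 - ‖x‖ ^ 2)) 0 := by
  obtain ⟨C, hC, h1⟩ := h.exists_upper_barrier hR
  obtain ⟨C', hC', h2⟩ := h.neg.exists_upper_barrier hR
  refine ⟨max C C', le_max_of_le_left hC, ?_⟩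
  filter_upwards [h1, h2] with x h1 h2
  have key : ∀ c, 0 ≤ c → c ≤ max C C' → max (c * (R ^ 2 - ‖x‖ ^ 2)) 0 ≤
      max (max C C' * (R ^ 2 - ‖x‖ ^ 2)) 0 := by
    intro c hc hc'
    refine max_le ?_ (le_max_right _ _)
    rcases le_total 0 (R ^ 2 - ‖x‖ ^ 2) with h | h
    · exact (mul_le_mul_of_nonneg_right hc' h).trans (le_max_left _ _)
    · exact (mul_nonpos_of_nonneg_of_nonpos hc h).trans (le_max_right _ _)
  exact abs_le'.2 ⟨h1.trans (key C hC (le_max_left _ _)), h2.trans (key C' hC' (le_max_right _ _))⟩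

end WeakSol

end

/-! ### A truncated Newtonian kernel and its smooth approximations

With `χ` a cutoff on the line, `radial χ e (|z|²)` is a truncation of `(|z|² + e)^(-1/2)`. -/

section profile

variable (χ : ContDiffBump (0 : ℝ)) {e t : ℝ}

/-- The truncated profile `χ(t) (t + e)^(-1/2)`. -/
def prof (e t : ℝ) : ℝ := χ t * (t + e) ^ (-(1 / 2) : ℝ)

/-- The derivative of `prof`. -/
def prof' (e t : ℝ) : ℝ :=
  deriv χ t * (t + e) ^ (-(1 / 2) : ℝ) - 1 / 2 * (χ t * (t + e) ^ (-(3 / 2) : ℝ))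

/-- The second derivative of `prof`. -/
def prof'' (e t : ℝ) : ℝ :=
  deriv (deriv χ) t * (t + e) ^ (-(1 / 2) : ℝ) - deriv χ t * (t + e) ^ (-(3 / 2) : ℝ) +
    3 / 4 * (χ t * (t + e) ^ (-(5 / 2) : ℝ))

/-- The part of the radial Laplacian of `prof` coming from the cutoff. -/
def profRes (e t : ℝ) : ℝ :=
  (6 * deriv χ t + 4 * t * deriv (deriv χ) t) * (t + e) ^ (-(1 / 2) : ℝ) -
    4 * t * deriv χ t * (t + e) ^ (-(3 / 2) : ℝ)

theorem hasDerivAt_add_rpow (h : 0 < t + e) (p q : ℝ) (hq : q = p - 1) :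
    HasDerivAt (fun t => (t + e) ^ p) (p * (t + e) ^ q) t := by
  subst hq
  simpa using ((hasDerivAt_id t).add_const e).rpow_const (p := p) (Or.inl h.ne')

theorem contDiff_deriv_bump : ContDiff ℝ ∞ (deriv χ) := by
  have h : ContDiff ℝ ∞ χ := χ.contDiff
  exact (contDiff_infty_iff_deriv.1 h).2

theorem contDiff_deriv_deriv_bump : ContDiff ℝ ∞ (deriv (deriv χ)) :=
  (contDiff_infty_iff_deriv.1 (contDiff_deriv_bump χ)).2

theorem hasDerivAt_prof (h : 0 < t + e) : HasDerivAt (prof χ e) (prof' χ e t) t := by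
  have h1 : HasDerivAt χ (deriv χ t) t := (χ.contDiff.differentiable one_ne_zero t).hasDerivAt
  refine (h1.mul (hasDerivAt_add_rpow h (-(1 / 2)) (-(3 / 2)) (by norm_num))).congr_deriv ?_
  simp only [prof']
  ring

theorem hasDerivAt_prof' (h : 0 < t + e) : HasDerivAt (prof' χ e) (prof'' χ e t) t := by
  have h1 : HasDerivAt χ (deriv χ t) t := (χ.contDiff.differentiable one_ne_zero t).hasDerivAt
  have h2 : HasDerivAt (deriv χ) (deriv (deriv χ) t) t :=
    ((contDiff_deriv_bump χ).differentiable (by simp) t).hasDerivAt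
  refine ((h2.mul (hasDerivAt_add_rpow h (-(1 / 2)) (-(3 / 2)) (by norm_num))).sub
    ((h1.mul (hasDerivAt_add_rpow h (-(3 / 2)) (-(5 / 2)) (by norm_num))).const_mul
      (1 / 2))).congr_deriv ?_
  simp only [prof'']
  ring

theorem prof_laplacian (h : 0 < t + e) : 6 * prof' χ e t + 4 * t * prof'' χ e t =
    -(3 * e * (t + e) ^ (-(5 / 2) : ℝ)) * χ t + profRes χ e t := by
  have h1 : (t + e) ^ (-(3 / 2) : ℝ) = (t + e) * (t + e) ^ (-(5 / 2) : ℝ) := by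
    rw [← Real.rpow_one_add' h.le (by norm_num)]; norm_num
  simp only [prof', prof'', profRes]
  linear_combination (-3 * χ t) * h1

theorem bump_eventuallyEq_zero (ht : χ.rOut < t) : χ =ᶠ[𝓝 t] 0 := by
  filter_upwards [lt_mem_nhds ht] with s hs
  exact χ.zero_of_le_dist (by rw [Real.dist_eq, sub_zero]; exact hs.le.trans (le_abs_self s))

theorem bump_zero_of_lt (ht : χ.rOut < t) : χ t = 0 ∧ deriv χ t = 0 ∧ deriv (deriv χ) t = 0 := by
  have h := bump_eventuallyEq_zero χ ht
  refine ⟨h.self_of_nhds, ?_, ?_⟩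
  · rw [h.deriv_eq]; simp
  · rw [h.deriv.deriv_eq]
    have : deriv (0 : ℝ → ℝ) = 0 := by ext; simp
    simp [this]

theorem bump_deriv_zero_of_lt (h0 : |t| < χ.rIn) : deriv χ t = 0 ∧ deriv (deriv χ) t = 0 := by
  have h : χ =ᶠ[𝓝 t] 1 := χ.eventuallyEq_one_of_mem_ball (by simpa using h0)
  have h1 : deriv χ =ᶠ[𝓝 t] 0 := by
    refine h.deriv.trans (Eventually.of_forall fun s => ?_)
    simp
  refine ⟨h1.self_of_nhds, ?_⟩
  rw [h1.deriv_eq]; simp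

theorem exists_deriv_bump_bound :
    ∃ B, 0 ≤ B ∧ ∀ t, |deriv χ t| ≤ B ∧ |deriv (deriv χ) t| ≤ B := by
  have hs : HasCompactSupport χ := χ.hasCompactSupport
  obtain ⟨B, hB⟩ := (contDiff_deriv_bump χ).continuous.bounded_above_of_compact_support hs.deriv
  obtain ⟨B', hB'⟩ := (contDiff_deriv_deriv_bump χ).continuous.bounded_above_of_compact_support
    hs.deriv.deriv
  exact ⟨max B B', (norm_nonneg _).trans ((hB 0).trans (le_max_left _ _)),
    fun t => ⟨(hB t).trans (le_max_left _ _), (hB' t).trans (le_max_right _ _)⟩⟩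

theorem exists_prof_bound : ∃ C, 0 ≤ C ∧ ∀ e t, 0 ≤ e → 0 < t →
    |prof χ e t| ≤ C * t ^ (-(1 / 2) : ℝ) ∧ |prof' χ e t| ≤ C * t ^ (-(3 / 2) : ℝ) ∧
      |prof'' χ e t| ≤ C * t ^ (-(5 / 2) : ℝ) := by
  obtain ⟨B, hB, hb⟩ := exists_deriv_bump_bound χ
  have hA := χ.rOut_pos
  refine ⟨1 + B * χ.rOut + B * χ.rOut ^ 2, by positivity, fun e t he ht => ?_⟩
  have hp : ∀ p : ℝ, p ≤ 0 → (t + e) ^ p ≤ t ^ p := fun p hp =>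
    Real.rpow_le_rpow_of_nonpos ht (by linarith) hp
  have hq : ∀ p : ℝ, 0 ≤ (t + e) ^ p := fun p => Real.rpow_nonneg (by linarith) p
  have hq' : ∀ p : ℝ, 0 ≤ t ^ p := fun p => Real.rpow_nonneg ht.le p
  rcases lt_or_ge χ.rOut t with h | h
  · obtain ⟨h0, h1, h2⟩ := bump_zero_of_lt χ h
    simp only [prof, prof', prof'', h0, h1, h2, zero_mul, mul_zero, sub_zero, add_zero, abs_zero]
    have := hq' (-(1 / 2))
    have := hq' (-(3 / 2))
    have := hq' (-(5 / 2))
    refine ⟨?_, ?_, ?_⟩ <;> positivity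
  · have hχ : |χ t| ≤ 1 := by rw [abs_of_nonneg χ.nonneg]; exact χ.le_one
    have e1 : t ^ (-(1 / 2) : ℝ) ≤ χ.rOut * t ^ (-(3 / 2) : ℝ) := by
      have : t ^ (-(1 / 2) : ℝ) = t * t ^ (-(3 / 2) : ℝ) := by
        rw [← Real.rpow_one_add' ht.le (by norm_num)]; norm_num
      rw [this]
      exact mul_le_mul_of_nonneg_right h (hq' _)
    have e2 : t ^ (-(3 / 2) : ℝ) ≤ χ.rOut * t ^ (-(5 / 2) : ℝ) := by
      have : t ^ (-(3 / 2) : ℝ) = t * t ^ (-(5 / 2) : ℝ) := by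
        rw [← Real.rpow_one_add' ht.le (by norm_num)]; norm_num
      rw [this]
      exact mul_le_mul_of_nonneg_right h (hq' _)
    have b1 : ∀ c B' : ℝ, ∀ p : ℝ, p ≤ 0 → |c| ≤ B' → |c * (t + e) ^ p| ≤ B' * t ^ p := by
      intro c B' p hp' hc
      rw [abs_mul, abs_of_nonneg (hq p)]
      exact mul_le_mul hc (hp p hp') (hq p) ((abs_nonneg _).trans hc)
    have c1 := b1 _ _ (-(1 / 2)) (by norm_num) hχ
    have c2 := b1 _ _ (-(3 / 2)) (by norm_num) hχ
    have c3 := b1 _ _ (-(5 / 2)) (by norm_num) hχ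
    have d1 := b1 _ _ (-(1 / 2)) (by norm_num) (hb t).1
    have d2 := b1 _ _ (-(3 / 2)) (by norm_num) (hb t).1
    have d3 := b1 _ _ (-(1 / 2)) (by norm_num) (hb t).2
    have g1 := mul_le_mul_of_nonneg_left e1 hB
    have g2 := mul_le_mul_of_nonneg_left e2 hB
    have g3 := mul_le_mul_of_nonneg_left e2 (mul_nonneg hB hA.le)
    have k1 := mul_nonneg (mul_nonneg hB hA.le) (hq' (-(1 / 2)))
    have k2 := mul_nonneg (mul_nonneg hB (sq_nonneg χ.rOut)) (hq' (-(1 / 2)))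
    have k3 := mul_nonneg (mul_nonneg hB (sq_nonneg χ.rOut)) (hq' (-(3 / 2)))
    have k4 := hq' (-(3 / 2))
    have k5 := hq' (-(5 / 2))
    refine ⟨?_, ?_, ?_⟩
    · simp only [prof]
      linarith
    · simp only [prof']
      rw [abs_le] at c2 d1 ⊢
      constructor <;> linarith
    · simp only [prof'']
      rw [abs_le] at c3 d2 d3 ⊢
      constructor <;> linarith

theorem exists_profRes_bound : ∃ C, 0 ≤ C ∧ ∀ e t, 0 ≤ e → 0 ≤ t → |profRes χ e t| ≤ C := by
  obtain ⟨B, hB, hb⟩ := exists_deriv_bump_bound χ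
  have hA := χ.rOut_pos
  have hI := χ.rIn_pos
  have hI1 : 0 ≤ χ.rIn ^ (-(1 / 2) : ℝ) := Real.rpow_nonneg hI.le _
  have hI2 : 0 ≤ χ.rIn ^ (-(3 / 2) : ℝ) := Real.rpow_nonneg hI.le _
  refine ⟨(6 * B + 4 * χ.rOut * B) * χ.rIn ^ (-(1 / 2) : ℝ) +
    4 * χ.rOut * B * χ.rIn ^ (-(3 / 2) : ℝ), by positivity, fun e t he ht => ?_⟩
  rcases lt_or_ge χ.rOut t with h | h
  · obtain ⟨h0, h1, h2⟩ := bump_zero_of_lt χ h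
    simp only [profRes, h1, h2, mul_zero, zero_mul, add_zero, sub_zero, abs_zero]
    positivity
  rcases lt_or_ge t χ.rIn with h' | h'
  · obtain ⟨h1, h2⟩ := bump_deriv_zero_of_lt χ (by rwa [abs_of_nonneg ht] : |t| < χ.rIn)
    simp only [profRes, h1, h2, mul_zero, zero_mul, add_zero, sub_zero, abs_zero]
    positivity
  · have hp : ∀ p : ℝ, p ≤ 0 → |(t + e) ^ p| ≤ χ.rIn ^ p := fun p hp => by
      rw [abs_of_nonneg (Real.rpow_nonneg (by linarith) p)]
      exact Real.rpow_le_rpow_of_nonpos hI (by linarith) hp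
    have h3 := (hb t).1
    have h4 := (hb t).2
    have h5 : |t| ≤ χ.rOut := by rwa [abs_of_nonneg ht]
    calc |profRes χ e t| ≤ |(6 * deriv χ t + 4 * t * deriv (deriv χ) t) * (t + e) ^ (-(1 / 2) : ℝ)| +
          |4 * t * deriv χ t * (t + e) ^ (-(3 / 2) : ℝ)| := abs_sub _ _
      _ ≤ (6 * |deriv χ t| + 4 * |t| * |deriv (deriv χ) t|) * |(t + e) ^ (-(1 / 2) : ℝ)| +
          4 * |t| * |deriv χ t| * |(t + e) ^ (-(3 / 2) : ℝ)| := by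
          simp only [abs_mul]
          gcongr
          · refine (abs_add_le _ _).trans (le_of_eq ?_)
            simp [abs_mul]
          · simp
      _ ≤ _ := by
          have := hp (-(1 / 2)) (by norm_num)
          have := hp (-(3 / 2)) (by norm_num)
          gcongr

theorem tendsto_add_rpow {e : ℕ → ℝ} (he : Tendsto e atTop (𝓝 0)) (ht : 0 < t) (p : ℝ) :
    Tendsto (fun n => (t + e n) ^ p) atTop (𝓝 ((t + 0) ^ p)) :=
  (tendsto_const_nhds.add he).rpow_const (Or.inl (by simpa using ht.ne'))

theorem tendsto_prof {e : ℕ → ℝ} (he : Tendsto e atTop (𝓝 0)) (ht : 0 < t) :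
    Tendsto (fun n => prof χ (e n) t) atTop (𝓝 (prof χ 0 t)) ∧
    Tendsto (fun n => prof' χ (e n) t) atTop (𝓝 (prof' χ 0 t)) ∧
    Tendsto (fun n => prof'' χ (e n) t) atTop (𝓝 (prof'' χ 0 t)) ∧
    Tendsto (fun n => profRes χ (e n) t) atTop (𝓝 (profRes χ 0 t)) := by
  have h1 := tendsto_add_rpow he ht (-(1 / 2))
  have h2 := tendsto_add_rpow he ht (-(3 / 2))
  have h3 := tendsto_add_rpow he ht (-(5 / 2))
  exact ⟨h1.const_mul _, (h1.const_mul _).sub ((h2.const_mul _).const_mul _),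
    ((h1.const_mul _).sub (h2.const_mul _)).add ((h3.const_mul _).const_mul _),
    (h1.const_mul _).sub (h2.const_mul _)⟩

theorem contDiff_profRes : ContDiff ℝ ∞ fun z : E3 => profRes χ 0 (‖z‖ ^ 2) := by
  have hn : ContDiff ℝ ∞ fun z : E3 => ‖z‖ ^ 2 := contDiff_norm_sq ℝ
  rw [contDiff_iff_contDiffAt]
  intro z
  by_cases hz : z = 0
  · have h1 : ∀ᶠ y : E3 in 𝓝 z, ‖y‖ ^ 2 < χ.rIn := by
      refine hn.continuous.continuousAt.eventually_lt continuousAt_const ?_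
      simpa [hz] using χ.rIn_pos
    refine (contDiffAt_const (c := (0 : ℝ))).congr_of_eventuallyEq ?_
    filter_upwards [h1] with y hy
    obtain ⟨h2, h3⟩ := bump_deriv_zero_of_lt χ (by rwa [abs_of_nonneg (sq_nonneg ‖y‖)] : |‖y‖ ^ 2| < _)
    simp [profRes, h2, h3]
  · have h0 : ‖z‖ ^ 2 + 0 ≠ 0 := by simpa using hz
    have hr : ∀ p : ℝ, ContDiffAt ℝ ∞ (fun z : E3 => (‖z‖ ^ 2 + 0) ^ p) z := fun p =>
      (hn.contDiffAt.add contDiffAt_const).rpow_const_of_ne h0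
    have hd := ((contDiff_deriv_bump χ).comp hn).contDiffAt (x := z)
    have hdd := ((contDiff_deriv_deriv_bump χ).comp hn).contDiffAt (x := z)
    exact (((contDiffAt_const.mul hd).add ((contDiffAt_const.mul hn.contDiffAt).mul hdd)).mul
      (hr _)).sub (((contDiffAt_const.mul hn.contDiffAt).mul hd).mul (hr _))

end profile

section kernels

variable (χ : ContDiffBump (0 : ℝ)) {e ρ : ℝ} {z : E3}

/-- The inner product as a continuous bilinear map. -/
def innerCLM : E3 →L[ℝ] E3 →L[ℝ] ℝ := innerSL ℝ

theorem innerCLM_apply (x y : E3) : innerCLM x y = inner ℝ x y := rfl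

theorem norm_innerCLM_apply (x : E3) : ‖innerCLM x‖ = ‖x‖ := innerSL_apply_norm (𝕜 := ℝ) x

/-- The truncated, regularised Newtonian kernel. -/
def ker (e : ℝ) (z : E3) : ℝ := prof χ e (‖z‖ ^ 2)

/-- The derivative of `ker`. -/
def ker' (e : ℝ) (z : E3) : E3 →L[ℝ] ℝ := (2 * prof' χ e (‖z‖ ^ 2)) • innerCLM z

/-- The derivative of `ker` in the direction `v`. -/
def kerDir (e : ℝ) (v z : E3) : ℝ := 2 * prof' χ e (‖z‖ ^ 2) * inner ℝ v z

/-- The derivative of `kerDir`. -/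
def kerDir' (e : ℝ) (v z : E3) : E3 →L[ℝ] ℝ :=
  (2 * prof' χ e (‖z‖ ^ 2)) • innerCLM v + (4 * prof'' χ e (‖z‖ ^ 2) * inner ℝ v z) • innerCLM z

theorem ker'_apply (v z : E3) : ker' χ e z v = kerDir χ e v z := by
  simp [ker', kerDir, innerCLM_apply, real_inner_comm]

theorem hasFDerivAt_ker (he : 0 < e) (z : E3) : HasFDerivAt (ker χ e) (ker' χ e z) z := by
  have h1 : HasFDerivAt (fun z : E3 => ‖z‖ ^ 2) (2 • innerCLM z) z :=
    (hasStrictFDerivAt_norm_sq z).hasFDerivAt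
  refine ((hasDerivAt_prof χ (by positivity : 0 < ‖z‖ ^ 2 + e)).comp_hasFDerivAt z h1).congr_fderiv ?_
  ext v
  simp [ker']
  ring

theorem hasFDerivAt_kerDir (he : 0 < e) (v z : E3) :
    HasFDerivAt (kerDir χ e v) (kerDir' χ e v z) z := by
  have h1 : HasFDerivAt (fun z : E3 => ‖z‖ ^ 2) (2 • innerCLM z) z :=
    (hasStrictFDerivAt_norm_sq z).hasFDerivAt
  have h2 := ((hasDerivAt_prof' χ (by positivity : 0 < ‖z‖ ^ 2 + e)).comp_hasFDerivAt z h1).const_mul 2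
  refine (h2.mul (innerCLM v).hasFDerivAt).congr_fderiv ?_
  ext w
  simp [kerDir', innerCLM_apply]
  ring

theorem ker_eq_zero (hχ : χ.rOut < ρ ^ 2) (hρ : 0 < ρ) (h : z ∉ ball (0 : E3) ρ) :
    ker χ e z = 0 ∧ ker' χ e z = 0 ∧ ∀ v, kerDir χ e v z = 0 ∧ kerDir' χ e v z = 0 := by
  rw [mem_ball_zero_iff, not_lt] at h
  obtain ⟨h0, h1, h2⟩ := bump_zero_of_lt χ (hχ.trans_le (by gcongr : ρ ^ 2 ≤ ‖z‖ ^ 2))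
  have p1 : prof' χ e (‖z‖ ^ 2) = 0 := by simp [prof', h0, h1]
  have p2 : prof'' χ e (‖z‖ ^ 2) = 0 := by simp [prof'', h0, h1, h2]
  exact ⟨by simp [ker, prof, h0], by simp [ker', p1], fun v => ⟨by simp [kerDir, p1],
    by simp [kerDir', p1, p2]⟩⟩

theorem rpow_norm_sq (z : E3) (p : ℝ) : (‖z‖ ^ 2) ^ p = ‖z‖ ^ (2 * p) := by
  rw [← Real.rpow_natCast, ← Real.rpow_mul (norm_nonneg _)]
  norm_num

theorem exists_ker_bound (hχ : χ.rOut < ρ ^ 2) (hρ : 0 < ρ) : ∃ C, 0 ≤ C ∧ ∀ e z, 0 ≤ e → z ≠ 0 →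
    ‖ker χ e z‖ ≤ (ball (0 : E3) ρ).indicator (fun z => C * ‖z‖ ^ (-1 : ℝ)) z ∧
    ‖ker' χ e z‖ ≤ (ball (0 : E3) ρ).indicator (fun z => C * ‖z‖ ^ (-2 : ℝ)) z ∧
    ∀ v, ‖kerDir' χ e v z‖ ≤ (ball (0 : E3) ρ).indicator (fun z => C * ‖v‖ * ‖z‖ ^ (-3 : ℝ)) z := by
  obtain ⟨C, hC, hb⟩ := exists_prof_bound χ
  refine ⟨6 * C, by positivity, fun e z he hz => ?_⟩
  by_cases hzb : z ∈ ball (0 : E3) ρ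
  · have hz0 : 0 < ‖z‖ := norm_pos_iff.2 hz
    simp only [Set.indicator_of_mem hzb]
    obtain ⟨h0, h1, h2⟩ := hb e (‖z‖ ^ 2) he (by positivity)
    rw [rpow_norm_sq] at h0 h1 h2
    rw [show (2 * -(1 / 2) : ℝ) = -1 by norm_num] at h0
    rw [show (2 * -(3 / 2) : ℝ) = -3 by norm_num] at h1
    rw [show (2 * -(5 / 2) : ℝ) = -5 by norm_num] at h2
    have e2 : ‖z‖ ^ (-3 : ℝ) * ‖z‖ = ‖z‖ ^ (-2 : ℝ) := by
      rw [← Real.rpow_add_one hz0.ne', show (-3 + 1 : ℝ) = -2 by norm_num]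
    have e3 : ‖z‖ ^ (-5 : ℝ) * ‖z‖ * ‖z‖ = ‖z‖ ^ (-3 : ℝ) := by
      rw [← Real.rpow_add_one hz0.ne', ← Real.rpow_add_one hz0.ne',
        show (-5 + 1 + 1 : ℝ) = -3 by norm_num]
    have n1 : 0 ≤ ‖z‖ ^ (-1 : ℝ) := Real.rpow_nonneg hz0.le _
    have n3 : 0 ≤ ‖z‖ ^ (-3 : ℝ) := Real.rpow_nonneg hz0.le _
    refine ⟨?_, ?_, fun v => ?_⟩
    · rw [Real.norm_eq_abs]
      exact h0.trans (by nlinarith [mul_nonneg hC n1])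
    · rw [ker', norm_smul, norm_innerCLM_apply, Real.norm_eq_abs, abs_mul, abs_two, ← e2]
      have := mul_le_mul_of_nonneg_right h1 hz0.le
      have := mul_nonneg hC (mul_nonneg n3 hz0.le)
      linarith
    · calc ‖kerDir' χ e v z‖ ≤ ‖(2 * prof' χ e (‖z‖ ^ 2)) • innerCLM v‖ +
            ‖(4 * prof'' χ e (‖z‖ ^ 2) * inner ℝ v z) • innerCLM z‖ := norm_add_le _ _
        _ = 2 * |prof' χ e (‖z‖ ^ 2)| * ‖v‖ +
            4 * |prof'' χ e (‖z‖ ^ 2)| * |inner ℝ v z| * ‖z‖ := by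
          rw [norm_smul, norm_smul, norm_innerCLM_apply, norm_innerCLM_apply, Real.norm_eq_abs,
            Real.norm_eq_abs, abs_mul, abs_mul, abs_mul, abs_two,
            abs_of_pos (by norm_num : (0 : ℝ) < 4)]
        _ ≤ 2 * (C * ‖z‖ ^ (-3 : ℝ)) * ‖v‖ + 4 * (C * ‖z‖ ^ (-5 : ℝ)) * (‖v‖ * ‖z‖) * ‖z‖ := by
          gcongr
          exact abs_real_inner_le_norm _ _
        _ = 2 * (C * ‖z‖ ^ (-3 : ℝ)) * ‖v‖ + 4 * (C * (‖z‖ ^ (-5 : ℝ) * ‖z‖ * ‖z‖)) * ‖v‖ := by ring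
        _ = _ := by rw [e3]; ring
  · obtain ⟨h0, h1, h2⟩ := ker_eq_zero χ (e := e) hχ hρ hzb
    simp [h0, h1, h2, Set.indicator_of_notMem hzb]

theorem tendsto_ker {e : ℕ → ℝ} (he : Tendsto e atTop (𝓝 0)) (hz : z ≠ 0) :
    Tendsto (fun n => ker χ (e n) z) atTop (𝓝 (ker χ 0 z)) ∧
    Tendsto (fun n => ker' χ (e n) z) atTop (𝓝 (ker' χ 0 z)) ∧
    ∀ v, Tendsto (fun n => kerDir' χ (e n) v z) atTop (𝓝 (kerDir' χ 0 v z)) := by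
  obtain ⟨h0, h1, h2, -⟩ := tendsto_prof χ he (pow_pos (norm_pos_iff.2 hz) 2)
  exact ⟨h0, (h1.const_mul 2).smul_const _, fun v =>
    ((h1.const_mul 2).smul_const _).add (((h2.const_mul 4).mul_const _).smul_const _)⟩

theorem continuous_ker (he : 0 < e) : Continuous (ker χ e) ∧ Continuous (ker' χ e) ∧
    ∀ v, Continuous (kerDir χ e v) ∧ Continuous (kerDir' χ e v) := by
  have hn : Continuous fun z : E3 => ‖z‖ ^ 2 := by fun_prop
  have hr : ∀ p : ℝ, Continuous fun z : E3 => (‖z‖ ^ 2 + e) ^ p := fun p =>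
    (hn.add continuous_const).rpow_const fun z => Or.inl (add_pos_of_nonneg_of_pos (sq_nonneg _) he).ne'
  have c0 := χ.continuous.comp hn
  have c1 := (contDiff_deriv_bump χ).continuous.comp hn
  have c2 := (contDiff_deriv_deriv_bump χ).continuous.comp hn
  have p1 : Continuous fun z : E3 => prof' χ e (‖z‖ ^ 2) :=
    (c1.mul (hr _)).sub (continuous_const.mul (c0.mul (hr _)))
  have p2 : Continuous fun z : E3 => prof'' χ e (‖z‖ ^ 2) :=
    ((c2.mul (hr _)).sub (c1.mul (hr _))).add (continuous_const.mul (c0.mul (hr _)))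
  refine ⟨c0.mul (hr _), (continuous_const.mul p1).smul innerCLM.continuous, fun v =>
    ⟨(continuous_const.mul p1).mul (innerCLM v).continuous, ?_⟩⟩
  exact ((continuous_const.mul p1).smul continuous_const).add
    (((continuous_const.mul p2).mul (innerCLM v).continuous).smul innerCLM.continuous)

theorem ker_laplacian (he : 0 < e) (z : E3) :
    ∑ i : Fin 3, kerDir' χ e (EuclideanSpace.single i 1) z (EuclideanSpace.single i 1) =
      -(3 * e * (‖z‖ ^ 2 + e) ^ (-(5 / 2) : ℝ)) * χ (‖z‖ ^ 2) + profRes χ e (‖z‖ ^ 2) := by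
  rw [← prof_laplacian χ (by positivity : 0 < ‖z‖ ^ 2 + e)]
  have h1 : ‖z‖ ^ 2 = z 0 * z 0 + z 1 * z 1 + z 2 * z 2 := by
    rw [EuclideanSpace.norm_sq_eq]; simp [Fin.sum_univ_three, pow_two]
  simp only [kerDir', add_apply, smul_apply, innerCLM_apply,
    EuclideanSpace.inner_single_right, EuclideanSpace.inner_single_left,
    Fin.sum_univ_three, smul_eq_mul]
  simp
  rw [show 4 * ‖z‖ ^ 2 * prof'' χ e (‖z‖ ^ 2) = 4 * prof'' χ e (‖z‖ ^ 2) * ‖z‖ ^ 2 by ring]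
  generalize prof'' χ e (‖z‖ ^ 2) = a
  rw [h1]
  ring

end kernels

section potential

variable {E : Type*} [NormedAddCommGroup E] {κ : ℕ → E3 → E} {κ₀ : E3 → E}
  {G : E3 → ℝ} {g : E3 → ℝ} {M : ℝ}

theorem integrable_smul_comp_sub [NormedSpace ℝ E] {k : E3 → E} (hk : Integrable k)
    (hg : AEStronglyMeasurable g)
    (hM : ∀ x, |g x| ≤ M) (x : E3) : Integrable fun y => g y • k (x - y) :=
  (hk.comp_sub_left x).bdd_smul M hg (ae_of_all _ hM)

theorem integrable_of_tendsto (hκ : ∀ n, Integrable (κ n)) (hG : Integrable G)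
    (hb : ∀ n, ∀ᵐ z, ‖κ n z‖ ≤ G z) (hlim : ∀ᵐ z, Tendsto (fun n => κ n z) atTop (𝓝 (κ₀ z))) :
    Integrable κ₀ := by
  refine hG.mono' (aestronglyMeasurable_of_tendsto_ae atTop (fun n => (hκ n).1) hlim) ?_
  filter_upwards [hlim, ae_all_iff.2 hb] with z h1 h2
  exact le_of_tendsto h1.norm (Eventually.of_forall h2)

theorem tendsto_integral_norm_sub (hκ : ∀ n, AEStronglyMeasurable (κ n) volume) {w : E3 → ℝ}
    (hw : AEStronglyMeasurable w volume) (hw0 : ∀ z, 0 ≤ w z)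
    (hG : Integrable fun z => w z * G z)
    (hb : ∀ n, ∀ᵐ z, ‖κ n z‖ ≤ G z) (hlim : ∀ᵐ z, Tendsto (fun n => κ n z) atTop (𝓝 (κ₀ z))) :
    (∀ n, Integrable fun z => w z * ‖κ n z - κ₀ z‖) ∧
    Tendsto (fun n => ∫ z, w z * ‖κ n z - κ₀ z‖) atTop (𝓝 0) := by
  have hm : AEStronglyMeasurable κ₀ := aestronglyMeasurable_of_tendsto_ae atTop hκ hlim
  have hm' : ∀ n, AEStronglyMeasurable (fun z => w z * ‖κ n z - κ₀ z‖) volume :=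
    fun n => hw.mul ((hκ n).sub hm).norm
  have hb' : ∀ n, ∀ᵐ z, ‖w z * ‖κ n z - κ₀ z‖‖ ≤ 2 * (w z * G z) := fun n => by
    filter_upwards [hlim, ae_all_iff.2 hb] with z h1 h2
    have h3 : ‖κ₀ z‖ ≤ G z := le_of_tendsto h1.norm (Eventually.of_forall h2)
    rw [Real.norm_eq_abs, abs_of_nonneg (mul_nonneg (hw0 z) (norm_nonneg _))]
    have := norm_sub_le (κ n z) (κ₀ z)
    nlinarith [hw0 z, h2 n]
  refine ⟨fun n => (hG.const_mul 2).mono' (hm' n) (hb' n), ?_⟩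
  have := tendsto_integral_of_dominated_convergence (f := fun _ => (0 : ℝ)) _ hm'
    (hG.const_mul 2) hb' (by
      filter_upwards [hlim] with z h1
      simpa using ((h1.sub_const (κ₀ z)).norm).const_mul (w z))
  simpa using this

theorem tendstoUniformly_conv [NormedSpace ℝ E] (hκ : ∀ n, Integrable (κ n)) (hG : Integrable G)
    (hb : ∀ n, ∀ᵐ z, ‖κ n z‖ ≤ G z) (hlim : ∀ᵐ z, Tendsto (fun n => κ n z) atTop (𝓝 (κ₀ z)))
    (hg : AEStronglyMeasurable g) (hM : ∀ x, |g x| ≤ M) :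
    TendstoUniformly (fun n x => ∫ y, g y • κ n (x - y)) (fun x => ∫ y, g y • κ₀ (x - y)) atTop := by
  have h0 := integrable_of_tendsto hκ hG hb hlim
  obtain ⟨hi, ht⟩ := tendsto_integral_norm_sub (w := fun _ => 1) (fun n => (hκ n).1)
    aestronglyMeasurable_const (fun _ => zero_le_one) (by simpa using hG) hb hlim
  simp only [one_mul] at hi ht
  rw [Metric.tendstoUniformly_iff]
  intro ε hε
  have h2 := (ht.const_mul M).eventually_lt_const (by simpa using hε)
  filter_upwards [h2] with n hn x
  rw [dist_comm, dist_eq_norm, ← integral_sub (integrable_smul_comp_sub (hκ n) hg hM x)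
    (integrable_smul_comp_sub h0 hg hM x)]
  refine lt_of_le_of_lt ?_ hn
  rw [← integral_sub_left_eq_self (fun z => ‖κ n z - κ₀ z‖) _ x, ← MeasureTheory.integral_const_mul]
  refine MeasureTheory.norm_integral_le_of_norm_le (((hi n).comp_sub_left x).const_mul M)
    (ae_of_all _ fun y => ?_)
  rw [← smul_sub, norm_smul]
  exact mul_le_mul_of_nonneg_right (hM y) (norm_nonneg _)

theorem tendstoUniformlyOn_conv [NormedSpace ℝ E] {β C r ρ : ℝ} {x₀ : E3} (hκ : ∀ n, Integrable (κ n))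
    (hβ : 0 ≤ β) (hG : Integrable fun z => ‖z‖ ^ β * G z)
    (hb : ∀ n, ∀ᵐ z, ‖κ n z‖ ≤ G z) (hlim : ∀ᵐ z, Tendsto (fun n => κ n z) atTop (𝓝 (κ₀ z)))
    (h0 : ∀ n, ∫ z, κ n z = 0) (hz : ∀ n, ∀ z ∉ ball (0 : E3) ρ, κ n z = 0)
    (hg : AEStronglyMeasurable g) (hM : ∀ x, |g x| ≤ M)
    (hH : ∀ x ∈ ball x₀ r, ∀ y ∈ ball x₀ (r + ρ), |g y - g x| ≤ C * ‖x - y‖ ^ β) :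
    TendstoUniformlyOn (fun n x => ∫ y, g y • κ n (x - y))
      (fun x => ∫ y, (g y - g x) • κ₀ (x - y)) atTop (ball x₀ r) := by
  have hwc : Continuous fun z : E3 => ‖z‖ ^ β := continuous_norm.rpow_const fun _ => Or.inr hβ
  have hw0 : ∀ z : E3, 0 ≤ ‖z‖ ^ β := fun z => Real.rpow_nonneg (norm_nonneg z) _
  obtain ⟨hi, ht⟩ := tendsto_integral_norm_sub (fun n => (hκ n).1)
    hwc.aestronglyMeasurable hw0 hG hb hlim
  have hm : AEStronglyMeasurable κ₀ :=
    aestronglyMeasurable_of_tendsto_ae atTop (fun n => (hκ n).1) hlim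
  have hz' : ∀ᵐ z, z ∉ ball (0 : E3) ρ → κ₀ z = 0 := by
    filter_upwards [hlim] with z h1 h2
    exact tendsto_nhds_unique h1 (by simp [hz _ z h2])
  have hG' : ∀ᵐ z, ‖κ₀ z‖ ≤ G z := by
    filter_upwards [hlim, ae_all_iff.2 hb] with z h1 h2
    exact le_of_tendsto h1.norm (Eventually.of_forall h2)
  have hii : Integrable fun z => ‖z‖ ^ β * ‖κ₀ z‖ := by
    refine hG.mono' (hwc.aestronglyMeasurable.mul hm.norm) ?_
    filter_upwards [hG'] with z h1
    rw [Real.norm_eq_abs, abs_of_nonneg (mul_nonneg (hw0 z) (norm_nonneg _))]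
    exact mul_le_mul_of_nonneg_left h1 (hw0 z)
  have key : ∀ x ∈ ball x₀ r, ∀ z : E3, z ∈ ball (0 : E3) ρ → |g (x - z) - g x| ≤ C * ‖z‖ ^ β := by
    intro x hx z hzz
    have := hH x hx (x - z) (by
      rw [mem_ball] at hx hzz ⊢
      calc dist (x - z) x₀ ≤ dist (x - z) x + dist x x₀ := dist_triangle _ _ _
        _ < r + ρ := by rw [dist_eq_norm (x - z)]; simp at hzz ⊢; linarith)
    simpa using this
  rw [Metric.tendstoUniformlyOn_iff]
  intro ε hε
  have h2 := (ht.const_mul C).eventually_lt_const (by simpa using hε)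
  filter_upwards [h2] with n hn x hx
  have e1 : ∫ y, g y • κ n (x - y) = ∫ z, (g (x - z) - g x) • κ n z := by
    rw [← integral_sub_left_eq_self (fun y => g y • κ n (x - y)) _ x]
    simp only [sub_sub_cancel, sub_smul]
    have i1 : Integrable fun z => g (x - z) • κ n z := by
      simpa using (integrable_smul_comp_sub (hκ n) hg hM x).comp_sub_left x
    have i2 : Integrable fun z => g x • κ n z := (hκ n).smul (g x)
    rw [integral_sub i1 i2, MeasureTheory.integral_smul, h0 n, smul_zero, sub_zero]
  have e2 : ∫ y, (g y - g x) • κ₀ (x - y) = ∫ z, (g (x - z) - g x) • κ₀ z := by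
    rw [← integral_sub_left_eq_self (fun y => (g y - g x) • κ₀ (x - y)) _ x]
    simp only [sub_sub_cancel]
  have hgm : AEStronglyMeasurable (fun z => g (x - z) - g x) volume :=
    (hg.comp_measurePreserving (Measure.measurePreserving_sub_left volume x)).sub aestronglyMeasurable_const
  have i1 : Integrable fun z => (g (x - z) - g x) • κ n z := by
    simp only [sub_smul]
    exact (by simpa using (integrable_smul_comp_sub (hκ n) hg hM x).comp_sub_left x :
      Integrable fun z => g (x - z) • κ n z).sub ((hκ n).smul (g x))
  have i2 : Integrable fun z => (g (x - z) - g x) • κ₀ z := by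
    refine (hii.const_mul C).mono' (hgm.smul hm) ?_
    filter_upwards [hz'] with z h1
    rw [norm_smul, ← mul_assoc]
    by_cases hzz : z ∈ ball (0 : E3) ρ
    · exact mul_le_mul_of_nonneg_right (key x hx z hzz) (norm_nonneg _)
    · simp [h1 hzz]
  rw [dist_comm, e1, e2, dist_eq_norm, ← integral_sub i1 i2]
  refine lt_of_le_of_lt ?_ hn
  rw [← MeasureTheory.integral_const_mul]
  refine MeasureTheory.norm_integral_le_of_norm_le ((hi n).const_mul C) ?_
  filter_upwards [hz'] with z h1
  rw [← smul_sub, norm_smul, ← mul_assoc]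
  by_cases hzz : z ∈ ball (0 : E3) ρ
  · exact mul_le_mul_of_nonneg_right (key x hx z hzz) (norm_nonneg _)
  · simp [h1 hzz, hz n z hzz]

theorem hasFDerivAt_conv {k : E3 → ℝ} (hk : ContDiff ℝ 1 k) (hkc : HasCompactSupport k)
    (hg : LocallyIntegrable g) (x : E3) :
    HasFDerivAt (fun x => ∫ y, g y * k (x - y)) (∫ y, g y • fderiv ℝ k (x - y)) x := by
  have := hkc.hasFDerivAt_convolution_right (ContinuousLinearMap.lsmul ℝ ℝ) hg hk x
  refine this.congr_fderiv ?_
  rw [convolution_def]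
  refine integral_congr_ae (ae_of_all _ fun y => ?_)
  ext v
  simp [ContinuousLinearMap.precompR_apply]

theorem integral_fderiv_eq_zero {k : E3 → ℝ} (hk : ContDiff ℝ 1 k) (hkc : HasCompactSupport k) :
    ∫ z, fderiv ℝ k z = 0 := by
  have hi : Integrable (fderiv ℝ k) :=
    (hk.continuous_fderiv (by norm_num)).integrable_of_hasCompactSupport (hkc.fderiv (𝕜 := ℝ))
  ext v
  rw [ContinuousLinearMap.integral_apply hi]
  have h1 := integral_mul_fderiv_eq_neg_fderiv_mul_of_integrable (μ := (volume : Measure E3))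
    (f := fun _ => (1 : ℝ)) (g := k) (v := v) (by simp) (by simpa using hi.apply_continuousLinearMap v)
    (by simpa using hk.continuous.integrable_of_hasCompactSupport hkc) (by simp)
    (fun x _ => (hk.differentiable (by norm_num)) x)
  simpa using h1

end potential

section newton

variable (χ : ContDiffBump (0 : ℝ)) {e ρ M : ℝ} {g : E3 → ℝ}

/-- The Newtonian-type potential of `g` with the truncated kernel. -/
def npot (g : E3 → ℝ) (x : E3) : ℝ := ∫ y, g y * ker χ 0 (x - y)

/-- The regularisation parameters. -/
def eps (n : ℕ) : ℝ := 1 / ((n : ℝ) + 1)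

theorem eps_pos (n : ℕ) : 0 < eps n := Nat.one_div_pos_of_nat

theorem tendsto_eps : Tendsto eps atTop (𝓝 0) := tendsto_one_div_add_atTop_nhds_zero_nat

theorem contDiff_ker (he : 0 < e) : ContDiff ℝ 1 (ker χ e) := by
  refine contDiff_one_iff_fderiv.2 ⟨fun z => (hasFDerivAt_ker χ he z).differentiableAt, ?_⟩
  rw [show fderiv ℝ (ker χ e) = ker' χ e from funext fun z => (hasFDerivAt_ker χ he z).fderiv]
  exact (continuous_ker χ he).2.1

theorem contDiff_kerDir (he : 0 < e) (v : E3) : ContDiff ℝ 1 (kerDir χ e v) := by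
  refine contDiff_one_iff_fderiv.2 ⟨fun z => (hasFDerivAt_kerDir χ he v z).differentiableAt, ?_⟩
  rw [show fderiv ℝ (kerDir χ e v) = kerDir' χ e v from
    funext fun z => (hasFDerivAt_kerDir χ he v z).fderiv]
  exact ((continuous_ker χ he).2.2 v).2

theorem hasCompactSupport_of_ball {E : Type*} [Zero E] {k : E3 → E}
    (h : ∀ z ∉ ball (0 : E3) ρ, k z = 0) : HasCompactSupport k :=
  HasCompactSupport.intro (isCompact_closedBall (0 : E3) ρ) fun z hz =>
    h z fun h' => hz (ball_subset_closedBall h')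

theorem integrable_indicator_rpow {a : ℝ} (ha : -3 < a) (C ρ : ℝ) :
    Integrable ((ball (0 : E3) ρ).indicator fun z => C * ‖z‖ ^ a) :=
  (integrable_indicator_iff measurableSet_ball).2 ((integrableOn_ball_norm_rpow ha ρ).const_mul C)

theorem ae_ne_zero : ∀ᵐ z : E3, z ≠ 0 := by
  simp [ae_iff]

theorem integrable_of_bound (hχ : χ.rOut < ρ ^ 2) (hρ : 0 < ρ) (he : 0 < e) (v : E3) :
    Integrable (ker χ e) ∧ Integrable (ker' χ e) ∧ Integrable (kerDir χ e v) ∧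
      Integrable (kerDir' χ e v) := by
  have hz := fun z (h : z ∉ ball (0 : E3) ρ) => ker_eq_zero χ (e := e) hχ hρ h
  obtain ⟨c0, c1, c2⟩ := continuous_ker χ he
  exact ⟨c0.integrable_of_hasCompactSupport (hasCompactSupport_of_ball fun z h => (hz z h).1),
    c1.integrable_of_hasCompactSupport (hasCompactSupport_of_ball fun z h => (hz z h).2.1),
    (c2 v).1.integrable_of_hasCompactSupport (hasCompactSupport_of_ball fun z h => ((hz z h).2.2 v).1),
    (c2 v).2.integrable_of_hasCompactSupport (hasCompactSupport_of_ball fun z h => ((hz z h).2.2 v).2)⟩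

theorem locallyIntegrable_of_bound (hg : AEStronglyMeasurable g) (hM : ∀ x, |g x| ≤ M) :
    LocallyIntegrable g := by
  have : MemLp g ∞ volume := memLp_top_of_bound hg M (ae_of_all _ hM)
  exact this.locallyIntegrable le_top

theorem npot_c1 (hχ : χ.rOut < ρ ^ 2) (hρ : 0 < ρ) (hg : AEStronglyMeasurable g)
    (hM : ∀ x, |g x| ≤ M) : Integrable (ker χ 0) ∧ Integrable (ker' χ 0) ∧
    (∀ x, HasFDerivAt (npot χ g) (∫ y, g y • ker' χ 0 (x - y)) x) ∧
    Continuous fun x => ∫ y, g y • ker' χ 0 (x - y) := by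
  obtain ⟨C, hC, hb⟩ := exists_ker_bound χ hχ hρ
  have hi := fun n => integrable_of_bound χ hχ hρ (eps_pos n) 0
  have hl : ∀ᵐ z : E3, _ := ae_ne_zero.mono fun z hz => tendsto_ker χ tendsto_eps hz
  have hB : ∀ n, ∀ᵐ z : E3, _ := fun n => ae_ne_zero.mono fun z hz => hb (eps n) z (eps_pos n).le hz
  have G0 := integrable_indicator_rpow (a := -1) (by norm_num) C ρ
  have G1 := integrable_indicator_rpow (a := -2) (by norm_num) C ρ
  have b0 := fun n => (hB n).mono fun z hz => hz.1
  have b1 := fun n => (hB n).mono fun z hz => hz.2.1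
  have l0 := hl.mono fun z hz => hz.1
  have l1 := hl.mono fun z hz => hz.2.1
  have u0 := tendstoUniformly_conv (fun n => (hi n).1) G0 b0 l0 hg hM
  have u1 := tendstoUniformly_conv (fun n => (hi n).2.1) G1 b1 l1 hg hM
  have hd : ∀ n x, HasFDerivAt (fun x => ∫ y, g y • ker χ (eps n) (x - y))
      (∫ y, g y • ker' χ (eps n) (x - y)) x := fun n x => by
    have := hasFDerivAt_conv (contDiff_ker χ (eps_pos n))
      (hasCompactSupport_of_ball fun z h => (ker_eq_zero χ hχ hρ h).1)
      (locallyIntegrable_of_bound hg hM) x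
    rwa [show fderiv ℝ (ker χ (eps n)) = ker' χ (eps n) from
      funext fun z => (hasFDerivAt_ker χ (eps_pos n) z).fderiv] at this
  refine ⟨integrable_of_tendsto (fun n => (hi n).1) G0 b0 l0,
    integrable_of_tendsto (fun n => (hi n).2.1) G1 b1 l1,
    hasFDerivAt_of_tendstoUniformly u1 hd fun x => u0.tendsto_at x, ?_⟩
  refine u1.continuous (Frequently.of_forall fun n => ?_)
  have : Continuous (convolution g (ker' χ (eps n)) (ContinuousLinearMap.lsmul ℝ ℝ) volume) :=
    (hasCompactSupport_of_ball fun z h => (ker_eq_zero χ hχ hρ h).2.1).continuous_convolution_right _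
      (locallyIntegrable_of_bound hg hM) (continuous_ker χ (eps_pos n)).2.1
  exact this

theorem fderiv_npot (hχ : χ.rOut < ρ ^ 2) (hρ : 0 < ρ) (hg : AEStronglyMeasurable g)
    (hM : ∀ x, |g x| ≤ M) (x v : E3) :
    fderiv ℝ (npot χ g) x v = ∫ y, g y • kerDir χ 0 v (x - y) := by
  obtain ⟨-, i1, h, -⟩ := npot_c1 χ hχ hρ hg hM
  rw [(h x).fderiv, ContinuousLinearMap.integral_apply (integrable_smul_comp_sub i1 hg hM x)]
  simp [ker'_apply]

theorem contDiff_npot (hχ : χ.rOut < ρ ^ 2) (hρ : 0 < ρ) (hg : AEStronglyMeasurable g)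
    (hM : ∀ x, |g x| ≤ M) : ContDiff ℝ 1 (npot χ g) := by
  obtain ⟨-, -, h, h'⟩ := npot_c1 χ hχ hρ hg hM
  refine contDiff_one_iff_fderiv.2 ⟨fun z => (h z).differentiableAt, ?_⟩
  rwa [show fderiv ℝ (npot χ g) = _ from funext fun z => (h z).fderiv]

theorem npot_c2 (hχ : χ.rOut < ρ ^ 2) (hρ : 0 < ρ) (hg : AEStronglyMeasurable g)
    (hM : ∀ x, |g x| ≤ M) {β C₀ r : ℝ} {x₀ : E3} (hβ : 0 < β)
    (hH : ∀ x ∈ ball x₀ r, ∀ y ∈ ball x₀ (r + ρ), |g y - g x| ≤ C₀ * ‖x - y‖ ^ β) (v : E3) :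
    ∃ W : E3 → E3 →L[ℝ] ℝ,
    (∀ x ∈ ball x₀ r, HasFDerivAt (fun x => fderiv ℝ (npot χ g) x v) (W x) x) ∧
    ContinuousOn W (ball x₀ r) ∧ ∀ x ∈ ball x₀ r,
      Tendsto (fun n => ∫ y, g y * kerDir' χ (eps n) v (x - y) v) atTop (𝓝 (W x v)) := by
  obtain ⟨C, hC, hb⟩ := exists_ker_bound χ hχ hρ
  have hi := fun n => integrable_of_bound χ hχ hρ (eps_pos n) v
  have hl : ∀ᵐ z : E3, _ := ae_ne_zero.mono fun z hz => tendsto_ker χ tendsto_eps hz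
  have hB : ∀ n, ∀ᵐ z : E3, _ := fun n => ae_ne_zero.mono fun z hz => hb (eps n) z (eps_pos n).le hz
  have G1 := integrable_indicator_rpow (a := -2) (by norm_num) (C * ‖v‖) ρ
  have G2 : Integrable fun z : E3 => ‖z‖ ^ β *
      (ball (0 : E3) ρ).indicator (fun z => C * ‖v‖ * ‖z‖ ^ (-3 : ℝ)) z := by
    refine (integrable_indicator_rpow (a := β - 3) (by linarith) (C * ‖v‖) ρ).congr ?_
    filter_upwards [ae_ne_zero] with z hz
    by_cases hzb : z ∈ ball (0 : E3) ρ
    · rw [Set.indicator_of_mem hzb, Set.indicator_of_mem hzb, sub_eq_add_neg,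
        Real.rpow_add (norm_pos_iff.2 hz)]
      ring
    · simp [Set.indicator_of_notMem hzb]
  have b1 : ∀ n, ∀ᵐ z, ‖kerDir χ (eps n) v z‖ ≤
      (ball (0 : E3) ρ).indicator (fun z => C * ‖v‖ * ‖z‖ ^ (-2 : ℝ)) z := fun n => by
    filter_upwards [hB n] with z hz
    rw [← ker'_apply]
    refine (ContinuousLinearMap.le_opNorm _ _).trans ?_
    refine (mul_le_mul_of_nonneg_right hz.2.1 (norm_nonneg v)).trans_eq ?_
    by_cases hzb : z ∈ ball (0 : E3) ρ
    · rw [Set.indicator_of_mem hzb, Set.indicator_of_mem hzb]; ring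
    · simp [Set.indicator_of_notMem hzb]
  have l1 : ∀ᵐ z, Tendsto (fun n => kerDir χ (eps n) v z) atTop (𝓝 (kerDir χ 0 v z)) := by
    filter_upwards [hl] with z hz
    simp only [← ker'_apply]
    exact ((ContinuousLinearMap.apply ℝ ℝ v).continuous.tendsto _).comp hz.2.1
  have b2 := fun n => (hB n).mono fun z hz => hz.2.2 v
  have l2 := hl.mono fun z hz => hz.2.2 v
  have hzero := fun n z (h : z ∉ ball (0 : E3) ρ) => (ker_eq_zero χ (e := eps n) hχ hρ h).2.2 v
  have hcs := fun n => hasCompactSupport_of_ball fun z h => (hzero n z h).1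
  have hfd : ∀ n, fderiv ℝ (kerDir χ (eps n) v) = kerDir' χ (eps n) v := fun n =>
    funext fun z => (hasFDerivAt_kerDir χ (eps_pos n) v z).fderiv
  have h0 : ∀ n, ∫ z, kerDir' χ (eps n) v z = 0 := fun n => by
    rw [← hfd n]
    exact integral_fderiv_eq_zero (contDiff_kerDir χ (eps_pos n) v) (hcs n)
  have u1 := tendstoUniformly_conv (fun n => (hi n).2.2.1) G1 b1 l1 hg hM
  have u2 := tendstoUniformlyOn_conv (fun n => (hi n).2.2.2) hβ.le G2 b2 l2 h0
    (fun n z h => (hzero n z h).2) hg hM hH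
  have hd : ∀ n x, HasFDerivAt (fun x => ∫ y, g y • kerDir χ (eps n) v (x - y))
      (∫ y, g y • kerDir' χ (eps n) v (x - y)) x := fun n x => by
    have := hasFDerivAt_conv (contDiff_kerDir χ (eps_pos n) v) (hcs n)
      (locallyIntegrable_of_bound hg hM) x
    rwa [hfd n] at this
  refine ⟨fun x => ∫ y, (g y - g x) • kerDir' χ 0 v (x - y), ?_, ?_, ?_⟩
  · intro x hx
    simp only [fderiv_npot χ hχ hρ hg hM]
    exact hasFDerivAt_of_tendstoUniformlyOn isOpen_ball u2 (fun n x _ => hd n x)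
      (fun x _ => u1.tendsto_at x) hx
  · refine u2.continuousOn (Frequently.of_forall fun n => Continuous.continuousOn ?_)
    have : Continuous (convolution g (kerDir' χ (eps n) v) (ContinuousLinearMap.lsmul ℝ ℝ) volume) :=
      (hasCompactSupport_of_ball fun z h => (hzero n z h).2).continuous_convolution_right _
        (locallyIntegrable_of_bound hg hM) ((continuous_ker χ (eps_pos n)).2.2 v).2
    exact this
  · intro x hx
    have := ((ContinuousLinearMap.apply ℝ ℝ v).continuous.tendsto _).comp (u2.tendsto_at hx)
    refine this.congr fun n => ?_
    simp only [Function.comp_apply, ContinuousLinearMap.apply_apply]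
    rw [ContinuousLinearMap.integral_apply (integrable_smul_comp_sub (hi n).2.2.2 hg hM x)]
    simp

theorem contDiffOn_npot (hχ : χ.rOut < ρ ^ 2) (hρ : 0 < ρ) (hg : AEStronglyMeasurable g)
    (hM : ∀ x, |g x| ≤ M) {β C₀ r : ℝ} {x₀ : E3} (hβ : 0 < β)
    (hH : ∀ x ∈ ball x₀ r, ∀ y ∈ ball x₀ (r + ρ), |g y - g x| ≤ C₀ * ‖x - y‖ ^ β) :
    ContDiffOn ℝ 2 (npot χ g) (ball x₀ r) := by
  rw [show (2 : WithTop ℕ∞) = 1 + 1 from rfl, contDiffOn_succ_iff_fderiv_of_isOpen isOpen_ball]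
  refine ⟨(contDiff_npot χ hχ hρ hg hM).differentiable (by norm_num) |>.differentiableOn,
    by simp, ?_⟩
  rw [contDiffOn_clm_apply]
  intro v
  obtain ⟨W, h1, h2, -⟩ := npot_c2 χ hχ hρ hg hM hβ hH v
  rw [show (1 : WithTop ℕ∞) = 0 + 1 from rfl, contDiffOn_succ_iff_fderiv_of_isOpen isOpen_ball]
  refine ⟨fun x hx => (h1 x hx).differentiableAt.differentiableWithinAt, by simp, ?_⟩
  rw [contDiffOn_zero]
  exact h2.congr fun x hx => (h1 x hx).fderiv

theorem tendsto_lap3_npot (hχ : χ.rOut < ρ ^ 2) (hρ : 0 < ρ) (hg : AEStronglyMeasurable g)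
    (hM : ∀ x, |g x| ≤ M) {β C₀ r : ℝ} {x₀ : E3} (hβ : 0 < β)
    (hH : ∀ x ∈ ball x₀ r, ∀ y ∈ ball x₀ (r + ρ), |g y - g x| ≤ C₀ * ‖x - y‖ ^ β)
    {x : E3} (hx : x ∈ ball x₀ r) :
    Tendsto (fun n => ∫ y, g y * (-(3 * eps n * (‖x - y‖ ^ 2 + eps n) ^ (-(5 / 2) : ℝ)) *
      χ (‖x - y‖ ^ 2) + profRes χ (eps n) (‖x - y‖ ^ 2))) atTop (𝓝 (lap3 (npot χ g) x)) := by
  choose W h1 h2 h3 using npot_c2 χ hχ hρ hg hM hβ hH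
  have e1 : lap3 (npot χ g) x = ∑ i : Fin 3, W (EuclideanSpace.single i 1) x
      (EuclideanSpace.single i 1) :=
    Finset.sum_congr rfl fun i _ => by rw [(h1 _ x hx).fderiv]
  rw [e1]
  refine (tendsto_finsetSum _ fun i _ => h3 (EuclideanSpace.single i 1) x hx).congr fun n => ?_
  simp only [← ker_laplacian χ (eps_pos n), Finset.mul_sum]
  rw [MeasureTheory.integral_finsetSum]
  intro i _
  exact integrable_smul_comp_sub ((integrable_of_bound χ hχ hρ (eps_pos n) _).2.2.2.apply_continuousLinearMap _) hg hM x

end newton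

section laplacian

variable (χ : ContDiffBump (0 : ℝ)) {e ρ M : ℝ} {g : E3 → ℝ}

/-- The profile of the regularised Laplacian of the Newtonian kernel. -/
def bubble (z : E3) : ℝ := 3 * (‖z‖ ^ 2 + 1) ^ (-(5 / 2) : ℝ)

theorem bubble_pos (z : E3) : 0 < bubble z := by unfold bubble; positivity

theorem integrable_bubble : Integrable bubble := by
  have := integrable_rpow_neg_one_add_norm_sq (E := E3) (μ := volume) (r := 5) (by simp; norm_num)
  refine (this.const_mul 3).congr (ae_of_all _ fun z => ?_)
  simp only [bubble, add_comm (1 : ℝ)]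
  norm_num

/-- The total mass of `bubble`. -/
def mass : ℝ := ∫ z, bubble z

theorem mass_pos : 0 < mass := by
  rw [mass, integral_pos_iff_support_of_nonneg (fun z => (bubble_pos z).le) integrable_bubble]
  rw [show Function.support bubble = Set.univ from Set.eq_univ_of_forall fun z => (bubble_pos z).ne']
  simp

theorem tendsto_norm_mul_bubble :
    Tendsto (fun z : E3 => ‖z‖ ^ Module.finrank ℝ E3 * (mass⁻¹ * bubble z))
      (Bornology.cobounded E3) (𝓝 0) := by
  have h1 : Tendsto (fun z : E3 => mass⁻¹ * (3 * ‖z‖⁻¹ ^ 2)) (Bornology.cobounded E3) (𝓝 0) := by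
    have := (tendsto_inv_atTop_zero.comp tendsto_norm_cobounded_atTop :
      Tendsto (fun z : E3 => ‖z‖⁻¹) (Bornology.cobounded E3) (𝓝 0))
    simpa using ((this.pow 2).const_mul 3).const_mul mass⁻¹
  refine squeeze_zero' (Eventually.of_forall fun z => ?_) ?_ h1
  · have := bubble_pos z
    have := mass_pos
    positivity
  · filter_upwards [tendsto_norm_cobounded_atTop.eventually_ge_atTop (1 : ℝ)] with z hz
    have hz0 : 0 < ‖z‖ := by linarith
    have : (‖z‖ ^ 2 + 1) ^ (-(5 / 2) : ℝ) ≤ ‖z‖⁻¹ ^ 5 := by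
      calc (‖z‖ ^ 2 + 1) ^ (-(5 / 2) : ℝ) ≤ (‖z‖ ^ 2) ^ (-(5 / 2) : ℝ) :=
            Real.rpow_le_rpow_of_nonpos (by positivity) (by linarith) (by norm_num)
        _ = ‖z‖⁻¹ ^ 5 := by
            rw [rpow_norm_sq, show (2 * -(5 / 2) : ℝ) = -((5 : ℕ) : ℝ) by norm_num,
              Real.rpow_neg hz0.le, Real.rpow_natCast, inv_pow]
    have hm := mass_pos
    calc ‖z‖ ^ Module.finrank ℝ E3 * (mass⁻¹ * bubble z)
        = mass⁻¹ * (3 * (‖z‖ ^ 3 * (‖z‖ ^ 2 + 1) ^ (-(5 / 2) : ℝ))) := by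
          rw [show Module.finrank ℝ E3 = 3 by simp, bubble]; ring
      _ ≤ mass⁻¹ * (3 * (‖z‖ ^ 3 * ‖z‖⁻¹ ^ 5)) := by gcongr
      _ = mass⁻¹ * (3 * ‖z‖⁻¹ ^ 2) := by
          congr 2
          field_simp

theorem tendsto_integral_bubble {h : E3 → ℝ} (hi : Integrable h) {x : E3} (hc : ContinuousAt h x) :
    Tendsto (fun n => ∫ y, (3 * eps n * (‖x - y‖ ^ 2 + eps n) ^ (-(5 / 2) : ℝ)) * h y) atTop
      (𝓝 (mass * h x)) := by
  have hm := mass_pos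
  have h1 := tendsto_integral_comp_smul_smul_of_integrable' (μ := (volume : Measure E3))
    (φ := fun z => mass⁻¹ * bubble z)
    (fun z => by have := bubble_pos z; positivity)
    (by rw [MeasureTheory.integral_const_mul]; exact inv_mul_cancel₀ hm.ne')
    tendsto_norm_mul_bubble hi hc
  have h2 : Tendsto (fun n : ℕ => (Real.sqrt (eps n))⁻¹) atTop atTop := by
    have : Tendsto (fun n : ℕ => Real.sqrt ((n : ℝ) + 1)) atTop atTop :=
      Real.tendsto_sqrt_atTop.comp (tendsto_natCast_atTop_atTop.atTop_add tendsto_const_nhds)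
    refine this.congr fun n => ?_
    rw [eps, ← Real.sqrt_inv, one_div, inv_inv]
  refine ((h1.comp h2).const_mul mass).congr fun n => ?_
  rw [Function.comp_apply, ← MeasureTheory.integral_const_mul]
  refine integral_congr_ae (ae_of_all _ fun y => ?_)
  have he := eps_pos n
  have hs : 0 < Real.sqrt (eps n) := Real.sqrt_pos.2 he
  have hq : Real.sqrt (eps n) ^ 2 = eps n := Real.sq_sqrt he.le
  simp only [smul_eq_mul, bubble, norm_smul, norm_inv, Real.norm_eq_abs, abs_of_pos hs]
  rw [show Module.finrank ℝ E3 = 3 by simp]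
  generalize Real.sqrt (eps n) = s at hs hq
  rw [← hq]
  have e1 : ((s⁻¹ * ‖x - y‖) ^ 2 + 1) = (‖x - y‖ ^ 2 + s ^ 2) * (s ^ 2)⁻¹ := by
    field_simp
  have e2 : ((s ^ 2)⁻¹) ^ (-(5 / 2) : ℝ) = s ^ 5 := by
    rw [Real.inv_rpow (by positivity), Real.rpow_neg (by positivity), inv_inv,
      ← Real.rpow_natCast s 2, ← Real.rpow_mul hs.le, ← Real.rpow_natCast s 5]
    norm_num
  rw [e1, Real.mul_rpow (by positivity) (by positivity), e2]
  field_simp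

theorem continuous_bump_norm_sq : Continuous fun z : E3 => χ (‖z‖ ^ 2) :=
  χ.continuous.comp (by fun_prop)

theorem bump_norm_sq_eq_zero (hχ : χ.rOut < ρ ^ 2) (hρ : 0 < ρ) {z : E3} (h : z ∉ ball (0 : E3) ρ) :
    χ (‖z‖ ^ 2) = 0 ∧ profRes χ e (‖z‖ ^ 2) = 0 := by
  rw [mem_ball_zero_iff, not_lt] at h
  obtain ⟨h0, h1, h2⟩ := bump_zero_of_lt χ (hχ.trans_le (by gcongr : ρ ^ 2 ≤ ‖z‖ ^ 2))
  exact ⟨h0, by simp [profRes, h1, h2]⟩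

theorem continuous_profRes (he : 0 < e) : Continuous fun z : E3 => profRes χ e (‖z‖ ^ 2) := by
  have hn : Continuous fun z : E3 => ‖z‖ ^ 2 := by fun_prop
  have hr : ∀ p : ℝ, Continuous fun z : E3 => (‖z‖ ^ 2 + e) ^ p := fun p =>
    (hn.add continuous_const).rpow_const fun z =>
      Or.inl (add_pos_of_nonneg_of_pos (sq_nonneg _) he).ne'
  have c1 := (contDiff_deriv_bump χ).continuous.comp hn
  have c2 := (contDiff_deriv_deriv_bump χ).continuous.comp hn
  exact (((continuous_const.mul c1).add ((continuous_const.mul hn).mul c2)).mul (hr _)).sub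
    (((continuous_const.mul hn).mul c1).mul (hr _))

theorem tendsto_integral_profRes (hχ : χ.rOut < ρ ^ 2) (hρ : 0 < ρ) (hg : AEStronglyMeasurable g)
    (hM : ∀ x, |g x| ≤ M) (x : E3) :
    Tendsto (fun n => ∫ y, g y * profRes χ (eps n) (‖x - y‖ ^ 2)) atTop
      (𝓝 (∫ y, g y * profRes χ 0 (‖x - y‖ ^ 2))) := by
  obtain ⟨C, hC, hb⟩ := exists_profRes_bound χ
  refine (tendstoUniformly_conv (κ := fun n z => profRes χ (eps n) (‖z‖ ^ 2))
    (κ₀ := fun z => profRes χ 0 (‖z‖ ^ 2)) (G := (ball (0 : E3) ρ).indicator fun _ => C)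
    (fun n => ?_) ?_ (fun n => ae_of_all _ fun z => ?_) ?_ hg hM).tendsto_at x
  · exact (continuous_profRes χ (eps_pos n)).integrable_of_hasCompactSupport
      (hasCompactSupport_of_ball fun z h => (bump_norm_sq_eq_zero χ hχ hρ h).2)
  · exact (integrable_indicator_iff measurableSet_ball).2 (integrableOn_const measure_ball_lt_top.ne)
  · by_cases hzb : z ∈ ball (0 : E3) ρ
    · rw [Set.indicator_of_mem hzb]
      exact hb _ _ (eps_pos n).le (sq_nonneg _)
    · simp [Set.indicator_of_notMem hzb, (bump_norm_sq_eq_zero χ (e := eps n) hχ hρ hzb).2]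
  · filter_upwards [ae_ne_zero] with z hz
    exact (tendsto_prof χ tendsto_eps (pow_pos (norm_pos_iff.2 hz) 2)).2.2.2

theorem lap3_npot (hχ : χ.rOut < ρ ^ 2) (hρ : 0 < ρ) (hg : AEStronglyMeasurable g)
    (hM : ∀ x, |g x| ≤ M) {β C₀ r : ℝ} {x₀ : E3} (hβ : 0 < β)
    (hH : ∀ x ∈ ball x₀ r, ∀ y ∈ ball x₀ (r + ρ), |g y - g x| ≤ C₀ * ‖x - y‖ ^ β)
    {x : E3} (hx : x ∈ ball x₀ r) (hc : ContinuousAt g x) :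
    lap3 (npot χ g) x = -(mass * g x) + ∫ y, g y * profRes χ 0 (‖x - y‖ ^ 2) := by
  have hcs : HasCompactSupport fun z : E3 => χ (‖z‖ ^ 2) :=
    hasCompactSupport_of_ball fun z h => (bump_norm_sq_eq_zero χ (e := 0) hχ hρ h).1
  have i0 : Integrable fun y => g y * χ (‖x - y‖ ^ 2) := integrable_smul_comp_sub
    ((continuous_bump_norm_sq χ).integrable_of_hasCompactSupport hcs) hg hM x
  have hc' : ContinuousAt (fun y => g y * χ (‖x - y‖ ^ 2)) x :=
    hc.mul ((continuous_bump_norm_sq χ).comp (by fun_prop : Continuous fun y => x - y)).continuousAt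
  have t1 := tendsto_integral_bubble i0 hc'
  have t2 := tendsto_integral_profRes χ hχ hρ hg hM x
  have t3 := tendsto_lap3_npot χ hχ hρ hg hM hβ hH hx
  have hx1 : χ (‖x - x‖ ^ 2) = 1 := χ.one_of_mem_closedBall (by simp [χ.rIn_pos.le])
  rw [hx1, mul_one] at t1
  refine tendsto_nhds_unique t3 ((t1.neg.add t2).congr fun n => ?_)
  rw [← MeasureTheory.integral_neg, ← MeasureTheory.integral_add]
  · refine integral_congr_ae (ae_of_all _ fun y => ?_)
    simp only
    ring
  · have cb : Continuous fun z : E3 => 3 * eps n * (‖z‖ ^ 2 + eps n) ^ (-(5 / 2) : ℝ) * χ (‖z‖ ^ 2) :=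
      (continuous_const.mul (((by fun_prop : Continuous fun z : E3 => ‖z‖ ^ 2).add
        continuous_const).rpow_const fun z =>
        Or.inl (add_pos_of_nonneg_of_pos (sq_nonneg _) (eps_pos n)).ne')).mul
        (continuous_bump_norm_sq χ)
    have := integrable_smul_comp_sub (cb.integrable_of_hasCompactSupport (hasCompactSupport_of_ball
      (ρ := ρ) fun z h => by simp [(bump_norm_sq_eq_zero χ (e := 0) hχ hρ h).1])) hg hM x
    refine this.neg.congr (ae_of_all _ fun y => ?_)
    simp only [Pi.neg_apply, smul_eq_mul]
    ring
  · exact integrable_smul_comp_sub ((continuous_profRes χ (eps_pos n)).integrable_of_hasCompactSupport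
      (hasCompactSupport_of_ball (ρ := ρ) fun z h => (bump_norm_sq_eq_zero χ hχ hρ h).2)) hg hM x

end laplacian

section representation

theorem inner_gradient_eq_sum (D : E3 → E3) (Φ : E3 → ℝ) (x : E3) :
    inner ℝ (D x) (gradient Φ x) = ∑ i : Fin 3, inner ℝ (D x) (EuclideanSpace.single i (1 : ℝ)) *
      fderiv ℝ Φ x (EuclideanSpace.single i 1) := by
  rw [real_inner_comm, ← (EuclideanSpace.basisFun (Fin 3) ℝ).sum_inner_mul_inner]
  refine Finset.sum_congr rfl fun i _ => ?_
  rw [EuclideanSpace.basisFun_apply, inner_gradient_left, mul_comm, real_inner_comm]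

theorem contDiff_fderiv_apply {Φ : E3 → ℝ} (hΦ : ContDiff ℝ 2 Φ) (v : E3) :
    ContDiff ℝ 1 fun x => fderiv ℝ Φ x v :=
  (hΦ.fderiv_right (m := 1) (by norm_num)).clm_apply contDiff_const

theorem H1.integral_inner_gradient {u : E3 → ℝ} {D : E3 → E3} (h : H1 u D) {Φ : E3 → ℝ}
    (hΦ : ContDiff ℝ 2 Φ) (hc : HasCompactSupport Φ) :
    ∫ x, inner ℝ (D x) (gradient Φ x) = -∫ x, u x * lap3 Φ x := by
  have ht : ∀ v : E3, IsTest fun x => fderiv ℝ Φ x v := fun v =>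
    ⟨contDiff_fderiv_apply hΦ v, (hc.fderiv (𝕜 := ℝ)).comp_left (g := fun L : E3 →L[ℝ] ℝ => L v) rfl⟩
  simp only [inner_gradient_eq_sum D Φ, lap3, Finset.mul_sum]
  rw [MeasureTheory.integral_finsetSum, MeasureTheory.integral_finsetSum, ← Finset.sum_neg_distrib]
  · exact Finset.sum_congr rfl fun i _ => h.integral_inner_mul (ht _) _
  · intro i _
    exact h.memLp.integrable_mul ((ht _).memLp_fderiv_apply _ 2)
  · intro i _
    exact (h.memLp_grad.inner_const _).integrable_mul ((ht _).memLp 2)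

theorem integral_mul_conv_comm {K g ζ : E3 → ℝ} {M : ℝ} (hK : Integrable K)
    (heven : ∀ z, K (-z) = K z) (hg : AEStronglyMeasurable g) (hM : ∀ x, |g x| ≤ M)
    (hζ : Integrable ζ) :
    ∫ x, g x * ∫ y, ζ y * K (x - y) = ∫ y, ζ y * ∫ x, g x * K (y - x) := by
  have hi : Integrable (Function.uncurry fun x y => g x * (ζ y * K (x - y)))
      ((volume : Measure E3).prod volume) :=
    (hζ.convolution_integrand (ContinuousLinearMap.lsmul ℝ ℝ) hK).bdd_mul
      hg.comp_fst (ae_of_all _ fun p => hM p.1)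
  simp only [← MeasureTheory.integral_const_mul]
  rw [integral_integral_swap hi]
  refine integral_congr_ae (ae_of_all _ fun y => integral_congr_ae (ae_of_all _ fun x => ?_))
  simp only
  rw [← heven (x - y), neg_sub]
  ring

theorem ker_even (χ : ContDiffBump (0 : ℝ)) (e : ℝ) (z : E3) : ker χ e (-z) = ker χ e z := by
  simp [ker]

variable {R : ℝ} {u g : E3 → ℝ} {D : E3 → E3}

theorem WeakSol.exists_rep (h : WeakSol R u D g) {x₀ : E3} {δ : ℝ} (hδ : 0 < δ)
    (hb : ball x₀ (2 * δ) ⊆ ball 0 R) : ∃ w : E3 → ℝ, ContDiff ℝ 1 w ∧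
    (∀ᵐ x, x ∈ ball x₀ δ → u x = w x) ∧ ∀ β C : ℝ, 0 < β →
      (∀ x ∈ ball x₀ (2 * δ), ∀ y ∈ ball x₀ (2 * δ), |g y - g x| ≤ C * ‖x - y‖ ^ β) →
      ContDiffOn ℝ 2 w (ball x₀ δ) := by
  obtain ⟨K, hK⟩ := h.bound
  obtain ⟨M, hM⟩ := h.bound'
  have hum : AEStronglyMeasurable u := h.mem.h1.memLp.1
  let χ : ContDiffBump (0 : ℝ) := ⟨δ ^ 2 / 4, δ ^ 2 / 2, by positivity, by nlinarith⟩
  have hχ : χ.rOut < δ ^ 2 := by change δ ^ 2 / 2 < δ ^ 2; nlinarith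
  obtain ⟨iker, -, -, -⟩ := npot_c1 χ hχ hδ h.meas hM
  have hkc : HasCompactSupport fun z : E3 => profRes χ 0 (‖z‖ ^ 2) :=
    hasCompactSupport_of_ball fun z hz => (bump_norm_sq_eq_zero χ hχ hδ hz).2
  have ik : Integrable fun z : E3 => profRes χ 0 (‖z‖ ^ 2) :=
    (contDiff_profRes χ).continuous.integrable_of_hasCompactSupport hkc
  have hw2 : ContDiff ℝ ∞ fun x => ∫ y, u y * profRes χ 0 (‖x - y‖ ^ 2) :=
    hkc.contDiff_convolution_right (ContinuousLinearMap.lsmul ℝ ℝ)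
      (locallyIntegrable_of_bound hum hK) (contDiff_profRes χ)
  have hm := mass_pos
  refine ⟨fun x => mass⁻¹ * (npot χ g x + ∫ y, u y * profRes χ 0 (‖x - y‖ ^ 2)), ?_, ?_, ?_⟩
  · exact contDiff_const.mul ((contDiff_npot χ hχ hδ h.meas hM).add (hw2.of_le (by simp)))
  · have hcw : Continuous fun x => npot χ g x + ∫ y, u y * profRes χ 0 (‖x - y‖ ^ 2) :=
      (contDiff_npot χ hχ hδ h.meas hM).continuous.add hw2.continuous
    have key : ∀ᵐ x, x ∈ ball x₀ δ →
        mass * u x - (npot χ g x + ∫ y, u y * profRes χ 0 (‖x - y‖ ^ 2)) = 0 := by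
      have hli : LocallyIntegrable fun x =>
          mass * u x - (npot χ g x + ∫ y, u y * profRes χ 0 (‖x - y‖ ^ 2)) :=
        ((locallyIntegrable_of_bound hum hK).smul mass).sub hcw.locallyIntegrable
      refine isOpen_ball.ae_eq_zero_of_integral_contDiff_smul_eq_zero (hli.locallyIntegrableOn _) ?_
      intro ζ hζ hζc hζs
      obtain ⟨L, hL⟩ := hζ.lipschitzWith_of_hasCompactSupport hζc (by simp)
      obtain ⟨Z, hZ⟩ := hζ.continuous.bounded_above_of_compact_support hζc
      have iζ := hζ.continuous.integrable_of_hasCompactSupport hζc (μ := volume)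
      have hζm := hζ.continuous.aestronglyMeasurable (μ := (volume : Measure E3))
      have hH : ∀ r : ℝ, ∀ x ∈ ball (0 : E3) r, ∀ y ∈ ball (0 : E3) (r + δ),
          |ζ y - ζ x| ≤ L * ‖x - y‖ ^ (1 : ℝ) := fun r x _ y _ => by
        have := hL.dist_le_mul y x
        rwa [Real.rpow_one, norm_sub_rev, ← dist_eq_norm, ← Real.dist_eq]
      have hΦ : ContDiff ℝ 2 (npot χ ζ) := contDiff_iff_contDiffAt.2 fun x =>
        (contDiffOn_npot χ hχ hδ hζm hZ zero_lt_one (hH (‖x‖ + 1))).contDiffAt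
          (isOpen_ball.mem_nhds (by simp))
      have hΦ0 : ∀ x ∉ ball (0 : E3) R, npot χ ζ x = 0 := fun x hx => by
        refine integral_eq_zero_of_ae (ae_of_all _ fun y => ?_)
        by_cases hy : y ∈ ball x₀ δ
        · have : x - y ∉ ball (0 : E3) δ := fun hxy => hx (hb (by
            rw [mem_ball_zero_iff, ← dist_eq_norm] at hxy
            rw [mem_ball] at hy ⊢
            linarith [dist_triangle x y x₀]))
          simp [(ker_eq_zero χ hχ hδ this).1]
        · simp [image_eq_zero_of_notMem_tsupport fun h' => hy (hζs h')]
      have hΦc := hasCompactSupport_of_ball hΦ0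
      have hΦt : IsTest (npot χ ζ) := ⟨hΦ.of_le (by norm_num), hΦc⟩
      obtain ⟨B, hB⟩ := hΦ.continuous.bounded_above_of_compact_support hΦc
      have e1 := h.eq (npot χ ζ) (gradient (npot χ ζ)) B ⟨hΦt.h1, ae_of_all _ hΦ0⟩ hB
      rw [h.mem.h1.integral_inner_gradient hΦ hΦc] at e1
      have e2 : ∀ x, lap3 (npot χ ζ) x =
          -(mass * ζ x) + ∫ y, ζ y * profRes χ 0 (‖x - y‖ ^ 2) := fun x =>
        lap3_npot χ hχ hδ hζm hZ zero_lt_one (hH (‖x‖ + 1)) (by simp) hζ.continuous.continuousAt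

      have iζu : Integrable fun x => u x * (mass * ζ x) :=
        (iζ.const_mul mass).bdd_mul hum (ae_of_all _ hK)
      have e3 : ∫ x, u x * lap3 (npot χ ζ) x = -(mass * ∫ x, ζ x * u x) +
          ∫ y, ζ y * ∫ x, u x * profRes χ 0 (‖y - x‖ ^ 2) := by
        rw [← integral_mul_conv_comm ik (by simp) hum hK iζ, ← MeasureTheory.integral_const_mul,
          ← MeasureTheory.integral_neg, ← MeasureTheory.integral_add]
        · refine integral_congr_ae (ae_of_all _ fun x => ?_)
          simp only [e2 x]
          ring
        · refine iζu.neg.congr (ae_of_all _ fun x => ?_)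
          simp only [Pi.neg_apply]
          ring
        · exact (iζ.integrable_convolution (ContinuousLinearMap.lsmul ℝ ℝ) ik).bdd_mul hum
            (ae_of_all _ hK)
      have e4 : ∫ x, g x * npot χ ζ x = ∫ y, ζ y * npot χ g y :=
        integral_mul_conv_comm iker (ker_even χ 0) h.meas hM iζ
      rw [e3, e4] at e1
      have i1 : Integrable fun x => ζ x * npot χ g x :=
        ((contDiff_npot χ hχ hδ h.meas hM).continuous.mul hζ.continuous).integrable_of_hasCompactSupport
          hζc.mul_left |>.congr (ae_of_all _ fun x => mul_comm _ _)
      have i2 : Integrable fun x => ζ x * ∫ y, u y * profRes χ 0 (‖x - y‖ ^ 2) :=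
        (hw2.continuous.mul hζ.continuous).integrable_of_hasCompactSupport
          hζc.mul_left |>.congr (ae_of_all _ fun x => mul_comm _ _)
      have i3 : Integrable fun x => mass * (ζ x * u x) :=
        iζu.congr (ae_of_all _ fun x => by simp only; ring)
      have i4 : Integrable fun x => ζ x * npot χ g x + ζ x * ∫ y, u y * profRes χ 0 (‖x - y‖ ^ 2) :=
        i1.add i2
      calc ∫ x, ζ x • (mass * u x - (npot χ g x + ∫ y, u y * profRes χ 0 (‖x - y‖ ^ 2)))
          = ∫ x, (mass * (ζ x * u x) -
            (ζ x * npot χ g x + ζ x * ∫ y, u y * profRes χ 0 (‖x - y‖ ^ 2))) :=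
            integral_congr_ae (ae_of_all _ fun x => by simp only [smul_eq_mul]; ring)
        _ = 0 := by
          rw [MeasureTheory.integral_sub i3 i4, MeasureTheory.integral_add i1 i2,
            MeasureTheory.integral_const_mul]
          linarith
    filter_upwards [key] with x hx hxb
    have := hx hxb
    field_simp
    linarith
  · intro β C hβ hH
    refine contDiffOn_const.mul (ContDiffOn.add ?_ (hw2.of_le (by norm_cast)).contDiffOn)
    refine contDiffOn_npot χ hχ hδ h.meas hM hβ (C₀ := C) fun x hx y hy => hH x ?_ y ?_
    · exact ball_subset_ball (by linarith) hx
    · rwa [two_mul]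

end representation

section gluing

theorem eqOn_ball_of_ae {u w : E3 → ℝ} {x₀ : E3} {δ : ℝ} (hu : ContinuousOn u (ball x₀ δ))
    (hw : ContinuousOn w (ball x₀ δ)) (h : ∀ᵐ x, x ∈ ball x₀ δ → u x = w x) :
    Set.EqOn u w (ball x₀ δ) :=
  Measure.eqOn_open_of_ae_eq ((ae_restrict_iff' measurableSet_ball).2 h) isOpen_ball hu hw

variable {R : ℝ} {u g : E3 → ℝ} {D : E3 → E3}

theorem exists_ball_two_mul_subset {x : E3} (hx : x ∈ ball (0 : E3) R) :
    ∃ δ, 0 < δ ∧ ball x (2 * δ) ⊆ ball 0 R := by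
  obtain ⟨ε, hε, h⟩ := Metric.isOpen_iff.1 isOpen_ball x hx
  exact ⟨ε / 2, half_pos hε, by rwa [mul_div_cancel₀ _ two_ne_zero]⟩

theorem WeakSol.exists_continuous (hR : 0 < R) (h : WeakSol R u D g) : ∃ w : E3 → ℝ,
    w =ᵐ[volume] u ∧ (∀ x ∉ ball (0 : E3) R, w x = 0) ∧ Continuous w ∧
    ContDiffOn ℝ 1 w (ball 0 R) ∧ ∃ K, ∀ x, |w x| ≤ K := by
  classical
  have h' : ∀ x : E3, ∃ δ, ∃ w : E3 → ℝ, x ∈ ball (0 : E3) R → 0 < δ ∧ ball x (2 * δ) ⊆ ball 0 R ∧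
      ContDiff ℝ 1 w ∧ ∀ᵐ y, y ∈ ball x δ → u y = w y := by
    intro x
    by_cases hx : x ∈ ball (0 : E3) R
    · obtain ⟨δ, hδ, hb⟩ := exists_ball_two_mul_subset hx
      obtain ⟨w, hw, hw', -⟩ := h.exists_rep hδ hb
      exact ⟨δ, w, fun _ => ⟨hδ, hb, hw, hw'⟩⟩
    · exact ⟨0, 0, fun h => absurd h hx⟩
  choose δ w hw using h'
  set v : E3 → ℝ := fun x => if x ∈ ball (0 : E3) R then w x x else 0 with hv
  have hsub : ∀ x ∈ ball (0 : E3) R, ball x (δ x) ⊆ ball (0 : E3) R := fun x hx =>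
    (ball_subset_ball (by linarith [(hw x hx).1])).trans (hw x hx).2.1
  have hloc : ∀ x ∈ ball (0 : E3) R, Set.EqOn v (w x) (ball x (δ x)) := by
    intro x hx y hy
    have hyB := hsub x hx hy
    simp only [hv, if_pos hyB]
    refine Measure.eqOn_open_of_ae_eq (μ := volume) (U := ball x (δ x) ∩ ball y (δ y))
      ?_ (isOpen_ball.inter isOpen_ball) (hw y hyB).2.2.1.continuous.continuousOn
      (hw x hx).2.2.1.continuous.continuousOn ⟨hy, mem_ball_self (hw y hyB).1⟩
    refine (ae_restrict_iff' (measurableSet_ball.inter measurableSet_ball)).2 ?_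
    filter_upwards [(hw x hx).2.2.2, (hw y hyB).2.2.2] with z h1 h2 hz
    rw [← h1 hz.1, ← h2 hz.2]
  have hnhds : ∀ x ∈ ball (0 : E3) R, v =ᶠ[𝓝 x] w x := fun x hx =>
    (hloc x hx).eventuallyEq_of_mem (ball_mem_nhds _ (hw x hx).1)
  have hz : ∀ x ∉ ball (0 : E3) R, v x = 0 := fun x hx => by simp only [hv, if_neg hx]
  have hC1 : ContDiffOn ℝ 1 v (ball 0 R) := fun x hx =>
    ((hw x hx).2.2.1.contDiffAt.congr_of_eventuallyEq (hnhds x hx)).contDiffWithinAt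
  have hvu : v =ᵐ[volume] u := by
    have h0 : volume {x | x ∈ ball (0 : E3) R ∧ v x ≠ u x} = 0 := by
      refine measure_null_of_locally_null _ fun x hx => ?_
      refine ⟨ball x (δ x) ∩ {x | x ∈ ball (0 : E3) R ∧ v x ≠ u x},
        Filter.inter_mem (mem_nhdsWithin_of_mem_nhds (ball_mem_nhds _ (hw x hx.1).1))
          self_mem_nhdsWithin, ?_⟩
      refine measure_mono_null ?_ (hw x hx.1).2.2.2
      rintro y ⟨hy, -, hy'⟩
      exact fun hh => hy' ((hloc x hx.1 hy).trans (hh hy).symm)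
    filter_upwards [h.mem.zero, show ∀ᵐ x, ¬ (x ∈ ball (0 : E3) R ∧ v x ≠ u x) by
      simpa [ae_iff] using h0] with x h1 h2
    by_cases hx : x ∈ ball (0 : E3) R
    · by_contra h3
      exact h2 ⟨hx, h3⟩
    · rw [hz x hx, h1 hx]
  obtain ⟨C, hC, hbar⟩ := h.exists_barrier hR
  have hb : ∀ x, |v x| ≤ max (C * (R ^ 2 - ‖x‖ ^ 2)) 0 := by
    intro x
    by_cases hx : x ∈ ball (0 : E3) R
    · have hcb : Continuous fun x : E3 => max (C * (R ^ 2 - ‖x‖ ^ 2)) 0 := by fun_prop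
      have h1 : Set.EqOn (fun x => max (|v x| - max (C * (R ^ 2 - ‖x‖ ^ 2)) 0) 0) (fun _ => 0)
          (ball 0 R) := by
        refine eqOn_ball_of_ae ((hC1.continuousOn.abs.sub hcb.continuousOn).sup continuousOn_const)
          continuousOn_const ?_
        filter_upwards [hvu, hbar] with y h1 h2 _
        rw [h1]
        exact max_eq_right (sub_nonpos.2 h2)
      have := h1 hx
      simp only [max_eq_right_iff] at this
      linarith
    · rw [hz x hx, abs_zero]
      exact le_max_right _ _
  refine ⟨v, hvu, hz, continuous_iff_continuousAt.2 fun x => ?_, hC1, C * R ^ 2, fun x =>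
    (hb x).trans (max_le (by gcongr; linarith [sq_nonneg ‖x‖]) (by positivity))⟩
  by_cases hx : x ∈ ball (0 : E3) R
  · exact hC1.continuousOn.continuousAt (isOpen_ball.mem_nhds hx)
  · have hcb : Continuous fun x : E3 => max (C * (R ^ 2 - ‖x‖ ^ 2)) 0 := by fun_prop
    have h0 : max (C * (R ^ 2 - ‖x‖ ^ 2)) 0 = 0 := by
      rw [mem_ball_zero_iff, not_lt] at hx
      exact max_eq_right (mul_nonpos_of_nonneg_of_nonpos hC (by nlinarith))
    have := hcb.tendsto x
    rw [h0] at this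
    rw [ContinuousAt, hz x hx]
    exact squeeze_zero_norm hb this

end gluing

section holder

variable {f : ℝ → ℝ} {V : E3 → ℝ} {R : ℝ} {u g : E3 → ℝ} {D : E3 → E3}

theorem contDiffOn_phiu (hR : 0 < R) (hu : AEStronglyMeasurable u volume) {K : ℝ}
    (hK : ∀ x, |u x| ≤ K) (hz : ∀ x ∉ ball (0 : E3) R, u x = 0) :
    ContDiffOn ℝ 1 (phiu u) (ball 0 R) := by
  let χ : ContDiffBump (0 : ℝ) := ⟨(2 * R) ^ 2, (2 * R) ^ 2 + 1, by positivity, by linarith⟩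
  have hχ : χ.rOut < (2 * R + 1) ^ 2 := by change (2 * R) ^ 2 + 1 < (2 * R + 1) ^ 2; nlinarith
  have h := contDiff_npot χ hχ (by positivity) (hu.pow 2) (M := K ^ 2) fun x => by
    simp only [Pi.pow_apply, abs_pow]
    gcongr
    exact hK x
  refine ((contDiff_const (c := 1 / (4 * Real.pi))).mul h).contDiffOn.congr fun x hx => ?_
  rw [phiu]
  congr 1
  refine integral_congr_ae (ae_of_all _ fun y => ?_)
  by_cases hy : y ∈ ball (0 : E3) R
  · have h1 : χ (‖x - y‖ ^ 2) = 1 := by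
      refine χ.one_of_mem_closedBall ?_
      rw [mem_ball_zero_iff] at hx hy
      rw [mem_closedBall_zero_iff, Real.norm_of_nonneg (by positivity)]
      change ‖x - y‖ ^ 2 ≤ (2 * R) ^ 2
      gcongr
      linarith [norm_sub_le x y]
    simp only [ker, prof, h1, add_zero, one_mul, Pi.pow_apply]
    rw [div_eq_mul_inv, ← Real.rpow_natCast ‖x - y‖, ← Real.rpow_mul (norm_nonneg _),
      ← Real.rpow_neg_one]
    norm_num
  · simp [hz y hy]

theorem continuous_of_locallyHolder (hV : LocallyHolder V) : Continuous V := by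
  refine continuous_iff_continuousAt.2 fun x => ?_
  obtain ⟨s, hs, C, β, hβ, -, h⟩ := hV x
  exact (h.continuousOn hβ).continuousAt hs

theorem exists_holder_rhs (hR : 0 < R) (hf : ContDiff ℝ 1 f) (hV : LocallyHolder V)
    (hu : Continuous u) (hu' : ContDiffOn ℝ 1 u (ball 0 R)) {K : ℝ} (hK : ∀ x, |u x| ≤ K)
    (hz : ∀ x ∉ ball (0 : E3) R, u x = 0) {x₀ : E3} (hx₀ : x₀ ∈ ball (0 : E3) R) :
    ∃ δ β C : ℝ, 0 < δ ∧ 0 < β ∧ ball x₀ (2 * δ) ⊆ ball 0 R ∧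
      ∀ x ∈ ball x₀ (2 * δ), ∀ y ∈ ball x₀ (2 * δ),
        |rhs f V u y - rhs f V u x| ≤ C * ‖x - y‖ ^ β := by
  have hB := isOpen_ball.mem_nhds hx₀
  have hua : ContDiffAt ℝ 1 u x₀ := hu'.contDiffAt hB
  have hφ := (contDiffOn_phiu hR hu.aestronglyMeasurable hK hz).contDiffAt hB
  obtain ⟨L, t, ht, hL⟩ := ((hf.contDiffAt.comp x₀ hua).sub (hφ.mul hua)).exists_lipschitzOnWith
  obtain ⟨L', t', ht', hL'⟩ := hua.exists_lipschitzOnWith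
  obtain ⟨s, hs, C, β, hβ, hβ1, hC⟩ := hV x₀
  obtain ⟨ε, hε, hsub⟩ := Metric.mem_nhds_iff.1
    (Filter.inter_mem hB (Filter.inter_mem ht (Filter.inter_mem ht' hs)))
  obtain ⟨A, hA⟩ := (isCompact_closedBall (0 : E3) R).exists_bound_of_continuousOn
    (continuous_of_locallyHolder hV).continuousOn
  have hsub' : ball x₀ (2 * min (ε / 2) (1 / 4)) ⊆ ball x₀ ε :=
    ball_subset_ball (by linarith [min_le_left (ε / 2) (1 / 4)])
  refine ⟨min (ε / 2) (1 / 4), β, L + A * L' + C * K, by positivity, hβ,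
    fun x hx => (hsub (hsub' hx)).1, fun x hx y hy => ?_⟩
  obtain ⟨hxB, hxt, hxt', hxs⟩ := hsub (hsub' hx)
  obtain ⟨hyB, hyt, hyt', hys⟩ := hsub (hsub' hy)
  have hd1 : dist y x ≤ 1 := by
    replace hx := mem_ball.1 hx
    replace hy := mem_ball.1 hy
    linarith [dist_triangle_right y x x₀, min_le_right (ε / 2) (1 / 4)]
  have hd : dist y x ≤ dist y x ^ (β : ℝ) := by
    rcases (dist_nonneg (x := y) (y := x)).eq_or_lt with h0 | h0
    · rw [← h0, Real.zero_rpow (by exact_mod_cast hβ.ne')]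
    · simpa using Real.rpow_le_rpow_of_exponent_ge h0 hd1 (by exact_mod_cast hβ1 : (β : ℝ) ≤ 1)
  have h1 := hL.dist_le_mul y hyt x hxt
  have h2 := hL'.dist_le_mul y hyt' x hxt'
  have h3 := hC.dist_le hys hxs
  have h4 := hA y (ball_subset_closedBall hyB)
  have h5 := hK x
  rw [Real.dist_eq] at h1 h2 h3
  rw [Real.norm_eq_abs] at h4
  rw [norm_sub_rev, ← dist_eq_norm]
  have hA0 : 0 ≤ A := (abs_nonneg _).trans h4
  calc |rhs f V u y - rhs f V u x|
      = |((f ∘ u - phiu u * u) y - (f ∘ u - phiu u * u) x) - V y * (u y - u x)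
        - (V y - V x) * u x| := by
        simp only [rhs, Pi.sub_apply, Pi.mul_apply, Function.comp_apply]
        ring_nf
    _ ≤ |(f ∘ u - phiu u * u) y - (f ∘ u - phiu u * u) x| + |V y| * |u y - u x|
        + |V y - V x| * |u x| := by
        rw [← abs_mul, ← abs_mul]
        exact (abs_sub _ _).trans (add_le_add_left (abs_sub _ _) _)
    _ ≤ L * dist y x ^ (β : ℝ) + A * (L' * dist y x ^ (β : ℝ)) + C * dist y x ^ (β : ℝ) * K := by
        gcongr
        · exact h1.trans (by gcongr)
        · exact h2.trans (by gcongr)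
    _ = _ := by ring

theorem WeakSol.exists_contDiffOn (hR : 0 < R) (hf : ContDiff ℝ 1 f) (hN : Nonlin f)
    (hV : LocallyHolder V) (h : WeakSol R u D (rhs f V u)) : ∃ w : E3 → ℝ, w =ᵐ[volume] u ∧
    WeakSol R w D (rhs f V w) ∧ Continuous w ∧ ContDiffOn ℝ 2 w (ball 0 R) := by
  obtain ⟨w, hwu, hz, hc, hC1, K, hK⟩ := h.exists_continuous hR
  have hw := h.congr hN (continuous_of_locallyHolder hV) hwu hK hz
  refine ⟨w, hwu, hw, hc, fun x hx => ?_⟩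
  obtain ⟨δ, β, C, hδ, hβ, hb, hH⟩ := exists_holder_rhs hR hf hV hc hC1 hK hz hx
  obtain ⟨p, hp, hae, hp2⟩ := hw.exists_rep hδ hb
  have e := eqOn_ball_of_ae hc.continuousOn hp.continuous.continuousOn hae
  have hn := ball_mem_nhds x hδ
  exact (((hp2 β C hβ hH).contDiffAt hn).congr_of_eventuallyEq
    (e.eventuallyEq_of_mem hn)).contDiffWithinAt

end holder

section green

variable {R : ℝ} {u g ψ : E3 → ℝ} {D : E3 → E3}

theorem contDiff_mul_of_tsupport {n : WithTop ℕ∞} (hu : ContDiffOn ℝ n u (ball 0 R))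
    (hψ : ContDiff ℝ n ψ) (hs : tsupport ψ ⊆ ball 0 R) : ContDiff ℝ n fun x => ψ x * u x := by
  refine contDiff_iff_contDiffAt.2 fun x => ?_
  by_cases hx : x ∈ ball (0 : E3) R
  · exact hψ.contDiffAt.mul (hu.contDiffAt (isOpen_ball.mem_nhds hx))
  · have h0 : (fun x => ψ x * u x) =ᶠ[𝓝 x] fun _ => 0 := by
      filter_upwards [notMem_tsupport_iff_eventuallyEq.1 fun h => hx (hs h)] with y hy
      simp [hy]
    exact contDiffAt_const.congr_of_eventuallyEq h0

theorem integrable_mul_of_tsupport (hu : ContinuousOn u (ball 0 R)) (hψ : Continuous ψ)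
    (hc : HasCompactSupport ψ) (hs : tsupport ψ ⊆ ball 0 R) : Integrable fun x => ψ x * u x :=
  (contDiff_zero.1 (contDiff_mul_of_tsupport (n := 0) (contDiffOn_zero.2 hu)
    (contDiff_zero.2 hψ) hs)).integrable_of_hasCompactSupport hc.mul_right

theorem integral_mul_fderiv_of_tsupport (hu : ContDiffOn ℝ 1 u (ball 0 R)) (hψ : IsTest ψ)
    (hs : tsupport ψ ⊆ ball 0 R) (v : E3) :
    ∫ x, ψ x * fderiv ℝ u x v = -∫ x, fderiv ℝ ψ x v * u x := by
  have hc : HasCompactSupport fun x => ψ x * u x := hψ.2.mul_right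
  have hk := contDiff_mul_of_tsupport hu hψ.1 hs
  have h0 := congrArg (fun L : E3 →L[ℝ] ℝ => L v) (integral_fderiv_eq_zero hk hc)
  have hi : Integrable (fderiv ℝ fun x => ψ x * u x) :=
    (hk.continuous_fderiv (by norm_num)).integrable_of_hasCompactSupport (hc.fderiv (𝕜 := ℝ))
  simp only [ContinuousLinearMap.integral_apply hi, zero_apply] at h0
  have e : ∀ x, fderiv ℝ (fun x => ψ x * u x) x v = ψ x * fderiv ℝ u x v + fderiv ℝ ψ x v * u x := by
    intro x
    by_cases hx : x ∈ tsupport ψ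
    · rw [fderiv_fun_mul (hψ.differentiable x)
        ((hu.contDiffAt (isOpen_ball.mem_nhds (hs hx))).differentiableAt one_ne_zero)]
      simp [mul_comm]
    · have h1 := notMem_tsupport_iff_eventuallyEq.1 hx
      have h2 : (fun x => ψ x * u x) =ᶠ[𝓝 x] fun _ => 0 := by
        filter_upwards [h1] with y hy
        simp [hy]
      rw [h2.fderiv_eq, h1.fderiv_eq, h1.eq_of_nhds]
      simp
  have i1 : Integrable fun x => ψ x * fderiv ℝ u x v := by
    refine integrable_mul_of_tsupport ?_ hψ.1.continuous hψ.2 hs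
    exact (hu.continuousOn_fderiv_of_isOpen isOpen_ball le_rfl).clm_apply continuousOn_const
  have i2 : Integrable fun x => fderiv ℝ ψ x v * u x := by
    refine integrable_mul_of_tsupport hu.continuousOn
      ((hψ.1.continuous_fderiv one_ne_zero).clm_apply continuous_const)
      ((hψ.2.fderiv (𝕜 := ℝ)).comp_left (g := fun L : E3 →L[ℝ] ℝ => L v) rfl) ?_
    exact (tsupport_fderiv_apply_subset ℝ v).trans hs
  simp only [e] at h0
  rw [MeasureTheory.integral_add i1 i2] at h0
  linarith

theorem contDiffOn_fderiv_apply (hu : ContDiffOn ℝ 2 u (ball 0 R)) (v : E3) :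
    ContDiffOn ℝ 1 (fun x => fderiv ℝ u x v) (ball 0 R) :=
  (hu.fderiv_of_isOpen isOpen_ball (by norm_num)).clm_apply contDiffOn_const

theorem continuousOn_lap3 (hu : ContDiffOn ℝ 2 u (ball 0 R)) : ContinuousOn (lap3 u) (ball 0 R) :=
  continuousOn_finsetSum _ fun _ _ => ((contDiffOn_fderiv_apply hu _).continuousOn_fderiv_of_isOpen
    isOpen_ball le_rfl).clm_apply continuousOn_const

theorem integral_inner_gradient_of_tsupport (hu : ContDiffOn ℝ 2 u (ball 0 R)) (hψ : IsTest ψ)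
    (hs : tsupport ψ ⊆ ball 0 R) :
    ∫ x, inner ℝ (gradient u x) (gradient ψ x) = -∫ x, ψ x * lap3 u x := by
  simp only [inner_gradient_eq_sum (gradient u) ψ, inner_gradient_left, lap3, Finset.mul_sum]
  have ht : ∀ v : E3, tsupport (fun x => fderiv ℝ ψ x v) ⊆ ball 0 R := fun v =>
    (tsupport_fderiv_apply_subset ℝ v).trans hs
  rw [MeasureTheory.integral_finsetSum, MeasureTheory.integral_finsetSum, ← Finset.sum_neg_distrib]
  · refine Finset.sum_congr rfl fun i _ => ?_
    rw [integral_mul_fderiv_of_tsupport (contDiffOn_fderiv_apply hu _) hψ hs, neg_neg]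
    exact integral_congr_ae (ae_of_all _ fun x => mul_comm _ _)
  · intro i _
    exact integrable_mul_of_tsupport (((contDiffOn_fderiv_apply hu _).continuousOn_fderiv_of_isOpen
      isOpen_ball le_rfl).clm_apply continuousOn_const) hψ.1.continuous hψ.2 hs
  · intro i _
    refine (integrable_mul_of_tsupport (contDiffOn_fderiv_apply hu _).continuousOn
      ((hψ.1.continuous_fderiv one_ne_zero).clm_apply continuous_const)
      ((hψ.2.fderiv (𝕜 := ℝ)).comp_left (g := fun L : E3 →L[ℝ] ℝ => L _) rfl) (ht _)).congr
      (ae_of_all _ fun x => mul_comm _ _)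

theorem H1.grad_ae_eq_gradient (h : H1 u D) (hu : ContDiffOn ℝ 1 u (ball 0 R)) :
    ∀ᵐ x, x ∈ ball (0 : E3) R → D x = gradient u x := by
  have key : ∀ v : E3, ∀ᵐ x, x ∈ ball (0 : E3) R → inner ℝ (D x) v - fderiv ℝ u x v = 0 := by
    intro v
    have hDv := h.memLp_grad.inner_const v (𝕜 := ℝ)
    have hc : ContinuousOn (fun x => fderiv ℝ u x v) (ball 0 R) :=
      (hu.continuousOn_fderiv_of_isOpen isOpen_ball le_rfl).clm_apply continuousOn_const
    refine isOpen_ball.ae_eq_zero_of_integral_contDiff_smul_eq_zero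
      (((hDv.locallyIntegrable (by norm_num)).locallyIntegrableOn _).sub
        (hc.locallyIntegrableOn measurableSet_ball)) ?_
    intro ζ hζ hζc hζs
    have ht : IsTest ζ := ⟨hζ.of_le (by simp), hζc⟩
    have i1 : Integrable fun x => ζ x * inner ℝ (D x) v := (ht.memLp 2).integrable_mul hDv
    have i2 : Integrable fun x => ζ x * fderiv ℝ u x v :=
      integrable_mul_of_tsupport hc ht.1.continuous hζc hζs
    simp only [smul_eq_mul, mul_sub]
    rw [MeasureTheory.integral_sub i1 i2, integral_mul_fderiv_of_tsupport hu ht hζs]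
    have := h.integral_inner_mul ht v
    simp only [mul_comm (ζ _), mul_comm (fderiv ℝ ζ _ v), this]
    ring
  filter_upwards [ae_all_iff.2 fun i : Fin 3 => key (EuclideanSpace.single i 1)] with x hx hxB
  ext i
  have := hx i hxB
  rw [← inner_gradient_left, EuclideanSpace.inner_single_right,
    EuclideanSpace.inner_single_right] at this
  simpa [sub_eq_zero] using this

theorem WeakSol.lap3_eq (h : WeakSol R u D g) (hu : ContDiffOn ℝ 2 u (ball 0 R))
    (hg : ContinuousOn g (ball 0 R)) {x : E3} (hx : x ∈ ball (0 : E3) R) : -lap3 u x = g x := by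
  have hD := h.mem.h1.grad_ae_eq_gradient (hu.of_le (by norm_num))
  have hl := continuousOn_lap3 hu
  have key : ∀ᵐ x, x ∈ ball (0 : E3) R → lap3 u x + g x = 0 := by
    refine isOpen_ball.ae_eq_zero_of_integral_contDiff_smul_eq_zero
      ((hl.add hg).locallyIntegrableOn measurableSet_ball) ?_
    intro ζ hζ hζc hζs
    have ht : IsTest ζ := ⟨hζ.of_le (by simp), hζc⟩
    obtain ⟨B, hB⟩ := hζ.continuous.bounded_above_of_compact_support hζc
    have hζ0 : ∀ x ∉ ball (0 : E3) R, ζ x = 0 := fun x hx =>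
      image_eq_zero_of_notMem_tsupport fun h => hx (hζs h)
    have e1 := h.eq ζ (gradient ζ) B ⟨ht.h1, ae_of_all _ hζ0⟩ hB
    have e2 := integral_inner_gradient_of_tsupport hu ht hζs
    have e3 : ∫ x, inner ℝ (D x) (gradient ζ x) = ∫ x, inner ℝ (gradient u x) (gradient ζ x) := by
      refine integral_congr_ae (hD.mono fun x hx => ?_)
      by_cases hxB : x ∈ ball (0 : E3) R
      · simp only [hx hxB]
      · have : gradient ζ x = 0 := by
          rw [gradient, image_eq_zero_of_notMem_tsupport fun h =>
            hxB (hζs (tsupport_fderiv_subset ℝ h)), map_zero]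
        simp only [this, inner_zero_right]
    simp only [smul_eq_mul, mul_add]
    rw [MeasureTheory.integral_add (integrable_mul_of_tsupport hl ht.1.continuous hζc hζs)
      (integrable_mul_of_tsupport hg ht.1.continuous hζc hζs)]
    simp only [mul_comm (g _)] at e1
    linarith
  have := eqOn_ball_of_ae (u := fun x => lap3 u x + g x) (w := fun _ => 0) (hl.add hg)
    continuousOn_const key hx
  simp only at this
  linarith

end green

section classical

/-- A continuous cutoff of the positive half line, vanishing near the nonpositive numbers. -/
def cut (n : ℕ) (t : ℝ) : ℝ := min (max ((n + 1) * t - 1) 0) 1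

theorem continuous_cut (n : ℕ) : Continuous (cut n) := by
  unfold cut
  fun_prop

theorem cut_nonneg (n : ℕ) (t : ℝ) : 0 ≤ cut n t := le_min (le_max_right _ _) zero_le_one

theorem cut_le_one (n : ℕ) (t : ℝ) : cut n t ≤ 1 := min_le_right _ _

theorem abs_cut_le (n : ℕ) (t : ℝ) : |cut n t| ≤ 1 := by
  rw [abs_of_nonneg (cut_nonneg n t)]
  exact cut_le_one n t

theorem cut_eq_zero {n : ℕ} {t : ℝ} (h : (n + 1) * t ≤ 1) : cut n t = 0 := by
  rw [cut, max_eq_right (by linarith), min_eq_left zero_le_one]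

theorem cut_of_nonpos (n : ℕ) {t : ℝ} (h : t ≤ 0) : cut n t = 0 :=
  cut_eq_zero ((mul_nonpos_of_nonneg_of_nonpos (by positivity) h).trans zero_le_one)

theorem tendsto_cut (t : ℝ) : Tendsto (fun n => cut n t) atTop (𝓝 (if 0 < t then 1 else 0)) := by
  split_ifs with h
  · obtain ⟨N, hN⟩ := exists_nat_gt (2 / t)
    refine tendsto_const_nhds.congr' ?_
    filter_upwards [eventually_ge_atTop N] with n hn
    have h1 : 2 < N * t := (div_lt_iff₀ h).1 hN
    have h2 : (N : ℝ) * t ≤ n * t := by gcongr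
    exact (min_eq_right (le_max_of_le_left (by linarith))).symm
  · exact tendsto_const_nhds.congr fun n => (cut_of_nonpos n (not_lt.1 h)).symm

/-- The primitive of `cut n`. -/
def trunc (n : ℕ) (s : ℝ) : ℝ := ∫ t in (0 : ℝ)..s, cut n t

theorem hasDerivAt_trunc (n : ℕ) (s : ℝ) : HasDerivAt (trunc n) (cut n s) s :=
  intervalIntegral.integral_hasDerivAt_right ((continuous_cut n).intervalIntegrable _ _)
    ((continuous_cut n).stronglyMeasurableAtFilter _ _) (continuous_cut n).continuousAt

theorem contDiff_trunc (n : ℕ) : ContDiff ℝ 1 (trunc n) :=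
  contDiff_one_iff_deriv.2 ⟨fun s => (hasDerivAt_trunc n s).differentiableAt, by
    rw [show deriv (trunc n) = cut n from funext fun s => (hasDerivAt_trunc n s).deriv]
    exact continuous_cut n⟩

theorem trunc_eq_zero {n : ℕ} {s : ℝ} (h : (n + 1) * s ≤ 1) : trunc n s = 0 := by
  rw [trunc, integral_congr (g := fun _ => 0), intervalIntegral.integral_zero]
  intro t ht
  have : t ≤ max 0 s := ht.2
  refine cut_eq_zero ((mul_le_mul_of_nonneg_left this (by positivity)).trans ?_)
  rcases max_cases (0 : ℝ) s with h' | h' <;> rw [h'.1]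
  · simp
  · exact h

theorem abs_trunc_le (n : ℕ) (s : ℝ) : |trunc n s| ≤ max s 0 := by
  rcases le_total s 0 with h | h
  · rw [trunc_eq_zero ((mul_nonpos_of_nonneg_of_nonpos (by positivity) h).trans zero_le_one), abs_zero]
    exact le_max_right _ _
  · have := intervalIntegral.norm_integral_le_of_norm_le_const (a := 0) (b := s) (f := cut n) (C := 1)
      fun t _ => abs_cut_le n t
    rw [sub_zero, one_mul, abs_of_nonneg h] at this
    exact this.trans (le_max_left _ _)

theorem tendsto_trunc (s : ℝ) : Tendsto (fun n => trunc n s) atTop (𝓝 (max s 0)) := by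
  have h : Tendsto (fun n => trunc n s) atTop (𝓝 (∫ t in (0 : ℝ)..s, if 0 < t then 1 else 0)) :=
    intervalIntegral.tendsto_integral_filter_of_dominated_convergence (fun _ => 1)
      (Eventually.of_forall fun n => (continuous_cut n).aestronglyMeasurable)
      (Eventually.of_forall fun n => ae_of_all _ fun t _ => abs_cut_le n t) (by simp)
      (ae_of_all _ fun t _ => tendsto_cut t)
  convert h using 2
  rcases le_total s 0 with h | h
  · rw [max_eq_right h, integral_congr (g := fun _ => 0), intervalIntegral.integral_zero]
    intro t ht
    rw [Set.uIcc_of_ge h] at ht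
    simp [ht.2]
  · rw [max_eq_left h, intervalIntegral.integral_congr_uIoo (g := fun _ => 1),
      intervalIntegral.integral_const]
    · simp
    · intro t ht
      rw [Set.uIoo_of_le h] at ht
      simp [ht.1]

/-- `v` is a classical solution of the Dirichlet problem `-Δv = g` on the ball. -/
structure Classical (R : ℝ) (v g : E3 → ℝ) : Prop where
  smooth : ContDiffOn ℝ 2 v (ball 0 R)
  cont : Continuous v
  zero : ∀ x ∉ ball (0 : E3) R, v x = 0
  eq : ∀ x ∈ ball (0 : E3) R, -lap3 v x = g x
  meas : AEStronglyMeasurable g volume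
  bound : ∃ M, ∀ x, |g x| ≤ M

variable {R : ℝ} {v g : E3 → ℝ}

theorem lap3_neg (v : E3 → ℝ) (x : E3) : lap3 (fun y => -v y) x = -lap3 v x := by
  simp only [lap3, fderiv_fun_neg, neg_apply, Finset.sum_neg_distrib]

namespace Classical

theorem neg (h : Classical R v g) : Classical R (fun x => -v x) fun x => -g x where
  smooth := h.smooth.neg
  cont := h.cont.neg
  zero x hx := by simp [h.zero x hx]
  eq x hx := by rw [lap3_neg, h.eq x hx]
  meas := h.meas.neg
  bound := by simpa only [abs_neg] using h.bound

theorem tsupport_comp_subset (h : Classical R v g) {G : ℝ → ℝ} {n : ℕ}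
    (hG : ∀ s : ℝ, (n + 1) * s ≤ 1 → G s = 0) : tsupport (fun x => G (v x)) ⊆ ball 0 R := by
  have hcl : IsClosed {x | 1 ≤ (n + 1) * v x} :=
    isClosed_le continuous_const (continuous_const.mul h.cont)
  refine (closure_minimal (fun x hx => ?_) hcl).trans fun x (hx : 1 ≤ (n + 1) * v x) => ?_
  · by_contra h1
    exact hx (hG _ (not_le.1 h1).le)
  · by_contra h1
    rw [h.zero x h1, mul_zero] at hx
    linarith

theorem isTest_trunc (h : Classical R v g) (n : ℕ) : IsTest fun x => trunc n (v x) := by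
  have hs := h.tsupport_comp_subset (n := n) fun s => trunc_eq_zero
  refine ⟨contDiff_iff_contDiffAt.2 fun x => ?_, hasCompactSupport_of_ball (ρ := R) fun x hx =>
    trunc_eq_zero (by simp [h.zero x hx])⟩
  by_cases hx : x ∈ ball (0 : E3) R
  · exact (contDiff_trunc n).contDiffAt.comp x
      ((h.smooth.of_le (by norm_num)).contDiffAt (isOpen_ball.mem_nhds hx))
  · exact contDiffAt_const.congr_of_eventuallyEq
      (notMem_tsupport_iff_eventuallyEq.1 fun h' => hx (hs h'))

theorem gradient_trunc (h : Classical R v g) (n : ℕ) (x : E3) :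
    gradient (fun x => trunc n (v x)) x = cut n (v x) • gradient v x := by
  by_cases hx : x ∈ ball (0 : E3) R
  · exact gradient_comp ((h.smooth.contDiffAt (isOpen_ball.mem_nhds hx)).differentiableAt
      (by norm_num)) (hasDerivAt_trunc n _)
  · have hs := h.tsupport_comp_subset (n := n) fun s => trunc_eq_zero
    rw [gradient, (notMem_tsupport_iff_eventuallyEq.1 fun h' => hx (hs h')).fderiv_eq,
      h.zero x hx, cut_of_nonpos n le_rfl, zero_smul]
    simp

theorem integral_cut (h : Classical R v g) (n : ℕ) :
    ∫ x, cut n (v x) * ‖gradient v x‖ ^ 2 = ∫ x, g x * trunc n (v x) := by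
  have e := integral_inner_gradient_of_tsupport h.smooth (h.isTest_trunc n)
    (h.tsupport_comp_subset (n := n) fun s => trunc_eq_zero)
  simp only [h.gradient_trunc n, inner_smul_right, real_inner_self_eq_norm_sq] at e
  rw [e, ← MeasureTheory.integral_neg]
  refine integral_congr_ae (ae_of_all _ fun x => ?_)
  by_cases hx : x ∈ ball (0 : E3) R
  · simp only [← h.eq x hx]
    ring
  · simp [h.zero x hx, trunc]

theorem integrable_cut (h : Classical R v g) (n : ℕ) :
    Integrable fun x => cut n (v x) * ‖gradient v x‖ ^ 2 := by
  refine integrable_mul_of_tsupport (R := R) ?_ ((continuous_cut n).comp h.cont)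
    (hasCompactSupport_of_ball (ρ := R) fun x hx => cut_eq_zero (by simp [h.zero x hx]))
    (h.tsupport_comp_subset (n := n) fun s => cut_eq_zero)
  simp only [norm_gradient]
  exact (h.smooth.continuousOn_fderiv_of_isOpen isOpen_ball (by norm_num)).norm.pow 2

theorem posPart (h : Classical R v g) :
    H10 R (fun x => max (v x) 0) (fun x => if 0 < v x then gradient v x else 0) ∧
    ∫ x, ‖if 0 < v x then gradient v x else 0‖ ^ 2 = ∫ x, g x * max (v x) 0 := by
  obtain ⟨M, hM⟩ := h.bound
  have hM0 : 0 ≤ M := (abs_nonneg _).trans (hM 0)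
  set p : E3 → ℝ := fun x => max (v x) 0 with hp
  set P : E3 → E3 := fun x => if 0 < v x then gradient v x else 0 with hP
  have hp0 : ∀ x, 0 ≤ p x := fun x => le_max_right _ _
  have hpc : Continuous p := h.cont.max continuous_const
  have hpz : ∀ x ∉ ball (0 : E3) R, p x = 0 := fun x hx => by simp [hp, h.zero x hx]
  have hps := hasCompactSupport_of_ball hpz
  have hpi : Integrable p := hpc.integrable_of_hasCompactSupport hps
  have hp2 : MemLp p 2 := hpc.memLp_of_hasCompactSupport hps
  have ht := h.isTest_trunc
  have hW : ∀ n x, gradient (fun x => trunc n (v x)) x = cut n (v x) • P x := by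
    intro n x
    rw [h.gradient_trunc, hP]
    dsimp only
    split_ifs with h1
    · rfl
    · rw [cut_of_nonpos n (not_lt.1 h1), zero_smul, zero_smul]
  have hlim : ∀ x, Tendsto (fun n => gradient (fun x => trunc n (v x)) x) atTop (𝓝 (P x)) := by
    intro x
    simp only [hW]
    by_cases h1 : 0 < v x
    · simpa [h1] using (tendsto_cut (v x)).smul_const (P x)
    · simp [hP, h1]
  have hgT : ∀ n x, |g x * trunc n (v x)| ≤ M * p x := fun n x => by
    rw [abs_mul]
    exact mul_le_mul (hM x) (abs_trunc_le n _) (abs_nonneg _) hM0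
  have hle : ∀ n, eLpNorm (gradient fun x => trunc n (v x)) 2 volume ≤
      ENNReal.ofReal √(∫ x, M * p x) := by
    intro n
    rw [eLpNorm_two_eq_sqrt ((ht n).memLp_gradient 2)]
    refine ENNReal.ofReal_le_ofReal (Real.sqrt_le_sqrt ?_)
    calc ∫ x, ‖gradient (fun x => trunc n (v x)) x‖ ^ 2
        ≤ ∫ x, cut n (v x) * ‖gradient v x‖ ^ 2 := by
          refine integral_mono_of_nonneg (ae_of_all _ fun x => by positivity) (h.integrable_cut n)
            (ae_of_all _ fun x => ?_)
          simp only [h.gradient_trunc n, norm_smul, mul_pow, Real.norm_eq_abs, sq_abs]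
          gcongr
          nlinarith [cut_nonneg n (v x), cut_le_one n (v x)]
      _ = ∫ x, g x * trunc n (v x) := h.integral_cut n
      _ ≤ ∫ x, M * p x := by
          refine (le_abs_self _).trans ?_
          rw [← Real.norm_eq_abs]
          exact MeasureTheory.norm_integral_le_of_norm_le (hpi.const_mul M)
            (ae_of_all _ fun x => hgT n x)
  have hPm : AEStronglyMeasurable P volume := aestronglyMeasurable_of_tendsto_ae atTop
    (fun n => ((ht n).memLp_gradient 2).1) (ae_of_all _ hlim)
  have hP2 : MemLp P 2 := by
    refine ⟨hPm, (Lp.eLpNorm_lim_le_liminf_eLpNorm (fun n => ((ht n).memLp_gradient 2).1) P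
      (ae_of_all _ hlim)).trans_lt ?_⟩
    exact (liminf_le_of_frequently_le' (Frequently.of_forall hle)).trans_lt ENNReal.ofReal_lt_top
  have hPi : Integrable fun x => ‖P x‖ ^ 2 := hP2.norm.integrable_sq
  refine ⟨⟨H1.of_tendsto (fun n => (ht n).h1) hp2 hP2 ?_ ?_, ae_of_all _ hpz⟩, ?_⟩
  · refine tendsto_eLpNorm_two_of_dominated (b := fun x => 2 * p x)
      (fun n => ((ht n).memLp 2).1.sub hp2.1) (hp2.const_mul 2) (fun n => ae_of_all _ fun x => ?_)
      (ae_of_all _ fun x => ?_)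
    · have h1 := abs_trunc_le n (v x)
      have h2 := abs_sub (trunc n (v x)) (p x)
      rw [abs_of_nonneg (hp0 x)] at h2
      rw [Pi.sub_apply, Real.norm_eq_abs, two_mul]
      exact h2.trans (by gcongr)
    · have := (tendsto_trunc (v x)).sub_const (p x)
      rwa [show max (v x) 0 - p x = 0 from sub_self _] at this
  · refine tendsto_eLpNorm_two_of_dominated (b := fun x => ‖P x‖)
      (fun n => ((ht n).memLp_gradient 2).1.sub hPm) hP2.norm (fun n => ae_of_all _ fun x => ?_)
      (ae_of_all _ fun x => ?_)
    · rw [Pi.sub_apply, hW, show cut n (v x) • P x - P x = (cut n (v x) - 1) • P x by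
        rw [sub_smul, one_smul], norm_smul, Real.norm_eq_abs]
      refine mul_le_of_le_one_left (norm_nonneg _) (abs_le.2 ⟨?_, ?_⟩)
      · linarith [cut_nonneg n (v x)]
      · linarith [cut_le_one n (v x)]
    · simpa using (hlim x).sub_const (P x)
  · refine tendsto_nhds_unique (f := fun n => ∫ x, cut n (v x) * ‖gradient v x‖ ^ 2) (l := atTop)
      ?_ ?_
    · refine tendsto_integral_of_dominated_convergence (fun x => ‖P x‖ ^ 2)
        (fun n => (h.integrable_cut n).1) hPi (fun n => ae_of_all _ fun x => ?_)
        (ae_of_all _ fun x => ?_)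
      · rw [Real.norm_of_nonneg (mul_nonneg (cut_nonneg _ _) (sq_nonneg _)), hP]
        dsimp only
        split_ifs with h1
        · exact mul_le_of_le_one_left (sq_nonneg _) (cut_le_one _ _)
        · simp [cut_of_nonpos n (not_lt.1 h1)]
      · have := (tendsto_cut (v x)).mul_const (‖gradient v x‖ ^ 2)
        have e : (if 0 < v x then 1 else 0) * ‖gradient v x‖ ^ 2 = ‖P x‖ ^ 2 := by
          by_cases h1 : 0 < v x <;> simp [hP, h1]
        rwa [e] at this
    · rw [show (fun n => ∫ x, cut n (v x) * ‖gradient v x‖ ^ 2) =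
        fun n => ∫ x, g x * trunc n (v x) from funext h.integral_cut]
      refine tendsto_integral_of_dominated_convergence (fun x => M * p x)
        (fun n => h.meas.mul ((ht n).memLp 2).1) (hpi.const_mul M) (fun n => ae_of_all _ fun x => hgT n x)
        (ae_of_all _ fun x => (tendsto_trunc (v x)).const_mul (g x))

end Classical

end classical

section solutions

variable {f : ℝ → ℝ} {V : E3 → ℝ} {α R : ℝ} {u v g p q : E3 → ℝ} {D P Q : E3 → E3}

theorem pairing_self_of_disjoint (hp : H10 R p P) (hq : H10 R q Q)
    (hd : ∀ x, (p x = 0 ∧ P x = 0) ∨ (q x = 0 ∧ Q x = 0)) :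
    pairing f V R (fun x => p x + q x) (fun x => P x + Q x) p P =
      nrm V R p P + cc p p + cc p q - mulInt f R p := by
  have e1 : ∀ x, inner ℝ (P x + Q x) (P x) = ‖P x‖ ^ 2 := fun x => by
    rcases hd x with h | h <;> simp [h]
  have e2 : ∀ x, (p x + q x) ^ 2 = p x ^ 2 + q x ^ 2 := fun x => by
    rcases hd x with h | h <;> simp [h]
  have e3 : ∀ x, (p x + q x) * p x = p x ^ 2 := fun x => by
    rcases hd x with h | h <;> simp [h, pow_two]
  have e4 : ∀ x, f (p x + q x) * p x = f (p x) * p x := fun x => by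
    rcases hd x with h | h <;> simp [h]
  simp only [pairing, e1, e2, e3, e4, nrm, cc, mulInt]
  rw [hp.l2Ball_sq.coul_add_left hq.l2Ball_sq hp.l2Ball_sq, hq.l2Ball_sq.coul_comm hp.l2Ball_sq]
  ring

theorem nehari_of_disjoint (hf : Nonlin f) (hV : Continuous V) (hp : H10 R p P) (hq : H10 R q Q)
    (hd : ∀ x, (p x = 0 ∧ P x = 0) ∨ (q x = 0 ∧ Q x = 0)) {K : ℝ} (hK : ∀ x, |p x + q x| ≤ K)
    (h : ∫ x, ‖P x‖ ^ 2 = ∫ x, rhs f V (fun x => p x + q x) x * p x) :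
    nrm V R p P + cc p p + cc p q = mulInt f R p := by
  have k := pairing_self_of_disjoint (f := f) (V := V) hp hq hd
  have e1 : ∀ x, inner ℝ (P x + Q x) (P x) = ‖P x‖ ^ 2 := fun x => by
    rcases hd x with h | h <;> simp [h]
  rw [pairing_eq_rhs hf hV (hp.add hq) hK hp, ← h] at k
  simp only [e1, sub_self] at k
  linarith

namespace Classical

theorem negPart (h : Classical R v g) :
    H10 R (fun x => min (v x) 0) (fun x => if v x < 0 then gradient v x else 0) ∧
    ∫ x, ‖if v x < 0 then gradient v x else 0‖ ^ 2 = ∫ x, g x * min (v x) 0 := by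
  obtain ⟨h1, h2⟩ := h.neg.posPart
  have e1 : ∀ x, -max (-v x) 0 = min (v x) 0 := fun x => by rw [← neg_zero, max_neg_neg]; simp
  have e2 : ∀ x, gradient (fun x => -v x) x = -gradient v x := fun x => by
    simp only [gradient, fderiv_fun_neg, map_neg]
  have e3 : ∀ x, -(if 0 < -v x then gradient (fun x => -v x) x else 0) =
      if v x < 0 then gradient v x else 0 := fun x => by
    simp only [neg_pos, e2]; split_ifs <;> simp
  refine ⟨by simpa only [e1, e3] using h1.neg, ?_⟩
  simp only [← e3, norm_neg, h2, ← e1]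
  exact integral_congr_ae (ae_of_all _ fun x => by ring)

theorem parts_disj (v : E3 → ℝ) (x : E3) :
    (max (v x) 0 = 0 ∧ (if 0 < v x then gradient v x else 0) = 0) ∨
      (min (v x) 0 = 0 ∧ (if v x < 0 then gradient v x else 0) = 0) := by
  rcases le_total (v x) 0 with h | h
  · left; simp [h, h.not_gt]
  · right; simp [h, h.not_gt]

theorem split (h : Classical R v g) :
    Split R (fun x => max (v x) 0) (fun x => if 0 < v x then gradient v x else 0)
      (fun x => min (v x) 0) (fun x => if v x < 0 then gradient v x else 0) where
  left := h.posPart.1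
  right := h.negPart.1
  nonneg _ := le_max_right _ _
  nonpos _ := min_le_right _ _
  disj := parts_disj v

theorem exists_abs_le (h : Classical R v g) : ∃ K, ∀ x, |v x| ≤ K := by
  obtain ⟨K, hK⟩ := (hasCompactSupport_of_ball h.zero).exists_bound_of_continuous h.cont
  exact ⟨K, hK⟩

theorem nehari (hf : Nonlin f) (hV : Continuous V) (h : Classical R v (rhs f V v))
    (h1 : (fun x => max (v x) 0) ≠ 0) (h2 : (fun x => min (v x) 0) ≠ 0) :
    Nehari f V R (fun x => max (v x) 0) (fun x => if 0 < v x then gradient v x else 0)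
      (fun x => min (v x) 0) (fun x => if v x < 0 then gradient v x else 0) := by
  obtain ⟨K, hK⟩ := h.exists_abs_le
  have hs := h.split
  have e : ∀ x, max (v x) 0 + min (v x) 0 = v x := fun x => by rw [max_add_min, add_zero]
  have hd := hs.disj
  have hd' := fun x => (hd x).symm
  refine ⟨hs, fun h' => h1 ((Continuous.ae_eq_iff_eq volume (h.cont.max continuous_const)
    continuous_zero).1 h'), fun h' => h2 ((Continuous.ae_eq_iff_eq volume
    (h.cont.min continuous_const) continuous_zero).1 h'), ?_, ?_⟩
  · exact nehari_of_disjoint hf hV hs.left hs.right hd (K := K) (by simpa only [e] using hK)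
      (by simpa only [e] using h.posPart.2)
  · have := nehari_of_disjoint hf hV hs.right hs.left hd' (K := K)
      (by simpa only [add_comm (min _ _), e] using hK)
      (by simpa only [add_comm (min _ _), e] using h.negPart.2)
    rwa [cc_comm hs.right hs.left] at this

end Classical

/-- The energy of a function that is `C¹` in the ball. -/
theorem energyBall_eq (hV : Continuous V) (h : H10 R v D) (hv : ContDiffOn ℝ 1 v (ball 0 R))
    (hz : ∀ x ∉ ball (0 : E3) R, v x = 0) : energyBall f V R v = en f V R v D := by
  have e1 : ∫ x in ball (0 : E3) R, (‖fderiv ℝ v x‖ ^ 2 + V x * v x ^ 2) = nrm V R v D := by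
    have i2 : IntegrableOn (fun x => V x * v x ^ 2) (ball 0 R) :=
      H10.integrableOn_pot hV h.integrable_sq
    have i1 : IntegrableOn (fun x => ‖D x‖ ^ 2) (ball 0 R) := h.integrable_grad_sq.integrableOn
    have e : ∫ x, ‖D x‖ ^ 2 = ∫ x in ball (0 : E3) R, ‖D x‖ ^ 2 := by
      refine (setIntegral_eq_integral_of_ae_compl_eq_zero ?_).symm
      filter_upwards [h.grad_zero] with x hx hxb
      simp [hx hxb]
    rw [nrm, e, ← integral_add i1 i2]
    refine integral_congr_ae ?_
    filter_upwards [ae_restrict_mem measurableSet_ball,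
      ae_restrict_of_ae (h.h1.grad_ae_eq_gradient hv)] with x hx h'
    rw [h' hx, norm_gradient]
  have e2 : ∫ x in ball (0 : E3) R, phiu v x * v x ^ 2 = cc v v := by
    rw [cc, coul, ← MeasureTheory.integral_const_mul,
      setIntegral_eq_integral_of_forall_compl_eq_zero fun x hx => by simp [hz x hx]]
    simp only [phiu_eq, mul_assoc]
  rw [energyBall, e1, e2]
  rfl

theorem continuous_of_solution (hv : IsSignChangingBallSolution f V R v) :
    Continuous v := by
  rw [← continuousOn_univ, ← Set.union_compl_self (ball (0 : E3) R)]
  have h : ContinuousOn v (closedBall 0 R ∪ (ball 0 R)ᶜ) :=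
    hv.2.1.union_of_isClosed ((continuousOn_const (c := 0)).congr hv.2.2.1) isClosed_closedBall
      isOpen_ball.isClosed_compl
  exact h.mono (Set.union_subset_union_left _ ball_subset_closedBall)

theorem classical_of_solution (hf : Nonlin f) (hV : Continuous V)
    (hv : IsSignChangingBallSolution f V R v) : Classical R v (rhs f V v) := by
  have hc := continuous_of_solution hv
  have hs := hasCompactSupport_of_ball hv.2.2.1
  obtain ⟨K, hK⟩ := hs.exists_bound_of_continuous hc
  have hL : L2Ball R fun x => v x ^ 2 :=
    ⟨(hc.pow 2).memLp_of_hasCompactSupport (hasCompactSupport_of_ball (ρ := R) fun x hx => by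
      simp [hv.2.2.1 x hx]), ae_of_all _ fun x hx => by simp [hv.2.2.1 x hx]⟩
  refine ⟨hv.1, hc, hv.2.2.1, fun x hx => ?_,
    aestronglyMeasurable_rhs hf hV hL hc.aestronglyMeasurable,
    exists_rhs_bound hf hV hL hK hv.2.2.1⟩
  rw [rhs, ← hv.2.2.2.1 x hx]
  ring

/-- Every sign-changing solution has at least the energy of the minimizer. -/
theorem IsMinimizer.en_le_energyBall (hf : Nonlin f) (hV : Continuous V)
    (hu : IsMinimizer f V R u D) (hv : IsSignChangingBallSolution f V R v) :
    en f V R u D ≤ energyBall f V R v := by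
  have hc := classical_of_solution hf hV hv
  have hs := hc.split
  have h10 : H10 R v fun x => (if 0 < v x then gradient v x else 0) +
      if v x < 0 then gradient v x else 0 := by
    simpa only [max_add_min, add_zero] using hs.left.add hs.right
  have h1 := hu.le _ _ _ _ (hc.nehari hf hV hv.2.2.2.2.1 hv.2.2.2.2.2)
  rw [hs.energy_eq hf hV, hu.nehari.split.energy_eq hf hV] at h1
  simp only [max_add_min, add_zero] at h1
  rw [energyBall_eq hV h10 (hv.1.of_le (by norm_num)) hv.2.2.1]
  refine le_trans (le_of_eq (en_congr ae_eq_rfl ?_)) h1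
  filter_upwards [hu.mem.h1.grad_eq_zero] with x hx
  rcases lt_trichotomy (u x) 0 with h | h | h
  · simp [h, h.not_gt]
  · simp [h, hx h]
  · simp [h, h.not_gt]

end solutions

/-- A classical representative of the minimizer is a least energy sign-changing solution. -/
theorem Setup.exists_solution {f : ℝ → ℝ} {V : E3 → ℝ} {α R : ℝ} (h : Setup f V α R)
    (hVh : LocallyHolder V) : ∃ w, IsSignChangingBallSolution f V R w ∧
      ∀ v, IsSignChangingBallSolution f V R v → energyBall f V R w ≤ energyBall f V R v := by
  obtain ⟨u, D, hu⟩ := h.exists_minimizer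
  obtain ⟨w₀, hw₀, hs₀⟩ := (hu.crit h).exists_weakSol (fun x => h.pos.le.trans (h.le x)) h.cont
    h.nonlin
  obtain ⟨w, hw, hs, hc, h2⟩ := hs₀.exists_contDiffOn h.radius h.nonlin.smooth h.nonlin hVh
  have hwu := hw.trans hw₀
  obtain ⟨K, hK⟩ := hs.bound
  have hg : ContinuousOn (rhs f V w) (ball 0 R) :=
    ((h.nonlin.continuous.comp hc).continuousOn.sub (h.cont.mul hc).continuousOn).sub
      ((contDiffOn_phiu h.radius hc.aestronglyMeasurable hK hs.zero).continuousOn.mul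
        hc.continuousOn)
  refine ⟨w, ⟨h2, hc.continuousOn, hs.zero, fun x hx => ?_, fun h0 => hu.nehari.left_ne ?_,
    fun h0 => hu.nehari.right_ne ?_⟩, fun v hv => ?_⟩
  · rw [hs.lap3_eq h2 hg hx, rhs]
    ring
  · filter_upwards [hwu] with x hx
    rw [← hx]
    exact congrFun h0 x
  · filter_upwards [hwu] with x hx
    rw [← hx]
    exact congrFun h0 x
  · rw [energyBall_eq h.cont hs.mem (h2.of_le (by norm_num)) hs.zero, en_congr hwu ae_eq_rfl]
    exact hu.en_le_energyBall h.nonlin h.cont hv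

end BallSolution

/-- **Proposition 8.1.** Let `f` be `C¹` satisfying `(f₁)–(f₄)` and let
`V : ℝ³ → ℝ` be locally Hölder continuous with `V ≥ α > 0`. Then for every `R > 0` the
problem `(AP_R)` has a sign-changing solution `u` of least energy among all sign-changing
solutions on `B_R`. -/
theorem signChanging_solution_ball
    (f : ℝ → ℝ) (hf : ContDiff ℝ 1 f)
    (hf1 : Tendsto (fun s : ℝ => f s / s) (𝓝[≠] 0) (𝓝 0))
    (hf2 : Tendsto (fun s : ℝ => f s / |s| ^ 5) (cocompact ℝ) (𝓝 0))
    (hf3 : Tendsto (fun s : ℝ => (∫ t in (0:ℝ)..s, f t) / s ^ 4) (cocompact ℝ) atTop)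
    (hf4 : ∀ t s : ℝ, (0 < t ∧ t < s) ∨ (s < t ∧ t < 0) → f t / t ^ 3 ≤ f s / s ^ 3)
    (V : EuclideanSpace ℝ (Fin 3) → ℝ) (hVholder : LocallyHolder V)
    (α : ℝ) (hα : 0 < α) (hV1 : ∀ x, α ≤ V x)
    (R : ℝ) (hR : 0 < R) :
    ∃ u : EuclideanSpace ℝ (Fin 3) → ℝ,
      IsSignChangingBallSolution f V R u ∧
      ∀ v : EuclideanSpace ℝ (Fin 3) → ℝ,
        IsSignChangingBallSolution f V R v →
        energyBall f V R u ≤ energyBall f V R v := by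
  exact (BallSolution.Setup.mk ⟨hf, hf1, hf2, hf3, hf4⟩
    (BallSolution.continuous_of_locallyHolder hVholder) hα hV1 hR).exists_solution hVholder

end
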